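/- There exist natural numbers m, n and positive real numbers u_1, …, u_m, v_1, …, v_n such that P_S(t) · ∏_{j=1}^n (1 − v_j t) = ∏_{i=1}^m (1 + u_i t) as formal power series over ℝ; moreover, writing ∏_{i=1}^m (1 + u_i t) = ∑_{i=0}^m a_i t^i and ∏_{j=1}^n (1 − v_j t) = ∑_{j=0}^n (−1)^j b_j t^j, the numerator is reciprocal, i.e. a_i = a_{m−i} for all 0 ≤ i ≤ m, and the denominator is skew-reciprocal, i.e. b_j = b_{n−j} for all 0 ≤ j ≤ n. -/

import Mathlib

open TensorProduct Polynomial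

noncomputable section

/-- The linear map `V ⊗ V → T(V)` sending `v ⊗ w` to `ι v * ι w`. -/
def mulTwo (K : Type) [Field K] (V : Type) [AddCommGroup V] [Module K V] :
    V ⊗[K] V →ₗ[K] TensorAlgebra K V :=
  TensorProduct.lift
    ((LinearMap.mul K (TensorAlgebra K V)).compl₁₂ (TensorAlgebra.ι K) (TensorAlgebra.ι K))

/-- `R : V ⊗ V → V ⊗ V` is a Hecke symmetry with parameter `q`:
it is invertible, satisfies the braid relation, the Hecke relation
`(R + 1)(R - q) = 0`, and its half adjoint `R♯ : V* ⊗ V → V ⊗ V*`,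
characterized by `⟨R♯(ξ ⊗ v), w⟩ = ⟨ξ, R(v ⊗ w)⟩`, is invertible. -/
def IsHeckeSymmetry (K : Type) [Field K] (V : Type) [AddCommGroup V] [Module K V]
    (q : K) (R : V ⊗[K] V →ₗ[K] V ⊗[K] V) : Prop :=
  Function.Bijective R ∧
  (TensorProduct.map R LinearMap.id ∘ₗ
      ((TensorProduct.assoc K V V V).symm.toLinearMap ∘ₗ
        TensorProduct.map LinearMap.id R ∘ₗ (TensorProduct.assoc K V V V).toLinearMap) ∘ₗ
      TensorProduct.map R LinearMap.id =
    ((TensorProduct.assoc K V V V).symm.toLinearMap ∘ₗ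
        TensorProduct.map LinearMap.id R ∘ₗ (TensorProduct.assoc K V V V).toLinearMap) ∘ₗ
      TensorProduct.map R LinearMap.id ∘ₗ
      ((TensorProduct.assoc K V V V).symm.toLinearMap ∘ₗ
        TensorProduct.map LinearMap.id R ∘ₗ (TensorProduct.assoc K V V V).toLinearMap)) ∧
  ((R + LinearMap.id) ∘ₗ (R - q • LinearMap.id) = 0) ∧
  (∃ Rs : Module.Dual K V ⊗[K] V →ₗ[K] V ⊗[K] Module.Dual K V,
    Function.Bijective Rs ∧
    ∀ (ξ : Module.Dual K V) (v w : V),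
      dualTensorHom K V V ((TensorProduct.comm K V (Module.Dual K V)) (Rs (ξ ⊗ₜ[K] v))) w =
        TensorProduct.lid K V (TensorProduct.map ξ LinearMap.id (R (v ⊗ₜ[K] w))))

/-- The relation on `T(V)` whose closure cuts out the function algebra `S` of `R`:
all elements of the image of `R - q` in degree two are set to zero. -/
def sRel (K : Type) [Field K] (V : Type) [AddCommGroup V] [Module K V]
    (q : K) (R : V ⊗[K] V →ₗ[K] V ⊗[K] V) :
    TensorAlgebra K V → TensorAlgebra K V → Prop :=
  fun a b => b = 0 ∧ ∃ u : V ⊗[K] V, a = mulTwo K V ((R - q • (LinearMap.id : V ⊗[K] V →ₗ[K] V ⊗[K] V)) u)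

/-- The `l`-th homogeneous component of the function algebra `S = T(V)/(im(R - q))`,
as the image of the `l`-th graded piece of the tensor algebra. -/
def sGrade (K : Type) [Field K] (V : Type) [AddCommGroup V] [Module K V]
    (q : K) (R : V ⊗[K] V →ₗ[K] V ⊗[K] V) (l : ℕ) :
    Submodule K (RingQuot (sRel K V q R)) :=
  Submodule.map (RingQuot.mkAlgHom K (sRel K V q R)).toLinearMap
    (LinearMap.range (TensorAlgebra.ι K : V →ₗ[K] TensorAlgebra K V) ^ l)

/-- The Poincaré series `P_S(t) = ∑ (dim S_l) t^l` of the function algebra,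
as a formal power series over `ℝ`. -/
def poincareS (K : Type) [Field K] (V : Type) [AddCommGroup V] [Module K V]
    (q : K) (R : V ⊗[K] V →ₗ[K] V ⊗[K] V) : PowerSeries ℝ :=
  PowerSeries.mk fun l => (Module.finrank K (sGrade K V q R l) : ℝ)

open Subalgebra (smul_mem)
open Finset (range mem_filter mem_range prod_insert mem_insert_of_mem disjoint_left
  mem_insert_self subset_insert prod_eq_zero_iff prod_eq_zero mem_insert mul_prod_erase
  prod_ne_zero_iff ne_of_mem_erase mem_singleton mem_biUnion mem_image mul_sum sum_biUnion
  sum_congr sum_image sum_eq_single sum_mul sum_comm sum_eq_zero sum_subset sum_pair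
  sum_fiberwise_of_maps_to mem_image_of_mem sum_mul_sum sum_sigma' mem_sigma sum_le_sum_of_subset
  sum_le_sum sum_singleton sum_eq_sum_iff_of_le sum_add_distrib sum_range_succ sum_range
  range_mono sum_range_reflect sum_range_succ' prod_congr)
open List (count_pos_iff count_cons cons_append count_append append_nil count_cons_self
  count_cons_of_ne length_eq_zero_iff exists_cons_of_length_eq_add_one count_eq_zero nil_append
  replicate replicate_add length_replicate nodup_range nodup_cons mem_toFinset)
open Polynomial (induction_on' coeff_coe coe_mul mul_coeff_zero coe_injective)
open Nat (strong_induction_on find_spec find_min find le_succ lt_succ_iff lt_succ_self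
  exists_eq_add_of_le cast_zero le_mul_of_pos_right succ_ne_zero)
open Lagrange (basis eval_basis_self)
open Submodule (span_induction subset_span mem_span_singleton_self mem_span_singleton)
open Matrix (det of det_succ_column_zero submatrix_apply of_apply exists_mulVec_eq_zero_iff mulVec
  fromBlocks)
open LinearMap (mulLeftRight mulLeftRight_apply)

namespace HS

structure HeckeSys {K A : Type} [Field K] [Ring A] [Algebra K A] (q : K) (T : ℕ → A) : Prop where
  q0 : q ≠ 0
  qn : ∀ n : ℕ, 0 < n → q ^ n ≠ 1
  quad : ∀ i, T i * T i = (q - 1) • T i + q • (1 : A)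
  braid : ∀ i, T i * T (i+1) * T i = T (i+1) * T i * T (i+1)
  comm : ∀ i j, i + 2 ≤ j → T i * T j = T j * T i

def JM {K A : Type} [Field K] [Ring A] [Algebra K A] (q : K) (T : ℕ → A) : ℕ → A
  | 0 => 1
  | n+1 => q⁻¹ • (T n * JM q T n * T n)

def HH (K : Type) {A : Type} [Field K] [Ring A] [Algebra K A] (T : ℕ → A) (n : ℕ) :
    Subalgebra K A := Algebra.adjoin K {a | ∃ i, i + 1 < n ∧ a = T i}

section A
variable {K A : Type} [Field K] [Ring A] [Algebra K A] {q : K} {T : ℕ → A}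

lemma HH_mono {m n : ℕ} (h : m ≤ n) : HH K T m ≤ HH K T n := by
  apply Algebra.adjoin_mono
  rintro a ⟨i, hi, rfl⟩
  exact ⟨i, by omega, rfl⟩

lemma T_mem_HH {i n : ℕ} (h : i + 1 < n) : T i ∈ HH K T n :=
  Algebra.subset_adjoin ⟨i, h, rfl⟩

lemma JM_mem (n : ℕ) : JM q T n ∈ HH K T (n+1) := by
  induction n with
  | zero => exact Subalgebra.one_mem _
  | succ n ih =>
    have h1 : T n ∈ HH K T (n+1+1) := T_mem_HH (by omega)
    have h2 := HH_mono (K := K) (T := T) (show n+1 ≤ n+1+1 by omega) ih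
    exact smul_mem _ (Subalgebra.mul_mem _ (Subalgebra.mul_mem _ h1 h2) h1) _

lemma HH_centralizes {n : ℕ} {b : A} (h : ∀ i, i + 1 < n → T i * b = b * T i) {a : A}
    (ha : a ∈ HH K T n) : a * b = b * a := by
  unfold HH at ha
  induction ha using Algebra.adjoin_induction with
  | mem x hx => obtain ⟨i, hi, rfl⟩ := hx; exact h i hi
  | algebraMap r => exact Algebra.commutes r b
  | add x y _ _ hx hy => rw [add_mul, mul_add, hx, hy]
  | mul x y _ _ hx hy => rw [mul_assoc, hy, ← mul_assoc, hx, mul_assoc]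

namespace HeckeSys
variable (hs : HeckeSys q T)
include hs

lemma T_comm_HH {n m : ℕ} (h : n ≤ m) {a : A} (ha : a ∈ HH K T n) : a * T m = T m * a :=
  HH_centralizes (fun i hi => hs.comm i m (by omega)) ha

lemma T_JM_gt {n i : ℕ} (h : n < i) : T i * JM q T n = JM q T n * T i :=
  (hs.T_comm_HH h (JM_mem n)).symm

lemma T_JM_lt {n i : ℕ} (h : i + 2 ≤ n) : T i * JM q T n = JM q T n * T i := by
  obtain ⟨k, rfl⟩ : ∃ k, n = i + 2 + k := ⟨n - (i+2), by omega⟩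
  clear h
  induction k with
  | zero =>
    simp only [JM, mul_smul_comm, smul_mul_assoc]
    congr 2
    have hb := hs.braid i
    have hL := hs.T_JM_gt (show i < i+1 by omega)
    calc T i * (T (i+1) * (T i * JM q T i * T i) * T (i+1))
        = (T i * T (i+1) * T i) * JM q T i * T i * T (i+1) := by noncomm_ring
      _ = T (i+1) * T i * (T (i+1) * JM q T i) * T i * T (i+1) := by rw [hb]; noncomm_ring
      _ = T (i+1) * T i * JM q T i * (T (i+1) * T i * T (i+1)) := by rw [hL]; noncomm_ring
      _ = _ := by rw [← hb]; noncomm_ring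
  | succ k ih =>
    show T i * (q⁻¹ • _) = (q⁻¹ • _) * T i
    simp only [mul_smul_comm, smul_mul_assoc]
    congr 1
    have hc := hs.comm i (i+2+k) (by omega)
    change T i * (T (i+2+k) * JM q T (i+2+k) * T (i+2+k)) = T (i+2+k) * JM q T (i+2+k) * T (i+2+k) * T i
    rw [← mul_assoc, ← mul_assoc, hc, mul_assoc (T (i+2+k)), ih, mul_assoc, mul_assoc, mul_assoc, hc]
    simp only [mul_assoc]

lemma JM_comm_HH {n m : ℕ} (h : n ≤ m) {a : A} (ha : a ∈ HH K T n) :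
    a * JM q T m = JM q T m * a :=
  HH_centralizes (fun _ hi => hs.T_JM_lt (by omega)) ha

lemma JM_comm (i j : ℕ) : JM q T i * JM q T j = JM q T j * JM q T i := by
  rcases lt_trichotomy i j with h | rfl | h
  · exact hs.JM_comm_HH h (JM_mem i)
  · rfl
  · exact (hs.JM_comm_HH h (JM_mem j)).symm

lemma q_smul_JM (n : ℕ) : T n * JM q T n * T n = q • JM q T (n+1) := by
  simp [JM, smul_smul, hs.q0]

lemma T_mul_x (n : ℕ) : T n * JM q T n = JM q T (n+1) * T n - (q-1) • JM q T (n+1) := by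
  have h : q • (JM q T (n+1) * T n - (q-1) • JM q T (n+1)) = q • (T n * JM q T n) := by
    rw [smul_sub, smul_comm q (q-1), ← smul_mul_assoc, ← hs.q_smul_JM, mul_assoc, hs.quad]
    simp only [mul_add, mul_smul_comm, mul_one]
    abel
  have := congrArg (fun z => q⁻¹ • z) h
  simpa [smul_smul, hs.q0] using this.symm

lemma x_mul_T (n : ℕ) : JM q T n * T n = T n * JM q T (n+1) - (q-1) • JM q T (n+1) := by
  have h : q • (T n * JM q T (n+1) - (q-1) • JM q T (n+1)) = q • (JM q T n * T n) := by
    rw [smul_sub, smul_comm q (q-1), ← mul_smul_comm, ← hs.q_smul_JM, ← mul_assoc, ← mul_assoc, hs.quad]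
    simp only [add_mul, smul_mul_assoc, one_mul, mul_assoc]
    abel
  have := congrArg (fun z => q⁻¹ • z) h
  simpa [smul_smul, hs.q0] using this.symm

lemma qz_inj {a b : ℤ} (h : q ^ a = q ^ b) : a = b := by
  by_contra hne
  wlog hlt : a < b generalizing a b
  · exact this h.symm (Ne.symm hne) (by omega)
  have h1 : q ^ (b - a) = 1 := by rw [zpow_sub₀ hs.q0, h, div_self (zpow_ne_zero _ hs.q0)]
  obtain ⟨k, hk⟩ := Int.eq_ofNat_of_zero_le (show 0 ≤ b - a by omega)
  rw [hk] at h1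
  exact hs.qn k (by omega) (by exact_mod_cast h1)

lemma q_ne_one : q ≠ 1 := by simpa using hs.qn 1 (by norm_num)
lemma one_add_q : 1 + q ≠ 0 := by
  intro h
  have : q = -1 := by linear_combination h
  exact hs.qn 2 (by norm_num) (by rw [this]; norm_num)

end HeckeSys
end A

def addable (S : List ℕ) (r : ℕ) : Prop := r = 0 ∨ S.count r < S.count (r-1)
instance (S : List ℕ) : DecidablePred (addable S) := fun _ => by unfold addable; infer_instance
def valid : List ℕ → Prop
  | [] => True
  | r :: S => valid S ∧ addable S r

def cz (S : List ℕ) (r : ℕ) : ℤ := (S.count r : ℤ) - r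
def cont {K : Type} [Field K] (q : K) (S : List ℕ) (r : ℕ) : K := q ^ cz S r
def Adds (S : List ℕ) : Finset ℕ := (range (S.length + 1)).filter (addable S)
def removable (S : List ℕ) (r : ℕ) : Prop := S.count (r+1) < S.count r

lemma valid_mem {S : List ℕ} (h : valid S) {x : ℕ} (hx : x ∈ S) : x < S.length := by
  induction S generalizing x with
  | nil => simp at hx
  | cons r S ih =>
    rcases List.mem_cons.1 hx with rfl | hx
    · rcases h.2 with h0 | h0
      · subst h0; simp
      · have : x - 1 ∈ S := count_pos_iff.1 (by omega)
        have := ih h.1 this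
        simp; omega
    · have := ih h.1 hx
      simp; omega

lemma mem_Adds {S : List ℕ} (h : valid S) {r : ℕ} : r ∈ Adds S ↔ addable S r := by
  simp only [Adds, mem_filter, mem_range, and_iff_right_iff_imp]
  rintro (h0 | h0)
  · omega
  · have : r - 1 ∈ S := count_pos_iff.1 (by omega)
    have := valid_mem h this
    omega

lemma valid_step {S : List ℕ} (h : valid S) (r : ℕ) : S.count (r+1) ≤ S.count r := by
  induction S with
  | nil => simp
  | cons s S ih =>
    have := ih h.1
    have h2 := h.2
    simp only [count_cons, addable] at *
    rcases h2 with h2 | h2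
    · subst h2; simp; omega
    · by_cases h3 : s = r + 1
      · subst h3; simp at h2 ⊢; omega
      · simp [h3]; split_ifs <;> omega

lemma valid_anti {S : List ℕ} (h : valid S) {r s : ℕ} (hrs : r ≤ s) : S.count s ≤ S.count r :=
  antitone_nat_of_succ_le (f := fun i => S.count i) (fun n => valid_step h n) hrs

lemma cz_gap {S : List ℕ} (h : valid S) {r s : ℕ} (hs : addable S s) (hrs : r < s) :
    cz S s + 2 ≤ cz S r := by
  rcases hs with hs | hs
  · omega
  · have := valid_anti h (show r ≤ s - 1 by omega)
    simp only [cz]; omega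

lemma cz_ne {S : List ℕ} (h : valid S) {r s : ℕ} (hr : addable S r) (hs : addable S s) (hrs : r ≠ s) :
    cz S s + 2 ≤ cz S r ∨ cz S r + 2 ≤ cz S s := by
  rcases lt_or_gt_of_ne hrs with h1 | h1
  · exact Or.inl (cz_gap h hs h1)
  · exact Or.inr (cz_gap h hr h1)

lemma addable_cons_ne {S : List ℕ} {r s : ℕ} (hrs : s ≠ r) (h : addable S r) : addable (s :: S) r := by
  rcases h with h | h
  · exact Or.inl h
  · right; simp only [count_cons]; simp [hrs]; split_ifs <;> omega

inductive Step (S : List ℕ) : List ℕ → List ℕ → Prop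
  | swap (r s : ℕ) (t : List ℕ) (hne : r ≠ s) (h1 : valid (r :: s :: (t ++ S)))
      (h2 : valid (s :: r :: (t ++ S))) : Step S (r :: s :: t) (s :: r :: t)
  | cons (r : ℕ) (t t' : List ℕ) (h : Step S t t') (hv : valid (r :: (t ++ S))) :
      Step S (r :: t) (r :: t')

def Conn (S : List ℕ) : List ℕ → List ℕ → Prop := Relation.ReflTransGen (Step S)

lemma addable_congr {S S' : List ℕ} (h : ∀ i, S.count i = S'.count i) {r : ℕ} :
    addable S r ↔ addable S' r := by simp [addable, h]

lemma Step.perm {S t t' : List ℕ} (h : Step S t t') : t.Perm t' := by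
  induction h with
  | swap r s t _ _ _ => exact List.Perm.swap s r t
  | cons r t t' _ _ ih => exact ih.cons r

lemma Step.valid {S t t' : List ℕ} (h : Step S t t') : valid (t ++ S) ∧ valid (t' ++ S) := by
  induction h with
  | swap r s t _ h1 h2 => exact ⟨h1, h2⟩
  | cons r t t' h hv ih =>
    refine ⟨hv, ih.2, ?_⟩
    refine (addable_congr (fun i => ?_)).1 hv.2
    simp [h.perm.count_eq]

lemma Step.symm {S t t' : List ℕ} (h : Step S t t') : Step S t' t := by
  induction h with
  | swap r s t hne h1 h2 => exact Step.swap s r t hne.symm h2 h1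
  | cons r t t' h hv ih => exact Step.cons r _ _ ih (Step.cons r t t' h hv).valid.2

lemma Conn.symm {S t t' : List ℕ} (h : Conn S t t') : Conn S t' t := by
  induction h with
  | refl => exact Relation.ReflTransGen.refl
  | tail _ h ih => exact Relation.ReflTransGen.head h.symm ih

lemma Conn.perm {S t t' : List ℕ} (h : Conn S t t') : t.Perm t' := by
  induction h with
  | refl => exact List.Perm.refl _
  | tail _ h ih => exact ih.trans h.perm

lemma Conn.valid {S t t' : List ℕ} (h : Conn S t t') (hv : valid (t ++ S)) : HS.valid (t' ++ S) := by
  induction h with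
  | refl => exact hv
  | tail _ h ih => exact h.valid.2

lemma Conn.cons {S t t' : List ℕ} (h : Conn S t t') (r : ℕ) (hv : HS.valid (r :: (t ++ S))) :
    Conn S (r :: t) (r :: t') := by
  induction h with
  | refl => exact Relation.ReflTransGen.refl
  | tail h1 h ih =>
    refine Relation.ReflTransGen.tail ih (Step.cons r _ _ h ⟨h.valid.1, ?_⟩)
    refine (addable_congr (fun i => ?_)).1 hv.2
    simp [(show Conn _ _ _ from h1).perm.count_eq]

lemma conn_removable {S w : List ℕ} (hv : valid (w ++ S)) {s : ℕ} (hr : removable (w ++ S) s)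
    (hc : 0 < w.count s) : ∃ w2, Conn S w (s :: w2) := by
  induction w with
  | nil => simp at hc
  | cons r w ih =>
    by_cases hrs : r = s
    · subst hrs; exact ⟨w, Relation.ReflTransGen.refl⟩
    · have hc' : 0 < w.count s := by simpa [count_cons, hrs] using hc
      have hr' : removable (w ++ S) s := by
        simp only [removable, cons_append, count_cons] at hr ⊢
        simp only [count_append] at *
        have e1 : (r == s) = false := by simpa using hrs
        rw [e1] at hr
        simp only [Bool.false_eq_true, if_false] at hr
        split_ifs at hr <;> omega
      obtain ⟨w2, hw2⟩ := ih hv.1 hr' hc'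
      have h1 : Conn S (r :: w) (r :: s :: w2) := hw2.cons r hv
      refine ⟨r :: w2, Relation.ReflTransGen.tail h1 ?_⟩
      have hval := h1.valid hv
      have hcnt : ∀ i, (r :: (w ++ S)).count i = (r :: s :: (w2 ++ S)).count i := fun i => by
        have := (h1.perm.append_right S).count_eq i
        simpa using this
      have hr2 : removable (r :: s :: (w2 ++ S)) s := by
        unfold removable; rw [← hcnt, ← hcnt]; exact hr
      have hv2 : valid (r :: s :: (w2 ++ S)) := hval
      refine Step.swap r s w2 hrs hv2 ⟨⟨hv2.1.1, ?_⟩, addable_cons_ne hrs hv2.1.2⟩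
      rcases hv2.2 with h | h
      · exact Or.inl h
      · right
        simp only [removable, count_cons] at h hr2
        simp [hrs, Ne.symm hrs] at h hr2
        by_cases h3 : s = r - 1
        · have : r = s + 1 ∨ r = 0 := by omega
          rcases this with h4 | h4
          · subst h4; simp at h hr2 ⊢; omega
          · omega
        · simpa [h3] using h

lemma removable_head {S : List ℕ} {r : ℕ} (h : valid (r :: S)) : removable (r :: S) r := by
  have := valid_step h.1 r
  simp only [removable, count_cons]; simp; omega

lemma conn_of_count {S w u : List ℕ} (hw : valid (w ++ S)) (hu : valid (u ++ S))
    (hc : ∀ i, w.count i = u.count i) : Conn S w u := by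
  induction w generalizing u with
  | nil =>
    have : u = [] := by
      rw [List.eq_nil_iff_forall_not_mem]
      intro a ha
      have := count_pos_iff.2 ha
      rw [← hc a] at this; simp at this
    subst this; exact Relation.ReflTransGen.refl
  | cons r w ih =>
    have hr : removable (u ++ S) r := by
      have := removable_head (S := w ++ S) hw
      unfold removable at this ⊢
      rw [count_append, count_append, ← hc, ← hc]
      rwa [← cons_append, count_append, count_append] at this
    obtain ⟨u2, hu2⟩ := conn_removable hu hr (by rw [← hc]; simp)
    have hv2 : valid (r :: (u2 ++ S)) := hu2.valid hu
    have := ih (u := u2) hw.1 hv2.1 (fun i => by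
      have h1 := hc i
      rw [hu2.perm.count_eq] at h1
      simpa [count_cons] using h1)
    exact (this.cons r hw).trans hu2.symm

end HS

namespace HS
section A
variable {K A : Type} [Field K] [Ring A] [Algebra K A] {q : K} {T : ℕ → A}

def IsW (q : K) (T : ℕ → A) : List ℕ → A → Prop
  | [], _ => True
  | r :: S, v => IsW q T S v ∧ JM q T S.length * v = cont q S r • v

lemma aeval_eig {L v : A} {c : K} (h : L * v = c • v) (p : K[X]) :
    aeval L p * v = p.eval c • v := by
  induction p using induction_on' with
  | add p r hp hr => simp [add_mul, add_smul, hp, hr]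
  | monomial n a =>
    have : ∀ n : ℕ, L ^ n * v = c ^ n • v := by
      intro n
      induction n with
      | zero => simp
      | succ n ih => rw [pow_succ, mul_assoc, h, mul_smul_comm, ih, smul_smul, pow_succ, mul_comm]
    simp [aeval_monomial, this, mul_assoc, ← Algebra.smul_def, smul_smul, smul_mul_assoc]

lemma IsW.map {S : List ℕ} {v X : A} (h : IsW q T S v)
    (hX : ∀ i, i < S.length → X * JM q T i = JM q T i * X) : IsW q T S (X * v) := by
  induction S with
  | nil => trivial
  | cons r S ih =>
    refine ⟨ih h.1 (fun i hi => hX i (by simp; omega)), ?_⟩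
    rw [← mul_assoc, ← hX _ (by simp), mul_assoc, h.2, mul_smul_comm]

lemma IsW.mul_right {S : List ℕ} {v : A} (h : IsW q T S v) (X : A) : IsW q T S (v * X) := by
  induction S with
  | nil => trivial
  | cons r S ih => exact ⟨ih h.1, by rw [← mul_assoc, h.2, smul_mul_assoc]⟩

lemma IsW.smul {S : List ℕ} {v : A} (h : IsW q T S v) (c : K) : IsW q T S (c • v) := by
  induction S with
  | nil => trivial
  | cons r S ih => exact ⟨ih h.1, by rw [mul_smul_comm, h.2, smul_comm]⟩

def phi (q : K) (T : ℕ → A) (n : ℕ) : A :=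
  T n * (JM q T n - JM q T (n+1)) + (q-1) • JM q T (n+1)

lemma phi_mem (n : ℕ) : phi q T n ∈ HH K T (n+2) := by
  have h1 : T n ∈ HH K T (n+2) := T_mem_HH (by omega)
  have h2 := HH_mono (K := K) (T := T) (show n+1 ≤ n+2 by omega) (JM_mem (q := q) n)
  have h3 := JM_mem (q := q) (T := T) (n+1)
  exact Subalgebra.add_mem _ (Subalgebra.mul_mem _ h1 (Subalgebra.sub_mem _ h2 h3))
    (smul_mem _ h3 _)

def Trans (q : K) (T : ℕ → A) (S S' : List ℕ) : Prop :=
  ∃ X Y, X ∈ HH K T S.length ∧ Y ∈ HH K T S.length ∧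
    (∀ v, IsW q T S v → IsW q T S' (X * v) ∧ Y * (X * v) = v) ∧
    (∀ v, IsW q T S' v → IsW q T S (Y * v) ∧ X * (Y * v) = v)

namespace HeckeSys
variable (hs : HeckeSys q T)
include hs

lemma yT (n : ℕ) : JM q T (n+1) * T n = T n * JM q T n + (q-1) • JM q T (n+1) := by
  rw [hs.T_mul_x]; abel

lemma phi_x (n : ℕ) : phi q T n * JM q T n = JM q T (n+1) * phi q T n := by
  have e1 := hs.yT n
  have e2 := hs.JM_comm n (n+1)
  unfold phi
  generalize JM q T (n+1) = y at *
  generalize JM q T n = x at *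
  simp only [mul_add, add_mul, mul_sub, sub_mul, mul_smul_comm, smul_mul_assoc, mul_assoc, e2]
  rw [← mul_assoc y, ← mul_assoc y, e1]
  simp only [mul_add, add_mul, mul_sub, sub_mul, mul_smul_comm, smul_mul_assoc, mul_assoc, e2]
  module

lemma phi_y (n : ℕ) : phi q T n * JM q T (n+1) = JM q T n * phi q T n := by
  have e1 := hs.x_mul_T n
  have e2 := hs.JM_comm n (n+1)
  unfold phi
  generalize JM q T (n+1) = y at *
  generalize JM q T n = x at *
  simp only [mul_add, add_mul, mul_sub, sub_mul, mul_smul_comm, smul_mul_assoc, mul_assoc, e2]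
  rw [← mul_assoc x, ← mul_assoc x, e1]
  simp only [mul_add, add_mul, mul_sub, sub_mul, mul_smul_comm, smul_mul_assoc, mul_assoc, e2]
  module

lemma phi_sq (n : ℕ) : phi q T n * phi q T n =
    (q • JM q T n - JM q T (n+1)) * (q • JM q T (n+1) - JM q T n) := by
  have h1 := hs.phi_x n
  have h2 := hs.phi_y n
  have e0 := hs.x_mul_T n
  have e1 := hs.yT n
  have e2 := hs.JM_comm n (n+1)
  have e3 := hs.quad n
  unfold phi at *
  generalize JM q T (n+1) = y at *
  generalize JM q T n = x at *
  generalize T n = t at *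
  have e3' : ∀ z, t * (t * z) = (q-1) • (t * z) + q • z := fun z => by
    rw [← mul_assoc, e3]; simp [add_mul]
  have e0' : ∀ z, x * (t * z) = t * (y * z) - (q-1) • (y * z) := fun z => by
    rw [← mul_assoc, e0]; simp [sub_mul, mul_assoc]
  have e1' : ∀ z, y * (t * z) = t * (x * z) + (q-1) • (y * z) := fun z => by
    rw [← mul_assoc, e1]; simp [add_mul, mul_assoc]
  simp only [mul_add, add_mul, mul_sub, sub_mul, mul_smul_comm, smul_mul_assoc, mul_assoc, e2,
    e0', e1', e3', smul_sub, smul_add, smul_smul]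
  module

lemma phi_JM_lt {n i : ℕ} (h : i < n) : phi q T n * JM q T i = JM q T i * phi q T n := by
  have h1 := hs.T_JM_gt h
  have h2 := hs.JM_comm n i
  have h3 := hs.JM_comm (n+1) i
  unfold phi
  simp only [add_mul, mul_add, mul_sub, sub_mul, mul_assoc, h2, h3, smul_mul_assoc, mul_smul_comm]
  rw [← mul_assoc, ← mul_assoc, h1]
  simp only [mul_assoc]

lemma phi_act {n : ℕ} {v : A} {c d : K} (hx : JM q T n * v = c • v)
    (hy : JM q T (n+1) * v = d • v) :
    phi q T n * v = (c - d) • (T n * v) + ((q-1) * d) • v := by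
  unfold phi
  simp only [add_mul, mul_sub, sub_mul, mul_assoc, hx, hy, smul_mul_assoc, mul_smul_comm]
  module

lemma phi_weight {n : ℕ} {v : A} {c d : K} (hx : JM q T n * v = c • v)
    (hy : JM q T (n+1) * v = d • v) :
    JM q T n * (phi q T n * v) = d • (phi q T n * v) ∧
    JM q T (n+1) * (phi q T n * v) = c • (phi q T n * v) := by
  constructor
  · rw [← mul_assoc, ← hs.phi_y, mul_assoc, hy, mul_smul_comm]
  · rw [← mul_assoc, ← hs.phi_x, mul_assoc, hx, mul_smul_comm]

lemma phi_phi {n : ℕ} {v : A} {c d : K} (hx : JM q T n * v = c • v)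
    (hy : JM q T (n+1) * v = d • v) :
    phi q T n * (phi q T n * v) = ((q * c - d) * (q * d - c)) • v := by
  rw [← mul_assoc, hs.phi_sq]
  simp only [mul_sub, sub_mul, mul_assoc, smul_mul_assoc, mul_smul_comm, hx, hy, smul_smul]
  module

lemma cont_gap {z w : ℤ} (h : z + 2 ≤ w ∨ w + 2 ≤ z) :
    (q * q ^ z - q ^ w) * (q * q ^ w - q ^ z) ≠ 0 := by
  rw [← zpow_one_add₀ hs.q0, ← zpow_one_add₀ hs.q0]
  apply mul_ne_zero <;>
  · intro h0
    have := hs.qz_inj (sub_eq_zero.1 h0)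
    omega

lemma cont_cons_ne {S : List ℕ} {r s : ℕ} (h : r ≠ s) : cont q (r :: S) s = cont q S s := by
  simp [cont, cz, count_cons, h]

lemma trans_step {S w w' : List ℕ} (h : Step S w w') : Trans q T (w ++ S) (w' ++ S) := by
  induction h with
  | swap r s t hne h1 h2 =>
    have hnz : (q * cont q (t ++ S) s - cont q (t ++ S) r) *
        (q * cont q (t ++ S) r - cont q (t ++ S) s) ≠ 0 :=
      hs.cont_gap (cz_ne h1.1.1 h2.1.2 h1.1.2 hne)
    have key : ∀ a b, a ≠ b → ∀ v, IsW q T (a :: b :: (t ++ S)) v →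
        IsW q T (b :: a :: (t ++ S)) (phi q T (t ++ S).length * v) ∧
        phi q T (t ++ S).length * (phi q T (t ++ S).length * v) =
        ((q * cont q (t ++ S) b - cont q (t ++ S) a) *
        (q * cont q (t ++ S) a - cont q (t ++ S) b)) • v := by
      intro a b hab v hv
      have hx := hv.1.2
      have hy := hv.2
      rw [hs.cont_cons_ne hab.symm] at hy
      have hw := hs.phi_weight hx hy
      refine ⟨⟨⟨hv.1.1.map fun i hi => hs.phi_JM_lt hi, hw.1⟩, ?_⟩, hs.phi_phi hx hy⟩
      rw [hs.cont_cons_ne hab]; exact hw.2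
    have hm : phi q T (t ++ S).length ∈ HH K T (r :: s :: (t ++ S)).length := phi_mem _
    refine ⟨phi q T (t ++ S).length, ((q * cont q (t ++ S) s - cont q (t ++ S) r) *
        (q * cont q (t ++ S) r - cont q (t ++ S) s))⁻¹ • phi q T (t ++ S).length, hm,
        smul_mem _ hm _, ?_, ?_⟩
    · intro v hv
      obtain ⟨ha, hb⟩ := key r s hne v hv
      refine ⟨ha, ?_⟩
      rw [smul_mul_assoc, hb, smul_smul, inv_mul_cancel₀ hnz, one_smul]
    · intro v hv
      obtain ⟨ha, hb⟩ := key s r hne.symm v hv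
      refine ⟨?_, ?_⟩
      · rw [smul_mul_assoc]; exact ha.smul _
      · rw [mul_comm] at hnz
        rw [smul_mul_assoc, mul_smul_comm, hb, smul_smul, mul_comm (q * cont q (t ++ S) s - _),
          inv_mul_cancel₀ hnz, one_smul]
  | cons r t t' h hv ih =>
    obtain ⟨X, Y, hX, hY, h1, h2⟩ := ih
    have hlen : (t' ++ S).length = (t ++ S).length := by simp [h.perm.length_eq]
    have hc : cont q (t' ++ S) r = cont q (t ++ S) r := by
      simp [cont, cz, h.perm.count_eq]
    refine ⟨X, Y, HH_mono (by simp) hX, HH_mono (by simp) hY, ?_, ?_⟩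
    · intro v hv
      have hv2 : JM q T (t ++ S).length * v = cont q (t ++ S) r • v := hv.2
      refine ⟨⟨(h1 v hv.1).1, ?_⟩, (h1 v hv.1).2⟩
      change JM q T (t' ++ S).length * _ = cont q (t' ++ S) r • _
      rw [hlen, hc, ← mul_assoc, ← hs.JM_comm_HH le_rfl hX, mul_assoc, hv2, mul_smul_comm]
    · intro v hv
      refine ⟨⟨(h2 v hv.1).1, ?_⟩, (h2 v hv.1).2⟩
      have hv2 : JM q T (t' ++ S).length * v = cont q (t' ++ S) r • v := hv.2
      change JM q T (t ++ S).length * _ = cont q (t ++ S) r • _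
      rw [hlen, hc] at hv2
      rw [← mul_assoc, ← hs.JM_comm_HH le_rfl hY, mul_assoc, hv2, mul_smul_comm]

lemma trans_conn {S w w' : List ℕ} (h : Conn S w w') : Trans q T (w ++ S) (w' ++ S) := by
  induction h with
  | refl => exact ⟨1, 1, Subalgebra.one_mem _, Subalgebra.one_mem _, by simp, by simp⟩
  | @tail b c h1 h ih =>
    obtain ⟨X, Y, hX, hY, a1, a2⟩ := ih
    obtain ⟨X', Y', hX', hY', b1, b2⟩ := hs.trans_step h
    have hl : (b ++ S).length = (w ++ S).length := by
      simp [(show Conn S w b from h1).perm.length_eq]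
    rw [hl] at hX' hY'
    refine ⟨X' * X, Y * Y', Subalgebra.mul_mem _ hX' hX, Subalgebra.mul_mem _ hY hY', ?_, ?_⟩
    · intro v hv
      have := a1 v hv
      have h3 := b1 _ this.1
      refine ⟨by rw [mul_assoc]; exact h3.1, ?_⟩
      rw [mul_assoc X', mul_assoc Y, h3.2, this.2]
    · intro v hv
      have := b2 v hv
      have h3 := a2 _ this.1
      refine ⟨by rw [mul_assoc]; exact h3.1, ?_⟩
      rw [mul_assoc X', mul_assoc Y, h3.2, this.2]

omit hs in
lemma aeval_comm {L X : A} (h : X * L = L * X) (p : K[X]) : X * aeval L p = aeval L p * X := by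
  have : Commute X (aeval L p) := by
    induction p using induction_on' with
    | add p r hp hr => simpa using hp.add_right hr
    | monomial n a =>
      rw [aeval_monomial]
      exact (Algebra.commute_algebraMap_right a X).mul_right ((show Commute X L from h).pow_right n)
  exact this

def _root_.HS.pz (q : K) (Z : Finset ℤ) : K[X] := ∏ z ∈ Z, (X - C (q ^ z))

omit hs in
lemma strike {L v : A} (Z G : Finset ℤ) (hZ : aeval L (pz q Z) * v = 0)
    (hbad : ∀ z ∈ Z, z ∉ G → ∀ p : K[X], L * (aeval L p * v) = q ^ z • (aeval L p * v) →
      aeval L p * v = 0) : aeval L (pz q G) * v = 0 := by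
  have key : ∀ Z2 : Finset ℤ, ∀ Z1 : Finset ℤ, (∀ z ∈ Z2, z ∉ G → ∀ p : K[X], L * (aeval L p * v) = q ^ z • (aeval L p * v) →
      aeval L p * v = 0) → aeval L (pz q Z2 * pz q Z1) * v = 0 → Z1 ⊆ G → (Disjoint Z1 Z2) →
      aeval L (pz q G) * v = 0 := by
    intro Z2
    induction Z2 using Finset.induction_on with
    | empty =>
      intro Z1 _ h hsub _
      have : pz q G = pz q (G \ Z1) * pz q Z1 := by
        unfold pz; rw [Finset.prod_sdiff hsub]
      rw [this, map_mul, mul_assoc]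
      have h' : aeval L (pz q Z1) * v = 0 := by simpa [pz] using h
      rw [h', mul_zero]
    | insert z Z2 hz ih =>
      intro Z1 hb h hsub hd
      have e1 : pz q (insert z Z2) = (X - C (q ^ z)) * pz q Z2 := by
        unfold pz; rw [prod_insert hz]
      by_cases hzG : z ∈ G
      · refine ih (insert z Z1) (fun z' hz' => hb z' (mem_insert_of_mem hz')) ?_ ?_ ?_
        · have hz1 : z ∉ Z1 := fun h1 => (disjoint_left.1 hd h1) (mem_insert_self _ _)
          have e2 : pz q (insert z Z1) = (X - C (q ^ z)) * pz q Z1 := by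
            unfold pz; rw [prod_insert hz1]
          rw [e2, mul_left_comm, ← mul_assoc, ← e1]; exact h
        · exact Finset.insert_subset hzG hsub
        · rw [Finset.disjoint_insert_left]
          exact ⟨hz, hd.mono_right (subset_insert _ _)⟩
      · refine ih Z1 (fun z' hz' => hb z' (mem_insert_of_mem hz')) ?_ hsub
          (hd.mono_right (subset_insert _ _))
        apply hb z (mem_insert_self _ _) hzG
        rw [e1, mul_assoc, map_mul, mul_assoc] at h
        rw [← sub_eq_zero, ← h]
        simp [sub_mul, Algebra.smul_def]
  exact key Z ∅ hbad (by simpa [pz] using hZ) (by simp) (by simp)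

omit hs in
lemma eig_mem {L v : A} {Z : Finset ℤ} {c : K} (hL : L * v = c • v) (h : aeval L (pz q Z) * v = 0)
    (hv : v ≠ 0) : ∃ z ∈ Z, c = q ^ z := by
  rw [aeval_eig hL, smul_eq_zero] at h
  have h := h.resolve_right hv
  unfold pz at h
  rw [eval_prod, prod_eq_zero_iff] at h
  obtain ⟨z, hz, h⟩ := h
  exact ⟨z, hz, by simpa [sub_eq_zero] using h⟩

def _root_.HS.ZA (S : List ℕ) : Finset ℤ := (Adds S).image (cz S)

omit hs in
lemma mem_ZA {S : List ℕ} (h : valid S) {z : ℤ} : z ∈ ZA S ↔ ∃ r, addable S r ∧ cz S r = z := by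
  simp [ZA, mem_Adds h]

omit hs in
lemma not_mem_ZA {S : List ℕ} (h : valid S) {r : ℕ} (hr : addable S r) {z : ℤ}
    (hz : z = cz S r + 1 ∨ z = cz S r - 1) : z ∉ ZA S := by
  rw [mem_ZA h]
  rintro ⟨s, hs, rfl⟩
  by_cases hrs : r = s
  · subst hrs; omega
  · have := cz_ne h hr hs hrs; omega

lemma T_act {n : ℕ} {S : List ℕ} (hS : S.length = n) (hv : valid S)
    (hann : ∀ v, IsW q T S v → aeval (JM q T n) (pz q (ZA S)) * v = 0) {v : A} {c d : ℤ}
    (hw : IsW q T S v) (hx : JM q T n * v = q ^ c • v) (hy : JM q T (n+1) * v = q ^ d • v)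
    (hd : d ∉ ZA S) : (q ^ c - q ^ d) • (T n * v) = (-((q-1) * q ^ d)) • v := by
  have h1 := hs.phi_act hx hy
  have h2 := (hs.phi_weight hx hy).1
  have h3 : IsW q T S (phi q T n * v) := hw.map fun i hi => hs.phi_JM_lt (by omega)
  have h4 : phi q T n * v = 0 := by
    by_contra hne
    obtain ⟨z, hz, he⟩ := eig_mem h2 (hann _ h3) hne
    exact hd (hs.qz_inj he ▸ hz)
  rw [h4] at h1
  rw [neg_smul]
  exact eq_neg_of_add_eq_zero_left h1.symm

lemma T_act_up {n : ℕ} {v : A} {c : ℤ} (h : (q ^ c - q ^ (c+1)) • (T n * v) = (-((q-1) * q ^ (c+1))) • v) :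
    T n * v = q • v := by
  have hz := zpow_ne_zero c hs.q0
  have h1 : q - 1 ≠ 0 := sub_ne_zero.2 hs.q_ne_one
  rw [zpow_add_one₀ hs.q0] at h
  have h2 : (q ^ c - q ^ c * q) = -(q^c * (q-1)) := by ring
  have h3 : (-((q-1) * (q ^ c * q))) = (-(q^c * (q-1))) * q := by ring
  rw [h2, h3, mul_smul] at h
  exact smul_right_injective A (neg_ne_zero.2 (mul_ne_zero hz h1)) h

lemma T_act_down {n : ℕ} {v : A} {c : ℤ} (h : (q ^ (c+1) - q ^ c) • (T n * v) = (-((q-1) * q ^ c)) • v) :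
    T n * v = (-1 : K) • v := by
  have hz := zpow_ne_zero c hs.q0
  have h1 : q - 1 ≠ 0 := sub_ne_zero.2 hs.q_ne_one
  rw [zpow_add_one₀ hs.q0] at h
  have h2 : (q ^ c * q - q ^ c) = (q^c * (q-1)) := by ring
  have h3 : (-((q-1) * (q ^ c))) = ((q^c * (q-1))) * (-1) := by ring
  rw [h2, h3, mul_smul _ (-1 : K)] at h
  exact smul_right_injective A ((mul_ne_zero hz h1)) h

lemma braid_kill {n : ℕ} {v : A} {a b : K} (h1 : T n * v = a • v) (h2 : T (n+1) * v = b • v)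
    (hab : (a = q ∧ b = -1) ∨ (a = -1 ∧ b = q)) : v = 0 := by
  have hb := congrArg (fun z => z * v) (hs.braid n)
  simp only [mul_assoc, h1, h2, mul_smul_comm, smul_smul] at hb
  have h3 : (a * (b * a) - b * (a * b)) • v = 0 := by rw [sub_smul, sub_eq_zero]; exact hb
  rw [smul_eq_zero] at h3
  refine h3.resolve_left ?_
  have h0 := hs.q0
  have hq := hs.one_add_q
  rcases hab with ⟨rfl, rfl⟩ | ⟨rfl, rfl⟩
  · rw [show a * (-1 * a) - -1 * (a * -1) = -(a * (1 + a)) by ring]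
    exact neg_ne_zero.2 (mul_ne_zero h0 hq)
  · rw [show -1 * (b * -1) - b * (-1 * b) = (b * (1 + b)) by ring]
    exact (mul_ne_zero h0 hq)

theorem ann (n : ℕ) : ∀ S : List ℕ, S.length = n → valid S → ∀ v, IsW q T S v →
    aeval (JM q T n) (pz q (ZA S)) * v = 0 := by
  induction n using strong_induction_on with
  | _ N IH =>
  intro S hN hv v hw
  match S, hN, hv, hw with
  | [], hN, hv, hw =>
    simp at hN; subst hN
    have : (0:ℤ) ∈ ZA [] := by rw [mem_ZA hv]; exact ⟨0, Or.inl rfl, by simp [cz]⟩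
    have e : JM q T 0 * v = (q ^ (0:ℤ)) • v := by simp [JM]
    rw [aeval_eig e]
    unfold pz
    rw [eval_prod, prod_eq_zero this (by simp), zero_smul]
  | r :: S0, hN, hv, hw =>
    obtain ⟨n, rfl⟩ : ∃ n, N = n + 1 := ⟨S0.length, by simpa using hN.symm⟩
    have hn : S0.length = n := by simpa using hN
    have A0 := IH n (by omega) S0 hn hv.1
    set c := cz S0 r with hc
    have hx : JM q T n * v = q ^ c • v := by rw [← hn]; exact hw.2
    have hr := hv.2
    have up : c + 1 ∉ ZA S0 := not_mem_ZA hv.1 hr (Or.inl rfl)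
    have dn : c - 1 ∉ ZA S0 := not_mem_ZA hv.1 hr (Or.inr rfl)
    have hdisj : c + 1 ∉ insert (c-1) (ZA S0) := by
      simp only [mem_insert, not_or]; exact ⟨by omega, up⟩
    apply strike (insert (c+1) (insert (c-1) (ZA S0))) (ZA (r :: S0))
    · have h1 := A0 (phi q T n * v) (hw.1.map fun i hi => hs.phi_JM_lt (by omega))
      have h2 : phi q T n * (aeval (JM q T (n+1)) (pz q (ZA S0)) * v) = 0 := by
        rw [← h1, ← mul_assoc, ← mul_assoc]
        congr 1
        generalize pz q (ZA S0) = p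
        have : ∀ k : ℕ, phi q T n * JM q T (n+1) ^ k = JM q T n ^ k * phi q T n := by
          intro k
          induction k with
          | zero => simp
          | succ k ih => rw [pow_succ, ← mul_assoc, ih, mul_assoc, hs.phi_y, ← mul_assoc, ← pow_succ]
        induction p using induction_on' with
        | add p r hp hr => simp [mul_add, add_mul, hp, hr]
        | monomial k a =>
          rw [aeval_monomial, aeval_monomial, ← mul_assoc, ← Algebra.commutes a (phi q T n), mul_assoc, this,
            mul_assoc]
      have h3 := congrArg (fun z => phi q T n * z) h2
      simp only [mul_zero] at h3
      rw [← mul_assoc, hs.phi_sq] at h3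
      set y := JM q T (n+1) with hy
      set u := aeval y (pz q (ZA S0)) * v with hu
      have hxu : JM q T n * u = q ^ c • u := by
        rw [hu, ← mul_assoc, aeval_comm (hs.JM_comm n (n+1)), mul_assoc, hx, mul_smul_comm]
      have h4 : (y - (q^(c+1)) • 1) * ((y - (q^(c-1)) • 1) * u) = 0 := by
        have hxy : ∀ z, JM q T n * (y * z) = y * (JM q T n * z) := fun z => by
          rw [← mul_assoc, hs.JM_comm, mul_assoc]
        have : (-q) • ((y - (q^(c+1)) • 1) * ((y - (q^(c-1)) • 1) * u)) = 0 := by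
          rw [← h3]
          simp only [sub_mul, mul_sub, smul_mul_assoc, mul_smul_comm, one_mul, mul_assoc, hxu,
            smul_sub, smul_smul, hxy, zpow_add_one₀ hs.q0, zpow_sub_one₀ hs.q0]
          have := hs.q0
          match_scalars <;> field_simp <;> ring
        exact (smul_eq_zero.1 this).resolve_left (neg_ne_zero.2 hs.q0)
      unfold pz
      rw [prod_insert hdisj, prod_insert dn, map_mul, map_mul, mul_assoc, mul_assoc]
      simpa [Algebra.smul_def, hu, pz] using h4
    · intro z hz hzG p hzy
      set u := aeval (JM q T (n+1)) p * v with hu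
      have hwu : IsW q T (r :: S0) u := hw.map fun i hi => (aeval_comm (hs.JM_comm i (n+1)) p).symm
      have hxu : JM q T n * u = q ^ c • u := by rw [← hn]; exact hwu.2
      clear_value u
      rw [mem_ZA hv] at hzG
      simp only [mem_insert] at hz
      by_contra hne
      have main : ∀ s, removable S0 s → (cz S0 s = c ∧ z = c - 1 ∨ cz S0 s = c + 2 ∧ z = c + 1) → False := by
        intro s hrem hcase
        obtain ⟨S1, hS1⟩ := conn_removable (S := []) (w := S0) (by simpa using hv.1)
          (by simpa using hrem) (by unfold removable at hrem; omega)
        have htr := hs.trans_conn hS1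
        simp only [append_nil] at htr
        obtain ⟨X, Y, hX, hY, t1, t2⟩ := htr
        rw [hn] at hX hY
        obtain ⟨w1, w2⟩ := t1 u hwu.1
        have hne' : X * u ≠ 0 := fun h0 => hne (by rw [← w2, h0, mul_zero])
        have hl : S0.length = S1.length + 1 := by simpa using hS1.perm.length_eq
        have hv1 : valid (s :: S1) := by simpa using hS1.valid (by simpa using hv.1)
        obtain ⟨k, rfl⟩ : ∃ k, n = k + 1 := ⟨S1.length, by omega⟩
        have hk : S1.length = k := by omega
        have e1 : cz S1 s = cz S0 s - 1 := by
          have := hS1.perm.count_eq s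
          simp only [count_cons_self] at this
          simp only [cz]; omega
        have x0 : JM q T k * (X * u) = q ^ (cz S0 s - 1) • (X * u) := by
          have := w1.2; rw [hk] at this; rw [this, ← e1]; rfl
        have x1 : JM q T (k+1) * (X * u) = q ^ c • (X * u) := by
          rw [← mul_assoc, ← hs.JM_comm_HH le_rfl hX, mul_assoc, hxu, mul_smul_comm]
        have x2 : JM q T (k+1+1) * (X * u) = q ^ z • (X * u) := by
          rw [← mul_assoc, ← hs.JM_comm_HH (by omega) hX, mul_assoc, hzy, mul_smul_comm]
        have tt : T (k+1) * (X * u) = X * (T (k+1) * u) := by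
          rw [← mul_assoc, ← hs.T_comm_HH le_rfl hX, mul_assoc]
        have A1 := IH k (by omega) S1 hk hv1.1
        rcases hcase with ⟨ha, hb⟩ | ⟨ha, hb⟩
        · have f1 : T (k+1) * u = (-1:K) • u := by
            have := hs.T_act hn hv.1 A0 (c := c) (d := z) hwu.1 hxu hzy (hb ▸ dn)
            apply hs.T_act_down (c := z); rw [hb, sub_add_cancel, ← hb]; exact this
          have f2 : T k * (X * u) = q • (X * u) := by
            have := hs.T_act hk hv1.1 A1 (c := cz S0 s - 1) (d := c) w1.1 x0 x1
              (not_mem_ZA hv1.1 hv1.2 (by omega))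
            apply hs.T_act_up (c := c - 1); rw [sub_add_cancel, ← ha]; rw [ha] at this ⊢; exact this
          exact hne' (hs.braid_kill f2 (by rw [tt, f1, mul_smul_comm]) (Or.inl ⟨rfl, rfl⟩))
        · have f1 : T (k+1) * u = q • u := by
            have := hs.T_act hn hv.1 A0 (c := c) (d := z) hwu.1 hxu hzy (hb ▸ up)
            apply hs.T_act_up (c := c); rw [← hb]; exact this
          have f2 : T k * (X * u) = (-1:K) • (X * u) := by
            have := hs.T_act hk hv1.1 A1 (c := cz S0 s - 1) (d := c) w1.1 x0 x1
              (not_mem_ZA hv1.1 hv1.2 (by omega))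
            apply hs.T_act_down (c := c); rw [ha, show c + 2 - 1 = c + 1 by ring] at this; exact this
          exact hne' (hs.braid_kill f2 (by rw [tt, f1, mul_smul_comm]) (Or.inr ⟨rfl, rfl⟩))
      rcases hz with rfl | rfl | hz
      ·
        have hna : ¬ addable (r :: S0) r := fun h => hzG ⟨r, h, by simp [cz, hc]; ring⟩
        simp only [addable, not_or, not_lt, count_cons_self] at hna
        obtain ⟨hr0, hna⟩ := hna
        have hr' := hr.resolve_left hr0
        rw [count_cons_of_ne (by omega)] at hna
        apply main (r-1)
        · unfold removable; rw [show r - 1 + 1 = r by omega]; exact hr'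
        · right; refine ⟨?_, rfl⟩
          simp only [cz, hc]; omega
      · have hna : ¬ addable (r :: S0) (r+1) := by
          intro h
          by_cases heq : S0.count (r+1) = S0.count r
          · exact hzG ⟨r+1, h, by simp only [cz, hc]; rw [count_cons_of_ne (by omega)]; push_cast; omega⟩
          · refine main r ?_ (Or.inl ⟨rfl, rfl⟩)
            have := valid_step hv.1 r
            unfold removable; omega
        by_cases heq : S0.count (r+1) = S0.count r
        · apply hna; right; rw [count_cons_of_ne (by omega)]; simp; omega
        · refine main r ?_ (Or.inl ⟨rfl, rfl⟩)
          have := valid_step hv.1 r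
          unfold removable; omega
      · rw [mem_ZA hv.1] at hz
        obtain ⟨s, hsa, rfl⟩ := hz
        by_cases hsr : r = s
        · subst hsr
          set t := T n * u with ht
          have hxt : JM q T n * t = q ^ c • t - ((q-1) * q ^ c) • u := by
            rw [ht, ← mul_assoc, hs.x_mul_T, sub_mul, mul_assoc, smul_mul_assoc, hzy, mul_smul_comm, smul_smul, hc]
          have hwt : IsW q T S0 t := hwu.1.map fun i hi => hs.T_JM_gt (by omega)
          have ka := A0 t hwt
          have der : ∀ p : K[X], aeval (JM q T n) p * t = p.eval (q ^ c) • t - (p.derivative.eval (q^c) * ((q-1) * q ^ c)) • u := by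
            intro p
            induction p using induction_on' with
            | add p r hp hr => simp only [map_add, add_mul, hp, hr, eval_add, derivative_add]; module
            | monomial k a =>
              have : ∀ k : ℕ, JM q T n ^ k * t = (q^c)^k • t - ((k : K) * (q^c)^(k-1) * ((q-1) * q ^ c)) • u := by
                intro k
                induction k with
                | zero => simp
                | succ k ih =>
                  rw [pow_succ', mul_assoc, ih, mul_sub, mul_smul_comm, mul_smul_comm, hxt, hxu]
                  rcases k with _ | k
                  · simp
                  · simp only [Nat.add_sub_cancel, smul_sub, smul_smul, pow_succ]
                    push_cast
                    match_scalars <;> ring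
              rw [aeval_monomial, mul_assoc, this, ← Algebra.smul_def, derivative_monomial]
              simp only [eval_monomial, smul_sub, smul_smul]
              match_scalars <;> ring
          rw [der] at ka
          have hmem : c ∈ ZA S0 := (mem_ZA hv.1).2 ⟨r, hr, rfl⟩
          have e0 : (pz q (ZA S0)).eval (q ^ c) = 0 := by
            unfold pz; rw [eval_prod, prod_eq_zero hmem (by simp)]
          have e1 : (pz q (ZA S0)).derivative.eval (q ^ c) ≠ 0 := by
            have : pz q (ZA S0) = (X - C (q ^ c)) * pz q ((ZA S0).erase c) := by
              unfold pz; rw [mul_prod_erase _ (fun z => (X - C (q ^ z))) hmem]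
            rw [this, derivative_mul]
            simp only [derivative_sub, derivative_X, derivative_C, sub_zero, one_mul, eval_add, eval_mul,
              eval_sub, eval_X, eval_C, sub_self, zero_mul, add_zero]
            unfold pz
            rw [eval_prod, prod_ne_zero_iff]
            intro z hz
            simp only [eval_sub, eval_X, eval_C]
            intro h0
            exact (ne_of_mem_erase hz) (hs.qz_inj (sub_eq_zero.1 h0)).symm
          rw [e0, zero_smul, zero_sub, neg_eq_zero, smul_eq_zero] at ka
          rcases ka with ka | ka
          · exact mul_ne_zero e1 (mul_ne_zero (sub_ne_zero.2 hs.q_ne_one) (zpow_ne_zero _ hs.q0)) ka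
          · exact hne ka
        · refine hzG ⟨s, addable_cons_ne hsr hsa, ?_⟩
          simp only [cz]; rw [count_cons_of_ne hsr]

end HeckeSys
end A
end HS

namespace HS

def rel : ℕ → List ℕ → Finset (List ℕ)
  | 0, _ => {[]}
  | k+1, S => (rel k S).biUnion fun w => (Adds (w ++ S)).image fun r => r :: w

lemma mem_rel {k : ℕ} {S : List ℕ} (hS : valid S) {w : List ℕ} :
    w ∈ rel k S ↔ w.length = k ∧ valid (w ++ S) := by
  induction k generalizing w with
  | zero =>
    simp only [rel, mem_singleton, length_eq_zero_iff]
    constructor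
    · rintro rfl; exact ⟨rfl, hS⟩
    · exact fun h => h.1
  | succ k ih =>
    simp only [rel, mem_biUnion, mem_image]
    constructor
    · rintro ⟨w, hw, r, hr, rfl⟩
      obtain ⟨h1, h2⟩ := ih.1 hw
      exact ⟨by simp [h1], h2, (mem_Adds h2).1 hr⟩
    · rintro ⟨h1, h2⟩
      match w, h1, h2 with
      | r :: w, h1, h2 =>
        exact ⟨w, ih.2 ⟨by simpa using h1, h2.1⟩, r, (mem_Adds h2.1).2 h2.2, rfl⟩

lemma cz_strictAnti {S : List ℕ} (h : valid S) {r s : ℕ} (hrs : r < s) : cz S s < cz S r := by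
  have := valid_anti h hrs.le
  simp only [cz]; omega

lemma cz_inj {S : List ℕ} (h : valid S) {r s : ℕ} (hrs : cz S r = cz S s) : r = s := by
  rcases lt_trichotomy r s with h1 | h1 | h1
  · have := cz_strictAnti h h1; omega
  · exact h1
  · have := cz_strictAnti h h1; omega

lemma cz_adj {U : List ℕ} {r s : ℕ} (h : valid (r :: s :: U)) : cz (s :: U) r ≠ cz U s := by
  have hU := h.1.1
  rcases lt_trichotomy r s with h1 | h1 | h1
  · have := cz_strictAnti hU h1
    simp only [cz] at *; rw [count_cons_of_ne (by omega)]; omega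
  · subst h1; simp [cz]
  · have h2 := h.2.resolve_left (by omega)
    rw [count_cons_of_ne (by omega)] at h2
    simp only [cz]; rw [count_cons_of_ne (by omega)]
    by_cases h3 : s = r - 1
    · subst h3; simp at h2; omega
    · rw [count_cons_of_ne h3] at h2
      have := valid_anti hU (show s ≤ r - 1 by omega)
      omega

section A
variable {K A : Type} [Field K] [Ring A] [Algebra K A] {q : K} {T : ℕ → A}

def idem (q : K) (T : ℕ → A) : List ℕ → A
  | [] => 1
  | r :: S => idem q T S * aeval (JM q T S.length) (basis (Adds S) (cont q S) r)

lemma aeval_mem {B : Subalgebra K A} {x : A} (hx : x ∈ B) (p : K[X]) : aeval x p ∈ B := by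
  have := (aeval (⟨x, hx⟩ : B) p).2
  convert this
  exact (Polynomial.aeval_algHom_apply B.val ⟨x, hx⟩ p)

lemma idem_mem (S : List ℕ) : idem q T S ∈ HH K T S.length := by
  induction S with
  | nil => exact Subalgebra.one_mem _
  | cons r S ih =>
    exact Subalgebra.mul_mem _ (HH_mono (by simp) ih) (aeval_mem (JM_mem _) _)

lemma HH_le_one {n : ℕ} (hn : n ≤ 1) {a : A} (ha : a ∈ HH K T n) : ∃ c : K, a = c • 1 := by
  have : {a | ∃ i, i + 1 < n ∧ a = T i} = (∅ : Set A) := by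
    ext a; simp; intros; omega
  unfold HH at ha
  rw [this, Algebra.adjoin_empty, Algebra.mem_bot] at ha
  obtain ⟨c, rfl⟩ := ha
  exact ⟨c, by rw [Algebra.smul_def, mul_one]⟩

def sameSh (S S' : List ℕ) : Prop := ∀ i, S.count i = S'.count i

lemma IsW_ne {S S' : List ℕ} (hs : HeckeSys q T) (h : valid S) (h' : valid S')
    (hl : S.length = S'.length) (hne : S ≠ S') {v : A}
    (hv : IsW q T S v) (hv' : IsW q T S' v) : v = 0 := by
  induction S generalizing S' with
  | nil => exact absurd (length_eq_zero_iff.1 hl.symm).symm hne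
  | cons r S ih =>
    match S', h', hl, hne, hv' with
    | r' :: S', h', hl, hne, hv' =>
      by_cases hSS : S = S'
      · subst hSS
        have hrr : r ≠ r' := fun h => hne (by rw [h])
        have h1 := hv.2
        rw [hv'.2] at h1
        have h2 : (cont q S r' - cont q S r) • v = 0 := by rw [sub_smul, sub_eq_zero]; exact h1
        refine (smul_eq_zero.1 h2).resolve_left fun h3 => hrr ?_
        exact (cz_inj h.1 (hs.qz_inj (sub_eq_zero.1 h3))).symm
      · exact ih h.1 h'.1 (by simpa using hl) hSS hv.1 hv'.1

namespace HeckeSys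
variable (hs : HeckeSys q T)
include hs

lemma idem_JM (S : List ℕ) (i : ℕ) : idem q T S * JM q T i = JM q T i * idem q T S := by
  induction S with
  | nil => simp [idem]
  | cons r S ih =>
    simp only [idem]
    rw [mul_assoc, ← aeval_comm (hs.JM_comm i _), ← mul_assoc, ih, mul_assoc]

lemma cont_injOn {S : List ℕ} (h : valid S) : Set.InjOn (cont q S) (Adds S) := by
  intro r _ s _ he
  exact cz_inj h (hs.qz_inj he)

lemma isW_idem {S : List ℕ} (h : valid S) : IsW q T S (idem q T S) := by
  induction S with
  | nil => trivial
  | cons r S ih =>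
    have hS := ih h.1
    refine ⟨hS.mul_right _, ?_⟩
    have hr := (mem_Adds h.1).2 h.2
    have hp : pz q (ZA S) = ∏ s ∈ Adds S, (X - C (cont q S s)) := by
      unfold pz ZA
      rw [Finset.prod_image]
      · rfl
      · intro r _ s _ he; exact cz_inj h.1 he
    have hpoly : ∃ k : K, (X - C (cont q S r)) * basis (Adds S) (cont q S) r =
        C k * pz q (ZA S) := by
      refine ⟨∏ j ∈ (Adds S).erase r, (cont q S r - cont q S j)⁻¹, ?_⟩
      rw [hp, ← mul_prod_erase _ _ hr]
      unfold basis Lagrange.basisDivisor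
      rw [Finset.prod_mul_distrib, map_prod]
      ring
    obtain ⟨k, hk⟩ := hpoly
    have hann := hs.ann S.length S rfl h.1 _ hS
    have h1 : aeval (JM q T S.length) ((X - C (cont q S r)) * basis (Adds S) (cont q S) r)
        * idem q T S = 0 := by
      rw [hk, map_mul, mul_assoc, hann, mul_zero]
    rw [map_mul, mul_assoc, ← aeval_comm (hs.idem_JM S _)] at h1
    simp only [map_sub, aeval_X, aeval_C, sub_mul] at h1
    rw [sub_eq_zero] at h1
    simp only [idem]
    rw [h1, Algebra.smul_def]

lemma idem_act {S : List ℕ} (h : valid S) {v : A} (hv : IsW q T S v) : idem q T S * v = v := by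
  induction S with
  | nil => simp [idem]
  | cons r S ih =>
    simp only [idem]
    rw [mul_assoc, aeval_eig hv.2, eval_basis_self (hs.cont_injOn h.1) ((mem_Adds h.1).2 h.2),
      one_smul, ih h.1 hv.1]

lemma idem_idem {S : List ℕ} (h : valid S) : idem q T S * idem q T S = idem q T S :=
  hs.idem_act h (hs.isW_idem h)

lemma idem_comm (S S' : List ℕ) : idem q T S * idem q T S' = idem q T S' * idem q T S := by
  induction S' with
  | nil => simp [idem]
  | cons r S' ih =>
    simp only [idem]
    rw [← mul_assoc, ih, mul_assoc, aeval_comm (hs.idem_JM S _), mul_assoc]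

lemma idem_orth {S S' : List ℕ} (h : valid S) (h' : valid S')
    (hl : S.length = S'.length) (hne : S ≠ S') : idem q T S * idem q T S' = 0 := by
  apply IsW_ne hs h h' hl hne ((hs.isW_idem h).mul_right _)
  rw [hs.idem_comm]
  exact (hs.isW_idem h').mul_right _

lemma idem_sum {S : List ℕ} (h : valid S) : ∑ r ∈ Adds S, idem q T (r :: S) = idem q T S := by
  simp only [idem]
  rw [← mul_sum, ← map_sum, Lagrange.sum_basis (hs.cont_injOn h), map_one, mul_one]
  exact ⟨0, (mem_Adds h).2 (Or.inl rfl)⟩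

lemma idem_sum_rel (k : ℕ) {S : List ℕ} (h : valid S) :
    ∑ w ∈ rel k S, idem q T (w ++ S) = idem q T S := by
  induction k with
  | zero => simp [rel]
  | succ k ih =>
    rw [rel, sum_biUnion]
    · rw [← ih]
      refine sum_congr rfl fun w hw => ?_
      rw [sum_image (fun a _ b _ hab => by simpa using hab)]
      exact hs.idem_sum ((mem_rel h).1 hw).2
    · intro w _ w' _ hne
      rw [Function.onFun, disjoint_left]
      simp only [mem_image]
      rintro _ ⟨r, _, rfl⟩ ⟨r', _, h'⟩
      exact hne (by simpa using (List.cons.inj h').2.symm)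

lemma idem_cons_left {S : List ℕ} {r : ℕ} (h : valid S) :
    idem q T S * idem q T (r :: S) = idem q T (r :: S) := by
  simp only [idem]; rw [← mul_assoc, hs.idem_idem h]

lemma idem_cons_right {S : List ℕ} {r : ℕ} (h : valid S) :
    idem q T (r :: S) * idem q T S = idem q T (r :: S) := by
  rw [hs.idem_comm, hs.idem_cons_left h]

lemma T_phi {U : List ℕ} {r s : ℕ} (h : valid (r :: s :: U)) {v : A}
    (hv : IsW q T (r :: s :: U) v) :
    T U.length * v = (cont q U s - cont q (s :: U) r)⁻¹ •
      (phi q T U.length * v - ((q-1) * cont q (s :: U) r) • v) := by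
  have hne : cont q U s - cont q (s :: U) r ≠ 0 := by
    intro h0
    exact cz_adj h (hs.qz_inj (sub_eq_zero.1 h0)).symm
  rw [hs.phi_act hv.1.2 hv.2, add_sub_cancel_right, smul_smul, inv_mul_cancel₀ hne, one_smul]

def _root_.HS.adiag (q c d : K) : K := (q - 1) * d / (d - c)

omit hs in
lemma swap_comb {U : List ℕ} {r s r' s' : ℕ} (h : valid (r :: s :: U)) (h' : valid (r' :: s' :: U))
    (e1 : cz U s = cz (s' :: U) r') (e2 : cz (s :: U) r = cz U s') : s = r' ∧ r = s' ∧ s' ≠ r' := by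
  have hU := h.1.1
  have key : ∀ a b : ℕ, addable U a → addable U b → cz U a = cz U b + 1 → False := by
    intro a b ha hb hab
    by_cases hne : a = b
    · subst hne; omega
    · have := cz_ne hU ha hb hne; omega
  by_cases hsr : s' = r'
  · subst hsr
    exact (key s s' h.1.2 h'.1.2 (by rw [e1]; simp [cz]; ring)).elim
  · have e3 : cz (s' :: U) r' = cz U r' := by simp [cz, count_cons_of_ne hsr]
    rw [e3] at e1
    have e4 := cz_inj hU e1
    refine ⟨e4, ?_, hsr⟩
    by_cases hrs : s = r
    · subst hrs
      exact (key s' s h'.1.2 h.1.2 (by rw [← e2]; simp [cz]; ring)).elim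
    · have e5 : cz (s :: U) r = cz U r := by simp [cz, count_cons_of_ne hrs]
      rw [e5] at e2
      exact cz_inj hU e2

lemma phi_block {U U' : List ℕ} {r s r' s' : ℕ} (hl : U.length = U'.length)
    (h : valid (r :: s :: U)) (h' : valid (r' :: s' :: U'))
    (hne : ¬ (U = U' ∧ s = r' ∧ r = s' ∧ s' ≠ r')) :
    idem q T (r :: s :: U) * (phi q T U.length * idem q T (r' :: s' :: U')) = 0 := by
  set v := idem q T (r :: s :: U) * (phi q T U.length * idem q T (r' :: s' :: U')) with hv
  have hi' := hs.isW_idem h'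
  have w1 : IsW q T (r :: s :: U) v := (hs.isW_idem h).mul_right _
  have w2 : IsW q T U' v := by
    refine (hi'.1.1.map (X := phi q T U.length) fun i hi => hs.phi_JM_lt (by omega)).map
      fun i hi => hs.idem_JM _ _
  by_cases hU : U = U'
  · subst hU
    have hw := hs.phi_weight hi'.1.2 hi'.2
    by_contra hv0
    apply hne
    have f1 : JM q T U.length * v = cont q (s' :: U) r' • v := by
      rw [hv, ← mul_assoc, ← hs.idem_JM, mul_assoc, hw.1, mul_smul_comm]
    have f2 : JM q T (U.length + 1) * v = cont q U s' • v := by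
      rw [hv, ← mul_assoc, ← hs.idem_JM, mul_assoc, hw.2, mul_smul_comm]
    have g1 := w1.1.2
    have g2 : JM q T (U.length + 1) * v = cont q (s :: U) r • v := w1.2
    have e1 : cz U s = cz (s' :: U) r' := hs.qz_inj (smul_left_injective K hv0 (g1.symm.trans f1))
    have e2 : cz (s :: U) r = cz U s' := hs.qz_inj (smul_left_injective K hv0 (g2.symm.trans f2))
    exact ⟨rfl, swap_comb h h' e1 e2⟩
  · exact IsW_ne hs h.1.1 h'.1.1 hl hU w1.1.1 w2

lemma T_block {U U' : List ℕ} {r s r' s' : ℕ} (hl : U.length = U'.length)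
    (h : valid (r :: s :: U)) (h' : valid (r' :: s' :: U'))
    (hne : ¬ (U = U' ∧ s = r' ∧ r = s' ∧ s' ≠ r')) (hne' : ¬ (r :: s :: U = r' :: s' :: U')) :
    idem q T (r :: s :: U) * (T U.length * idem q T (r' :: s' :: U')) = 0 := by
  have := hs.T_phi h' (hs.isW_idem h')
  rw [hl, this, mul_smul_comm, mul_sub, ← hl, hs.phi_block hl h h' hne, mul_smul_comm,
    hs.idem_orth h h' (by simp [hl]) hne', smul_zero, sub_zero, smul_zero]

lemma T_diag {U : List ℕ} {r s : ℕ} (h : valid (r :: s :: U)) :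
    idem q T (r :: s :: U) * (T U.length * idem q T (r :: s :: U)) =
      adiag q (cont q U s) (cont q (s :: U) r) • idem q T (r :: s :: U) := by
  rw [hs.T_phi h (hs.isW_idem h), mul_smul_comm, mul_sub, hs.phi_block rfl h h, mul_smul_comm,
    hs.idem_idem h, zero_sub, smul_neg, smul_smul, ← neg_smul]
  · congr 1
    have hne : cont q U s - cont q (s :: U) r ≠ 0 := by
      intro h0
      exact cz_adj h (hs.qz_inj (sub_eq_zero.1 h0)).symm
    have hne' : cont q (s :: U) r - cont q U s ≠ 0 := by
      intro h0
      exact cz_adj h (hs.qz_inj (sub_eq_zero.1 h0))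
    unfold adiag
    field_simp
    ring
  · rintro ⟨_, rfl, _, h⟩
    exact h rfl

lemma HH_succ_aux (n : ℕ) (hTT : ∀ x ∈ HH K T (n+1), T n * (x * T n) ∈
      Submodule.span K ({z | z ∈ HH K T (n+1)} ∪
      {z | ∃ x y, x ∈ HH K T (n+1) ∧ y ∈ HH K T (n+1) ∧ z = x * (T n * y)})) {a : A} (ha : a ∈ HH K T (n+2)) :
    a ∈ Submodule.span K ({z | z ∈ HH K T (n+1)} ∪
      {z | ∃ x y, x ∈ HH K T (n+1) ∧ y ∈ HH K T (n+1) ∧ z = x * (T n * y)}) := by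
  set M := Submodule.span K ({z | z ∈ HH K T (n+1)} ∪
      {z | ∃ x y, x ∈ HH K T (n+1) ∧ y ∈ HH K T (n+1) ∧ z = x * (T n * y)}) with hM
  have hr : ∀ m ∈ M, ∀ b ∈ HH K T (n+1), m * b ∈ M := by
    intro m hm b hb
    induction hm using span_induction with
    | mem z hz =>
      rcases hz with hz | ⟨x, y, hx, hy, rfl⟩
      · exact subset_span (Or.inl (mul_mem (show z ∈ HH K T (n+1) from hz) hb))
      · exact subset_span (Or.inr ⟨x, y * b, hx, mul_mem hy hb, by simp only [mul_assoc]⟩)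
    | zero => simp
    | add x y _ _ h1 h2 => rw [add_mul]; exact M.add_mem h1 h2
    | smul c x _ h1 => rw [smul_mul_assoc]; exact M.smul_mem _ h1
  have key : ∀ m ∈ M, a * m ∈ M := by
    unfold HH at ha
    induction ha using Algebra.adjoin_induction with
    | mem t ht =>
      obtain ⟨i, hi, rfl⟩ := ht
      intro m hm
      induction hm using span_induction with
      | mem z hz =>
        by_cases hin : i = n
        · subst hin
          rcases hz with hz | ⟨x, y, hx, hy, rfl⟩
          · exact subset_span (Or.inr ⟨1, z, one_mem _, hz, by simp⟩)
          · have := hr _ (hTT x hx) y hy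
            simpa only [mul_assoc] using this
        · have hT : T i ∈ HH K T (n+1) := T_mem_HH (by omega)
          rcases hz with hz | ⟨x, y, hx, hy, rfl⟩
          · exact subset_span (Or.inl (mul_mem hT (show z ∈ HH K T (n+1) from hz)))
          · exact subset_span (Or.inr ⟨T i * x, y, mul_mem hT hx, hy, by simp only [mul_assoc]⟩)
      | zero => simp
      | add x y _ _ h1 h2 => rw [mul_add]; exact M.add_mem h1 h2
      | smul c x _ h1 => rw [mul_smul_comm]; exact M.smul_mem _ h1
    | algebraMap c => intro m hm; rw [← Algebra.smul_def]; exact M.smul_mem _ hm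
    | add x y _ _ hx hy => intro m hm; rw [add_mul]; exact M.add_mem (hx m hm) (hy m hm)
    | mul x y _ _ hx hy => intro m hm; rw [mul_assoc]; exact hx _ (hy _ hm)
  have := key 1 (subset_span (Or.inl (show (1:A) ∈ HH K T _ from one_mem _)))
  rwa [mul_one] at this

lemma HH_succ (n : ℕ) {a : A} (ha : a ∈ HH K T (n+2)) :
    a ∈ Submodule.span K ({z | z ∈ HH K T (n+1)} ∪
      {z | ∃ x y, x ∈ HH K T (n+1) ∧ y ∈ HH K T (n+1) ∧ z = x * (T n * y)}) := by
  induction n generalizing a with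
  | zero => exact hs.HH_succ_aux 0 (fun x hx => by
      obtain ⟨c, rfl⟩ := HH_le_one le_rfl hx
      simp only [smul_mul_assoc, one_mul, mul_smul_comm]
      rw [hs.quad]
      refine Submodule.smul_mem _ _ (Submodule.add_mem _ (Submodule.smul_mem _ _ ?_) (Submodule.smul_mem _ _ ?_))
      · exact subset_span (Or.inr ⟨1, 1, one_mem _, one_mem _, by simp⟩)
      · exact subset_span (Or.inl (show (1:A) ∈ HH K T _ from one_mem _))) ha
  | succ n ih =>
    refine hs.HH_succ_aux (n+1) (fun x hx => ?_) ha
    replace hx := ih hx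
    induction hx using span_induction with
    | mem x hx =>
      have hle := HH_mono (K := K) (T := T) (show n+1 ≤ n+1+1 by omega)
      rcases hx with hx | ⟨x, y, hx, hy, rfl⟩
      · have hx : x ∈ HH K T (n+1) := hx
        rw [hs.T_comm_HH le_rfl hx, ← mul_assoc, hs.quad]
        rw [add_mul, smul_mul_assoc, smul_mul_assoc, one_mul, ← hs.T_comm_HH le_rfl hx]
        refine (Submodule.add_mem _ (Submodule.smul_mem _ _ ?_) (Submodule.smul_mem _ _ ?_))
        · exact subset_span (Or.inr ⟨x, 1, hle hx, one_mem _, by simp⟩)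
        · exact subset_span (Or.inl (hle hx))
      · apply subset_span
        right
        refine ⟨x * T n, T n * y, mul_mem (hle hx) (T_mem_HH (by omega)),
          mul_mem (T_mem_HH (by omega)) (hle hy), ?_⟩
        have e1 := hs.T_comm_HH le_rfl hx
        have e2 := hs.T_comm_HH le_rfl hy
        calc T (n+1) * (x * (T n * y) * T (n+1)) = (T (n+1) * x) * T n * (y * T (n+1)) := by
              simp only [mul_assoc]
          _ = x * (T (n+1) * T n * T (n+1)) * y := by rw [← e1, e2]; simp only [mul_assoc]
          _ = _ := by rw [← hs.braid]; simp only [mul_assoc]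
    | zero => simp
    | add x y _ _ h1 h2 => rw [add_mul, mul_add]; exact Submodule.add_mem _ h1 h2
    | smul c x _ h1 => rw [smul_mul_assoc, mul_smul_comm]; exact Submodule.smul_mem _ _ h1

lemma idem_count_comm {k : ℕ} {a : A} (ha : a ∈ HH K T k) {S U : List ℕ} {r t : ℕ}
    (hS : S.length = k) (hU : U.length = k)
    (h : valid (r :: S)) (h' : valid (t :: U)) (hsh : sameSh S U) (hrt : r ≠ t) :
    idem q T (r :: S) * (a * idem q T (t :: U)) = 0 := by
  set v := idem q T (r :: S) * (a * idem q T (t :: U)) with hv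
  have e1 : JM q T k * v = cont q S r • v := by
    rw [hv, ← mul_assoc]
    have := (hs.isW_idem h).2
    rw [hS] at this
    rw [this, smul_mul_assoc]
  have e2 : JM q T k * v = cont q U t • v := by
    have := (hs.isW_idem h').2
    rw [hU] at this
    rw [hv, ← mul_assoc, ← hs.idem_JM, mul_assoc, ← mul_assoc _ a, ← hs.JM_comm_HH le_rfl ha,
      mul_assoc, this, mul_smul_comm, mul_smul_comm]
  by_contra hv0
  have := hs.qz_inj (smul_left_injective K hv0 (e1.symm.trans e2))
  apply hrt
  have h3 : cz U t = cz S t := by simp [cz, hsh t]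
  rw [h3] at this
  exact cz_inj h.1 this

omit hs in
lemma addable_sh {S S' : List ℕ} (h : sameSh S S') {r : ℕ} (hr : addable S r) : addable S' r :=
  (addable_congr h).1 hr

lemma idem_expand_right {k : ℕ} {a : A} (ha : a ∈ HH K T k) {S U : List ℕ} {r : ℕ}
    (hS : S.length = k) (hU : U.length = k)
    (h : valid (r :: S)) (h' : valid U) (hsh : sameSh S U) :
    idem q T (r :: S) * (a * idem q T U) = idem q T (r :: S) * (a * idem q T (r :: U)) := by
  have hr : r ∈ Adds U := (mem_Adds h').2 (addable_sh hsh h.2)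
  rw [← hs.idem_sum h', mul_sum, mul_sum]
  refine sum_eq_single r (fun t ht htr => ?_) (fun h => absurd hr h)
  exact hs.idem_count_comm ha hS hU h ⟨h', (mem_Adds h').1 ht⟩ hsh htr.symm

lemma idem_expand_left {k : ℕ} {a : A} (ha : a ∈ HH K T k) {S U : List ℕ} {r : ℕ}
    (hS : S.length = k) (hU : U.length = k)
    (h : valid (r :: S)) (h' : valid U) (hsh : sameSh U S) :
    idem q T U * (a * idem q T (r :: S)) = idem q T (r :: U) * (a * idem q T (r :: S)) := by
  have hr : r ∈ Adds U := (mem_Adds h').2 (addable_sh (fun i => (hsh i).symm) h.2)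
  rw [← hs.idem_sum h', sum_mul]
  refine sum_eq_single r (fun t ht htr => ?_) (fun h => absurd hr h)
  exact hs.idem_count_comm ha hU hS ⟨h', (mem_Adds h').1 ht⟩ h hsh htr

lemma idem_HH_cons {k : ℕ} {a : A} {S U : List ℕ} {r t : ℕ}
    (h : valid S) (h' : valid U) :
    idem q T (r :: S) * (a * idem q T (t :: U)) =
      idem q T (r :: S) * ((idem q T S * (a * idem q T U)) * idem q T (t :: U)) := by
  rw [mul_assoc, ← mul_assoc _ (idem q T S), hs.idem_cons_right h, mul_assoc, hs.idem_cons_left h']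

theorem block (n : ℕ) : ∀ a ∈ HH K T n, ∀ S S' : List ℕ, S.length = n → S'.length = n →
    valid S → valid S' →
    (¬ sameSh S S' → idem q T S * (a * idem q T S') = 0) ∧
    (S = S' → idem q T S * (a * idem q T S) ∈ Submodule.span K {idem q T S}) := by
  classical
  have small : ∀ n ≤ 1, ∀ a ∈ HH K T n, ∀ S S' : List ℕ, S.length = n → S'.length = n →
    valid S → valid S' →
    (¬ sameSh S S' → idem q T S * (a * idem q T S') = 0) ∧
    (S = S' → idem q T S * (a * idem q T S) ∈ Submodule.span K {idem q T S}) := by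
    intro n hn a ha S S' hS hS' h h'
    obtain ⟨c, rfl⟩ := HH_le_one hn ha
    refine ⟨fun hne => ?_, fun he => ?_⟩
    · rw [smul_mul_assoc, one_mul, mul_smul_comm, hs.idem_orth h h' (by omega), smul_zero]
      rintro rfl; exact hne fun i => rfl
    · rw [smul_mul_assoc, one_mul, mul_smul_comm, hs.idem_idem h]
      exact Submodule.smul_mem _ _ (mem_span_singleton_self _)
  induction n with
  | zero => exact small 0 (by omega)
  | succ n ih =>
  rcases n with _ | k
  · exact small 1 le_rfl
  intro a ha S S' hS hS' h h'
  obtain ⟨r, S, rfl⟩ : ∃ r S0, S = r :: S0 := exists_cons_of_length_eq_add_one hS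
  obtain ⟨r', S', rfl⟩ : ∃ r S0, S' = r :: S0 := exists_cons_of_length_eq_add_one hS'
  have hS : S.length = k + 1 := by simpa using hS
  have hS' : S'.length = k + 1 := by simpa using hS'
  have hsum : (1 : A) = ∑ w ∈ rel (k+1) [], idem q T w := by
    have := hs.idem_sum_rel (k+1) (S := []) trivial
    simpa [idem] using this.symm
  have hrel : ∀ U ∈ rel (k+1) [], U.length = k+1 ∧ valid U := fun U hU => by
    simpa using (mem_rel (S := []) trivial).1 hU
  have part1 : ∀ a ∈ HH K T (k+1), (¬ sameSh (r :: S) (r' :: S') → idem q T (r :: S) * (a * idem q T (r' :: S')) = 0) ∧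
    (r :: S = r' :: S' → idem q T (r :: S) * (a * idem q T (r :: S)) ∈ Submodule.span K {idem q T (r :: S)}) := by
    intro a ha
    constructor
    · intro hne
      by_cases hSS : sameSh S S'
      · refine hs.idem_count_comm ha hS hS' h h' hSS ?_
        rintro rfl
        exact hne fun i => by simp [count_cons, hSS i]
      · rw [hs.idem_HH_cons (k := 0) h.1 h'.1, (ih a ha S S' hS hS' h.1 h'.1).1 hSS, zero_mul, mul_zero]
    · intro _
      have := (ih a ha S S hS hS h.1 h.1).2 rfl
      obtain ⟨c, hc⟩ := mem_span_singleton.1 this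
      rw [hs.idem_HH_cons (k := 0) h.1 h.1, ← hc, smul_mul_assoc, hs.idem_cons_left h.1, mul_smul_comm,
        hs.idem_idem h]
      exact Submodule.smul_mem _ _ (mem_span_singleton_self _)
  have term : ∀ x ∈ HH K T (k+1), ∀ y ∈ HH K T (k+1), ∀ U ∈ rel (k+1) [], ∀ U' ∈ rel (k+1) [],
      idem q T (r :: S) * ((x * idem q T U) * (T k * (idem q T U' * (y * idem q T (r' :: S'))))) =
      if sameSh S U ∧ sameSh U' S' then
       (idem q T (r :: S) * x) * ((idem q T (r :: U) * (T k * idem q T (r' :: U'))) * (y * idem q T (r' :: S'))) else 0 := by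
    intro x hx y hy U hU U' hU'
    obtain ⟨u1, u2⟩ := hrel U hU
    obtain ⟨u1', u2'⟩ := hrel U' hU'
    split_ifs with hc
    · rw [hs.idem_expand_left hy hS' u1' h' u2' hc.2, ← mul_assoc (idem q T (r :: S)),
        hs.idem_expand_right hx hS u1 h u2 hc.1]
      simp only [mul_assoc]
    · by_cases hc1 : sameSh S U
      · have h3 : ¬ sameSh U' S' := fun h3 => hc ⟨hc1, h3⟩
        have := (ih y hy U' S' u1' hS' u2' h'.1).1 h3
        rw [← hs.idem_cons_left (r := r') h'.1, ← mul_assoc y, ← mul_assoc (idem q T U'), this]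
        simp
      · have := (ih x hx S U hS u1 h.1 u2).1 hc1
        rw [← hs.idem_cons_right (r := r) h.1, ← mul_assoc _ (x * _), mul_assoc _ (idem q T S) (x * _), this]
        simp
  have hexp : ∀ x y : A, idem q T (r :: S) * (x * (T k * y) * idem q T (r' :: S')) =
      ∑ U ∈ rel (k+1) [], ∑ U' ∈ rel (k+1) [],
      idem q T (r :: S) * ((x * idem q T U) * (T k * (idem q T U' * (y * idem q T (r' :: S'))))) := by
    intro x y
    have e : x * (T k * y) * idem q T (r' :: S') = (x * 1) * (T k * (1 * (y * idem q T (r' :: S')))) := by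
      simp only [mul_assoc, one_mul, mul_one]
    rw [e]
    conv_lhs => rw [hsum]
    simp only [mul_sum, sum_mul]
    rw [sum_comm]
  have hcons : ∀ U ∈ rel (k+1) [], ∃ s U0, U = s :: U0 ∧ U0.length = k := fun U hU => by
    obtain ⟨u1, u2⟩ := hrel U hU
    obtain ⟨s, U0, rfl⟩ := exists_cons_of_length_eq_add_one u1
    exact ⟨s, U0, rfl, by simpa using u1⟩
  have ha2 := hs.HH_succ k ha
  clear ha
  constructor
  · intro hne
    induction ha2 using span_induction with
    | mem z hz =>
      rcases hz with hz | ⟨x, y, hx, hy, rfl⟩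
      · exact (part1 z hz).1 hne
      · rw [hexp]
        refine sum_eq_zero fun U hU => sum_eq_zero fun U' hU' => ?_
        rw [term x hx y hy U hU U' hU']
        split_ifs with hc
        · obtain ⟨u1, u2⟩ := hrel U hU
          obtain ⟨u1', u2'⟩ := hrel U' hU'
          obtain ⟨s, U, rfl, hl⟩ := hcons U hU
          obtain ⟨s', U', rfl, hl'⟩ := hcons U' hU'
          rw [← hl, hs.T_block (by omega) ⟨u2, addable_sh hc.1 h.2⟩
            ⟨u2', addable_sh (fun i => (hc.2 i).symm) h'.2⟩]
          · simp
          · rintro ⟨rfl, rfl, rfl, -⟩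
            apply hne
            intro i
            have h1 := hc.1 i
            have h2 := hc.2 i
            simp only [count_cons] at *
            omega
          · intro he
            simp only [List.cons.injEq] at he
            obtain ⟨rfl, rfl, rfl⟩ := he
            apply hne
            intro i
            have h1 := hc.1 i
            have h2 := hc.2 i
            simp only [count_cons] at *
            omega
        · rfl
    | zero => simp
    | add x y _ _ h1 h2 => rw [add_mul, mul_add, h1, h2, add_zero]
    | smul c x _ h1 => rw [smul_mul_assoc, mul_smul_comm, h1, smul_zero]
  · intro he
    simp only [List.cons.injEq] at he
    obtain ⟨rfl, rfl⟩ := he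
    induction ha2 using span_induction with
    | mem z hz =>
      rcases hz with hz | ⟨x, y, hx, hy, rfl⟩
      · exact (part1 z hz).2 rfl
      · rw [hexp]
        refine Submodule.sum_mem _ fun U hU => Submodule.sum_mem _ fun U' hU' => ?_
        rw [term x hx y hy U hU U' hU']
        split_ifs with hc
        · obtain ⟨u1, u2⟩ := hrel U hU
          obtain ⟨u1', u2'⟩ := hrel U' hU'
          obtain ⟨s, U, rfl, hl⟩ := hcons U hU
          obtain ⟨s', U', rfl, hl'⟩ := hcons U' hU'
          have v1 : valid (r :: s :: U) := ⟨u2, addable_sh hc.1 h.2⟩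
          have v2 : valid (r :: s' :: U') := ⟨u2', addable_sh (fun i => (hc.2 i).symm) h'.2⟩
          have hcnt : ∀ i, (s :: U).count i = (s' :: U').count i := fun i => by
            rw [← hc.1 i, hc.2 i]
          by_cases hUU : U = U'
          · subst hUU
            have : s = s' := by
              have := hcnt s
              by_contra hne
              simp [count_cons, Ne.symm hne] at this
            subst this
            have e := hs.T_diag v1
            rw [hl] at e
            rw [e, smul_mul_assoc, mul_smul_comm]
            apply Submodule.smul_mem
            rw [← hs.idem_expand_left hy hS u1' h' u2' hc.2]
            rw [mul_assoc]
            have e2 : x * (idem q T (s :: U) * (y * idem q T (r :: S))) =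
              (x * idem q T (s :: U) * y) * idem q T (r :: S) := by simp only [mul_assoc]
            rw [e2]
            have e3 := idem_mem (q := q) (T := T) (s :: U)
            rw [u1] at e3
            exact (part1 _ (mul_mem (mul_mem hx e3) hy)).2 rfl
          · rw [← hl, hs.T_block (by omega) v1 v2]
            · simp
            · rintro ⟨h1, _⟩; exact hUU h1
            · intro he; simp only [List.cons.injEq] at he; exact hUU he.2.2
        · exact Submodule.zero_mem _
    | zero => simp
    | add x y _ _ h1 h2 => rw [add_mul, mul_add]; exact Submodule.add_mem _ h1 h2
    | smul c x _ h1 => rw [smul_mul_assoc, mul_smul_comm]; exact Submodule.smul_mem _ _ h1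

end HeckeSys
end A
end HS

namespace HS
variable {K A : Type} [Field K] [Ring A] [Algebra K A] {q : K} {T : ℕ → A}

namespace HeckeSys
variable (hs : HeckeSys q T)
include hs

lemma idem_app_left {S : List ℕ} (w : List ℕ) (h : valid S) :
    idem q T S * idem q T (w ++ S) = idem q T (w ++ S) := by
  induction w with
  | nil => exact hs.idem_idem h
  | cons r w ih =>
    show idem q T S * (idem q T (w ++ S) * _) = idem q T (w ++ S) * _
    rw [← mul_assoc, ih]

lemma idem_app_right {S : List ℕ} (w : List ℕ) (h : valid S) :
    idem q T (w ++ S) * idem q T S = idem q T (w ++ S) := by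
  rw [hs.idem_comm, hs.idem_app_left w h]

lemma eT_swap {U : List ℕ} {r s : ℕ} (h : valid (r :: s :: U)) (h' : valid (s :: r :: U))
    (hrs : r ≠ s) : idem q T (r :: s :: U) * T U.length =
      adiag q (cont q U s) (cont q (s :: U) r) • idem q T (r :: s :: U) +
      idem q T (r :: s :: U) * (T U.length * idem q T (s :: r :: U)) := by
  classical
  have h1 := hs.idem_sum_rel (U.length + 2) (S := []) trivial
  have : idem q T (r :: s :: U) * T U.length =
      ∑ w ∈ rel (U.length + 2) [], idem q T (r :: s :: U) * (T U.length * idem q T (w ++ [])) := by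
    rw [← mul_sum, ← mul_sum, h1]; simp [idem]
  rw [this]
  have hm : ∀ w, valid w → w.length = U.length + 2 → w ∈ rel (U.length+2) [] := by
    intro w hw hl; rw [mem_rel (S := []) trivial]; simpa using ⟨hl, hw⟩
  have hsub : ({r :: s :: U, s :: r :: U} : Finset (List ℕ)) ⊆ rel (U.length + 2) [] := by
    intro w hw
    simp only [mem_insert, mem_singleton] at hw
    rcases hw with rfl | rfl
    · exact hm _ h (by simp)
    · exact hm _ h' (by simp)
  rw [← sum_subset hsub, sum_pair (by simp [hrs]), append_nil, append_nil, hs.T_diag h]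
  intro w hw hw'
  rw [mem_rel (S := []) trivial] at hw
  simp only [mem_insert, mem_singleton, not_or] at hw'
  rw [append_nil] at hw ⊢
  obtain ⟨hl, hv⟩ := hw
  match w, hl with
  | r' :: s' :: U', hl =>
    apply hs.T_block (by simpa using hl.symm) h hv
    · rintro ⟨rfl, rfl, rfl, -⟩; exact hw'.2 rfl
    · intro e; exact hw'.1 e.symm

lemma eT_noswap {U : List ℕ} {r s : ℕ} (h : valid (r :: s :: U)) (h' : ¬ valid (s :: r :: U) ∨ r = s) :
    idem q T (r :: s :: U) * T U.length =
      adiag q (cont q U s) (cont q (s :: U) r) • idem q T (r :: s :: U) := by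
  classical
  have h1 := hs.idem_sum_rel (U.length + 2) (S := []) trivial
  have : idem q T (r :: s :: U) * T U.length =
      ∑ w ∈ rel (U.length + 2) [], idem q T (r :: s :: U) * (T U.length * idem q T (w ++ [])) := by
    rw [← mul_sum, ← mul_sum, h1]; simp [idem]
  rw [this, sum_eq_single (r :: s :: U)]
  · rw [append_nil, hs.T_diag h]
  · intro w hw hne
    rw [mem_rel (S := []) trivial] at hw
    rw [append_nil] at hw ⊢
    obtain ⟨hl, hv⟩ := hw
    match w, hl with
    | r' :: s' :: U', hl =>
      apply hs.T_block (by simpa using hl.symm) h hv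
      · rintro ⟨rfl, rfl, rfl, h4⟩
        rcases h' with h' | h'
        · exact h' hv
        · exact h4 h'
      · intro e; exact hne e.symm
  · intro h2; exact absurd ((mem_rel (S := []) trivial).2 ⟨by simp, by simpa using h⟩) h2

lemma cont_ne_zero (S : List ℕ) (r : ℕ) : cont q S r ≠ 0 := zpow_ne_zero _ hs.q0

lemma adiag_row {c : K} (hc : c ≠ 0) : adiag q c (q * c) = q := by
  have := hs.q_ne_one
  unfold adiag
  have : q * c - c ≠ 0 := by
    rw [show q * c - c = (q - 1) * c by ring]; exact mul_ne_zero (sub_ne_zero.2 this) hc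
  field_simp

lemma adiag_col {d : K} (hd : d ≠ 0) : adiag q (q * d) d = -1 := by
  have := hs.q_ne_one
  unfold adiag
  have : d - q * d ≠ 0 := by
    rw [show d - q * d = (1 - q) * d by ring]; exact mul_ne_zero (sub_ne_zero.2 this.symm) hd
  field_simp; ring

lemma eT_row {U : List ℕ} {r : ℕ} (h : valid (r :: r :: U)) :
    idem q T (r :: r :: U) * T U.length = q • idem q T (r :: r :: U) := by
  rw [hs.eT_noswap h (Or.inr rfl)]
  have : cont q (r :: U) r = q * cont q U r := by
    simp only [cont, cz, count_cons_self]
    rw [← zpow_one_add₀ hs.q0]; congr 1; push_cast; ring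
  rw [this, hs.adiag_row (hs.cont_ne_zero _ _)]

lemma eT_col {U : List ℕ} {r s : ℕ} (h : valid (r :: s :: U)) (h' : ¬ valid (s :: r :: U)) :
    idem q T (r :: s :: U) * T U.length = (-1 : K) • idem q T (r :: s :: U) := by
  rw [hs.eT_noswap h (Or.inl h')]
  obtain ⟨⟨hU, hsU⟩, hr⟩ := h
  have hne : r ≠ s := by
    rintro rfl; exact h' ⟨⟨hU, hsU⟩, hr⟩
  have hnr : ¬ addable U r := fun hr' => h' ⟨⟨hU, hr'⟩, addable_cons_ne hne hsU⟩
  simp only [addable, not_or, count_cons] at hr hnr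
  rcases hr with hr | hr
  · exact absurd hr hnr.1
  have hst := valid_step hU (r-1)
  have hr1 : r - 1 + 1 = r := by omega
  rw [hr1] at hst
  have hs1 : s = r - 1 := by
    by_contra hc
    simp [hne.symm, hc] at hr; omega
  have : cont q U s = q * cont q (s :: U) r := by
    simp only [cont, cz]
    rw [← zpow_one_add₀ hs.q0]; congr 1
    simp [hne.symm]
    have : U.count r = U.count s := by rw [hs1]; omega
    rw [this]; push_cast [hs1]; omega
  rw [this, hs.adiag_col (hs.cont_ne_zero _ _)]

lemma adiag_ne_q {U : List ℕ} {r s : ℕ} (h : valid (r :: s :: U)) (hne : r ≠ s) :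
    adiag q (cont q U s) (cont q (s :: U) r) ≠ q := by
  intro e
  have hc := cz_adj h
  unfold adiag at e
  have hne0 : cont q (s :: U) r - cont q U s ≠ 0 := by
    intro e; exact hc (hs.qz_inj (sub_eq_zero.1 e))
  rw [div_eq_iff hne0] at e
  have : cont q (s :: U) r = q * cont q U s := by linear_combination -e
  simp only [cont] at this
  rw [← zpow_one_add₀ hs.q0] at this
  have := hs.qz_inj this
  obtain ⟨⟨hU, hsU⟩, hr⟩ := h
  simp only [cz, count_cons] at this
  simp [hne.symm] at this
  by_cases hrU : addable U r
  · have := cz_ne hU hrU hsU hne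
    simp only [cz] at this; omega
  · simp only [addable, not_or, count_cons] at hr hrU
    have hst := valid_anti hU (show r - 1 ≤ r by omega)
    have hs1 : s = r - 1 := by
      by_contra hc
      simp [hne.symm, hc] at hr; omega
    subst hs1; omega

lemma eP_step {P : A} {S w w' : List ℕ} (h : Step S w w')
    (hP : ∀ j, S.length ≤ j → j + 1 < S.length + w.length → T j * P = q • P) :
    ∃ Y ∈ HH K T (S.length + w.length), idem q T (w' ++ S) * P = Y * (idem q T (w ++ S) * P) := by
  induction h with
  | swap r s t hne h1 h2 =>
    have hp := hP (t ++ S).length (by simp) (by simp; omega)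
    have ha := hs.adiag_ne_q h2 hne.symm
    set a := adiag q (cont q (t ++ S) r) (cont q (r :: (t ++ S)) s) with hadef
    refine ⟨(q - a)⁻¹ • (idem q T (s :: r :: (t ++ S)) * T (t ++ S).length), ?_, ?_⟩
    · refine smul_mem _ (mul_mem ?_ (T_mem_HH (by simp; omega))) _
      refine HH_mono (by simp; omega) (idem_mem _)
    · have h3 := congrArg (· * P) (hs.eT_swap h2 h1 hne.symm)
      simp only [add_mul, mul_assoc, smul_mul_assoc, hp, mul_smul_comm] at h3
      rw [← hadef] at h3
      have h4 : idem q T (s :: r :: (t ++ S)) * P = (q - a)⁻¹ •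
        (idem q T (s :: r :: (t ++ S)) * (T (t ++ S).length * (idem q T (r :: s :: (t ++ S)) * P))) := by
        rw [eq_inv_smul_iff₀ (sub_ne_zero.2 (Ne.symm ha)), sub_smul, h3]; abel
      simp only [cons_append, smul_mul_assoc, mul_assoc]
      exact h4
  | cons r t t' hst hv ih =>
    obtain ⟨Y, hY, hY'⟩ := ih (fun j h1 h2 => hP j h1 (by simp; omega))
    refine ⟨Y, HH_mono (by simp) hY, ?_⟩
    have hc : ∀ i, (t' ++ S).count i = (t ++ S).count i := fun i => by
      simp [count_append, hst.perm.count_eq]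
    have hl : (t' ++ S).length = (t ++ S).length := by simp [hst.perm.length_eq]
    have hA : Adds (t' ++ S) = Adds (t ++ S) := by
      unfold Adds; rw [hl]; ext x; simp [addable_congr hc]
    have hco : cont q (t' ++ S) = cont q (t ++ S) := by funext x; simp only [cont, cz, hc]
    simp only [cons_append, idem]
    rw [hl, hA, hco]
    set E := aeval (JM q T (t ++ S).length) (basis (Adds (t ++ S)) (cont q (t ++ S)) r) with hE
    have hYE : Y * E = E * Y := aeval_comm (hs.JM_comm_HH (by simp; omega) hY) _
    have hiE : ∀ U, idem q T U * E = E * idem q T U := fun U => aeval_comm (hs.idem_JM _ _) _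
    rw [hiE, hiE, mul_assoc, hY', ← mul_assoc, ← hYE]; simp only [mul_assoc]

lemma eP_conn {P : A} {S w w' : List ℕ} (h : Conn S w w')
    (hP : ∀ j, S.length ≤ j → j + 1 < S.length + w.length → T j * P = q • P) :
    ∃ Y ∈ HH K T (S.length + w.length), idem q T (w' ++ S) * P = Y * (idem q T (w ++ S) * P) := by
  induction h with
  | refl => exact ⟨1, one_mem _, by simp⟩
  | tail h1 h2 ih =>
    obtain ⟨Y, hY, e⟩ := ih
    have hl := (Conn.perm h1).length_eq
    obtain ⟨Y', hY', e'⟩ := hs.eP_step h2 (fun j a b => hP j a (by omega))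
    exact ⟨Y' * Y, mul_mem (by rwa [hl]) hY, by rw [e', e, mul_assoc]⟩

omit hs in
lemma _root_.HS.count_app (w S : List ℕ) (i : ℕ) : (w ++ S).count i = w.count i + S.count i :=
  count_append ..

lemma eP_nonstrip {P : A} {S : List ℕ} (hS : valid S) (k : ℕ) : ∀ w : List ℕ, w.length = k → valid (w ++ S) →
    (∀ j, S.length ≤ j → j + 1 < S.length + w.length → T j * P = q • P) →
    (∃ i, S.count i < (w ++ S).count (i+1)) → idem q T (w ++ S) * P = 0 := by
  induction k using strong_induction_on with
  | _ k ih =>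
  intro w hk hv hP hi
  match w, hk with
  | [], hk =>
    obtain ⟨i, hi⟩ := hi
    have := valid_step hS i
    simp at hi; omega
  | r :: t, hk =>
    have hvt : valid (t ++ S) := hv.1
    by_cases hts : ∃ i, S.count i < (t ++ S).count (i+1)
    · have := ih t.length (by simp at hk; omega) t rfl hvt (fun j a b => hP j a (by simp; omega)) hts
      show idem q T (r :: (t ++ S)) * P = 0
      rw [← hs.idem_cons_right hvt, mul_assoc, this, mul_zero]
    · push Not at hts
      obtain ⟨i, hi⟩ := hi
      have h1 := hts i
      simp only [cons_append, count_cons] at hi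
      have hri : r = i + 1 := by
        by_contra hc
        have hc' : ¬ (r == i + 1) = true := by simpa using hc
        rw [if_neg hc'] at hi; omega
      subst hri
      have hadd := hv.2
      simp [addable] at hadd
      simp at hi
      have hti : 0 < t.count i := by
        simp only [count_app] at *; omega
      obtain ⟨w2, hw2⟩ := conn_removable hvt (s := i) (by unfold removable; simpa [count_app] using hadd) hti
      have hw3 := hw2.cons (i+1) hv
      have hv3 := hw3.valid hv
      have hl2 := hw2.perm.length_eq
      suffices hz : idem q T ((i+1) :: i :: w2 ++ S) * P = 0 by
        obtain ⟨Y, -, e⟩ := hs.eP_conn hw3.symm (P := P) (fun j a b => hP j a (by simp at b hl2 ⊢; omega))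
        rw [e, hz, mul_zero]
      have hcnt : ∀ x, t.count x = (i :: w2).count x := fun x => hw2.perm.count_eq x
      by_cases hsw : valid (i :: (i+1) :: w2 ++ S)
      · have hz0 : idem q T ((i+1) :: w2 ++ S) * P = 0 := by
          apply ih (w2.length + 1) (by simp at hk hl2; omega) _ (by simp) hsw.1
            (fun j a b => hP j a (by simp at b hl2 ⊢; omega))
          refine ⟨i, ?_⟩
          have := hcnt (i+1)
          simp [count_cons] at this
          simp [count_cons, count_app] at hi ⊢; omega
        have hz1 : idem q T (i :: (i+1) :: w2 ++ S) * P = 0 := by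
          show idem q T (i :: ((i+1) :: w2 ++ S)) * P = 0
          rw [← hs.idem_cons_right (S := (i+1) :: w2 ++ S) hsw.1, mul_assoc, hz0, mul_zero]
        obtain ⟨Y, -, e⟩ := hs.eP_step (Step.swap i (i+1) w2 (by omega) hsw hv3) (P := P)
          (fun j a b => hP j a (by simp at b hl2 ⊢; omega))
        rw [e, hz1, mul_zero]
      · have e1 := hs.eT_col (U := w2 ++ S) hv3 hsw
        have hp := hP (w2 ++ S).length (by simp) (by simp at hl2 ⊢; omega)
        have e2 := congrArg (· * P) e1
        simp only [mul_assoc, hp, mul_smul_comm, smul_mul_assoc] at e2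
        have e3 : (1 + q) • (idem q T ((i + 1) :: i :: (w2 ++ S)) * P) = 0 := by
          rw [add_smul, e2]; module
        exact (smul_eq_zero.1 e3).resolve_left hs.one_add_q
end HeckeSys
end HS

namespace HS
variable {K A : Type} [Field K] [Ring A] [Algebra K A] {q : K} {T : ℕ → A}

def sh (S : List ℕ) : ℕ → ℕ := fun i => S.count i

lemma sameSh_iff {S S' : List ℕ} : sameSh S S' ↔ sh S = sh S' := by
  simp [sameSh, sh, funext_iff]

structure TrS (d : ℕ) (B : ℕ → Subalgebra K A) (χ : ℕ → A →ₗ[K] K) (σ : ℕ → A →ₐ[K] A) : Prop where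
  mono : ∀ n, B n ≤ B (n+1)
  comm : ∀ n, ∀ a ∈ B n, ∀ b ∈ B n, χ n (a * b) = χ n (b * a)
  idem : ∀ n, ∀ a ∈ B n, a * a = a → ∃ r : ℕ, χ n a = r ∧ (r = 0 → a = 0)
  succ : ∀ n, ∀ a ∈ B n, χ (n+1) a = d * χ n a
  shc : ∀ n, ∀ a ∈ B n, ∀ b, a * σ n b = σ n b * a
  shm : ∀ n k, ∀ b ∈ B k, σ n b ∈ B (n+k)
  sht : ∀ n k, ∀ a ∈ B n, ∀ b ∈ B k, χ (n+k) (a * σ n b) = χ n a * χ k b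
  one : χ 0 1 = 1

structure Sys (q : K) (T : ℕ → A) (d : ℕ) (B : ℕ → Subalgebra K A) (χ : ℕ → A →ₗ[K] K)
    (σ : ℕ → A →ₐ[K] A) : Prop where
  hs : HeckeSys q T
  tr : TrS d B χ σ
  hT : ∀ i, T i ∈ B (i+2)
  hσ : ∀ n i, σ n (T i) = T (n+i)

open Classical in
def esh (q : K) (T : ℕ → A) (k : ℕ) (S : List ℕ) (f : ℕ → ℕ) : A :=
  ∑ w ∈ (rel k S).filter (fun w => sh (w ++ S) = f), idem q T (w ++ S)

open Classical in
def Lam (k : ℕ) (S : List ℕ) : Finset (ℕ → ℕ) := (rel k S).image (fun w => sh (w ++ S))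

namespace HeckeSys
variable (hs : HeckeSys q T)
include hs

lemma esh_sum {S : List ℕ} (h : valid S) (k : ℕ) : ∑ f ∈ Lam k S, esh q T k S f = idem q T S := by
  classical
  rw [← hs.idem_sum_rel k h]
  unfold esh Lam
  rw [← sum_fiberwise_of_maps_to (s := rel k S) (t := (rel k S).image (fun w => sh (w ++ S)))
    (g := fun w => sh (w ++ S)) (fun w hw => mem_image_of_mem _ hw)]

omit hs in
lemma esh_mem {S : List ℕ} (h : valid S) (k : ℕ) (f : ℕ → ℕ) : esh q T k S f ∈ HH K T (S.length + k) := by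
  classical
  refine sum_mem fun w hw => ?_
  rw [mem_filter, mem_rel h] at hw
  exact HH_mono (by simp; omega) (idem_mem _)

lemma esh_block {S : List ℕ} (h : valid S) (k : ℕ) {f g : ℕ → ℕ} (hfg : f ≠ g) {a : A}
    (ha : a ∈ HH K T (S.length + k)) : esh q T k S f * (a * esh q T k S g) = 0 := by
  classical
  unfold esh
  rw [mul_sum, sum_mul_sum]
  refine sum_eq_zero fun w hw => sum_eq_zero fun u hu => ?_
  rw [mem_filter, mem_rel h] at hw hu
  refine ((hs.block _ a ha (w ++ S) (u ++ S) (by simp; omega) (by simp; omega) hw.1.2 hu.1.2).1 ?_)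
  rw [sameSh_iff]; rintro e; exact hfg (by rw [← hw.2, ← hu.2, e])

lemma idem_esh {S : List ℕ} (h : valid S) (k : ℕ) (f : ℕ → ℕ) :
    idem q T S * esh q T k S f = esh q T k S f ∧ esh q T k S f * idem q T S = esh q T k S f := by
  unfold esh
  rw [mul_sum, sum_mul]
  exact ⟨sum_congr rfl fun w _ => hs.idem_app_left w h,
    sum_congr rfl fun w _ => hs.idem_app_right w h⟩

lemma idem_mul_esh {S : List ℕ} (h : valid S) {k : ℕ} {w : List ℕ} (hw : w ∈ rel k S) :
    idem q T (w ++ S) * esh q T k S (sh (w ++ S)) = idem q T (w ++ S) := by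
  classical
  unfold esh
  rw [mul_sum, sum_eq_single w]
  · exact hs.idem_idem ((mem_rel h).1 hw).2
  · intro u hu hne
    rw [mem_filter, mem_rel h] at hu
    rw [mem_rel h] at hw
    exact hs.idem_orth hw.2 hu.1.2 (by simp; omega) (by simpa using hne.symm)
  · intro hc; refine absurd ?_ hc; rw [mem_filter]; exact ⟨hw, rfl⟩

lemma esh_comm {S : List ℕ} (h : valid S) {k : ℕ} (f : ℕ → ℕ) {P : A}
    (hPm : P ∈ HH K T (S.length + k)) (hPS : P * idem q T S = idem q T S * P) :
    P * esh q T k S f = esh q T k S f * P := by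
  classical
  have key : esh q T k S f * (P * esh q T k S f) = (idem q T S * P) * esh q T k S f := by
    rw [← hs.esh_sum h k, mul_assoc, sum_mul]
    by_cases hf : f ∈ Lam k S
    · rw [sum_eq_single f (fun g _ hg => hs.esh_block h k hg hPm) (fun hc => absurd hf hc)]
    · have : esh q T k S f = 0 := by
        refine sum_eq_zero fun w hw => ?_
        rw [mem_filter] at hw
        exact absurd (mem_image.2 ⟨w, hw.1, hw.2⟩) hf
      simp [this]
  have key2 : esh q T k S f * (P * esh q T k S f) = esh q T k S f * (P * idem q T S) := by
    rw [← hs.esh_sum h k, mul_sum, mul_sum]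
    by_cases hf : f ∈ Lam k S
    · rw [sum_eq_single f (fun g _ hg => hs.esh_block h k hg.symm hPm) (fun hc => absurd hf hc)]
    · have : esh q T k S f = 0 := by
        refine sum_eq_zero fun w hw => ?_
        rw [mem_filter] at hw
        exact absurd (mem_image.2 ⟨w, hw.1, hw.2⟩) hf
      simp [this]
  rw [← hPS, mul_assoc, (hs.idem_esh h k f).1] at key
  rw [hPS, ← mul_assoc (esh q T k S f) (idem q T S) P, (hs.idem_esh h k f).2] at key2
  rw [← key, key2]

lemma esh_eq {S : List ℕ} (h : valid S) {k : ℕ} {w : List ℕ} (hw : w ∈ rel k S) {P : A}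
    (hP : ∀ j, S.length ≤ j → j + 1 < S.length + k → T j * P = q • P) :
    ∃ Y ∈ HH K T (S.length + k), esh q T k S (sh (w ++ S)) * P = Y * (idem q T (w ++ S) * P) := by
  classical
  unfold esh
  rw [sum_mul]
  have hw' := (mem_rel h).1 hw
  have : ∀ u ∈ (rel k S).filter (fun u => sh (u ++ S) = sh (w ++ S)),
      ∃ Y ∈ HH K T (S.length + k), idem q T (u ++ S) * P = Y * (idem q T (w ++ S) * P) := by
    intro u hu
    rw [mem_filter, mem_rel h] at hu
    have := hs.eP_conn (conn_of_count hw'.2 hu.1.2 (fun i => by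
      have := congrFun hu.2 i
      simp only [sh, count_app] at this; omega)) (P := P) (by rw [hw'.1]; exact hP)
    rwa [hw'.1] at this
  choose! Y hY hY' using this
  refine ⟨∑ u ∈ (rel k S).filter (fun u => sh (u ++ S) = sh (w ++ S)), Y u, sum_mem hY, ?_⟩
  rw [sum_mul]
  exact sum_congr rfl hY'
end HeckeSys

namespace Sys
variable {d : ℕ} {B : ℕ → Subalgebra K A} {χ : ℕ → A →ₗ[K] K} {σ : ℕ → A →ₐ[K] A}
variable (sy : Sys q T d B χ σ)
include sy

lemma B_mono {m n : ℕ} (h : m ≤ n) : B m ≤ B n := monotone_nat_of_le_succ sy.tr.mono h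

lemma HH_le (n : ℕ) : HH K T n ≤ B n := by
  refine Algebra.adjoin_le ?_
  rintro _ ⟨i, hi, rfl⟩
  exact sy.B_mono (by omega) (sy.hT i)

lemma tr_comm {n : ℕ} {a b : A} (ha : a ∈ HH K T n) (hb : b ∈ HH K T n) :
    χ n (a * b) = χ n (b * a) := sy.tr.comm n a (sy.HH_le n ha) b (sy.HH_le n hb)

lemma shift_HH {n k : ℕ} {a : A} (ha : a ∈ HH K T k) : σ n a ∈ HH K T (n+k) := by
  have : HH K T k ≤ Subalgebra.comap (σ n) (HH K T (n+k)) := by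
    refine Algebra.adjoin_le ?_
    rintro _ ⟨i, hi, rfl⟩
    show σ n (T i) ∈ HH K T (n+k)
    rw [sy.hσ]
    exact T_mem_HH (by omega)
  exact this ha

lemma Qtr {S : List ℕ} (h : valid S) {k : ℕ} {w : List ℕ} (hw : w ∈ rel k S) {P : A}
    (hP : ∀ j, S.length ≤ j → j + 1 < S.length + k → T j * P = q • P)
    (hPm : P ∈ HH K T (S.length + k)) (hPS : P * idem q T S = idem q T S * P) (hPP : P * P = P) :
    χ (S.length + k) (esh q T k S (sh (w ++ S)) * P) = 0 ∨
    χ (S.length + k) (esh q T k S (sh (w ++ S)) * P) = χ (S.length + k) (idem q T (w ++ S)) := by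
  have hs := sy.hs
  obtain ⟨Y, hY, hYe⟩ := hs.esh_eq h hw hP
  have hw' := (mem_rel h).1 hw
  set E := esh q T k S (sh (w ++ S)) with hE
  set e := idem q T (w ++ S) with he
  have hEP : P * E = E * P := hs.esh_comm h _ hPm hPS
  have heE : e * E = e := hs.idem_mul_esh h hw
  have hEm : E ∈ HH K T (S.length + k) := HeckeSys.esh_mem h k _
  have hem : e ∈ HH K T (S.length + k) := HH_mono (by simp; omega) (idem_mem _)
  have hee : e * e = e := hs.idem_idem hw'.2
  have hEPm := mul_mem hEm hPm
  have heQ : e * (E * P) = e * P := by rw [← mul_assoc, heE]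
  have hQ1 : Y * (e * (E * P)) = E * P := by rw [heQ, ← hYe]
  have hEE : E * (E * P) = E * P := by
    have : E * E = E := by
      classical
      conv_lhs => rw [hE]
      unfold esh
      rw [sum_mul, hE]
      unfold esh
      refine sum_congr rfl fun u hu => ?_
      rw [mem_filter] at hu
      have := hs.idem_mul_esh h hu.1
      rw [hu.2] at this; exact this
    rw [← mul_assoc, this]
  have hQQ : (E * P) * (E * P) = E * P := by
    rw [mul_assoc, ← mul_assoc P E P, hEP, mul_assoc E P P, hPP, hEE]
  set Q := E * P with hQ
  have hZ := (hs.block _ (Q * Y) (mul_mem hEPm hY) (w ++ S) (w ++ S) (by simp; omega) (by simp; omega)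
    hw'.2 hw'.2).2 rfl
  rw [← he, mem_span_singleton] at hZ
  obtain ⟨c, hc⟩ := hZ
  have hchi : χ (S.length + k) Q = c * χ (S.length + k) e := by
    rw [← hQ1, sy.tr_comm hY (mul_mem hem hEPm), mul_assoc, ← hee, mul_assoc,
      sy.tr_comm hem (mul_mem hem (mul_mem hEPm hY)), mul_assoc, ← hc, map_smul, hee, smul_eq_mul]
  have hZZ : (e * (Q * Y * e)) * (e * (Q * Y * e)) = e * (Q * Y * e) := by
    have : (e * (Q * Y * e)) * (e * (Q * Y * e)) = e * (Q * (Y * ((e * e) * Q)) * Y * e) := by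
      simp only [mul_assoc]
    rw [this, hee, hQ1, hQQ]
  rw [← hc] at hZZ
  rw [smul_mul_smul_comm, hee] at hZZ
  by_cases he0 : e = 0
  · left; rw [hchi, he0]; simp
  · have : c * c = c := by
      by_contra hne
      have : (c * c - c) • e = 0 := by rw [sub_smul, hZZ, sub_self]
      exact (smul_eq_zero.1 this).elim (fun h => hne (sub_eq_zero.1 h)) he0
    have h01 : c = 0 ∨ c = 1 := by
      have : c * (c - 1) = 0 := by linear_combination this
      rcases mul_eq_zero.1 this with h | h
      · exact Or.inl h
      · exact Or.inr (sub_eq_zero.1 h)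
    rcases h01 with h0 | h1
    · left; rw [hchi, h0, zero_mul]
    · right; rw [hchi, h1, one_mul]

lemma esh_nonstrip {S : List ℕ} (h : valid S) {k : ℕ} {f : ℕ → ℕ} {P : A}
    (hP : ∀ j, S.length ≤ j → j + 1 < S.length + k → T j * P = q • P)
    (hf : ∃ i, S.count i < f (i+1)) : esh q T k S f * P = 0 := by
  classical
  unfold esh
  rw [sum_mul]
  refine sum_eq_zero fun w hw => ?_
  rw [mem_filter, mem_rel h] at hw
  obtain ⟨⟨rfl, hv⟩, rfl⟩ := hw
  exact sy.hs.eP_nonstrip h _ w rfl hv hP hf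
end Sys
end HS

namespace HS
variable {K A : Type} [Field K] [Ring A] [Algebra K A] {q : K} {T : ℕ → A}

def up (f : ℕ → ℕ) (r : ℕ) : ℕ → ℕ := fun i => f i + if i = r then 1 else 0
def dn (f : ℕ → ℕ) (r : ℕ) : ℕ → ℕ := fun i => f i - if i = r then 1 else 0

lemma sh_cons (r : ℕ) (S : List ℕ) : sh (r :: S) = up (sh S) r := by
  funext i; simp only [sh, up, count_cons, beq_iff_eq, eq_comm (a := r)]

lemma sh_anti {S : List ℕ} (h : valid S) : Antitone (sh S) := fun _ _ hr => valid_anti h hr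

lemma up_dn {f : ℕ → ℕ} {r : ℕ} (h : 0 < f r) : up (dn f r) r = f := by
  funext i; simp only [up, dn]; split_ifs with h1
  · subst h1; omega
  · simp

lemma len_of_sh {S S' : List ℕ} (h : sh S = sh S') : S.length = S'.length :=
  (List.perm_iff_count.2 fun i => congrFun h i).length_eq

lemma sh_bdd {S : List ℕ} (h : valid S) : ∀ i, S.length ≤ i → sh S i = 0 := fun i hi =>
  count_eq_zero.2 fun hm => by have := valid_mem h hm; omega

lemma exists_word {f : ℕ → ℕ} (hf : Antitone f) {M : ℕ} (hM : ∀ i, M ≤ i → f i = 0) (k : ℕ) :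
    ∀ S : List ℕ, valid S → (∀ i, sh S i ≤ f i) → ∑ i ∈ range M, (f i - sh S i) = k →
    ∃ w, valid (w ++ S) ∧ sh (w ++ S) = f := by
  classical
  induction k with
  | zero =>
    intro S hS hle hk
    refine ⟨[], hS, ?_⟩
    funext i
    by_cases hi : i < M
    · have := (Finset.sum_eq_zero_iff.1 hk) i (mem_range.2 hi)
      have := hle i
      simp only [nil_append]; omega
    · have := hM i (by omega); have := hle i; simp only [nil_append]; omega
  | succ k ih =>
    intro S hS hle hk
    have hex : ∃ i, sh S i < f i := by
      by_contra hc
      push Not at hc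
      rw [sum_eq_zero (fun i _ => by have := hc i; omega)] at hk; omega
    have h1 := find_spec hex
    have h2 := fun j => find_min hex (m := j)
    set r := find hex
    have hadd : addable S r := by
      by_cases hr : r = 0
      · exact Or.inl hr
      · right
        have h3 := h2 (r-1) (by omega)
        have h4 := hf (show r - 1 ≤ r by omega)
        have h5 : sh S (r-1) ≥ f (r-1) := by omega
        exact lt_of_lt_of_le h1 (h4.trans h5)
    have hv : valid (r :: S) := ⟨hS, hadd⟩
    have hrM : r < M := by
      by_contra hc; have := hM r (by omega); omega
    obtain ⟨w, hw, hw'⟩ := ih (r :: S) hv (fun i => by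
      rw [sh_cons]; simp only [up]; split_ifs with h
      · rw [h]; omega
      · have := hle i; omega) (by
      rw [← Finset.add_sum_erase _ _ (mem_range.2 hrM)] at hk ⊢
      have : ∑ x ∈ (range M).erase r, (f x - sh (r :: S) x) =
          ∑ x ∈ (range M).erase r, (f x - sh S x) := by
        refine sum_congr rfl fun x hx => ?_
        rw [sh_cons]; simp [up, ne_of_mem_erase hx]
      rw [this, sh_cons]; simp only [up, if_true]; omega)
    exact ⟨w ++ [r], by simpa using hw, by simpa using hw'⟩

lemma exists_word' {f : ℕ → ℕ} (hf : Antitone f) {M : ℕ} (hM : ∀ i, M ≤ i → f i = 0)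
    {S : List ℕ} (hS : valid S) (hle : ∀ i, sh S i ≤ f i) : ∃ w, valid (w ++ S) ∧ sh (w ++ S) = f :=
  exists_word hf hM _ S hS hle rfl

lemma mem_Lam {k : ℕ} {S : List ℕ} (h : valid S) {f : ℕ → ℕ} :
    f ∈ Lam k S ↔ ∃ w, w.length = k ∧ valid (w ++ S) ∧ sh (w ++ S) = f := by
  classical
  simp [Lam, mem_rel h, and_assoc]

open Classical in
def LS (k : ℕ) (S : List ℕ) : Finset (ℕ → ℕ) := (Lam k S).filter fun f => ∀ i, f (i+1) ≤ S.count i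

def AddF (f : ℕ → ℕ) (M : ℕ) : Finset ℕ := (range M).filter fun r => r = 0 ∨ f r < f (r-1)

def cmap (S : List ℕ) (r : ℕ) (ρ : ℕ → ℕ) : ℕ := if ρ (r+1) ≤ S.count r then r else r + 1

lemma cmap_spec {k : ℕ} {S : List ℕ} (hS : valid S) {r : ℕ} (hr : addable S r) {ρ : ℕ → ℕ}
    (hρ : ρ ∈ LS k (r :: S)) :
    0 < ρ (cmap S r ρ) ∧ dn ρ (cmap S r ρ) ∈ LS k S ∧ cmap S r ρ ∈ AddF (dn ρ (cmap S r ρ)) (S.length + k + 1) := by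
  classical
  obtain ⟨h1, h2⟩ := mem_filter.1 hρ
  have hvr : valid (r :: S) := ⟨hS, hr⟩
  obtain ⟨w, hk, hv, hw⟩ := (mem_Lam hvr).1 h1
  have hup : ∀ i, up (sh S) r i ≤ ρ i := fun i => by
    rw [← hw, ← sh_cons]; simp [sh, count_app]
  have hanti : Antitone ρ := hw ▸ sh_anti hv
  have hbd : ∀ i, S.length + k + 1 ≤ i → ρ i = 0 := fun i hi => by
    rw [← hw]; exact sh_bdd hv i (by simp; omega)
  have hmon : ∀ i, ρ (i+1) ≤ ρ i := fun i => hanti (le_succ i)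
  have h2' : ∀ i, ρ (i+1) ≤ up (sh S) r i := fun i => by rw [← sh_cons]; exact h2 i
  have hSa : ∀ i, sh S (i+1) ≤ sh S i := fun i => sh_anti hS (le_succ i)
  have main : 0 < ρ (cmap S r ρ) ∧ Antitone (dn ρ (cmap S r ρ)) ∧ (∀ i, sh S i ≤ dn ρ (cmap S r ρ) i) ∧
      (∀ i, dn ρ (cmap S r ρ) (i+1) ≤ sh S i) ∧
      (cmap S r ρ = 0 ∨ dn ρ (cmap S r ρ) (cmap S r ρ) < dn ρ (cmap S r ρ) (cmap S r ρ - 1)) := by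
    unfold cmap
    have hc : S.count r = sh S r := rfl
    rw [hc]
    split_ifs with hcase
    · have e0 := hup r
      simp only [up, if_true] at e0
      refine ⟨by omega, antitone_nat_of_succ_le fun i => ?_, fun i => ?_, fun i => ?_, ?_⟩
      · have a1 := hmon i; have a2 := hmon r
        simp only [dn]
        split_ifs with b1 b2 b2
        · omega
        · omega
        · subst b2; omega
        · simpa using a1
      · have := hup i
        simp only [dn, up] at this ⊢
        split_ifs at this ⊢ with b1 <;> omega
      · have := h2' i
        simp only [dn, up] at this ⊢
        by_cases b : i = r
        · subst b; simp; omega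
        · simp [b] at this; split_ifs <;> omega
      · by_cases hr0 : r = 0
        · exact Or.inl hr0
        · right
          have := hmon (r-1)
          simp only [dn, if_true]
          rw [if_neg (by omega)]
          rw [show r - 1 + 1 = r by omega] at this
          omega
    · have e0 := hup r
      have e1 := h2' r
      have e2 := h2' (r+1)
      have e3 := hSa r
      simp only [up, if_true] at e0 e1 e2
      simp at e2
      refine ⟨by omega, antitone_nat_of_succ_le fun i => ?_, fun i => ?_, fun i => ?_, ?_⟩
      · have a1 := hmon i
        simp only [dn]
        split_ifs with b1 b2 b2
        · omega
        · have := hmon i; simp at this ⊢; omega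
        · subst b2; simp at e3 ⊢; omega
        · simpa using a1
      · have := hup i
        simp only [dn, up] at this ⊢
        by_cases b : i = r + 1
        · subst b; simp at e3 ⊢; omega
        · simp only [if_neg b]; split_ifs at this <;> omega
      · have := h2' i
        simp only [dn, up] at this ⊢
        by_cases b : i = r
        · subst b; simp; omega
        · simp [b] at this ⊢; omega
      · right
        simp only [dn, if_true]
        simp; omega
  obtain ⟨m1, m2, m3, m4, m5⟩ := main
  refine ⟨m1, ?_, ?_⟩
  · obtain ⟨w', hw', hw''⟩ := exists_word' m2 (M := S.length + k + 1) (fun i hi => by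
      simp only [dn, hbd i hi, Nat.zero_sub]) hS m3
    refine mem_filter.2 ⟨(mem_Lam hS).2 ⟨w', ?_, hw', hw''⟩, m4⟩
    have : sh (cmap S r ρ :: (w' ++ S)) = sh (w ++ r :: S) := by
      rw [sh_cons, hw'', up_dn m1, hw]
    have := len_of_sh this
    simp at this; omega
  · refine mem_filter.2 ⟨mem_range.2 ?_, m5⟩
    by_contra hc
    have := hbd _ (not_lt.1 hc); omega

lemma cmap_inj {k : ℕ} {S : List ℕ} (hS : valid S) {r r' : ℕ} (hr : addable S r) (hr' : addable S r') {ρ : ℕ → ℕ}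
    (hρ : ρ ∈ LS k (r :: S)) (hρ' : ρ ∈ LS k (r' :: S)) (h : cmap S r ρ = cmap S r' ρ) : r = r' := by
  classical
  have h1 := (mem_filter.1 hρ).2
  have h2 := (mem_filter.1 hρ').2
  by_contra hne
  have e1 := h1 r'
  have e2 := h2 r
  simp only [count_cons] at e1 e2
  have b1 : ¬ (r == r') = true := by simpa using hne
  have b2 : ¬ (r' == r) = true := by simpa using Ne.symm hne
  rw [if_neg b1] at e1
  rw [if_neg b2] at e2
  unfold cmap at h
  split_ifs at h <;> omega

open Classical in
lemma count_ineq (N : (ℕ → ℕ) → ℕ) {k : ℕ} {S : List ℕ} (hS : valid S) :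
    ∑ r ∈ Adds S, ∑ ρ ∈ LS k (r :: S), N ρ ≤
      ∑ f ∈ LS k S, ∑ r ∈ AddF f (S.length + k + 1), N (up f r) := by
  rw [sum_sigma', sum_sigma']
  have hm : ∀ x ∈ (Adds S).sigma (fun r => LS k (r :: S)), addable S x.1 ∧ x.2 ∈ LS k (x.1 :: S) := by
    intro x hx
    rw [mem_sigma, mem_Adds hS] at hx; exact hx
  let g : (_ : ℕ) × (ℕ → ℕ) → (_ : ℕ → ℕ) × ℕ := fun x => ⟨dn x.2 (cmap S x.1 x.2), cmap S x.1 x.2⟩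
  have hg : Set.InjOn g ((Adds S).sigma (fun r => LS k (r :: S)) : Finset _) := by
    rintro ⟨r, ρ⟩ hx ⟨r', ρ'⟩ hx' e
    obtain ⟨a1, a2⟩ := hm _ hx
    obtain ⟨a1', a2'⟩ := hm _ hx'
    simp only at a1 a2 a1' a2'
    simp only [g, Sigma.mk.injEq, heq_eq_eq] at e
    have c1 := up_dn (cmap_spec hS a1 a2).1
    have c2 := up_dn (cmap_spec hS a1' a2').1
    have : ρ = ρ' := by rw [← c1, ← c2, e.1, e.2]
    subst this
    have := cmap_inj hS a1 a1' a2 a2' e.2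
    subst this; rfl
  calc _ = ∑ y ∈ ((Adds S).sigma (fun r => LS k (r :: S))).image g, N (up y.1 y.2) := by
        rw [sum_image hg]
        refine sum_congr rfl fun x hx => ?_
        obtain ⟨a1, a2⟩ := hm _ hx
        rw [up_dn (cmap_spec hS a1 a2).1]
    _ ≤ _ := by
        refine sum_le_sum_of_subset ?_
        intro y hy
        obtain ⟨x, hx, rfl⟩ := mem_image.1 hy
        obtain ⟨a1, a2⟩ := hm _ hx
        obtain ⟨c1, c2, c3⟩ := cmap_spec hS a1 a2
        exact mem_sigma.2 ⟨c2, c3⟩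
end HS

namespace HS
variable {K A : Type} [Field K] [Ring A] [Algebra K A] {q : K} {T : ℕ → A}

open Classical in
def Nw (q : K) (T : ℕ → A) (χ : ℕ → A →ₗ[K] K) (S : List ℕ) : ℕ :=
  if h : ∃ r : ℕ, χ S.length (idem q T S) = r then h.choose else 0

open Classical in
def Nf (q : K) (T : ℕ → A) (χ : ℕ → A →ₗ[K] K) (f : ℕ → ℕ) : ℕ :=
  if h : ∃ S, valid S ∧ sh S = f then Nw q T χ h.choose else 0

abbrev row (k : ℕ) : List ℕ := replicate k 0

lemma valid_row (k : ℕ) : valid (row k) := by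
  induction k with
  | zero => trivial
  | succ k ih => exact ⟨ih, Or.inl rfl⟩

lemma HeckeSys.row_T (hs : HeckeSys q T) {i k : ℕ} (h : i + 1 < k) :
    idem q T (row k) * T i = q • idem q T (row k) := by
  obtain ⟨j, rfl⟩ : ∃ j, k = j + (i + 2) := ⟨k - (i+2), by omega⟩
  have e1 : row (j + (i+2)) = replicate j 0 ++ row (i+2) := by simp [row, replicate_add]
  have e2 := hs.eT_row (U := row i) (r := 0) (valid_row (i+2))
  simp only [length_replicate] at e2
  rw [e1, ← hs.idem_app_right _ (valid_row (i+2)), mul_assoc]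
  rw [show row (i+2) = 0 :: 0 :: row i from rfl, e2, mul_smul_comm]

lemma HeckeSys.Te_row (hs : HeckeSys q T) {U : List ℕ} {r : ℕ} (h : valid (r :: r :: U)) :
    T U.length * idem q T (r :: r :: U) = q • idem q T (r :: r :: U) := by
  have h1 := hs.idem_sum_rel (U.length + 2) (S := []) trivial
  have : T U.length * idem q T (r :: r :: U)  =
      ∑ w ∈ rel (U.length + 2) [], idem q T (w ++ []) * (T U.length * idem q T (r :: r :: U)) := by
    rw [← sum_mul, h1]; simp [idem]
  rw [this, sum_eq_single (r :: r :: U)]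
  · rw [append_nil, ← mul_assoc, hs.eT_row h, smul_mul_assoc, hs.idem_idem h]
  · intro w hw hne
    rw [mem_rel (S := []) trivial] at hw
    rw [append_nil] at hw ⊢
    obtain ⟨hl, hv⟩ := hw
    match w, hl with
    | r' :: s' :: U', hl =>
      have : U.length = U'.length := by simpa using hl.symm
      rw [this]
      apply hs.T_block this.symm hv h
      · rintro ⟨rfl, rfl, rfl, h4⟩
        exact h4 rfl
      · intro e; exact hne e
  · intro h2; exact absurd ((mem_rel (S := []) trivial).2 ⟨by simp, by simpa using h⟩) h2

lemma HeckeSys.T_row (hs : HeckeSys q T) {i k : ℕ} (h : i + 1 < k) :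
    T i * idem q T (row k) = q • idem q T (row k) := by
  obtain ⟨j, rfl⟩ : ∃ j, k = j + (i + 2) := ⟨k - (i+2), by omega⟩
  have e1 : row (j + (i+2)) = replicate j 0 ++ row (i+2) := by simp [row, replicate_add]
  have e2 := hs.Te_row (U := row i) (r := 0) (valid_row (i+2))
  simp only [length_replicate] at e2
  rw [e1, ← hs.idem_app_left _ (valid_row (i+2)), ← mul_assoc]
  rw [show row (i+2) = 0 :: 0 :: row i from rfl, e2, smul_mul_assoc]

namespace Sys
variable [CharZero K]
variable {d : ℕ} {B : ℕ → Subalgebra K A} {χ : ℕ → A →ₗ[K] K} {σ : ℕ → A →ₐ[K] A}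
variable (sy : Sys q T d B χ σ)
include sy

lemma idem_B (S : List ℕ) : idem q T S ∈ B S.length := sy.HH_le _ (idem_mem S)

lemma Nw_ex {S : List ℕ} (h : valid S) :
    χ S.length (idem q T S) = Nw q T χ S ∧ (Nw q T χ S = 0 → idem q T S = 0) := by
  obtain ⟨r, hr, hr0⟩ := sy.tr.idem _ _ (sy.idem_B S) (sy.hs.idem_idem h)
  have hex : ∃ r : ℕ, χ S.length (idem q T S) = r := ⟨r, hr⟩
  have h1 : Nw q T χ S = hex.choose := by unfold Nw; rw [dif_pos hex]
  have h2 := hex.choose_spec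
  rw [h1]
  refine ⟨h2, fun h0 => hr0 ?_⟩
  rw [h0, hr] at h2; exact_mod_cast h2

lemma Nw_spec {S : List ℕ} (h : valid S) : χ S.length (idem q T S) = Nw q T χ S := (sy.Nw_ex h).1

lemma Nw_zero {S : List ℕ} (h : valid S) : Nw q T χ S = 0 ↔ idem q T S = 0 := by
  refine ⟨(sy.Nw_ex h).2, fun h0 => ?_⟩
  have := sy.Nw_spec h
  rw [h0, map_zero] at this; exact_mod_cast this.symm

lemma Nw_nil : Nw q T χ [] = 1 := by
  have := sy.Nw_spec (S := []) trivial
  simp only [idem, List.length_nil, sy.tr.one] at this; exact_mod_cast this.symm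

lemma trans_sh {S S' : List ℕ} (h : valid S) (h' : valid S') (e : sh S = sh S') : Trans q T S S' := by
  have := sy.hs.trans_conn (conn_of_count (S := []) (w := S) (u := S') (by simpa using h) (by simpa using h')
    (fun i => congrFun e i))
  simpa using this

lemma Nw_sh {S S' : List ℕ} (h : valid S) (h' : valid S') (e : sh S = sh S') :
    Nw q T χ S = Nw q T χ S' := by
  obtain ⟨X, Y, hX, hY, h1, h2⟩ := sy.trans_sh h h' e
  have hl := len_of_sh e
  have a1 := h1 _ (sy.hs.isW_idem h)
  have a2 := h2 _ (sy.hs.isW_idem h')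
  have b1 := sy.hs.idem_act h' a1.1
  have b2 := sy.hs.idem_act h a2.1
  have hi := idem_mem (q := q) (T := T) S
  have hi' : idem q T S' ∈ HH K T S.length := hl ▸ idem_mem (q := q) (T := T) S'
  have : χ S.length (idem q T S) = χ S.length (idem q T S') := by
    calc χ S.length (idem q T S) = χ S.length (Y * (idem q T S' * (X * idem q T S))) := by
          rw [b1, a1.2]
      _ = χ S.length ((X * idem q T S) * (Y * idem q T S')) := by
          rw [← mul_assoc, sy.tr_comm (mul_mem hY hi') (mul_mem hX hi)]
      _ = χ S.length (X * (idem q T S * (Y * idem q T S'))) := by rw [mul_assoc]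
      _ = _ := by rw [b2, a2.2]
  rw [sy.Nw_spec h, hl, sy.Nw_spec h'] at this
  exact_mod_cast this

lemma Nf_sh {S : List ℕ} (h : valid S) : Nf q T χ (sh S) = Nw q T χ S := by
  have hex : ∃ S', valid S' ∧ sh S' = sh S := ⟨S, h, rfl⟩
  unfold Nf
  rw [dif_pos hex]
  exact sy.Nw_sh hex.choose_spec.1 h hex.choose_spec.2

lemma Nw_add {S : List ℕ} (h : valid S) : d * Nw q T χ S = ∑ r ∈ Adds S, Nw q T χ (r :: S) := by
  have : ((d * Nw q T χ S : ℕ) : K) = ((∑ r ∈ Adds S, Nw q T χ (r :: S) : ℕ) : K) := by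
    push_cast
    rw [← sy.Nw_spec h, ← sy.tr.succ _ _ (sy.idem_B S), ← sy.hs.idem_sum h, map_sum]
    refine sum_congr rfl fun r hr => ?_
    exact sy.Nw_spec (S := r :: S) ⟨h, (mem_Adds h).1 hr⟩
  exact_mod_cast this

lemma Nw_app_zero {S : List ℕ} (w : List ℕ) (h : valid S) (h' : valid (w ++ S)) (h0 : Nw q T χ S = 0) :
    Nw q T χ (w ++ S) = 0 := by
  rw [sy.Nw_zero h', ← sy.hs.idem_app_left w h, (sy.Nw_zero h).1 h0, zero_mul]

def _root_.HS.Psh (q : K) (T : ℕ → A) (σ : ℕ → A →ₐ[K] A) (n k : ℕ) : A := σ n (idem q T (row k))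

omit [CharZero K] in
lemma Psh_props (S : List ℕ) (k : ℕ) :
    (∀ j, S.length ≤ j → j + 1 < S.length + k → T j * Psh q T σ S.length k = q • Psh q T σ S.length k) ∧
    Psh q T σ S.length k ∈ HH K T (S.length + k) ∧
    Psh q T σ S.length k * idem q T S = idem q T S * Psh q T σ S.length k ∧
    Psh q T σ S.length k * Psh q T σ S.length k = Psh q T σ S.length k := by
  unfold Psh
  refine ⟨fun j h1 h2 => ?_, ?_, ?_, ?_⟩
  · have : T j = σ S.length (T (j - S.length)) := by rw [sy.hσ]; congr 1; omega
    rw [this, ← map_mul, sy.hs.T_row (by omega), map_smul]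
  · have := idem_mem (q := q) (T := T) (row k)
    rw [length_replicate] at this
    exact sy.shift_HH this
  · exact (sy.tr.shc _ _ (sy.HH_le _ (idem_mem S)) _).symm
  · rw [← map_mul, sy.hs.idem_idem (valid_row k)]

def _root_.HS.xx (q : K) (T : ℕ → A) (χ : ℕ → A →ₗ[K] K) (σ : ℕ → A →ₐ[K] A) (k : ℕ) (S : List ℕ) (f : ℕ → ℕ) : K :=
  χ (S.length + k) (esh q T k S f * Psh q T σ S.length k)

lemma xx_sum {S : List ℕ} (h : valid S) (k : ℕ) :
    ∑ f ∈ Lam k S, xx q T χ σ k S f = Nw q T χ (row k) * Nw q T χ S := by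
  unfold xx
  rw [← map_sum, ← sum_mul, sy.hs.esh_sum h, Psh]
  have := sy.idem_B (row k)
  rw [length_replicate] at this
  rw [sy.tr.sht _ _ _ (sy.idem_B S) _ this, sy.Nw_spec h, mul_comm]
  have := sy.Nw_spec (valid_row k)
  rw [length_replicate] at this
  rw [this]

lemma xx_le {S : List ℕ} (h : valid S) (k : ℕ) {f : ℕ → ℕ} (hf : f ∈ Lam k S) :
    ∃ n : ℕ, xx q T χ σ k S f = n ∧ n ≤ Nf q T χ f := by
  obtain ⟨w, hk, hv, rfl⟩ := (mem_Lam h).1 hf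
  obtain ⟨p1, p2, p3, p4⟩ := sy.Psh_props S k
  rcases sy.Qtr h ((mem_rel h).2 ⟨hk, hv⟩) p1 p2 p3 p4 with e | e
  · exact ⟨0, by simpa [xx] using e, Nat.zero_le _⟩
  · refine ⟨Nf q T χ (sh (w ++ S)), ?_, le_rfl⟩
    rw [sy.Nf_sh hv, ← sy.Nw_spec hv]
    unfold xx
    rw [e]; congr 2; simp; omega

lemma xx_nonstrip {S : List ℕ} (h : valid S) (k : ℕ) {f : ℕ → ℕ} (hf : ∃ i, S.count i < f (i+1)) :
    xx q T χ σ k S f = 0 := by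
  obtain ⟨p1, p2, p3, p4⟩ := sy.Psh_props S k
  unfold xx
  rw [sy.esh_nonstrip h p1 hf, map_zero]

lemma xx_LS {S : List ℕ} (h : valid S) (k : ℕ) :
    ∑ f ∈ LS k S, xx q T χ σ k S f = Nw q T χ (row k) * Nw q T χ S := by
  classical
  rw [← sy.xx_sum h]
  refine sum_subset (Finset.filter_subset _ _) fun f hf hf' => ?_
  apply sy.xx_nonstrip h
  by_contra hc; push Not at hc
  exact hf' (mem_filter.2 ⟨hf, hc⟩)

lemma LS_sub {k : ℕ} {S : List ℕ} {f : ℕ → ℕ} (hf : f ∈ LS k S) : f ∈ Lam k S := by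
  classical
  exact (mem_filter.1 hf).1

lemma pie_le {S : List ℕ} (h : valid S) (k : ℕ) :
    Nw q T χ (row k) * Nw q T χ S ≤ ∑ f ∈ LS k S, Nf q T χ f := by
  have : ∀ f ∈ LS k S, ∃ n : ℕ, xx q T χ σ k S f = n ∧ n ≤ Nf q T χ f := fun f hf => sy.xx_le h k (sy.LS_sub hf)
  choose! n hn hn' using this
  have e := sy.xx_LS h k
  rw [sum_congr rfl hn] at e
  have e' : ∑ f ∈ LS k S, n f = Nw q T χ (row k) * Nw q T χ S := by exact_mod_cast e
  rw [← e']; exact sum_le_sum hn'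

lemma LS_nil (k : ℕ) : LS k [] = {sh (row k)} := by
  classical
  have hval : valid ([] : List ℕ) := trivial
  have h0 : ∀ f ∈ LS k [], f = sh (row k) := by
    intro f hf
    obtain ⟨a, b⟩ := mem_filter.1 hf
    obtain ⟨w, hk, hv, rfl⟩ := (mem_Lam hval).1 a
    rw [append_nil] at b hv ⊢
    have : w = row k := by
      rw [row, List.eq_replicate_iff]
      refine ⟨hk, fun x hx => ?_⟩
      by_contra hc
      have h1 := b (x-1)
      rw [show x - 1 + 1 = x by omega] at h1
      have h2 := count_pos_iff.2 hx
      simp only [sh, List.count_nil] at h1; omega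
    rw [this]
  refine Finset.eq_singleton_iff_unique_mem.2 ⟨?_, h0⟩
  refine mem_filter.2 ⟨(mem_Lam hval).2 ⟨row k, by simp, by simpa using valid_row k, by simp⟩, fun i => ?_⟩
  simp [sh, List.count_replicate]

lemma pieri {S : List ℕ} (h : valid S) (k : ℕ) :
    Nw q T χ (row k) * Nw q T χ S = ∑ f ∈ LS k S, Nf q T χ f := by
  induction S with
  | nil => rw [sy.LS_nil, sum_singleton, sy.Nf_sh (valid_row k), sy.Nw_nil, mul_one]
  | cons r S ih =>
    have hS := h.1
    have e := ih hS
    have hr : r ∈ Adds S := (mem_Adds hS).2 h.2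
    have hadd : ∀ f ∈ LS k S, d * Nf q T χ f = ∑ r ∈ AddF f (S.length + k + 1), Nf q T χ (up f r) := by
      intro f hf
      obtain ⟨w, hk, hv, rfl⟩ := (mem_Lam hS).1 (sy.LS_sub hf)
      rw [sy.Nf_sh hv, sy.Nw_add hv]
      have : AddF (sh (w ++ S)) (S.length + k + 1) = Adds (w ++ S) := by
        unfold AddF Adds; rw [show (w ++ S).length = S.length + k by simp; omega]; rfl
      rw [this]
      refine sum_congr rfl fun r hr => ?_
      rw [← sh_cons, sy.Nf_sh (S := r :: (w ++ S)) ⟨hv, (mem_Adds hv).1 hr⟩]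
    have hle : ∀ r ∈ Adds S, Nw q T χ (row k) * Nw q T χ (r :: S) ≤ ∑ f ∈ LS k (r :: S), Nf q T χ f :=
      fun r hr => sy.pie_le (S := r :: S) ⟨hS, (mem_Adds hS).1 hr⟩ k
    have h1 : ∑ r ∈ Adds S, Nw q T χ (row k) * Nw q T χ (r :: S) =
        ∑ f ∈ LS k S, ∑ r ∈ AddF f (S.length + k + 1), Nf q T χ (up f r) := by
      rw [← mul_sum, ← sy.Nw_add hS, mul_left_comm, e, mul_sum, sum_congr rfl hadd]
    have h2 := count_ineq (Nf q T χ) (k := k) hS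
    rw [← h1] at h2
    exact (sum_eq_sum_iff_of_le hle).1 (le_antisymm (sum_le_sum hle) h2) r hr

lemma xx_eq {S : List ℕ} (h : valid S) (k : ℕ) {f : ℕ → ℕ} (hf : f ∈ LS k S) :
    xx q T χ σ k S f = Nf q T χ f := by
  have : ∀ f ∈ LS k S, ∃ n : ℕ, xx q T χ σ k S f = n ∧ n ≤ Nf q T χ f := fun f hf => sy.xx_le h k (sy.LS_sub hf)
  choose! n hn hn' using this
  have e := sy.xx_LS h k
  rw [sum_congr rfl hn] at e
  have e' : ∑ f ∈ LS k S, n f = ∑ f ∈ LS k S, Nf q T χ f := by rw [← sy.pieri h]; exact_mod_cast e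
  rw [hn f hf, (sum_eq_sum_iff_of_le hn').1 e' f hf]
end Sys
end HS

namespace HS
variable {K A : Type} [Field K] [Ring A] [Algebra K A] {q : K} {T : ℕ → A}

def Par (n : ℕ) (f : ℕ → ℕ) : Prop := Antitone f ∧ ∀ i, n ≤ i → f i = 0

def strip (f g : ℕ → ℕ) : Prop := ∀ i, f i ≤ g i ∧ g (i+1) ≤ f i

structure PD (N : (ℕ → ℕ) → ℕ) (h : ℕ → ℕ) : Prop where
  pieri : ∀ n f k, Par n f → ∃ F : Finset (ℕ → ℕ),
    (∀ g, g ∈ F ↔ strip f g ∧ ∑ i ∈ range (n+1), g i = ∑ i ∈ range n, f i + k) ∧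
    h k * N f = ∑ g ∈ F, N g
  mono : ∀ n f g, Par n f → Par n g → (∀ i, f i ≤ g i) → N f = 0 → N g = 0
  zero : ∃ n f, Par n f ∧ N f = 0
  nil : N (fun _ => 0) = 1

lemma sum_sh {n : ℕ} {S : List ℕ} (h : ∀ i, n ≤ i → sh S i = 0) :
    ∑ i ∈ range n, sh S i = S.length := by
  induction S with
  | nil => simp [sh]
  | cons r S ih =>
    have h' : ∀ i, n ≤ i → sh S i = 0 := fun i hi => by
      have := h i hi; rw [sh_cons] at this; simp only [up] at this; omega
    have hr : r < n := by
      by_contra hc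
      have := h r (by omega); rw [sh_cons] at this; simp [up] at this
    rw [sh_cons]
    simp only [up, sum_add_distrib, ih h']
    simp [hr]

lemma Par.word {n : ℕ} {f : ℕ → ℕ} (h : Par n f) : ∃ S, valid S ∧ sh S = f := by
  obtain ⟨w, h1, h2⟩ := exists_word' h.1 h.2 (S := []) trivial (fun i => by simp [sh])
  exact ⟨w, by simpa using h1, by simpa using h2⟩

lemma mem_LS {k n : ℕ} {S : List ℕ} (hS : valid S) (hn : ∀ i, n ≤ i → sh S i = 0) {g : ℕ → ℕ} :
    g ∈ LS k S ↔ strip (sh S) g ∧ ∑ i ∈ range (n+1), g i = S.length + k := by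
  classical
  unfold LS
  rw [mem_filter, mem_Lam hS]
  constructor
  · rintro ⟨⟨u, hu, hv, rfl⟩, h2⟩
    refine ⟨fun i => ⟨by simp [sh, count_app], h2 i⟩, ?_⟩
    rw [sum_sh]
    · simp; omega
    · intro i hi
      have h3 := h2 (i-1)
      have h4 := hn (i-1) (by omega)
      rw [show i - 1 + 1 = i by omega] at h3
      simp only [sh] at h4 h3 ⊢; omega
  · rintro ⟨h1, h2⟩
    have h3 : ∀ i, n + 1 ≤ i → g i = 0 := fun i hi => by
      have h3 := (h1 (i-1)).2
      have h4 := hn (i-1) (by omega)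
      rw [show i - 1 + 1 = i by omega] at h3; omega
    obtain ⟨w, hw, hw'⟩ := exists_word' (antitone_nat_of_succ_le fun i => (h1 i).2.trans (h1 i).1)
      h3 hS (fun i => (h1 i).1)
    refine ⟨⟨w, ?_, hw, hw'⟩, fun i => (h1 i).2⟩
    rw [← hw', sum_sh (by rw [hw']; exact h3)] at h2
    simp at h2; omega

def stair : ℕ → List ℕ
  | 0 => []
  | r+1 => List.range (r+1) ++ stair r

lemma stair_count (r i : ℕ) : (stair r).count i = r - i := by
  induction r with
  | zero => simp [stair]
  | succ r ih =>
    simp only [stair, count_app, ih]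
    have h := (nodup_range (n := r+1)).count (a := i)
    rw [h]
    simp only [List.mem_range]
    split_ifs <;> omega

namespace Sys
variable [CharZero K]
variable {d : ℕ} {B : ℕ → Subalgebra K A} {χ : ℕ → A →ₗ[K] K} {σ : ℕ → A →ₐ[K] A}
variable (sy : Sys q T d B χ σ)
include sy

lemma corner (m : ℕ) : ∀ (C : List ℕ) (S : List ℕ), C.length = m → valid S → C.Nodup → (∀ c ∈ C, addable S c) →
    valid (C ++ S) ∧ m.factorial * Nw q T χ (C ++ S) ≤ d ^ m * Nw q T χ S := by
  induction m with
  | zero =>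
    intro C S hC hS _ _
    rw [length_eq_zero_iff] at hC
    subst hC
    simpa using hS
  | succ m ih =>
    intro C S hC hS hnd hadd
    have key : ∀ c ∈ C, valid (C.erase c ++ c :: S) ∧
        m.factorial * Nw q T χ (C.erase c ++ c :: S) ≤ d ^ m * Nw q T χ (c :: S) := by
      intro c hc
      refine ih (C.erase c) (c :: S) (by rw [List.length_erase_of_mem hc, hC]; rfl) ⟨hS, hadd c hc⟩ (hnd.erase c) ?_
      intro x hx
      rw [hnd.mem_erase_iff] at hx
      exact addable_cons_ne (Ne.symm hx.1) (hadd x hx.2)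
    have hcount : ∀ c ∈ C, ∀ i, sh (C.erase c ++ c :: S) i = sh (C ++ S) i := fun c hc i => by
      have h1 := (List.perm_cons_erase hc).count_eq i
      simp only [sh, count_app, count_cons, h1] at *; omega
    have hval : valid (C ++ S) := by
      match C, hC with
      | c :: C', hC =>
        have h1 := (ih C' S (by simpa using hC) hS (nodup_cons.1 hnd).2 (fun x hx => hadd x (by simp [hx]))).1
        refine ⟨h1, ?_⟩
        have h2 := hadd c (by simp)
        have h3 : C'.count c = 0 := count_eq_zero.2 (nodup_cons.1 hnd).1
        rcases h2 with h2 | h2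
        · exact Or.inl h2
        · right
          show (C' ++ S).count c < (C' ++ S).count (c-1)
          rw [count_app, count_app]; omega
    refine ⟨hval, ?_⟩
    have h1 : ∀ c ∈ C, m.factorial * Nw q T χ (C ++ S) ≤ d ^ m * Nw q T χ (c :: S) := fun c hc => by
      have := (key c hc).2
      rwa [sy.Nw_sh (key c hc).1 hval (funext (hcount c hc))] at this
    have h2 : ∑ c ∈ C.toFinset, Nw q T χ (c :: S) ≤ d * Nw q T χ S := by
      rw [sy.Nw_add hS]
      refine sum_le_sum_of_subset fun c hc => ?_
      exact (mem_Adds hS).2 (hadd c (mem_toFinset.1 hc))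
    calc (m+1).factorial * Nw q T χ (C ++ S) = ∑ c ∈ C.toFinset, m.factorial * Nw q T χ (C ++ S) := by
          rw [Finset.sum_const, List.toFinset_card_of_nodup hnd, hC, Nat.factorial_succ]; simp [mul_assoc]
      _ ≤ ∑ c ∈ C.toFinset, d ^ m * Nw q T χ (c :: S) :=
          sum_le_sum fun c hc => h1 c (mem_toFinset.1 hc)
      _ = d ^ m * ∑ c ∈ C.toFinset, Nw q T χ (c :: S) := by rw [mul_sum]
      _ ≤ d ^ m * (d * Nw q T χ S) := Nat.mul_le_mul_left _ h2
      _ = _ := by ring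

lemma stair_step (r : ℕ) : valid (stair r) ∧
    (valid (stair r) → (r+1).factorial * Nw q T χ (stair (r+1)) ≤ d ^ (r+1) * Nw q T χ (stair r)) := by
  have hadd : ∀ r, ∀ c ∈ List.range (r+1), addable (stair r) c := fun r c hc => by
    rw [List.mem_range] at hc
    unfold addable
    rw [stair_count, stair_count]; omega
  have hv : valid (stair r) := by
    induction r with
    | zero => trivial
    | succ r ih => exact (sy.corner (r+1) (List.range (r+1)) (stair r) (by simp) ih nodup_range (hadd r)).1
  exact ⟨hv, fun _ => (sy.corner (r+1) (List.range (r+1)) (stair r) (by simp) hv nodup_range (hadd r)).2⟩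

lemma vanish : ∃ S, valid S ∧ Nw q T χ S = 0 := by
  by_contra hc
  push Not at hc
  have hpos : ∀ r, 0 < Nw q T χ (stair r) := fun r => Nat.pos_of_ne_zero (hc _ (sy.stair_step r).1)
  obtain ⟨R, hR⟩ : ∃ R, ∀ r, R ≤ r → d ^ r < r.factorial := by
    have := FloorSemiring.tendsto_pow_div_factorial_atTop (K := ℝ) (d : ℝ)
    have h1 := this.eventually (gt_mem_nhds (show (0:ℝ) < 1 by norm_num))
    rw [Filter.eventually_atTop] at h1
    obtain ⟨R, hR⟩ := h1
    refine ⟨R, fun r hr => ?_⟩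
    have := hR r hr
    rw [div_lt_one (by positivity)] at this
    exact_mod_cast this
  have hdec : ∀ j, Nw q T χ (stair (R + j)) + j ≤ Nw q T χ (stair R) := by
    intro j
    induction j with
    | zero => simp
    | succ j ih =>
      have h1 := (sy.stair_step (R+j)).2 (sy.stair_step (R+j)).1
      have h2 := hR (R+j+1) (by omega)
      have h3 : Nw q T χ (stair (R+j+1)) < Nw q T χ (stair (R+j)) := by
        by_contra h4
        push Not at h4
        have := hpos (R+j)
        have h5 := Nat.mul_le_mul_left ((R+j+1).factorial) h4
        have h6 := Nat.mul_lt_mul_of_pos_right h2 this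
        omega
      show Nw q T χ (stair (R+j+1)) + (j+1) ≤ _
      omega
  have := hdec (Nw q T χ (stair R) + 1)
  omega

lemma toPD : PD (Nf q T χ) (fun k => Nw q T χ (row k)) where
  pieri n f k hf := by
    obtain ⟨S, hS, rfl⟩ := hf.word
    refine ⟨LS k S, fun g => ?_, ?_⟩
    · rw [mem_LS hS hf.2, sum_sh hf.2]
    · rw [sy.Nf_sh hS]; exact sy.pieri hS k
  mono n f g hf hg hle h0 := by
    obtain ⟨S, hS, rfl⟩ := hf.word
    obtain ⟨w, hw, rfl⟩ := exists_word' hg.1 hg.2 hS hle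
    rw [sy.Nf_sh hw]
    exact sy.Nw_app_zero w hS hw (by rw [← sy.Nf_sh hS]; exact h0)
  zero := by
    obtain ⟨S, hS, h0⟩ := sy.vanish
    exact ⟨S.length, sh S, ⟨sh_anti hS, sh_bdd hS⟩, by rw [sy.Nf_sh hS, h0]⟩
  nil := by
    have := sy.Nf_sh (S := []) trivial
    rw [sy.Nw_nil] at this
    exact this

end Sys

def col : ℕ → List ℕ
  | 0 => []
  | k+1 => k :: col k

lemma col_len (k : ℕ) : (col k).length = k := by induction k with
  | zero => rfl
  | succ k ih => simp [col, ih]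

lemma sh_col (k i : ℕ) : sh (col k) i = if i < k then 1 else 0 := by
  induction k with
  | zero => simp [col, sh]
  | succ k ih => rw [col, sh_cons]; simp only [up, ih]; split_ifs <;> omega

lemma valid_col (k : ℕ) : valid (col k) := by
  induction k with
  | zero => trivial
  | succ k ih =>
    refine ⟨ih, ?_⟩
    unfold addable
    have h1 := sh_col k k
    have h2 := sh_col k (k-1)
    simp only [sh] at h1 h2
    rw [h1, h2]; split_ifs <;> omega

lemma HeckeSys.col_T (hs : HeckeSys q T) {i k : ℕ} (h : i + 1 < k) :
    T i * idem q T (col k) = (-1 : K) • idem q T (col k) := by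
  obtain ⟨j, rfl⟩ : ∃ j, k = i + 2 + j := ⟨k - (i+2), by omega⟩
  have e1 : ∃ w, col (i+2+j) = w ++ col (i+2) := by
    clear h
    induction j with
    | zero => exact ⟨[], rfl⟩
    | succ j ih => obtain ⟨w, hw⟩ := ih; exact ⟨(i+2+j) :: w, by show (i+2+j) :: col (i+2+j) = _; rw [hw]; rfl⟩
  obtain ⟨w, hw⟩ := e1
  have hns : ¬ valid (i :: (i+1) :: col i) := by
    rintro ⟨⟨h1, h2⟩, h3⟩
    unfold addable at h2
    have a1 := sh_col i (i+1)
    have a2 := sh_col i i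
    simp [sh] at a1 a2 h2; omega
  have hv := valid_col (i+2)
  have e2 : T i * idem q T (col (i+2)) = (-1 : K) • idem q T (col (i+2)) := by
    have h1 := hs.idem_sum_rel (i + 2) (S := []) trivial
    have : T i * idem q T (col (i+2))  =
        ∑ w ∈ rel (i + 2) [], idem q T (w ++ []) * (T i * idem q T (col (i+2))) := by
      rw [← sum_mul, h1]; simp [idem]
    rw [this, sum_eq_single (col (i+2))]
    · have := hs.eT_col (U := col i) (r := i+1) (s := i) hv hns
      rw [col_len] at this
      rw [append_nil, ← mul_assoc]
      show idem q T ((i+1) :: i :: col i) * T i * idem q T ((i+1) :: i :: col i) = _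
      rw [this, smul_mul_assoc, hs.idem_idem (S := (i+1) :: i :: col i) hv]; rfl
    · intro w hw hne
      rw [mem_rel (S := []) trivial] at hw
      rw [append_nil] at hw ⊢
      obtain ⟨hl, hv'⟩ := hw
      match w, hl with
      | r' :: s' :: U', hl =>
        have hU : U'.length = i := by simpa using hl
        rw [← hU]
        show idem q T (r' :: s' :: U') * (T U'.length * idem q T ((U'.length+1) :: U'.length :: col U'.length)) = 0
        rw [← hU] at hv hns hne
        apply hs.T_block (by rw [col_len]) hv' hv
        · rintro ⟨h5, h6, h7, h4⟩
          rw [h6, h7] at hv'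
          apply hns
          rw [← h5]
          exact hv'
        · intro e; exact hne e
    · intro h2; exact absurd ((mem_rel (S := []) trivial).2 ⟨by simp [col_len], by simpa using hv⟩) h2
  rw [hw, ← hs.idem_app_left _ hv, ← mul_assoc, e2, smul_mul_assoc]

lemma dual_hs (hs : HeckeSys q T) : HeckeSys q (fun i => (q-1) • (1:A) - T i) where
  q0 := hs.q0
  qn := hs.qn
  quad i := by
    simp only [mul_sub, sub_mul, smul_mul_assoc, one_mul, mul_smul_comm, mul_one, hs.quad]
    module
  braid i := by
    have h1 := hs.braid i
    have h2 := hs.quad i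
    have h3 := hs.quad (i+1)
    simp only [mul_sub, sub_mul, smul_mul_assoc, one_mul, mul_smul_comm, mul_one, mul_assoc] at h1 ⊢
    rw [h1, h2, h3]
    module
  comm i j h := by
    simp only [mul_sub, sub_mul, smul_mul_assoc, one_mul, mul_smul_comm, mul_one, hs.comm i j h]
    module

lemma isW_row {T : ℕ → A} (hs : HeckeSys q T) {v : A} {k : ℕ} (h : ∀ i, i + 1 < k → T i * v = q • v) :
    IsW q T (row k) v ∧ ∀ j < k, JM q T j * v = q ^ j • v := by
  have hJ : ∀ j < k, JM q T j * v = q ^ j • v := by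
    intro j hj
    induction j with
    | zero => simp [JM]
    | succ j ih =>
      simp only [JM, smul_mul_assoc, mul_assoc]
      rw [h j (by omega), mul_smul_comm, ih (by omega), smul_comm q, mul_smul_comm, mul_smul_comm, h j hj]
      have := hs.q0
      simp only [smul_smul]; congr 1; field_simp; ring
  refine ⟨?_, hJ⟩
  clear h
  induction k with
  | zero => trivial
  | succ k ih =>
    refine ⟨ih (fun j hj => hJ j (by omega)), ?_⟩
    rw [length_replicate, hJ k (by omega)]
    simp [cont, cz]

lemma isW_col {T : ℕ → A} (hs : HeckeSys q T) {v : A} {k : ℕ} (h : ∀ i, i + 1 < k → T i * v = (-1 : K) • v) :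
    IsW q T (col k) v := by
  have hJ : ∀ j < k, JM q T j * v = (q⁻¹) ^ j • v := by
    intro j hj
    induction j with
    | zero => simp [JM]
    | succ j ih =>
      simp only [JM, smul_mul_assoc, mul_assoc]
      rw [h j (by omega), mul_smul_comm, ih (by omega), smul_comm (-1 : K), mul_smul_comm, mul_smul_comm, h j hj]
      have := hs.q0
      simp only [smul_smul]; congr 1; ring
  clear h
  induction k with
  | zero => trivial
  | succ k ih =>
    refine ⟨ih (fun j hj => hJ j (by omega)), ?_⟩
    rw [col_len, hJ k (by omega)]
    have := sh_col k k
    simp only [sh] at this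
    simp [cont, cz, this]

namespace Sys
variable [CharZero K]
variable {d : ℕ} {B : ℕ → Subalgebra K A} {χ : ℕ → A →ₗ[K] K} {σ : ℕ → A →ₐ[K] A}
variable (sy : Sys q T d B χ σ)
include sy

omit [CharZero K] in
lemma dual : Sys q (fun i => (q-1) • (1:A) - T i) d B χ σ where
  hs := dual_hs sy.hs
  tr := sy.tr
  hT i := sub_mem (smul_mem _ (one_mem _) _) (sy.hT i)
  hσ n i := by simp [map_sub, sy.hσ]

lemma dual_row (k : ℕ) : Nw q (fun i => (q-1) • (1:A) - T i) χ (row k) = Nw q T χ (col k) := by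
  have hs' := dual_hs sy.hs
  have h1 := sy.Nw_spec (valid_col k)
  have h2 := sy.dual.Nw_spec (valid_row k)
  rw [col_len] at h1
  rw [length_replicate] at h2
  set T' : ℕ → A := fun i => (q-1) • (1:A) - T i with hT'
  set e := idem q T (col k) with he
  set p := idem q T' (row k) with hp
  have e1 : p * e = e := by
    refine hs'.idem_act (valid_row k) (isW_row hs' fun i hi => ?_).1
    show ((q-1) • (1:A) - T i) * e = _
    rw [sub_mul, sy.hs.col_T hi, smul_mul_assoc, one_mul, ← sub_smul]; congr 1; ring
  have e2 : e * p = p := by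
    refine sy.hs.idem_act (valid_col k) (isW_col sy.hs fun i hi => ?_)
    have : T i = (q-1) • (1:A) - T' i := by simp [hT']
    rw [this, sub_mul, hs'.T_row hi, smul_mul_assoc, one_mul, ← sub_smul]; congr 1; ring
  have m1 : e ∈ B k := by have := sy.idem_B (col k); rwa [col_len] at this
  have m2 : p ∈ B k := by have := sy.dual.idem_B (row k); rwa [length_replicate] at this
  have : χ k p = χ k e := by rw [← e1, ← e2, sy.tr.comm k _ m1 _ m2, e2, e1]
  rw [h1, h2] at this
  exact_mod_cast this
end Sys
end HS

namespace HS

def Hz (h : ℕ → ℕ) (z : ℤ) : ℝ := if 0 ≤ z then (h z.toNat : ℝ) else 0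

def JT (h : ℕ → ℕ) (n : ℕ) (f : ℕ → ℕ) : ℝ :=
  det (of fun i j : Fin n => Hz h ((f i : ℤ) - (i : ℕ) + (j : ℕ)))

namespace PD
variable {N : (ℕ → ℕ) → ℕ} {h : ℕ → ℕ} (pd : PD N h)

def al (f : ℕ → ℕ) (i r : ℕ) : ℕ := if r < i then f r + 1 else f (r+1)

lemma al_par {n : ℕ} {f : ℕ → ℕ} (hf : Par (n+1) f) {i : ℕ} (hi : i ≤ n) : Par n (al f i) := by
  constructor
  · refine antitone_nat_of_succ_le fun r => ?_
    have h1 := hf.1 (Nat.le_add_right r 1)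
    have h2 := hf.1 (Nat.le_add_right (r+1) 1)
    simp only [al]; split_ifs <;> omega
  · intro r hr
    simp only [al]; rw [if_neg (by omega)]; exact hf.2 _ (by omega)

lemma al_sum (n : ℕ) (f : ℕ → ℕ) (i : ℕ) (hi : i ≤ n) :
    ∑ r ∈ range n, al f i r + f i = ∑ r ∈ range (n+1), f r + i := by
  induction n with
  | zero =>
    obtain rfl : i = 0 := by omega
    simp
  | succ n ih =>
    rcases Nat.lt_or_ge n i with h1 | h1
    · obtain rfl : i = n + 1 := by omega
      rw [sum_range_succ (n := n+1), sum_congr rfl (g := fun r => f r + 1)]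
      · simp [sum_add_distrib]; omega
      · intro r hr; simp only [al]; rw [if_pos (mem_range.1 hr)]
    · have := ih h1
      rw [sum_range_succ (n := n+1), sum_range_succ (n := n)]
      simp only [al] at this ⊢
      rw [if_neg (by omega)]; omega

lemma strip_ext {n : ℕ} {f g : ℕ → ℕ} (hg : ∀ i, n < i → g i = 0) (hf : ∀ i, n < i → f i = 0) (hle : ∀ i ≤ n, g i ≤ f i)
    (hs : ∑ i ∈ range (n+1), g i = ∑ i ∈ range (n+1), f i) : g = f := by
  have := (sum_eq_sum_iff_of_le (s := range (n+1)) (f := g) (g := f)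
    (fun i hi => hle i (by have := mem_range.1 hi; omega))).1 hs
  funext i
  by_cases hi : i ≤ n
  · exact this i (mem_range.2 (by omega))
  · rw [hg i (by omega), hf i (by omega)]

include pd

lemma exF {n : ℕ} {f : ℕ → ℕ} (hf : Par (n+1) f) {i : ℕ} (hi : i ≤ n) : ∃ F : Finset (ℕ → ℕ),
    (∀ g, g ∈ F ↔ strip (al f i) g ∧ ∑ r ∈ range (n+1), g r = ∑ r ∈ range (n+1), f r) ∧
    Hz h ((f i : ℤ) - i) * N (al f i) = ∑ g ∈ F, (N g : ℝ) := by
  have h0 := al_sum n f i hi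
  by_cases hlt : i ≤ f i
  · obtain ⟨F, h1, h2⟩ := pd.pieri n (al f i) (f i - i) (al_par hf hi)
    refine ⟨F, fun g => ?_, ?_⟩
    · rw [h1]; apply and_congr_right; intro _
      omega
    · rw [Hz, if_pos (by omega), show ((f i : ℤ) - i).toNat = f i - i by omega]
      exact_mod_cast h2
  · refine ⟨∅, fun g => ?_, ?_⟩
    · simp only [Finset.notMem_empty, false_iff]
      rintro ⟨h1, h2⟩
      have : ∑ r ∈ range n, al f i r ≤ ∑ r ∈ range n, g r := sum_le_sum fun r _ => (h1 r).1
      rw [sum_range_succ] at h2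
      omega
    · rw [Hz, if_neg (by omega)]; simp

theorem jt (n : ℕ) : ∀ f, Par n f → (N f : ℝ) = JT h n f := by
  induction n with
  | zero =>
    intro f hf
    have : f = fun _ => 0 := funext fun i => hf.2 i (by omega)
    rw [this, pd.nil]; simp [JT]
  | succ n ih =>
    intro f hf
    have hex : ∀ i, ∃ F : Finset (ℕ → ℕ), i ≤ n →
      (∀ g, g ∈ F ↔ strip (al f i) g ∧ ∑ r ∈ range (n+1), g r = ∑ r ∈ range (n+1), f r) ∧
      Hz h ((f i : ℤ) - i) * N (al f i) = ∑ g ∈ F, (N g : ℝ) := fun i => by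
      by_cases hi : i ≤ n
      · obtain ⟨F, hF⟩ := pd.exF hf hi
        exact ⟨F, fun _ => hF⟩
      · exact ⟨∅, fun h => absurd h hi⟩
    choose F hF using hex
    have e1 : JT h (n+1) f = ∑ i ∈ range (n+1), (-1)^i * (Hz h ((f i : ℤ) - i) * N (al f i)) := by
      rw [JT, det_succ_column_zero, sum_range]
      refine sum_congr rfl fun i _ => ?_
      rw [ih _ (al_par hf (lt_succ_iff.1 i.2)), JT, mul_assoc]
      congr 2
      · simp
      · congr 1
        ext r s
        simp only [submatrix_apply, of_apply, al]
        congr 1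
        by_cases hr : r.castSucc < i
        · rw [Fin.succAbove_of_castSucc_lt _ _ hr]
          have : (r : ℕ) < i := hr
          rw [if_pos this]; simp; ring
        · rw [Fin.succAbove_of_le_castSucc _ _ (not_lt.1 hr)]
          have : ¬ (r : ℕ) < i := hr
          rw [if_neg this]; simp; ring
    set X : ℕ → ℝ := fun i => ∑ g ∈ (F i).filter (fun g => g i ≤ f i), (N g : ℝ) with hX
    have hd : Antitone f := hf.1
    have e2 : ∀ i < n, Hz h ((f i : ℤ) - i) * N (al f i) = X i + X (i+1) := by
      intro i hi
      rw [(hF i hi.le).2, ← Finset.sum_filter_add_sum_filter_not (F i) (fun g => g i ≤ f i)]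
      congr 1
      refine sum_congr ?_ fun _ _ => rfl
      ext g
      rw [mem_filter, mem_filter, (hF i hi.le).1, (hF (i+1) hi).1]
      have hfi := hd (Nat.le_add_right i 1)
      constructor
      · rintro ⟨⟨h1, h2⟩, h3⟩
        have h4 := h1 i
        simp only [al, lt_irrefl, if_false] at h4
        refine ⟨⟨fun r => ?_, h2⟩, h4.2⟩
        have h5 := h1 r
        rcases Nat.lt_trichotomy r i with h6 | rfl | h6
        · simp only [al] at h5 ⊢; rw [if_pos h6] at h5; rw [if_pos (by omega)]; exact h5
        · simp only [al]; rw [if_pos (by omega)]; omega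
        · simp only [al] at h5 ⊢; rw [if_neg (by omega)] at h5 ⊢; exact h5
      · rintro ⟨⟨h1, h2⟩, h3⟩
        have h4 := h1 i
        simp only [al, lt_succ_self, if_true] at h4
        refine ⟨⟨fun r => ?_, h2⟩, by omega⟩
        have h5 := h1 r
        rcases Nat.lt_trichotomy r i with h6 | rfl | h6
        · simp only [al] at h5 ⊢; rw [if_pos (by omega)] at h5 ⊢; exact h5
        · simp only [al]; rw [if_neg (by omega)]; omega
        · simp only [al] at h5 ⊢; rw [if_neg (by omega)] at h5 ⊢; exact h5
    have e3 : Hz h ((f n : ℤ) - n) * N (al f n) = X n := by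
      rw [(hF n le_rfl).2, hX]
      refine sum_congr ?_ fun _ _ => rfl
      symm
      rw [Finset.filter_eq_self]
      intro g hg
      obtain ⟨h1, h2⟩ := ((hF n le_rfl).1 g).1 hg
      by_contra h3
      have : ∑ r ∈ range n, f r ≤ ∑ r ∈ range n, g r := sum_le_sum fun r hr => by
        have := (h1 r).1
        simp only [al] at this; rw [if_pos (mem_range.1 hr)] at this; omega
      rw [sum_range_succ, sum_range_succ] at h2
      omega
    have e4 : X 0 = N f := by
      have : (F 0).filter (fun g => g 0 ≤ f 0) = {f} := by
        ext g
        rw [mem_filter, (hF 0 (by omega)).1, mem_singleton]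
        constructor
        · rintro ⟨⟨h1, h2⟩, h3⟩
          have hle : ∀ i, g i ≤ f i := fun i => by
            cases i with
            | zero => exact h3
            | succ i => have := (h1 i).2; simpa [al] using this
          exact strip_ext (n := n) (fun i hi => by have := hle i; rw [hf.2 i hi] at this; omega)
            (fun i hi => hf.2 i hi) (fun i _ => hle i) h2
        · rintro rfl
          refine ⟨⟨fun i => ?_, rfl⟩, le_rfl⟩
          have := hd (Nat.le_add_right i 1)
          simpa [al] using this
      rw [hX]; simp only [this]; simp
    have e5 : ∀ k ≤ n, ∑ i ∈ range k, (-1:ℝ)^i * (Hz h ((f i : ℤ) - i) * N (al f i)) = X 0 - (-1)^k * X k := by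
      intro k hk
      induction k with
      | zero => simp
      | succ k ihk =>
        rw [sum_range_succ, ihk (by omega), e2 k (by omega)]; ring
    rw [e1, sum_range_succ, e5 n le_rfl, e3, e4]; ring

lemma h_zero : h 0 = 1 := by
  obtain ⟨F, h1, h2⟩ := pd.pieri 0 (fun _ => 0) 0 ⟨antitone_const, fun _ _ => rfl⟩
  have : F = {fun _ => 0} := by
    ext g
    rw [h1, mem_singleton]
    constructor
    · rintro ⟨a, b⟩
      simp at b
      funext i
      cases i with
      | zero => exact b
      | succ i => have := (a i).2; simpa using this
    · rintro rfl; simp [strip]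
  rw [this, pd.nil] at h2; simpa [pd.nil] using h2
end PD
end HS

namespace HS

def rect (a b : ℕ) (i : ℕ) : ℕ := if i < a then b else 0

lemma rect_par (a b : ℕ) : Par a (rect a b) :=
  ⟨fun i j hij => by simp only [rect]; split_ifs <;> omega, fun i hi => by simp only [rect]; rw [if_neg (by omega)]⟩

def ser (h : ℕ → ℕ) : PowerSeries ℝ := PowerSeries.mk fun k => (h k : ℝ)

def fz (f : ℝ[X]) (z : ℤ) : ℝ := if 0 ≤ z then f.coeff z.toNat else 0

lemma convP (h : ℕ → ℕ) (g : ℝ[X]) {d : ℕ} (hd : g.natDegree ≤ d) (z : ℤ) :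
    ∑ i ∈ range (d+1), g.coeff i * Hz h (z - i) =
      if 0 ≤ z then PowerSeries.coeff z.toNat (ser h * (g : PowerSeries ℝ)) else 0 := by
  by_cases hz : 0 ≤ z
  · obtain ⟨k, rfl⟩ := Int.eq_ofNat_of_zero_le hz
    have e1 : PowerSeries.coeff k (ser h * (g : PowerSeries ℝ)) = ∑ i ∈ range (k+1), g.coeff i * h (k - i) := by
      rw [mul_comm, PowerSeries.coeff_mul,
        Finset.Nat.sum_antidiagonal_eq_sum_range_succ_mk]
      simp [ser]
    have e2 : ∀ D, k ≤ D → g.natDegree ≤ D → ∑ i ∈ range (D+1), g.coeff i * Hz h ((k:ℤ) - i) = PowerSeries.coeff k (ser h * (g : PowerSeries ℝ)) := by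
      intro D h1 h2
      rw [e1]
      symm
      rw [← sum_subset (range_mono (show k + 1 ≤ D + 1 by omega))]
      · refine sum_congr rfl fun i hi => ?_
        have := mem_range.1 hi
        rw [Hz, if_pos (by omega), show ((k:ℤ) - i).toNat = k - i by omega]
      · intro i _ hi
        simp only [mem_range, not_lt] at hi
        rw [Hz, if_neg (by omega), mul_zero]
    rw [if_pos hz, Int.toNat_natCast, ← e2 (max k d) (le_max_left _ _) (hd.trans (le_max_right _ _))]
    refine sum_subset (range_mono (by have := le_max_right k d; omega)) ?_
    intro i _ hi
    simp only [mem_range, not_lt] at hi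
    rw [Polynomial.coeff_eq_zero_of_natDegree_lt (by omega), zero_mul]
  · rw [if_neg hz]
    refine sum_eq_zero fun i _ => ?_
    rw [Hz, if_neg (by omega), mul_zero]

lemma conv {h : ℕ → ℕ} {f g : ℝ[X]} (hfg : ser h * (g : PowerSeries ℝ) = f) {d : ℕ} (hd : g.natDegree ≤ d) (z : ℤ) :
    ∑ i ∈ range (d+1), g.coeff i * Hz h (z - i) = fz f z := by
  rw [convP h g hd, hfg]; simp [fz]

namespace PD
variable {N : (ℕ → ℕ) → ℕ} {h : ℕ → ℕ} (pd : PD N h)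
include pd

lemma exists_n : ∃ n b, 1 ≤ b ∧ (∀ f, Par (n+1) f → b ≤ f n → N f = 0) ∧ ∀ f, Par n f → N f ≠ 0 := by
  classical
  have hr : ∀ a f, Par a f → N f = 0 → N (rect a (f 0)) = 0 := fun a f hf h0 =>
    pd.mono a f _ hf (rect_par _ _) (fun i => by
      by_cases hi : i < a
      · simp only [rect, if_pos hi]; exact hf.1 (Nat.zero_le _)
      · rw [hf.2 i (by omega)]; exact Nat.zero_le _) h0
  have hex : ∃ a, ∃ b, N (rect a b) = 0 := by
    obtain ⟨a, f, hf, h0⟩ := pd.zero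
    exact ⟨a, f 0, hr a f hf h0⟩
  have hsp := find_spec hex
  have hmin := fun a (ha : a < find hex) => find_min hex ha
  obtain ⟨b, hb⟩ := hsp
  have ha : find hex ≠ 0 := by
    intro h0
    rw [h0] at hb
    have : rect 0 b = fun _ => 0 := funext fun i => by simp [rect]
    rw [this, pd.nil] at hb; omega
  obtain ⟨n, hn⟩ := Nat.exists_eq_succ_of_ne_zero ha
  rw [hn] at hb hmin
  refine ⟨n, b+1, by omega, fun f hf hbf => ?_, fun f hf h0 => ?_⟩
  · refine pd.mono (n+1) _ f (rect_par (n+1) b) hf (fun i => ?_) hb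
    by_cases hi : i < n + 1
    · simp only [rect, if_pos hi]; have := hf.1 (show i ≤ n by omega); omega
    · simp [rect, hi]
  · exact hmin n (by omega) ⟨f 0, hr n f hf h0⟩

lemma det_rows {n : ℕ} (k : Fin n → ℕ) (hk : StrictAnti k) (c : ℕ) (hkn : ∀ i, n - 1 + c ≤ k i + i) :
    ∃ f, Par n f ∧ (∀ i : Fin n, c ≤ f i) ∧
     det (of fun i j : Fin n => Hz h ((k i : ℤ) - (n - 1 : ℕ) + (j : ℕ))) = N f := by
  have hk1 : ∀ (i : ℕ) (hi : i < n) (j : ℕ) (hj : j < n), i ≤ j → k ⟨j, hj⟩ + j ≤ k ⟨i, hi⟩ + i := by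
    intro i hi j hj hij
    obtain ⟨e, rfl⟩ := exists_eq_add_of_le hij
    induction e with
    | zero => simp
    | succ e ih =>
      have := ih (by omega) (by omega)
      have h2 : k ⟨i+(e+1), hj⟩ < k ⟨i+e, by omega⟩ := hk (by simp [Fin.lt_def])
      omega
  set f : ℕ → ℕ := fun i => if hi : i < n then k ⟨i, hi⟩ + i - (n-1) else 0 with hf
  have hp : Par n f := by
    constructor
    · intro i j hij
      simp only [hf]
      by_cases hj : j < n
      · rw [dif_pos hj, dif_pos (by omega : i < n)]
        have := hk1 i (by omega) j hj hij
        omega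
      · rw [dif_neg hj]; omega
    · intro i hi; simp only [hf]; rw [dif_neg (by omega)]
  refine ⟨f, hp, fun i => ?_, ?_⟩
  · simp only [hf]; rw [dif_pos i.2]; have := hkn i; simp only [Fin.eta]; omega
  · rw [pd.jt n f hp, JT]
    congr 1
    ext i j
    simp only [of_apply]
    congr 1
    have := hkn i
    simp only [hf]; rw [dif_pos i.2]; simp only [Fin.eta]; omega

theorem rational : ∃ (n : ℕ) (f g : ℝ[X]), (∀ f, Par n f → N f ≠ 0) ∧ g.natDegree = n ∧ g.coeff 0 = 1 ∧
    ser h * (g : PowerSeries ℝ) = f ∧ IsCoprime f g := by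
  obtain ⟨n, b, hb, hz, hnz⟩ := pd.exists_n
  let M : (Fin (n+1) → ℝ) → Matrix (Fin (n+1)) (Fin (n+1)) ℝ := fun x =>
    of (Fin.cons x (fun i j => Hz h (((b + (n - 1 - i) : ℕ) : ℤ) - n + (j : ℕ))))
  set c : ℕ → ℝ := fun j => if hj : j < n+1 then (-1)^j * ((M 0).submatrix Fin.succ (Fin.succAbove ⟨j, hj⟩)).det else 0 with hc
  have hM : ∀ x, (M x).det = ∑ j : Fin (n+1), c j * x j := by
    intro x
    rw [Matrix.det_succ_row_zero]
    refine sum_congr rfl fun j _ => ?_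
    simp only [hc]; rw [dif_pos j.2]
    have : (M x).submatrix Fin.succ (Fin.succAbove j) = (M 0).submatrix Fin.succ (Fin.succAbove j) := by
      ext; simp [M]
    rw [this]
    simp [M]; ring
  have hzero : ∀ k : ℕ, b ≤ k → ∑ j : Fin (n+1), c j * Hz h ((k : ℤ) - n + (j:ℕ)) = 0 := by
    intro k hk
    rw [← hM (fun j => Hz h ((k : ℤ) - n + (j:ℕ)))]
    by_cases hkb : b + n ≤ k
    · let kk : Fin (n+1) → ℕ := Fin.cons k (fun i => b + (n - 1 - i))
      have h1 : StrictAnti kk := by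
        intro i j hij
        induction j using Fin.cases with
        | zero => exact absurd hij (Fin.not_lt_zero _)
        | succ j =>
          induction i using Fin.cases with
          | zero => simp [kk]; omega
          | succ i =>
            have := Fin.succ_lt_succ_iff.1 hij
            rw [Fin.lt_def] at this
            simp [kk]; omega
      obtain ⟨f, hf, hfc, hdet⟩ := pd.det_rows kk h1 b (fun i => by
        induction i using Fin.cases with
        | zero => simp [kk]; omega
        | succ i => simp [kk]; omega)
      have h2 := hz f hf (by simpa using hfc (Fin.last n))
      rw [h2] at hdet
      rw [← cast_zero, ← hdet]
      congr 1
      ext i j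
      induction i using Fin.cases with
      | zero => simp [M, kk]
      | succ i => simp [M, kk]
    · have h1 : b + (n - 1 - (n - 1 - (k - b))) = k := by omega
      refine Matrix.det_zero_of_row_eq (i := 0) (j := Fin.succ ⟨n - 1 - (k - b), by omega⟩) (by simp [Fin.ext_iff]) ?_
      funext j
      simp only [M, of_apply, Fin.cons_zero, Fin.cons_succ, h1]
  have hrn : ∀ b' : ℕ, (of fun i j : Fin n => Hz h ((b' : ℤ) - (i:ℕ) + (j:ℕ))).det ≠ 0 := by
    intro b'
    have := pd.jt n _ (rect_par n b')
    have h2 := hnz _ (rect_par n b')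
    rw [JT] at this
    have h3 : (of fun i j : Fin n => Hz h ((b' : ℤ) - (i:ℕ) + (j:ℕ))) =
        (of fun i j : Fin n => Hz h ((rect n b' i : ℤ) - (i:ℕ) + (j:ℕ))) := by
      ext i j; simp [rect]
    rw [h3, ← this]; exact_mod_cast h2
  have hc0 : c 0 ≠ 0 := by
    simp only [hc]; rw [dif_pos (by omega)]
    refine mul_ne_zero (by simp) ?_
    convert hrn b using 2
    ext i j
    simp [M]
    congr 1; omega
  have hcn : c n ≠ 0 := by
    simp only [hc]; rw [dif_pos (by omega)]
    refine mul_ne_zero (by simp) ?_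
    convert hrn (b-1) using 2
    ext i j
    have : Fin.succAbove ⟨n, lt_succ_self n⟩ j = j.castSucc := Fin.succAbove_last_apply j
    simp only [M, submatrix_apply, of_apply, Fin.cons_succ]
    rw [this]
    congr 1; simp; omega
  set g : ℝ[X] := ∑ i ∈ range (n+1), C (c (n-i) / c n) * X ^ i with hg
  have hgc : ∀ i ≤ n, g.coeff i = c (n-i) / c n := by
    intro i hi
    simp only [hg, Polynomial.finset_sum_coeff, Polynomial.coeff_C_mul, Polynomial.coeff_X_pow]
    simp [lt_succ_iff.2 hi]
  have hgd : g.natDegree ≤ n := by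
    refine Polynomial.natDegree_sum_le_of_forall_le _ _ fun i hi => ?_
    exact (Polynomial.natDegree_C_mul_X_pow_le _ _).trans (lt_succ_iff.1 (mem_range.1 hi))
  have hgn : g.natDegree = n := by
    refine le_antisymm hgd (Polynomial.le_natDegree_of_ne_zero ?_)
    rw [hgc n le_rfl]; simpa using ⟨hc0, hcn⟩
  have hg0 : g.coeff 0 = 1 := by rw [hgc 0 (by omega)]; simpa using hcn
  have hP : ∀ k, b ≤ k → PowerSeries.coeff k (ser h * (g : PowerSeries ℝ)) = 0 := by
    intro k hk
    have := convP h g hgd k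
    rw [if_pos (by omega), Int.toNat_natCast] at this
    rw [← this, ← sum_range_reflect]
    have h2 := hzero k hk
    rw [sum_range (n := n+1)]
    rw [← mul_zero (c n)⁻¹, ← h2, mul_sum]
    refine sum_congr rfl fun j _ => ?_
    have hj := j.2
    rw [hgc _ (by omega), show n - (n + 1 - 1 - (j:ℕ)) = j by omega,
      show ((k:ℤ) - ((n + 1 - 1 - (j:ℕ) : ℕ) : ℤ)) = (k:ℤ) - n + (j:ℕ) by omega]
    ring
  set f : ℝ[X] := PowerSeries.trunc b (ser h * (g : PowerSeries ℝ)) with hf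
  have hfg : ser h * (g : PowerSeries ℝ) = f := by
    ext k
    rw [coeff_coe, hf, PowerSeries.coeff_trunc]
    split_ifs with hk
    · rfl
    · exact hP k (by omega)
  refine ⟨n, f, g, hnz, hgn, hg0, hfg, ?_⟩
  have hg00 : g ≠ 0 := fun h0 => by rw [h0] at hg0; simp at hg0
  refine isCoprime_of_irreducible_dvd (fun h0 => hg00 h0.2) ?_
  rintro p hp ⟨f', hf'⟩ ⟨g', hg'⟩
  have hp0 := hp.ne_zero
  have hg'0 : g' ≠ 0 := fun h0 => hg00 (by rw [hg', h0, mul_zero])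
  have hd : g'.natDegree + 1 ≤ n := by
    rw [← hgn, hg', Polynomial.natDegree_mul hp0 hg'0]
    have := hp.natDegree_pos
    omega
  have hfg' : ser h * (g' : PowerSeries ℝ) = f' := by
    have hp1 : (p : PowerSeries ℝ) ≠ 0 := by simpa using hp0
    apply mul_left_cancel₀ hp1
    rw [mul_left_comm, ← coe_mul, ← coe_mul, ← hg', ← hf', hfg]
  refine hrn (f'.natDegree + 1) (exists_mulVec_eq_zero_iff.1 ⟨fun j => g'.coeff (n - 1 - j), ?_, ?_⟩)
  · intro h0
    have := congrFun h0 ⟨n - 1 - g'.natDegree, by omega⟩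
    simp only [Pi.zero_apply] at this
    rw [show n - 1 - (n - 1 - g'.natDegree) = g'.natDegree by omega] at this
    exact hg'0 (Polynomial.leadingCoeff_eq_zero.1 this)
  · funext i
    have hi := i.2
    have := conv hfg' (d := n - 1) (by omega) (((f'.natDegree + 1 : ℕ) : ℤ) - (i:ℕ) + (n-1 : ℕ))
    rw [fz, if_pos (by omega), Polynomial.coeff_eq_zero_of_natDegree_lt (by omega), show n - 1 + 1 = n by omega,
      ← sum_range_reflect, sum_range] at this
    simp only [mulVec, dotProduct, of_apply, Pi.zero_apply]
    rw [← this]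
    refine sum_congr rfl fun j _ => ?_
    have hj := j.2
    rw [mul_comm]
    congr 2
    omega
end PD
end HS

namespace HS

lemma re_sq (u : ℂ) (hu : ‖u‖ = 1) : (u^2).re = 2 * u.re^2 - 1 := by
  have h1 : u.re^2 + u.im^2 = 1 := by
    have := Complex.sq_norm u; rw [hu, Complex.normSq_apply] at this; nlinarith
  rw [sq, Complex.mul_re]; nlinarith

lemma re_neg (u : ℂ) (hu : ‖u‖ = 1) (h1 : u ≠ 1) : ∃ k, (u^k).re < 0 := by
  by_contra hc
  push Not at hc
  have hre : u.re < 1 := by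
    have h2 : u.re ≤ 1 := by rw [← hu]; exact Complex.re_le_norm u
    refine lt_of_le_of_ne h2 fun h3 => h1 ?_
    have := Complex.sq_norm u; rw [hu, Complex.normSq_apply, h3] at this
    apply Complex.ext
    · simpa using h3
    · have : u.im * u.im = 0 := by linarith
      simpa using this
  have key : ∀ j, 2^j * (1 - u.re) ≤ 1 - (u^(2^j)).re := by
    intro j
    induction j with
    | zero => simp
    | succ j ih =>
      rw [pow_succ (2:ℕ), pow_mul, re_sq _ (by rw [norm_pow, hu, one_pow]), pow_succ]
      have h2 := hc (2^j)
      have h3 : (u^(2^j)).re ≤ 1 := by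
        have := Complex.re_le_norm (u^(2^j)); rwa [norm_pow, hu, one_pow] at this
      nlinarith
  obtain ⟨j, hj⟩ := pow_unbounded_of_one_lt (1 / (1 - u.re)) (show (1:ℝ) < 2 by norm_num)
  have h2 := key j
  have h3 := hc (2^j)
  rw [div_lt_iff₀ (by linarith)] at hj
  linarith

lemma re_pos (u : ℂ) (hu : ‖u‖ = 1) : ∃ k, 1 ≤ k ∧ 0 < (u^k).re := by
  have h2 := re_sq u hu
  have h4 := re_sq (u^2) (by rw [norm_pow, hu, one_pow])
  have h1 : u.re^2 + u.im^2 = 1 := by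
    have := Complex.sq_norm u; rw [hu, Complex.normSq_apply] at this; nlinarith
  by_cases a : 0 < (u^2).re
  · exact ⟨2, by norm_num, a⟩
  by_cases b : 0 < (u^4).re
  · exact ⟨4, by norm_num, b⟩
  by_cases c : 0 < u.re
  · exact ⟨1, by norm_num, by simpa using c⟩
  refine ⟨3, by norm_num, ?_⟩
  have h3 : (u^3).re = 4 * u.re^3 - 3 * u.re := by
    have : u^3 = u^2 * u := by ring
    have h5 : (u^2).im = 2 * u.re * u.im := by rw [sq, Complex.mul_im]; ring
    rw [this, Complex.mul_re, h2, h5]; nlinarith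
  rw [h3]
  rw [← pow_mul, h2] at h4
  rw [h2] at a
  norm_num at h4
  rw [h4] at b
  push Not at a b c
  rcases c.eq_or_lt with c | c
  · rw [c] at b; norm_num at b
  · nlinarith [mul_pos_of_neg_of_neg c c]

lemma re_osc (z : ℂ) (hz : z ≠ 0) (hz' : ¬ (0 < z.re ∧ z.im = 0)) (M : ℕ) :
    (∃ k, M ≤ k ∧ 0 < (z^k).re) ∧ ∃ k, M ≤ k ∧ (z^k).re < 0 := by
  have hn : 0 < ‖z‖ := norm_pos_iff.2 hz
  set u : ℂ := z / ‖z‖ with hu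
  have hu1 : ‖u‖ = 1 := by rw [hu, norm_div]; simp [hz]
  have hzu : z = (‖z‖ : ℂ) * u := by rw [hu, mul_div_cancel₀]; exact_mod_cast hn.ne'
  have hre : ∀ k, (z^k).re = ‖z‖^k * (u^k).re := fun k => by
    conv_lhs => rw [hzu, mul_pow, ← Complex.ofReal_pow]
    rw [Complex.re_ofReal_mul]
  have hune : u ≠ 1 := fun h => hz' (by
    rw [h, mul_one] at hzu
    rw [hzu]; simpa using hn)
  constructor
  · obtain ⟨k, h1, h2⟩ := re_pos (u^M) (by rw [norm_pow, hu1, one_pow])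
    refine ⟨M * k, le_mul_of_pos_right _ h1, ?_⟩
    rw [hre, pow_mul u]; positivity
  · have : ∃ j, M ≤ j ∧ u ^ j ≠ 1 := by
      by_contra hc
      push Not at hc
      have h1 := hc M le_rfl
      have h2 := hc (M+1) (by omega)
      rw [pow_succ, h1, one_mul] at h2
      exact hune h2
    obtain ⟨j, h1, h2⟩ := this
    obtain ⟨k, h3⟩ := re_neg (u^j) (by rw [norm_pow, hu1, one_pow]) h2
    have hk : k ≠ 0 := by rintro rfl; norm_num at h3
    refine ⟨j * k, h1.trans (le_mul_of_pos_right _ (by omega)), ?_⟩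
    rw [hre, pow_mul u]
    exact mul_neg_of_pos_of_neg (by positivity) h3

lemma alt_seq (c : ℕ → ℝ) (hp : ∀ M, ∃ k, M ≤ k ∧ 0 < c k) (hn : ∀ M, ∃ k, M ≤ k ∧ c k < 0) (M : ℕ) :
    ∃ κ : ℕ → ℕ, StrictMono κ ∧ (∀ j, M ≤ κ j) ∧ ∀ j, 0 < (-1)^j * c (κ j) := by
  have h : ∀ j M : ℕ, ∃ k, M ≤ k ∧ 0 < (-1)^j * c k := by
    intro j M
    rcases neg_one_pow_eq_or ℝ j with h | h
    · rw [h]; simpa using hp M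
    · rw [h]; simpa using hn M
  choose p h1 h2 using h
  let κ : ℕ → ℕ := Nat.rec (p 0 M) (fun j x => p (j+1) (x+1))
  have hm : StrictMono κ := strictMono_nat_of_lt_succ fun j => h1 (j+1) (κ j + 1)
  refine ⟨κ, hm, fun j => (h1 0 M).trans (hm.monotone (Nat.zero_le j)), fun j => ?_⟩
  cases j with
  | zero => exact h2 0 M
  | succ j => exact h2 (j+1) _

lemma split_pos (n : ℕ) : ∀ g : ℝ[X], g.natDegree = n → g.coeff 0 = 1 →
    (∀ a : ℂ, Polynomial.aeval a g = 0 → 0 < a.re ∧ a.im = 0) →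
    ∃ y : Fin n → ℝ, (∀ j, 0 < y j) ∧ g = ∏ j, (1 - C (y j) * X) := by
  induction n with
  | zero =>
    intro g hg h0 _
    refine ⟨Fin.elim0, fun j => j.elim0, ?_⟩
    rw [Polynomial.eq_C_of_natDegree_eq_zero hg, h0]; simp
  | succ n ih =>
    intro g hg h0 hr
    obtain ⟨a, ha⟩ := IsAlgClosed.exists_aeval_eq_zero ℂ g (by
      rw [Polynomial.degree_eq_natDegree (by rintro rfl; simp at h0), hg]; exact_mod_cast succ_ne_zero n)
    obtain ⟨ha1, ha2⟩ := hr a ha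
    set r := a.re with hrr
    have har : a = (r : ℂ) := Complex.ext (by simp [hrr]) (by simp [ha2])
    have hroot : g.eval r = 0 := by
      rw [har, show (r : ℂ) = algebraMap ℝ ℂ r from rfl, Polynomial.aeval_algebraMap_apply] at ha
      simpa using ha
    obtain ⟨g', hg'⟩ := Polynomial.dvd_iff_isRoot.2 hroot
    have hfac : g = (1 - C r⁻¹ * X) * (C (-r) * g') := by
      rw [hg']
      have : (C r : ℝ[X]) * C r⁻¹ = 1 := by rw [← C_mul, mul_inv_cancel₀ ha1.ne', C_1]
      rw [C_neg]
      linear_combination (-X * g') * this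
    set G := C (-r) * g' with hG
    have hne : g ≠ 0 := by rintro rfl; simp at h0
    have hG0 : G ≠ 0 := by intro h; rw [h, mul_zero] at hfac; exact hne hfac
    have hdeg1 : (1 - C r⁻¹ * X : ℝ[X]).natDegree = 1 := by
      rw [show (1 - C r⁻¹ * X : ℝ[X]) = C (-r⁻¹) * X + C 1 by simp; ring]
      exact Polynomial.natDegree_linear (by simpa using ha1.ne')
    obtain ⟨y, hy, hy'⟩ := ih G (by
        have h1 : (1 - C r⁻¹ * X : ℝ[X]) ≠ 0 := by intro h; rw [h] at hdeg1; simp at hdeg1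
        have := Polynomial.natDegree_mul h1 hG0
        rw [← hfac, hg, hdeg1] at this; omega)
      (by rw [hfac, mul_coeff_zero] at h0; simpa using h0)
      (fun b hb => hr b (by rw [hfac, map_mul, hb, mul_zero]))
    refine ⟨Fin.cons r⁻¹ y, fun j => ?_, ?_⟩
    · induction j using Fin.cases with
      | zero => simpa using ha1
      | succ j => simpa using hy j
    · rw [Fin.prod_univ_succ]; simp only [Fin.cons_zero, Fin.cons_succ, ← hy']; exact hfac

namespace PD
variable {N : (ℕ → ℕ) → ℕ} {h : ℕ → ℕ} (pd : PD N h)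
include pd

lemma positive {n : ℕ} {f g : ℝ[X]} (hnz : ∀ f, Par n f → N f ≠ 0) (hgn : g.natDegree = n) (hg0 : g.coeff 0 = 1)
    (hfg : ser h * (g : PowerSeries ℝ) = f) :
    ∃ y : Fin n → ℝ, (∀ j, 0 < y j) ∧ g = ∏ j, (1 - C (y j) * X) := by
  refine split_pos n g hgn hg0 fun a ha => ?_
  by_contra hc
  have ha0 : a ≠ 0 := by
    rintro rfl
    rw [← Polynomial.coeff_zero_eq_aeval_zero', hg0] at ha; simp at ha
  set z := a⁻¹ with hz
  have hz0 : z ≠ 0 := inv_ne_zero ha0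
  have hzc : ¬ (0 < z.re ∧ z.im = 0) := by
    rintro ⟨h1, h2⟩
    apply hc
    have : a = ((z.re)⁻¹ : ℝ) := by
      rw [← inv_inv a, ← hz]
      conv_lhs => rw [show z = (z.re : ℂ) from Complex.ext (by simp) (by simp [h2])]
      simp
    rw [this]; simpa using h1
  set c : ℕ → ℝ := fun k => (z^k).re with hcdef
  have hrec : ∀ k, n ≤ k → ∑ i ∈ range (n+1), g.coeff i * c (k - i) = 0 := by
    intro k hk
    have h1 : ∑ i ∈ range (n+1), (g.coeff i : ℂ) * z^(k-i) = 0 := by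
      rw [Polynomial.aeval_eq_sum_range, hgn] at ha
      rw [← mul_zero (z^k), ← ha, mul_sum]
      refine sum_congr rfl fun i hi => ?_
      have hi := mem_range.1 hi
      rw [Complex.real_smul, show z ^ k = z^(k-i) * z^i by rw [← pow_add]; congr 1; omega]
      have hza : z^i * a^i = 1 := by rw [← mul_pow, hz, inv_mul_cancel₀ ha0, one_pow]
      linear_combination (-(g.coeff i : ℂ) * z^(k-i)) * hza
    have h2 := congrArg Complex.re h1
    simpa [Complex.re_sum, Complex.re_ofReal_mul] using h2
  have hrecH : ∀ k : ℕ, f.natDegree < k → ∀ j : ℕ, ∑ i ∈ range (n+1), g.coeff i * Hz h ((k:ℤ) - i + j) = 0 := by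
    intro k hk j
    have := conv hfg hgn.le ((k:ℤ) + j)
    rw [fz, if_pos (by omega), Polynomial.coeff_eq_zero_of_natDegree_lt (by omega)] at this
    rw [← this]
    refine sum_congr rfl fun i _ => ?_
    congr 2; ring
  set Kb := f.natDegree + n + 1 with hK
  let A : Matrix (Fin n) (Fin n) ℝ := of fun i j => Hz h (((Kb + (n - 1 - i) : ℕ) : ℤ) - (n-1 : ℕ) + (j : ℕ))
  have hA : IsUnit A.det := by
    obtain ⟨la, h1, -, h2⟩ := pd.det_rows (fun i : Fin n => Kb + (n - 1 - i)) (fun i j hij => by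
      rw [Fin.lt_def] at hij; have := j.2; simp only []; omega) 0 (fun i => by have := i.2; omega)
    rw [isUnit_iff_ne_zero]
    show det _ ≠ 0
    rw [h2]; exact_mod_cast hnz _ h1
  obtain ⟨w, hw⟩ : ∃ w : Fin n → ℝ, A.mulVec w = fun i : Fin n => c (Kb + (n - 1 - i)) :=
    ⟨A⁻¹.mulVec fun i : Fin n => c (Kb + (n - 1 - i)), by rw [Matrix.mulVec_mulVec, Matrix.mul_nonsing_inv _ hA, Matrix.one_mulVec]⟩
  have hcw : ∀ k, Kb ≤ k → c k = ∑ j : Fin n, Hz h ((k:ℤ) - (n-1:ℕ) + (j:ℕ)) * w j := by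
    intro k
    induction k using strong_induction_on with
    | _ k ih =>
      intro hk
      by_cases hkn : k < Kb + n
      · have := congrFun hw ⟨n - 1 - (k - Kb), by omega⟩
        simp only [mulVec, dotProduct, A, of_apply, show Kb + (n - 1 - (n - 1 - (k - Kb))) = k by omega] at this
        exact this.symm
      · have h1 := hrec k (by omega)
        have h2 : ∑ i ∈ range (n+1), g.coeff i * ∑ j : Fin n, Hz h (((k-i:ℕ):ℤ) - (n-1:ℕ) + (j:ℕ)) * w j = 0 := by
          simp only [mul_sum]
          rw [sum_comm]
          refine sum_eq_zero fun j _ => ?_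
          have := hrecH (k - (n-1)) (by omega) j
          rw [← zero_mul (w j), ← this, sum_mul]
          refine sum_congr rfl fun i hi => ?_
          have := mem_range.1 hi
          rw [← mul_assoc]; congr 3; omega
        rw [sum_range_succ'] at h1 h2
        rw [sum_congr rfl (fun i hi => by
          rw [ih (k - (i+1)) (by omega) (by have := mem_range.1 hi; omega)])] at h1
        simp only [hg0, one_mul, Nat.sub_zero] at h1 h2
        linarith
  have hosc := re_osc z hz0 hzc
  obtain ⟨κ, hκ, hκK, hκs⟩ := alt_seq c (fun M => (hosc M).1) (fun M => (hosc M).2) (Kb + n)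
  let D : Matrix (Fin (n+1)) (Fin (n+1)) ℝ := of fun i => Fin.cons (c (κ (n - i)))
    (fun j : Fin n => Hz h ((κ (n-i) : ℤ) - (n-1:ℕ) + (j:ℕ)))
  have hD0 : D.det = 0 := by
    apply exists_mulVec_eq_zero_iff.1
    refine ⟨Fin.cons (-1) w, fun h0 => by have := congrFun h0 0; simp at this, ?_⟩
    funext i
    simp only [mulVec, dotProduct, Fin.sum_univ_succ, D, of_apply, Fin.cons_zero, Fin.cons_succ]
    rw [hcw _ (by have := hκK (n-i); omega)]; simp
  rw [det_succ_column_zero] at hD0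
  have hterm : ∀ i : Fin (n+1), ∃ x : ℝ, 0 < x ∧ (D.submatrix i.succAbove Fin.succ).det = x := by
    intro i
    obtain ⟨la, h1, -, h2⟩ := pd.det_rows (fun r : Fin n => κ (n - (i.succAbove r : ℕ))) (fun r s hrs => by
      apply hκ
      have h3 := (Fin.strictMono_succAbove i) hrs
      rw [Fin.lt_def] at h3
      have := (i.succAbove s).2
      omega) 0 (fun r => by have := hκK (n - (i.succAbove r : ℕ)); omega)
    refine ⟨N la, by exact_mod_cast Nat.pos_of_ne_zero (hnz _ h1), ?_⟩
    rw [← h2]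
    congr 1
  choose x hx hx' using hterm
  have hsum : 0 < ∑ i : Fin (n+1), (-1)^n * ((-1)^(i:ℕ) * D i 0 * (D.submatrix i.succAbove Fin.succ).det) := by
    refine Finset.sum_pos (fun i _ => ?_) Finset.univ_nonempty
    rw [hx']
    have h3 := hκs (n - i)
    have h4 : D i 0 = c (κ (n-i)) := by simp [D]
    rw [h4]
    have h5 : ((-1:ℝ))^n * (-1)^(i:ℕ) = (-1)^(n-i) := by
      have hi := i.2
      have h6 : ((-1:ℝ))^n = (-1)^(n-i) * (-1)^(i:ℕ) := by rw [← pow_add]; congr 1; omega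
      rw [h6, mul_assoc, ← pow_add, ← two_mul (i:ℕ), pow_mul]; simp
    have := mul_pos h3 (hx i)
    rw [← h5] at this
    linarith
  rw [← mul_sum, hD0, mul_zero] at hsum
  exact lt_irrefl _ hsum
end PD
end HS

namespace HS

def colf (j : ℕ) (i : ℕ) : ℕ := if i < j then 1 else 0
def hook (a b : ℕ) (i : ℕ) : ℕ := if i = 0 then a else if i ≤ b then 1 else 0
def restr (n : ℕ) (f : ℕ → ℕ) (i : ℕ) : ℕ := if i < n then f i else 0

lemma restr_par {n : ℕ} {f : ℕ → ℕ} (hf : Antitone f) : Par n (restr n f) :=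
  ⟨fun i j hij => by have := hf hij; simp only [restr]; split_ifs <;> omega, fun i hi => by simp only [restr]; rw [if_neg (by omega)]⟩

namespace PD
variable {N : (ℕ → ℕ) → ℕ} {h : ℕ → ℕ} (pd : PD N h)
include pd

lemma fac {n s : ℕ} {f g : ℝ[X]} (hgn : g.natDegree = n) (hg0 : g.coeff 0 = 1)
    (hfg : ser h * (g : PowerSeries ℝ) = f) {l : ℕ → ℕ} (hl : Par (n+s) l) (hm : ∀ i < n, f.natDegree ≤ l i) :
    (N l : ℝ) = N (restr n l) * (of fun i j : Fin s => fz f ((l (n+i) : ℤ) - (i:ℕ) + (j:ℕ))).det := by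
  rw [pd.jt _ l hl, pd.jt _ _ (restr_par hl.1)]
  let gz : ℕ → ℕ → ℝ := fun k J => if k ≤ J then g.coeff (J - k) else 0
  let A : Matrix (Fin n ⊕ Fin s) (Fin n ⊕ Fin s) ℝ := of fun x y =>
    Hz h ((l (finSumFinEquiv x : ℕ) : ℤ) - (finSumFinEquiv x : ℕ) + (finSumFinEquiv y : ℕ))
  let U : Matrix (Fin n ⊕ Fin s) (Fin n ⊕ Fin s) ℝ := fromBlocks 1
    (of fun i j => gz i (n+j)) 0 (of fun i j => gz (n+i) (n+j))
  have hU : U.det = 1 := by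
    rw [Matrix.det_fromBlocks_zero₂₁, Matrix.det_one, one_mul, Matrix.det_of_upperTriangular]
    · refine Finset.prod_eq_one fun i _ => ?_
      simp [gz, hg0]
    · intro i j hij
      have : (j:ℕ) < i := hij
      simp only [of_apply, gz]; rw [if_neg (by omega)]
  have hJ : JT h (n+s) l = A.det := by
    rw [JT, ← Matrix.det_submatrix_equiv_self (finSumFinEquiv (m := n) (n := s))]
    congr 1
  have hcol : ∀ x (j : Fin s), (A * U) x (Sum.inr j) =
      fz f ((l (finSumFinEquiv x : ℕ) : ℤ) - (finSumFinEquiv x : ℕ) + (n + j : ℕ)) := by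
    intro x j
    have e1 := conv hfg (d := n + j) (by omega) ((l (finSumFinEquiv x : ℕ) : ℤ) - (finSumFinEquiv x : ℕ) + (n + j : ℕ))
    rw [← e1, Matrix.mul_apply]
    set z := ((l (finSumFinEquiv x : ℕ) : ℤ) - (finSumFinEquiv x : ℕ)) with hz
    have e2 : ∑ y, A x y * U y (Sum.inr j) = ∑ k ∈ range (n+s), Hz h (z + k) * gz k (n+j) := by
      rw [sum_range, ← Equiv.sum_comp (finSumFinEquiv (m := n) (n := s))]
      refine sum_congr rfl fun y _ => ?_
      rcases y with y | y <;> simp [A, U, hz]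
    rw [e2]
    conv_rhs => rw [← sum_range_reflect]
    have hj := j.2
    rw [← sum_subset (range_mono (show n + j + 1 ≤ n + s by omega))]
    · refine sum_congr rfl fun k hk => ?_
      have hk := mem_range.1 hk
      simp only [gz]
      rw [if_pos (by omega), mul_comm, show n + (j:ℕ) + 1 - 1 - k = n + j - k by omega]
      congr 2; omega
    · intro k _ hk
      simp only [mem_range, not_lt] at hk
      simp only [gz]; rw [if_neg (by omega), mul_zero]
  have hAU : A * U = fromBlocks (of fun i j : Fin n => Hz h ((l i : ℤ) - (i:ℕ) + (j:ℕ))) 0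
      (of fun (i : Fin s) (j : Fin n) => Hz h ((l (n+i) : ℤ) - (n+i:ℕ) + (j:ℕ)))
      (of fun i j : Fin s => fz f ((l (n+i) : ℤ) - (i:ℕ) + (j:ℕ))) := by
    ext x y
    rcases y with y | y
    · have : (A * U) x (Sum.inl y) = A x (Sum.inl y) := by
        rw [Matrix.mul_apply, Fintype.sum_sum_type]
        simp [U, Matrix.one_apply]
      rw [this]
      rcases x with x | x <;> simp [A]
    · rw [hcol]
      rcases x with x | x
      · have := hm x x.2
        have hx := x.2
        simp [fz]
        intro _
        exact Polynomial.coeff_eq_zero_of_natDegree_lt (by omega)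
      · simp; congr 1; ring
  have := congrArg det hAU
  rw [Matrix.det_mul, hU, mul_one, Matrix.det_fromBlocks_zero₁₂] at this
  rw [hJ, this, JT]
  congr 2
  ext i j
  simp [restr]

lemma hook_pieri (k j : ℕ) : (h k : ℝ) * N (colf j) =
    (if 1 ≤ j then (N (hook (k+1) (j-1)) : ℝ) else 0) + (if 1 ≤ k + j ∧ 1 ≤ k then (N (hook k j) : ℝ) else 0)
      + if k + j = 0 then 1 else 0 := by
  classical
  obtain ⟨F, h1, h2⟩ := pd.pieri j (colf j) k ⟨fun a b hab => by simp only [colf]; split_ifs <;> omega,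
    fun i hi => by simp only [colf]; rw [if_neg (by omega)]⟩
  have hcs : ∑ i ∈ range j, colf j i = j := by
    rw [sum_congr rfl (g := fun _ => 1) (fun i hi => by simp [colf, mem_range.1 hi])]; simp
  rw [hcs] at h1
  have h3 : (h k : ℝ) * N (colf j) = ∑ g ∈ F, (N g : ℝ) := by exact_mod_cast h2
  rw [h3]
  rcases j with _ | j
  · have : F = {hook k 0} := by
      ext g
      rw [h1, mem_singleton]
      constructor
      · rintro ⟨a, b⟩
        funext i
        cases i with
        | zero => simpa [hook] using b
        | succ i => have := (a i).2; simpa [hook, colf] using this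
      · rintro rfl
        exact ⟨fun i => by simp [colf, hook], by simp [hook]⟩
    rw [this, sum_singleton]
    rcases k with _ | k
    · have : hook 0 0 = fun _ => 0 := by funext i; simp only [hook]; split_ifs <;> omega
      simp [this, pd.nil]
    · simp
  · have hsum : ∀ g : ℕ → ℕ, (∀ i < j, g (i+1) = 1) → ∑ i ∈ range (j+1+1), g i = g 0 + j + g (j+1) := by
      intro g hg
      rw [sum_range_succ, sum_range_succ', sum_congr rfl (fun i hi => hg i (mem_range.1 hi))]
      simp; omega
    have hmem : ∀ g, g ∈ F ↔ g = hook (k+1) j ∨ (1 ≤ k ∧ g = hook k (j+1)) := by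
      intro g
      rw [h1]
      constructor
      · rintro ⟨a, b⟩
        have hg1 : ∀ i < j, g (i+1) = 1 := fun i hi => by
          have a1 := (a i).2
          have a2 := (a (i+1)).1
          simp only [colf] at a1 a2
          rw [if_pos (by omega)] at a1 a2; omega
        have hg2 : g (j+1) ≤ 1 := by have := (a j).2; simpa [colf] using this
        have hg3 : ∀ i, j + 1 < i → g i = 0 := fun i hi => by
          have := (a (i-1)).2
          simp only [colf] at this
          rw [if_neg (by omega), show i - 1 + 1 = i by omega] at this; omega
        have hg4 : 1 ≤ g 0 := by have := (a 0).1; simpa [colf] using this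
        rw [hsum g hg1] at b
        have hgen : ∀ J, J = j + g (j+1) → ∀ i, g i = hook (g 0) J i := by
          intro J hJ i
          rcases i with _ | i
          · simp [hook]
          · have e : hook (g 0) J (i+1) = if i + 1 ≤ J then 1 else 0 := by simp [hook]
            rw [e]
            rcases Nat.lt_trichotomy i j with hi | rfl | hi
            · rw [hg1 i hi, if_pos (by omega)]
            · split_ifs <;> omega
            · rw [hg3 _ (by omega), if_neg (by omega)]
        by_cases hg0 : g (j+1) = 0
        · left; funext i; rw [hgen j (by omega), show g 0 = k + 1 by omega]
        · right; refine ⟨by omega, ?_⟩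
          funext i; rw [hgen (j+1) (by omega), show g 0 = k by omega]
      · rintro (rfl | ⟨hk, rfl⟩)
        · refine ⟨fun i => ?_, ?_⟩
          · rcases i with _ | i
            · simp [colf, hook]; try (split_ifs <;> omega)
            try omega
            · simp only [colf, hook, succ_ne_zero, if_false]
              constructor <;> split_ifs <;> omega
          · rw [hsum _ (fun i hi => by simp [hook]; omega)]; simp [hook]; omega
        · refine ⟨fun i => ?_, ?_⟩
          · rcases i with _ | i
            · simp [colf, hook]; try omega
            · simp only [colf, hook, succ_ne_zero, if_false]
              constructor <;> split_ifs <;> omega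
          · rw [hsum _ (fun i hi => by simp [hook]; omega)]; simp [hook]; omega
    by_cases hk : 1 ≤ k
    · have : F = {hook (k+1) j, hook k (j+1)} := by
        ext g; rw [hmem]; simp [hk]
      rw [this, sum_pair]
      · simp [hk]
      · intro e; have := congrFun e 0; simp [hook] at this
    · have : F = {hook (k+1) j} := by
        ext g; rw [hmem]; simp [hk]
      rw [this, sum_singleton]; simp [hk]

lemma koszul : ser h * PowerSeries.rescale (-1) (ser fun j => N (colf j)) = 1 := by
  ext K
  rw [mul_comm, PowerSeries.coeff_mul, Finset.Nat.sum_antidiagonal_eq_sum_range_succ_mk, PowerSeries.coeff_one]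
  simp only [ser, PowerSeries.coeff_rescale, PowerSeries.coeff_mk]
  have e1 : ∀ j ∈ range (K+1), (-1:ℝ)^j * (N (colf j) : ℝ) * h (K-j) = (-1)^j * (
    (if 1 ≤ j then (N (hook (K-j+1) (j-1)) : ℝ) else 0) + (if 1 ≤ K-j then (N (hook (K-j) j) : ℝ) else 0)
      + if K = 0 then 1 else 0) := by
    intro j hj
    have hj := mem_range.1 hj
    rw [mul_assoc, mul_comm (N _ : ℝ), pd.hook_pieri]
    congr 3
    · have : (1 ≤ K - j + j ∧ 1 ≤ K - j) ↔ 1 ≤ K - j := by omega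
      simp only [this]
    · have : K - j + j = K := by omega
      rw [this]
  rw [sum_congr rfl e1]
  rcases K with _ | K
  · simp
  · have : ∀ k ≤ K+1, ∑ j ∈ range k, (-1:ℝ)^j * (
    (if 1 ≤ j then (N (hook (K+1-j+1) (j-1)) : ℝ) else 0) + (if 1 ≤ K+1-j then (N (hook (K+1-j) j) : ℝ) else 0)
      + if K+1 = 0 then 1 else 0) = if k = 0 then (0:ℝ) else (-1:ℝ)^(k-1) * N (hook (K+1-(k-1)) (k-1)) := by
      intro k hk
      induction k with
      | zero => simp
      | succ k ih =>
        rw [sum_range_succ, ih (by omega)]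
        rcases k with _ | k
        · simp
        · simp only [succ_ne_zero, if_false, Nat.add_sub_cancel]
          rw [if_pos (by omega), if_pos (by omega), show K + 1 - (k+1) + 1 = K + 1 - k by omega, pow_succ]; ring
    rw [sum_range_succ, this _ le_rfl]
    simp [pow_succ]
end PD

lemma eq_of_cop {f g a b : ℝ[X]} (h1 : IsCoprime f g) (h2 : IsCoprime a b) (h : f * a = g * b)
    (hf : f.coeff 0 = 1) (hb : b.coeff 0 = 1) : f = b := by
  have d1 : f ∣ b := h1.dvd_of_dvd_mul_left (h ▸ dvd_mul_right f a)
  have d2 : b ∣ f := h2.symm.dvd_of_dvd_mul_right (h ▸ dvd_mul_left b g)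
  obtain ⟨u, hu⟩ := associated_of_dvd_dvd d1 d2
  obtain ⟨r, hr, hru⟩ := Polynomial.isUnit_iff.1 u.isUnit
  rw [← hru] at hu
  have : r = 1 := by rw [← hu, mul_coeff_zero, hf] at hb; simpa using hb
  rw [← hu, this]; simp

theorem PD.poly {N N' : (ℕ → ℕ) → ℕ} {h h' : ℕ → ℕ} (pd : PD N h) (pd' : PD N' h') (hh : ∀ j, h' j = N (colf j)) :
    ∃ (m n : ℕ) (x : Fin m → ℝ) (y : Fin n → ℝ) (f g : ℝ[X]), (∀ i, 0 < x i) ∧ (∀ j, 0 < y j) ∧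
      f = ∏ i, (1 + C (x i) * X) ∧ g = ∏ j, (1 - C (y j) * X) ∧ f.natDegree = m ∧ g.natDegree = n ∧
      ser h * (g : PowerSeries ℝ) = f ∧ IsCoprime f g ∧ (∀ l, Par n l → N l ≠ 0) ∧ f.coeff 0 = 1 ∧ g.coeff 0 = 1 := by
  obtain ⟨n, f, g, hnz, hgn, hg0, hfg, hcop⟩ := pd.rational
  obtain ⟨m, f', g', hnz', hgn', hg0', hfg', hcop'⟩ := pd'.rational
  obtain ⟨y, hy, hyg⟩ := pd.positive hnz hgn hg0 hfg
  obtain ⟨x, hx, hxg⟩ := pd'.positive hnz' hgn' hg0' hfg'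
  have hf0 : f.coeff 0 = 1 := by
    rw [← coeff_coe, ← hfg, PowerSeries.coeff_mul, Finset.Nat.antidiagonal_zero, sum_singleton,
      coeff_coe, hg0]
    simp [ser, pd.h_zero]
  have hcc : ∀ (p : ℝ[X]) k, (p.comp (-X)).coeff k = (-1)^k * p.coeff k := fun p k => by
    rw [show (-X : ℝ[X]) = C (-1) * X by simp, Polynomial.comp_C_mul_X_coeff, mul_comm]
  have hcoe : ∀ p : ℝ[X], ((p.comp (-X) : ℝ[X]) : PowerSeries ℝ) = PowerSeries.rescale (-1) (p : PowerSeries ℝ) := by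
    intro p
    ext k
    rw [coeff_coe, PowerSeries.coeff_rescale, coeff_coe, hcc]
  have hk := pd.koszul
  have hser : (ser fun j => N (colf j)) = ser h' := by congr 1; funext j; rw [hh]
  rw [hser] at hk
  have e1 : f * f'.comp (-X) = g * g'.comp (-X) := by
    apply coe_injective ℝ
    rw [coe_mul, coe_mul, hcoe, hcoe, ← hfg, ← hfg', map_mul]
    linear_combination ((g : PowerSeries ℝ) * PowerSeries.rescale (-1) (g' : PowerSeries ℝ)) * hk
  have hfe : f = g'.comp (-X) := by
    refine eq_of_cop hcop ?_ e1 hf0 ?_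
    · have := hcop'.map (Polynomial.compRingHom (-X : ℝ[X]))
      simpa using this
    · rw [hcc, hg0']; simp
  refine ⟨m, n, x, y, f, g, hx, hy, ?_, hyg, ?_, hgn, hfg, hcop, hnz, hf0, hg0⟩
  · rw [hfe, hxg, Polynomial.prod_comp]
    refine prod_congr rfl fun i _ => ?_
    simp
  · rw [hfe, Polynomial.natDegree_comp]; simp [hgn']
end HS

namespace HS
variable {K A ι : Type} [Field K] [Ring A] [Algebra K A] [Fintype ι] [DecidableEq ι]

structure Leav {A ι : Type} [Fintype ι] [DecidableEq ι] [Ring A] (s s' : ι → A) : Prop where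
  orth : ∀ a b, s' a * s b = if a = b then 1 else 0
  sum : ∑ a, s a * s' a = 1

namespace Leav
variable {s s' : ι → A} (lv : Leav s s')

lemma exp_eq (lv : Leav s s') {x y : A} (h : ∀ a b, s' a * x * s b = s' a * y * s b) : x = y := by
  have e : ∀ x, x = ∑ a, ∑ b, s a * (s' a * x * s b) * s' b := fun x => by
    have : ∀ a, ∑ b, s a * (s' a * x * s b) * s' b = s a * s' a * x := fun a => by
      simp only [mul_assoc, ← mul_sum]
      rw [lv.sum, mul_one]
    simp only [this]
    rw [← sum_mul, lv.sum, one_mul]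
  rw [e x, e y]; simp only [h]

def sig (K : Type) [Field K] [Algebra K A] (lv : Leav s s') : A →ₐ[K] A :=
  AlgHom.ofLinearMap (∑ a, mulLeftRight K (s a, s' a)) (by simp [lv.sum]) (fun x y => by
    simp only [LinearMap.sum_apply, mulLeftRight_apply]
    rw [sum_mul_sum]
    refine sum_congr rfl fun a _ => ?_
    rw [sum_eq_single a]
    · have := lv.orth a a
      rw [if_pos rfl] at this
      simp only [mul_assoc]; rw [← mul_assoc (s' a) (s a), this, one_mul]
    · intro b _ hb
      simp only [mul_assoc]; rw [← mul_assoc (s' a) (s b), lv.orth, if_neg hb.symm]; simp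
    · simp)

lemma sig_apply (x : A) : lv.sig K x = ∑ a, s a * x * s' a := by
  simp [sig, LinearMap.sum_apply, mulLeftRight_apply]

lemma sig_s (x : A) (a : ι) : lv.sig K x * s a = s a * x := by
  rw [sig_apply, sum_mul, sum_eq_single a]
  · rw [mul_assoc, lv.orth, if_pos rfl, mul_one]
  · intro b _ hb; rw [mul_assoc, lv.orth, if_neg hb, mul_zero]
  · simp

lemma s_sig (x : A) (a : ι) : s' a * lv.sig K x = x * s' a := by
  rw [sig_apply, mul_sum, sum_eq_single a]
  · rw [mul_assoc, ← mul_assoc, lv.orth, if_pos rfl, one_mul]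
  · intro b _ hb; rw [mul_assoc, ← mul_assoc, lv.orth, if_neg hb.symm, zero_mul]
  · simp

lemma sig_ent (x : A) (a b : ι) : s' a * lv.sig K x * s b = if a = b then x else 0 := by
  rw [s_sig, mul_assoc, lv.orth]; split_ifs <;> simp

lemma mul_ent (lv : Leav s s') (x y : A) (a c : ι) : s' a * (x * y) * s c = ∑ b, (s' a * x * s b) * (s' b * y * s c) := by
  have : x * y = ∑ b, x * s b * (s' b * y) := by
    calc x * y = x * (∑ b, s b * s' b) * y := by rw [lv.sum, mul_one]
      _ = _ := by rw [mul_sum, sum_mul]; simp only [mul_assoc]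
  rw [this, mul_sum, sum_mul]
  simp only [mul_assoc]

lemma mul_sig_ent (x y : A) (a b : ι) : s' a * (x * lv.sig K y) * s b = (s' a * x * s b) * y := by
  simp only [mul_assoc, sig_s]

lemma sig_mul_ent (x y : A) (a b : ι) : s' a * (lv.sig K y * x) * s b = y * (s' a * x * s b) := by
  rw [← mul_assoc, s_sig]; simp only [mul_assoc]

def BB (K : Type) [Field K] [Algebra K A] (lv : Leav s s') : ℕ → Subalgebra K A
  | 0 => ⊥
  | n+1 =>
    { carrier := {x | ∀ a b, s' a * x * s b ∈ BB K lv n}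
      mul_mem' := fun {x y} hx hy a b => by
        rw [lv.mul_ent]; exact sum_mem fun c _ => mul_mem (hx a c) (hy c b)
      add_mem' := fun {x y} hx hy a b => by
        rw [mul_add, add_mul]; exact add_mem (hx a b) (hy a b)
      algebraMap_mem' := fun r a b => by
        rw [Algebra.algebraMap_eq_smul_one, mul_smul_comm, smul_mul_assoc, mul_one, lv.orth]
        refine smul_mem _ ?_ _
        split_ifs
        · exact one_mem _
        · exact zero_mem _ }

lemma mem_BB {n : ℕ} {x : A} : x ∈ lv.BB K (n+1) ↔ ∀ a b, s' a * x * s b ∈ lv.BB K n := Iff.rfl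

def chi (s s' : ι → A) (χ : A →ₗ[K] K) : ℕ → A →ₗ[K] K
  | 0 => χ
  | n+1 => ∑ a, (chi s s' χ n) ∘ₗ mulLeftRight K (s' a, s a)

omit [DecidableEq ι] in
lemma chi_succ (χ : A →ₗ[K] K) (n : ℕ) (x : A) : chi s s' χ (n+1) x = ∑ a, chi s s' χ n (s' a * x * s a) := by
  simp [chi, LinearMap.sum_apply, mulLeftRight_apply]

lemma sc_of_mem {χ : A →ₗ[K] K} (h1 : χ 1 = 1) {x : A} (hx : x ∈ lv.BB K 0) : x = χ x • 1 := by
  obtain ⟨c, rfl⟩ := Algebra.mem_bot.1 hx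
  rw [Algebra.algebraMap_eq_smul_one, map_smul, h1]; simp

lemma rep (lv : Leav s s') {χ : A →ₗ[K] K} (h1 : χ 1 = 1) (n : ℕ) : ∃ (J : Type) (_ : Fintype J) (_ : DecidableEq J) (S S' : J → A) (wd : J → List ι),
    Leav S S' ∧ (∀ x ∈ lv.BB K n, ∀ i j, S' i * x * S j = χ (S' i * x * S j) • 1) ∧
    (∀ x, chi s s' χ n x = ∑ j, χ (S' j * x * S j)) ∧ (∀ j, S j = ((wd j).map s).prod) ∧
    ∀ l : List ι, l.length = n ↔ ∃ j, wd j = l := by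
  induction n with
  | zero =>
    refine ⟨Unit, inferInstance, inferInstance, fun _ => 1, fun _ => 1, fun _ => [], ⟨fun _ _ => by simp, by simp⟩, ?_, ?_, ?_, ?_⟩
    · intro x hx i j; simpa using lv.sc_of_mem h1 hx
    · intro x; simp [chi]
    · simp
    · intro l; rw [length_eq_zero_iff]; simp [eq_comm]
  | succ n ih =>
    obtain ⟨J, i1, i2, S, S', wd, hL, h2, h3, h4, h5⟩ := ih
    refine ⟨ι × J, inferInstance, inferInstance, fun p => s p.1 * S p.2, fun p => S' p.2 * s' p.1,
      fun p => p.1 :: wd p.2, ⟨?_, ?_⟩, ?_, ?_, ?_, ?_⟩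
    · rintro ⟨a, i⟩ ⟨b, j⟩
      rw [mul_assoc, ← mul_assoc (s' a), lv.orth]
      by_cases hab : a = b
      · rw [if_pos hab, one_mul, hL.orth]; simp [hab]
      · rw [if_neg hab]; simp [hab]
    · rw [Fintype.sum_prod_type]
      have : ∀ a, ∑ j, s a * S j * (S' j * s' a) = s a * s' a := fun a => by
        simp only [mul_assoc, ← mul_sum]
        simp only [← mul_assoc (S _), ← sum_mul]
        rw [hL.sum, one_mul]
      simp only [this, lv.sum]
    · rintro x hx ⟨a, i⟩ ⟨b, j⟩
      have := h2 _ (lv.mem_BB.1 hx a b) i j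
      simpa only [mul_assoc] using this
    · intro x
      rw [chi_succ, Fintype.sum_prod_type]
      simp only [h3, mul_assoc]
    · rintro ⟨a, i⟩; simp [h4]
    · intro l
      constructor
      · intro hl
        match l, hl with
        | a :: l, hl =>
          obtain ⟨j, hj⟩ := (h5 l).1 (by simpa using hl)
          exact ⟨(a, j), by simp [hj]⟩
      · rintro ⟨⟨a, j⟩, rfl⟩
        simp [(h5 (wd j)).2 ⟨j, rfl⟩]

theorem trS [CharZero K] (lv : Leav s s') {χ : A →ₗ[K] K} (h1 : χ 1 = 1) :
    TrS (Fintype.card ι) (lv.BB K) (chi s s' χ) (fun n => (lv.sig K)^n) where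
  mono n := by
    induction n with
    | zero =>
      intro x hx a b
      obtain ⟨c, rfl⟩ := Algebra.mem_bot.1 hx
      have : (algebraMap K A) c ∈ lv.BB K 1 := Subalgebra.algebraMap_mem _ c
      exact this a b
    | succ n ih => exact fun x hx a b => ih (hx a b)
  comm n := by
    induction n with
    | zero =>
      intro x hx y hy
      obtain ⟨c, rfl⟩ := Algebra.mem_bot.1 hx
      rw [Algebra.commutes]
    | succ n ih =>
      intro x hx y hy
      simp only [chi_succ, lv.mul_ent, map_sum]
      rw [sum_comm]
      refine sum_congr rfl fun a _ => sum_congr rfl fun b _ => ?_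
      exact ih _ (hx b a) _ (hy a b)
  idem n x hx hxx := by
    obtain ⟨J, i1, i2, S, S', wd, hL, h2, h3, h4, h5⟩ := lv.rep h1 n
    let M : Matrix J J K := of fun i j => χ (S' i * x * S j)
    have hM : M * M = M := by
      ext i j
      rw [Matrix.mul_apply]
      simp only [M, of_apply]
      conv_rhs => rw [← hxx, hL.mul_ent, map_sum]
      refine sum_congr rfl fun k _ => ?_
      rw [h2 x hx i k, h2 x hx k j]; simp [h1, mul_comm]
    have hp : IsIdempotentElem (Matrix.toLin' M) := by
      show Matrix.toLin' M * Matrix.toLin' M = _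
      rw [Module.End.mul_eq_comp, ← Matrix.toLin'_mul, hM]
    refine ⟨Module.finrank K (LinearMap.range (Matrix.toLin' M)), ?_, fun h0 => ?_⟩
    · rw [h3, ← (LinearMap.IsIdempotentElem.isProj_range _ hp).trace, Matrix.trace_toLin'_eq]
      rfl
    · have h6 : M = 0 := by
        rw [Submodule.finrank_eq_zero, LinearMap.range_eq_bot] at h0
        simpa using h0
      refine hL.exp_eq fun i j => ?_
      rw [h2 x hx i j]
      have := congrFun (congrFun h6 i) j
      simp only [M, of_apply, Matrix.zero_apply] at this
      rw [this]; simp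
  succ n := by
    induction n with
    | zero =>
      intro x hx
      obtain ⟨c, rfl⟩ := Algebra.mem_bot.1 hx
      rw [Algebra.algebraMap_eq_smul_one, chi_succ]
      simp [lv.orth, chi, h1]
    | succ n ih =>
      intro x hx
      rw [chi_succ, chi_succ, mul_sum]
      exact sum_congr rfl fun a _ => ih _ (hx a a)
  shc n := by
    induction n with
    | zero =>
      intro x hx y
      obtain ⟨c, rfl⟩ := Algebra.mem_bot.1 hx
      rw [Algebra.commutes]
    | succ n ih =>
      intro x hx y
      refine lv.exp_eq fun a b => ?_
      simp only [pow_succ', AlgHom.mul_apply]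
      rw [lv.mul_sig_ent, lv.sig_mul_ent, ih _ (hx a b)]
  shm n k y hy := by
    induction n with
    | zero => simpa using hy
    | succ n ih =>
      rw [show n + 1 + k = (n + k) + 1 by ring, pow_succ', AlgHom.mul_apply]
      intro a b
      rw [lv.sig_ent]
      split_ifs
      · exact ih
      · exact zero_mem _
  sht n := by
    induction n with
    | zero =>
      intro k x hx y hy
      obtain ⟨c, rfl⟩ := Algebra.mem_bot.1 hx
      rw [Algebra.algebraMap_eq_smul_one]
      simp [chi, h1]
    | succ n ih =>
      intro k x hx y hy
      rw [show n + 1 + k = (n + k) + 1 by ring, pow_succ', AlgHom.mul_apply, chi_succ, chi_succ, sum_mul]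
      refine sum_congr rfl fun a _ => ?_
      rw [lv.mul_sig_ent, ih k _ (hx a a) y hy]
  one := h1
end Leav

lemma exists_leav (K ι : Type) [Field K] [Fintype ι] [DecidableEq ι] [Nonempty ι] :
    ∃ (s s' : ι → Module.End K (ℕ → K)) (χ : Module.End K (ℕ → K) →ₗ[K] K), Leav s s' ∧ χ 1 = 1 := by
  classical
  haveI : Encodable ι := Fintype.toEncodable ι
  haveI := Denumerable.ofEncodableOfInfinite (ι × ℕ)
  let e : ι × ℕ ≃ ℕ := Denumerable.eqv (ι × ℕ)
  refine ⟨fun a =>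
    { toFun := fun f k => if (e.symm k).1 = a then f (e.symm k).2 else 0
      map_add' := fun f g => by funext k; simp; split_ifs <;> simp
      map_smul' := fun c f => by funext k; simp },
    fun a => LinearMap.funLeft K K (fun k => e (a, k)),
    (LinearMap.proj 0) ∘ₗ (LinearMap.applyₗ (fun _ => (1:K))), ⟨fun a b => ?_, ?_⟩, by simp⟩
  · ext1 f
    funext k
    by_cases h : a = b <;> simp [LinearMap.funLeft_apply, h]
  · ext1 f
    funext k
    simp [LinearMap.sum_apply, Finset.sum_apply, LinearMap.funLeft_apply]
end HS

namespace HS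
section char
variable {K A M : Type} [Field K] [Ring A] [Algebra K A] [AddCommGroup M] [Module K M]

lemma char_row {q : K} {T : ℕ → A} (hs : HeckeSys q T) (φ : A →ₐ[K] A) (W : Submodule K A) (ψ : A →ₗ[K] M) {k : ℕ}
    (h : ∀ i, i + 1 < k → ∀ z ∈ W, φ (T i) * z ∈ W ∧ ψ (φ (T i) * z) = q • ψ z) {z : A} (hz : z ∈ W) :
    φ (idem q T (row k)) * z ∈ W ∧ ψ (φ (idem q T (row k)) * z) = ψ z := by
  have hJ : ∀ j < k, ∀ z ∈ W, φ (JM q T j) * z ∈ W ∧ ψ (φ (JM q T j) * z) = q ^ j • ψ z := by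
    intro j hj
    induction j with
    | zero => simp [JM]
    | succ j ih =>
      intro z hz
      have h1 := h j hj z hz
      have h2 := ih (by omega) _ h1.1
      have h3 := h j hj _ h2.1
      simp only [JM, map_smul, map_mul, smul_mul_assoc, mul_assoc]
      refine ⟨W.smul_mem _ h3.1, ?_⟩
      rw [h3.2, h2.2, h1.2, smul_smul, smul_smul, smul_smul]
      have := hs.q0
      congr 1; field_simp; ring
  have hp : ∀ j < k, ∀ p : K[X], ∀ z ∈ W, φ (aeval (JM q T j) p) * z ∈ W ∧
      ψ (φ (aeval (JM q T j) p) * z) = p.eval (q ^ j) • ψ z := by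
    intro j hj p
    induction p using induction_on' with
    | add p r h1 h2 =>
      intro z hz
      simp only [map_add, add_mul, eval_add, add_smul]
      exact ⟨add_mem (h1 z hz).1 (h2 z hz).1, by rw [(h1 z hz).2, (h2 z hz).2]⟩
    | monomial n a =>
      induction n with
      | zero =>
        intro z hz
        simp only [aeval_monomial, pow_zero, mul_one, eval_monomial, Algebra.algebraMap_eq_smul_one, map_smul, map_one,
          smul_mul_assoc, one_mul]
        exact ⟨W.smul_mem _ hz, trivial⟩
      | succ n ih =>
        intro z hz
        have h1 := hJ j hj z hz
        have h2 := ih _ h1.1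
        simp only [aeval_monomial, eval_monomial, pow_succ, map_mul, mul_assoc] at h2 ⊢
        refine ⟨h2.1, ?_⟩
        rw [h2.2, h1.2, smul_smul]
        congr 1; ring
  clear h hJ
  induction k generalizing z with
  | zero => simpa [idem] using hz
  | succ k ih =>
    have ih' := fun z (hz : z ∈ W) => ih hz (fun j hj => hp j (by omega))
    have h1 := hp k (by omega) (basis (Adds (row k)) (cont q (row k)) 0) z hz
    show φ (idem q T (0 :: row k)) * z ∈ W ∧ ψ (φ (idem q T (0 :: row k)) * z) = ψ z
    simp only [idem, map_mul, mul_assoc]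
    rw [length_replicate]
    have h2 := ih' _ h1.1
    refine ⟨h2.1, ?_⟩
    rw [h2.2, h1.2]
    have : q ^ k = cont q (row k) 0 := by simp [cont, cz]
    rw [this, eval_basis_self (hs.cont_injOn (valid_row k)) ((mem_Adds (valid_row k)).2 (Or.inl rfl)), one_smul]
end char

namespace Leav
variable {K A ι V : Type} [Field K] [CharZero K] [Ring A] [Algebra K A] [Fintype ι] [DecidableEq ι]
  [AddCommGroup V] [Module K V]
variable {s s' : ι → A} (lv : Leav s s') (b : Module.Basis ι K V)

lemma ext_right (lv : Leav s s') {x y : A} (h : ∀ a, x * s a = y * s a) : x = y :=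
  lv.exp_eq fun a b => by rw [mul_assoc, mul_assoc, h]

def sv (s : ι → A) (b : Module.Basis ι K V) : V →ₗ[K] A := b.constr K s

omit [CharZero K] [DecidableEq ι] in
lemma sv_b (a : ι) : sv s b (b a) = s a := b.constr_basis K s a

def m2 (s : ι → A) (b : Module.Basis ι K V) : V ⊗[K] V →ₗ[K] A :=
  TensorProduct.lift ((LinearMap.mul K A).compl₁₂ (sv s b) (sv s b))

omit [CharZero K] [DecidableEq ι] in
lemma m2_tmul (v w : V) : m2 s b (v ⊗ₜ w) = sv s b v * sv s b w := by simp [m2]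

def T0 (s s' : ι → A) (b : Module.Basis ι K V) (R : V ⊗[K] V →ₗ[K] V ⊗[K] V) : A :=
  ∑ c, ∑ d, m2 s b (R (b c ⊗ₜ b d)) * (s' d * s' c)

variable {R : V ⊗[K] V →ₗ[K] V ⊗[K] V}

omit [CharZero K] in
lemma T0_m2 (lv : Leav s s') (u : V ⊗[K] V) : T0 s s' b R * m2 s b u = m2 s b (R u) := by
  have : LinearMap.mulLeft K (T0 s s' b R) ∘ₗ m2 s b = m2 s b ∘ₗ R := by
    refine (b.tensorProduct b).ext fun ⟨a, e⟩ => ?_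
    simp only [LinearMap.comp_apply, LinearMap.mulLeft_apply, Module.Basis.tensorProduct_apply, m2_tmul, sv_b]
    have : ∀ c d, m2 s b (R (b c ⊗ₜ b d)) * (s' d * s' c) * (s a * s e) = if c = a then if d = e then m2 s b (R (b c ⊗ₜ b d)) else 0 else 0 := by
      intro c d
      rw [mul_assoc, mul_assoc (s' d), ← mul_assoc (s' c), lv.orth]
      split_ifs with h1 h2
      · rw [one_mul, lv.orth, if_pos h2, mul_one]
      · rw [one_mul, lv.orth, if_neg h2, mul_zero]
      · simp
    simp only [T0, sum_mul, this]
    simp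
  exact LinearMap.congr_fun this u

omit [CharZero K] in
lemma ext_m2 (lv : Leav s s') {x y : A} (h : ∀ u, x * m2 s b u = y * m2 s b u) : x = y := by
  refine lv.ext_right fun a => lv.ext_right fun c => ?_
  have := h (b a ⊗ₜ b c)
  rw [m2_tmul, sv_b, sv_b] at this
  simpa only [mul_assoc] using this

omit [CharZero K] in
lemma sig_sv (x : A) (v : V) : lv.sig K x * sv s b v = sv s b v * x := by
  have : LinearMap.mulLeft K (lv.sig K x) ∘ₗ sv s b = LinearMap.mulRight K x ∘ₗ sv s b :=
    b.ext fun a => by simp [sv_b, lv.sig_s]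
  exact LinearMap.congr_fun this v

def m3 (s : ι → A) (b : Module.Basis ι K V) : (V ⊗[K] V) ⊗[K] V →ₗ[K] A :=
  TensorProduct.lift ((LinearMap.mul K A).compl₁₂ (m2 s b) (sv s b))

omit [CharZero K] [DecidableEq ι] in
lemma m3_tmul (u : V ⊗[K] V) (w : V) : m3 s b (u ⊗ₜ w) = m2 s b u * sv s b w := by simp [m3]

omit [CharZero K] in
lemma T0_m3 (lv : Leav s s') (x : (V ⊗[K] V) ⊗[K] V) : T0 s s' b R * m3 s b x = m3 s b (TensorProduct.map R LinearMap.id x) := by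
  induction x with
  | zero => simp
  | add x y h1 h2 => simp only [map_add, mul_add, h1, h2]
  | tmul u w => rw [m3_tmul, ← mul_assoc, T0_m2 b lv, TensorProduct.map_tmul, m3_tmul, LinearMap.id_apply]

omit [CharZero K] [DecidableEq ι] in
lemma m3_assoc (v : V) (u : V ⊗[K] V) : m3 s b ((TensorProduct.assoc K V V V).symm (v ⊗ₜ u)) = sv s b v * m2 s b u := by
  induction u with
  | zero => simp
  | add x y h1 h2 => simp only [tmul_add, map_add, mul_add, h1, h2]
  | tmul u w => rw [TensorProduct.assoc_symm_tmul, m3_tmul, m2_tmul, m2_tmul, mul_assoc]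

omit [CharZero K] in
lemma T1_m3 (x : (V ⊗[K] V) ⊗[K] V) : lv.sig K (T0 s s' b R) * m3 s b x =
    m3 s b ((TensorProduct.assoc K V V V).symm (TensorProduct.map LinearMap.id R (TensorProduct.assoc K V V V x))) := by
  obtain ⟨y, rfl⟩ := (TensorProduct.assoc K V V V).symm.surjective x
  rw [LinearEquiv.apply_symm_apply]
  induction y with
  | zero => simp
  | add x y h1 h2 => simp only [map_add, mul_add, h1, h2]
  | tmul u w => rw [m3_assoc, ← mul_assoc, sig_sv, mul_assoc, T0_m2 b lv, TensorProduct.map_tmul, m3_assoc, LinearMap.id_apply]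

omit [CharZero K] in
lemma T0_mem : T0 s s' b R ∈ lv.BB K 2 := by
  have h2 : ∀ (u : V ⊗[K] V) a c, s' c * (s' a * m2 s b u) ∈ lv.BB K 0 := by
    intro u a c
    have : LinearMap.mulLeft K (s' c) ∘ₗ LinearMap.mulLeft K (s' a) ∘ₗ m2 s b =
      (Algebra.linearMap K A) ∘ₗ ((b.coord a) ∘ₗ TensorProduct.rid K V ∘ₗ LinearMap.lTensor V (b.coord c)) := by
      refine (b.tensorProduct b).ext fun ⟨x, y⟩ => ?_
      simp only [LinearMap.comp_apply, LinearMap.mulLeft_apply, Module.Basis.tensorProduct_apply, m2_tmul, sv_b]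
      rw [← mul_assoc (s' a), lv.orth]
      by_cases h : a = x
      · rw [if_pos h, one_mul, lv.orth]
        by_cases h' : c = y
        · simp [h, h']
        · simp [h, h', Ne.symm h', Finsupp.single_apply]
      · rw [if_neg h]; by_cases h' : y = c <;> simp [Ne.symm h, h, h', Finsupp.single_apply]
    exact ⟨_, (LinearMap.congr_fun this u).symm⟩
  intro a e c f
  simp only [T0, mul_sum, sum_mul]
  refine sum_mem fun x _ => sum_mem fun y _ => ?_
  have : s' c * (s' a * (m2 s b (R (b x ⊗ₜ b y)) * (s' y * s' x)) * s e) * s f =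
    (s' c * (s' a * m2 s b (R (b x ⊗ₜ b y)))) * (s' y * (s' x * s e) * s f) := by simp only [mul_assoc]
  rw [this]
  refine mul_mem (h2 _ _ _) ?_
  rw [lv.orth]
  split_ifs
  · rw [mul_one, lv.orth]
    split_ifs
    · exact one_mem _
    · exact zero_mem _
  · simp [zero_mem]

theorem sys {q : K} (hq0 : q ≠ 0) (hq : ∀ n : ℕ, 1 < n → q ^ n ≠ 1) (hR : IsHeckeSymmetry K V q R)
    {χ : A →ₗ[K] K} (h1 : χ 1 = 1) :
    Sys q (fun i => (lv.sig K ^ i) (T0 s s' b R)) (Fintype.card ι) (lv.BB K) (chi s s' χ) (fun n => (lv.sig K)^n) := by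
  have tr := lv.trS h1
  have hT : ∀ i, (lv.sig K ^ i) (T0 s s' b R) ∈ lv.BB K (i+2) := fun i => tr.shm i 2 _ (lv.T0_mem b)
  refine ⟨⟨hq0, ?_, ?_, ?_, ?_⟩, tr, hT, ?_⟩
  · intro n hn
    rcases (by omega : n = 1 ∨ 1 < n) with rfl | h
    · intro h; rw [pow_one] at h; exact hq 2 (by norm_num) (by rw [h]; simp)
    · exact hq n h
  · intro i
    rw [← map_mul, ← map_smul, ← map_one (lv.sig K ^ i), ← map_smul, ← map_add]
    congr 1
    refine lv.ext_m2 b fun u => ?_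
    rw [mul_assoc, T0_m2 b lv, T0_m2 b lv, add_mul, smul_mul_assoc, T0_m2 b lv, smul_mul_assoc, one_mul, ← map_smul (m2 s b), ← map_smul (m2 s b), ← map_add]
    congr 1
    have := LinearMap.congr_fun hR.2.2.1 u
    simp only [LinearMap.comp_apply, LinearMap.add_apply, LinearMap.sub_apply, LinearMap.smul_apply, LinearMap.id_apply, map_sub, map_smul, LinearMap.zero_apply] at this
    rw [← sub_eq_zero, ← this]; module
  · intro i
    have : ∀ x, (lv.sig K ^ (i+1)) x = (lv.sig K ^ i) (lv.sig K x) := fun x => by rw [pow_succ]; rfl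
    simp only [this, ← map_mul]
    congr 1
    refine lv.ext_right fun a => lv.ext_right fun c => lv.ext_right fun e => ?_
    have := congrArg (m3 s b) (LinearMap.congr_fun hR.2.1 ((b a ⊗ₜ b c) ⊗ₜ b e))
    simp only [LinearMap.comp_apply, LinearEquiv.coe_coe] at this
    rw [← T0_m3 b lv, ← T1_m3 lv b, ← T0_m3 b lv, ← T1_m3 lv b, ← T0_m3 b lv, ← T1_m3 lv b, m3_tmul, m2_tmul, sv_b, sv_b, sv_b] at this
    simpa only [mul_assoc] using this
  · intro i j hij
    obtain ⟨k, rfl⟩ := exists_eq_add_of_le hij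
    have := tr.shc _ _ (hT i) ((lv.sig K ^ k) (T0 s s' b R))
    simp only [← AlgHom.mul_apply, ← pow_add] at this
    exact this
  · intro n i
    simp only [← AlgHom.mul_apply, ← pow_add]
end Leav
end HS

namespace HS
namespace Leav
variable {K A ι V : Type} [Field K] [CharZero K] [Ring A] [Algebra K A] [Fintype ι] [DecidableEq ι]
  [AddCommGroup V] [Module K V]
variable {s s' : ι → A} (lv : Leav s s') (b : Module.Basis ι K V) {R : V ⊗[K] V →ₗ[K] V ⊗[K] V}

abbrev TT (lv : Leav s s') (b : Module.Basis ι K V) (R : V ⊗[K] V →ₗ[K] V ⊗[K] V) (i : ℕ) : A := (lv.sig K ^ i) (T0 s s' b R)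

def xv (q : K) (R : V ⊗[K] V →ₗ[K] V ⊗[K] V) : V →ₗ[K] RingQuot (sRel K V q R) :=
  (RingQuot.mkAlgHom K (sRel K V q R)).toLinearMap ∘ₗ TensorAlgebra.ι K

def n2 (q : K) (R : V ⊗[K] V →ₗ[K] V ⊗[K] V) : V ⊗[K] V →ₗ[K] RingQuot (sRel K V q R) :=
  (RingQuot.mkAlgHom K (sRel K V q R)).toLinearMap ∘ₗ mulTwo K V

omit [CharZero K] in
lemma n2_tmul (q : K) (v w : V) : n2 q R (v ⊗ₜ w) = xv q R v * xv q R w := by simp [n2, xv, mulTwo]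

omit [CharZero K] in
lemma n2_R (q : K) (u : V ⊗[K] V) : n2 q R (R u) = q • n2 q R u := by
  have := RingQuot.mkAlgHom_rel K (s := sRel K V q R) (x := mulTwo K V ((R - q • (LinearMap.id : V ⊗[K] V →ₗ[K] V ⊗[K] V)) u)) (y := 0) ⟨rfl, u, rfl⟩
  rw [map_zero] at this
  rw [← sub_eq_zero, ← map_smul, ← map_sub, ← this]; rfl

def fk (P : ℕ → A) (s : ι → A) (b : Module.Basis ι K V) : V →ₗ[K] Module.End K (ℕ → A) where
  toFun v :=
    { toFun := fun f k => match k with | 0 => 0 | k+1 => P (k+1) * sv s b v * f k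
      map_add' := fun f g => by funext k; cases k <;> simp [mul_add]
      map_smul' := fun c f => by funext k; cases k <;> simp }
  map_add' v w := by ext1 f; funext k; cases k <;> simp [mul_add, add_mul]
  map_smul' c v := by ext1 f; funext k; cases k <;> simp

omit [CharZero K] in
lemma dim_aux {q : K} (hs : HeckeSys q (lv.TT b R)) (k : ℕ) :
    idem q (lv.TT b R) (row (k+1)) * lv.sig K (idem q (lv.TT b R) (row k)) = idem q (lv.TT b R) (row (k+1)) := by
  have := (char_row hs (lv.sig K) ⊤ (LinearMap.mulLeft K (idem q (lv.TT b R) (row (k+1)))) (k := k) (fun i hi z _ => ⟨trivial, ?_⟩) (z := 1) trivial).2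
  · simpa using this
  · have h : lv.sig K (lv.TT b R i) = lv.TT b R (i+1) := by simp only [TT, pow_succ']; rfl
    rw [LinearMap.mulLeft_apply, h, ← mul_assoc, hs.row_T (by omega), smul_mul_assoc]; rfl

omit [CharZero K] [Fintype ι] [DecidableEq ι] in
open scoped Pointwise in
lemma pow_words {B : Type} [Ring B] [Algebra K B] (f : ι → B) (k : ℕ) :
    Submodule.span K (Set.range f) ^ k = Submodule.span K {z | ∃ w : List ι, w.length = k ∧ z = (w.map f).prod} := by
  induction k with
  | zero =>
    rw [pow_zero, Submodule.one_eq_span]; congr 1; ext z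
    simp only [length_eq_zero_iff]; simp
  | succ k ih =>
    rw [pow_succ', ih, Submodule.span_mul_span]; congr 1; ext z
    constructor
    · intro h
      obtain ⟨_, ⟨a, rfl⟩, _, ⟨w, hw, rfl⟩, rfl⟩ := Set.mem_mul.1 h
      exact ⟨a :: w, by simp [hw], by simp⟩
    · rintro ⟨w, hw, rfl⟩
      match w, hw with
      | a :: w, hw =>
        rw [List.map_cons, List.prod_cons]
        exact Set.mul_mem_mul ⟨a, rfl⟩ ⟨w, by simpa using hw, rfl⟩

lemma dim {q : K} {χ : A →ₗ[K] K} (h1 : χ 1 = 1)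
    (sy : Sys q (lv.TT b R) (Fintype.card ι) (lv.BB K) (chi s s' χ) (fun n => (lv.sig K)^n)) (k : ℕ) :
    Module.finrank K (sGrade K V q R k) = Nw q (lv.TT b R) (chi s s' χ) (row k) := by
  have hs := sy.hs
  set P : ℕ → A := fun k => idem q (lv.TT b R) (row k) with hP
  have hP2 : ∀ k, P (k+1) * lv.sig K (P k) = P (k+1) := fun k => lv.dim_aux b hs k
  have hP3 : ∀ k v z, P (k+1) * (sv s b v * (P k * z)) = P (k+1) * (sv s b v * z) := fun k v z => by
    rw [← mul_assoc (sv s b v), ← lv.sig_sv, ← mul_assoc, ← mul_assoc, hP2, mul_assoc]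
  obtain ⟨J, i1, i2, S, S', wd, hL, h2, h3, h4, h5⟩ := lv.rep h1 k
  have hlen : ∀ j, (wd j).length = k := fun j => (h5 _).2 ⟨j, rfl⟩
  let Xw : List ι → RingQuot (sRel K V q R) := fun w => (w.map fun a => xv q R (b a)).prod
  have hfk : ∀ v w f k, (fk P s b v * fk P s b w) f (k+2) = P (k+2) * m2 s b (v ⊗ₜ w) * f k := by
    intro v w f k
    show P (k+2) * sv s b v * (P (k+1) * sv s b w * f k) = _
    rw [m2_tmul]
    simp only [mul_assoc]
    rw [hP3]
  have hfk2 : ∀ u f k, (TensorAlgebra.lift K (fk P s b) (mulTwo K V u)) f (k+2) = P (k+2) * m2 s b u * f k := by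
    intro u f k
    induction u with
    | zero => simp
    | add x y h1 h2 => simp only [map_add, LinearMap.add_apply, Pi.add_apply, h1, h2, mul_add, add_mul]
    | tmul v w => rw [← hfk]; simp [mulTwo]
  have hfk3 : ∀ u f k, k < 2 → (TensorAlgebra.lift K (fk P s b) (mulTwo K V u)) f k = 0 := by
    intro u f k hk
    induction u with
    | zero => simp
    | add x y h1 h2 => simp only [map_add, LinearMap.add_apply, Pi.add_apply, h1, h2, add_zero]
    | tmul v w =>
      have : (TensorAlgebra.lift K (fk P s b)) (mulTwo K V (v ⊗ₜ[K] w)) = fk P s b v * fk P s b w := by simp [mulTwo]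
      rw [this]
      match k, hk with
      | 0, _ => rfl
      | 1, _ => show P 1 * sv s b v * 0 = 0; simp
  let Fh : RingQuot (sRel K V q R) →ₐ[K] Module.End K (ℕ → A) := RingQuot.liftAlgHom K ⟨TensorAlgebra.lift K (fk P s b), by
    rintro x y ⟨rfl, u, rfl⟩
    rw [map_zero]
    ext1 f
    funext k
    rcases lt_or_ge k 2 with hk | hk
    · exact hfk3 _ _ _ hk
    · obtain ⟨k, rfl⟩ := Nat.exists_eq_add_of_le' hk
      rw [hfk2]
      have : P (k+2) * m2 s b ((R - q • (LinearMap.id : V ⊗[K] V →ₗ[K] V ⊗[K] V)) u) = 0 := by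
        rw [LinearMap.sub_apply, map_sub, ← T0_m2 b lv, LinearMap.smul_apply, LinearMap.id_apply, map_smul, mul_sub, ← mul_assoc]
        have := hs.row_T (i := 0) (k := k+2) (by omega)
        rw [show P (k+2) * T0 s s' b R = q • P (k+2) from this]; simp
      rw [this, zero_mul]; rfl⟩
  have hFx : ∀ v, Fh (xv q R v) = fk P s b v := fun v => by simp [Fh, xv]
  have hFw : ∀ w : List ι, Fh (Xw w) (Pi.single 0 1) w.length = P w.length * (w.map s).prod := by
    intro w
    induction w with
    | nil => simp [Xw, P, idem]
    | cons a w ih =>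
      have : Xw (a :: w) = xv q R (b a) * Xw w := by simp [Xw]
      rw [this, map_mul, hFx]
      show P (w.length + 1) * sv s b (b a) * (Fh (Xw w) (Pi.single 0 1) w.length) = _
      rw [ih, mul_assoc, hP3, sv_b]; simp
  let Ψ : (J → K) →ₗ[K] RingQuot (sRel K V q R) := Fintype.linearCombination K (fun j => Xw (wd j))
  let G : (J → K) →ₗ[K] A := LinearMap.mulLeft K (P k) ∘ₗ Fintype.linearCombination K S
  let M : Matrix J J K := of fun i j => χ (S' i * P k * S j)
  have hPB : P k ∈ lv.BB K k := by
    have := sy.idem_B (row k); rwa [length_replicate] at this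
  have hG : ∀ v, G v = Fintype.linearCombination K S (Matrix.toLin' M v) := by
    intro v
    have hS : ∀ j, P k * S j = ∑ i, M i j • S i := fun j => by
      rw [← one_mul (P k * S j), ← hL.sum, sum_mul]
      refine sum_congr rfl fun i _ => ?_
      rw [mul_assoc, ← mul_assoc (S' i), h2 _ hPB i j]; simp [M]
    simp only [G, LinearMap.comp_apply, LinearMap.mulLeft_apply, Fintype.linearCombination_apply, mul_sum, mul_smul_comm, hS, Finset.smul_sum, Matrix.toLin'_apply,
      mulVec, dotProduct, Finset.sum_smul, smul_smul]
    rw [sum_comm]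
    simp only [mul_comm]
  have hSi : Function.Injective (Fintype.linearCombination K S) := by
    rw [injective_iff_map_eq_zero]
    intro v hv
    funext i
    have : χ (S' i * Fintype.linearCombination K S v) = v i := by
      simp [Fintype.linearCombination_apply, mul_sum, hL.orth, h1]
    rw [← this, hv]; simp
  have kGM : LinearMap.ker G = LinearMap.ker (Matrix.toLin' M) := by
    ext v
    rw [LinearMap.mem_ker, LinearMap.mem_ker, hG, map_eq_zero_iff _ hSi]
  have hFΨ : ∀ v, Fh (Ψ v) (Pi.single 0 1) k = G v := by
    intro v
    simp only [Ψ, G, Fintype.linearCombination_apply, map_sum, map_smul, LinearMap.sum_apply, Finset.sum_apply, LinearMap.smul_apply, Pi.smul_apply, LinearMap.comp_apply, LinearMap.mulLeft_apply]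
    refine sum_congr rfl fun j _ => ?_
    have := hFw (wd j)
    rw [hlen] at this
    rw [this, h4]
  let ψ : A →ₗ[K] RingQuot (sRel K V q R) := Ψ ∘ₗ LinearMap.pi (fun j => χ ∘ₗ LinearMap.mulLeft K (S' j))
  have hψS : ∀ j, ψ (S j) = Xw (wd j) := by
    intro j
    simp [ψ, Ψ, Fintype.linearCombination_apply, hL.orth, h1, apply_ite χ]
  have hψ : ∀ v, ψ (Fintype.linearCombination K S v) = Ψ v := by
    intro v
    simp only [Fintype.linearCombination_apply, map_sum, map_smul, hψS, Ψ]
  have hψw : ∀ w : List ι, w.length = k → ψ ((w.map s).prod) = Xw w := by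
    intro w hw
    obtain ⟨j, rfl⟩ := (h5 w).1 hw
    rw [← h4, hψS]
  let W : Submodule K A := Submodule.span K {z | ∃ w : List ι, w.length = k ∧ z = (w.map s).prod}
  have hT : ∀ i, i + 1 < k → ∀ z ∈ W, lv.TT b R i * z ∈ W ∧ ψ (lv.TT b R i * z) = q • ψ z := by
    intro i hi z hz
    induction hz using span_induction with
    | zero => simp
    | add x y _ _ h1 h2 =>
      rw [mul_add]; exact ⟨add_mem h1.1 h2.1, by rw [map_add, h1.2, h2.2, map_add, smul_add]⟩
    | smul c x _ h1 =>
      rw [mul_smul_comm]; exact ⟨W.smul_mem _ h1.1, by rw [map_smul, h1.2, map_smul, smul_comm]⟩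
    | mem z hz =>
      obtain ⟨w, hw, rfl⟩ := hz
      have hw' : w = w.take i ++ ((w[i]'(by omega)) :: (w[i+1]'(by omega)) :: w.drop (i+2)) := by
        rw [← List.drop_eq_getElem_cons, ← List.drop_eq_getElem_cons, List.take_append_drop]
      generalize hu : w.take i = u at hw'
      have hul : u.length = i := by rw [← hu, List.length_take]; omega
      generalize w[i]'(by omega) = a at hw'
      generalize w[i+1]'(by omega) = c at hw'
      generalize w.drop (i+2) = r at hw'
      have key : ∀ t : V ⊗[K] V, (u.map s).prod * m2 s b t * (r.map s).prod ∈ W ∧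
          ψ ((u.map s).prod * m2 s b t * (r.map s).prod) = Xw u * n2 q R t * Xw r := by
        intro t
        have ht : t ∈ Submodule.span K (Set.range (b.tensorProduct b)) := by rw [Module.Basis.span_eq]; trivial
        induction ht using span_induction with
        | zero => simp
        | add x y _ _ h1 h2 =>
          simp only [map_add, mul_add, add_mul]; exact ⟨add_mem h1.1 h2.1, by rw [h1.2, h2.2]⟩
        | smul c x _ h1 =>
          simp only [map_smul, mul_smul_comm, smul_mul_assoc]; exact ⟨W.smul_mem _ h1.1, by rw [h1.2]⟩
        | mem z hz =>
          obtain ⟨⟨x, y⟩, rfl⟩ := hz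
          have hl : (u ++ x :: y :: r).length = k := by rw [← hw, hw']; simp
          have e : (u.map s).prod * m2 s b ((b.tensorProduct b) (x, y)) * (r.map s).prod = ((u ++ x :: y :: r).map s).prod := by
            rw [Module.Basis.tensorProduct_apply, m2_tmul, sv_b, sv_b]; simp [mul_assoc]
          rw [e, hψw _ hl]
          refine ⟨subset_span ⟨_, hl, rfl⟩, ?_⟩
          rw [Module.Basis.tensorProduct_apply, n2_tmul]; simp [Xw, mul_assoc]
      have hpu : ∀ (x : A) (u : List ι), (lv.sig K ^ u.length) x * (u.map s).prod = (u.map s).prod * x := by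
        intro x u
        induction u with
        | nil => simp
        | cons a u ih =>
          rw [List.length_cons, pow_succ', AlgHom.mul_apply, List.map_cons, List.prod_cons, ← mul_assoc, lv.sig_s, mul_assoc, ih, mul_assoc]
      have e0 : (w.map s).prod = (u.map s).prod * m2 s b (b a ⊗ₜ b c) * (r.map s).prod := by
        rw [hw', m2_tmul, sv_b, sv_b]; simp [mul_assoc]
      have e1 : lv.TT b R i * (w.map s).prod = (u.map s).prod * m2 s b (R (b a ⊗ₜ b c)) * (r.map s).prod := by
        rw [e0, ← mul_assoc, ← mul_assoc, ← hul, TT, hpu, mul_assoc (u.map s).prod, T0_m2 b lv]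
      rw [e1, e0]
      exact ⟨(key _).1, by rw [(key _).2, (key _).2, n2_R]; simp⟩
  have kΨ : LinearMap.ker Ψ = LinearMap.ker G := by
    ext v
    rw [LinearMap.mem_ker, LinearMap.mem_ker]
    constructor
    · intro h; rw [← hFΨ, h]; simp
    · intro h
      have hv : Fintype.linearCombination K S v ∈ W := by
        rw [Fintype.linearCombination_apply]
        exact sum_mem fun j _ => W.smul_mem _ (subset_span ⟨wd j, hlen j, h4 j⟩)
      have := (char_row hs (AlgHom.id K A) W ψ hT hv).2
      rw [hψ] at this
      rw [← this]
      show ψ (G v) = 0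
      rw [h, map_zero]
  have rΨ : LinearMap.range Ψ = sGrade K V q R k := by
    rw [sGrade, LinearMap.range_eq_map (TensorAlgebra.ι K), ← b.span_eq, Submodule.map_span, ← Set.range_comp, pow_words, Submodule.map_span, Fintype.range_linearCombination]
    congr 1
    have hX : ∀ w : List ι, Xw w = (RingQuot.mkAlgHom K (sRel K V q R)) ((w.map (TensorAlgebra.ι K ∘ b)).prod) := by
      intro w; rw [map_list_prod]; simp [Xw, xv, Function.comp_def]
    ext z
    constructor
    · rintro ⟨j, rfl⟩
      exact ⟨_, ⟨_, hlen j, rfl⟩, (hX _).symm⟩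
    · rintro ⟨y, ⟨w, hw, rfl⟩, rfl⟩
      obtain ⟨j, rfl⟩ := (h5 w).1 hw
      exact ⟨j, hX _⟩
  have e1 := LinearMap.finrank_range_add_finrank_ker Ψ
  have e2 := LinearMap.finrank_range_add_finrank_ker (Matrix.toLin' M)
  rw [kΨ, kGM, rΨ] at e1
  have hM : M * M = M := by
    ext i j
    rw [Matrix.mul_apply]
    simp only [M, of_apply]
    conv_rhs => rw [← show P k * P k = P k from hs.idem_idem (valid_row _), hL.mul_ent, map_sum]
    refine sum_congr rfl fun l _ => ?_
    rw [h2 _ hPB i l, h2 _ hPB l j]; simp [h1, mul_comm]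
  have hp : IsIdempotentElem (Matrix.toLin' M) := by
    show Matrix.toLin' M * Matrix.toLin' M = _
    rw [Module.End.mul_eq_comp, ← Matrix.toLin'_mul, hM]
  have e3 := (LinearMap.IsIdempotentElem.isProj_range _ hp).trace
  rw [Matrix.trace_toLin'_eq] at e3
  have e4 := sy.Nw_spec (valid_row k)
  rw [length_replicate, h3] at e4
  have e5 : (Nw q (lv.TT b R) (chi s s' χ) (row k) : K) = Module.finrank K (LinearMap.range (Matrix.toLin' M)) := by
    rw [← e3, ← e4]; rfl
  have e6 : Nw q (lv.TT b R) (chi s s' χ) (row k) = Module.finrank K (LinearMap.range (Matrix.toLin' M)) := by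
    exact_mod_cast e5
  omega
end Leav
end HS

namespace HS

structure Dat {K A ι : Type} [Field K] [Ring A] [Algebra K A] [Fintype ι] (q : K) (T : ℕ → A) (d : ℕ) (B : ℕ → Subalgebra K A)
    (χ : ℕ → A →ₗ[K] K) (σ : ℕ → A →ₐ[K] A) (E : ι → ι → A) (D : A) (β : A →ₗ[K] K) (t : K) : Prop where
  E1 : ∀ a b, E a b ∈ B 1
  D1 : D ∈ B 1
  tr : ∑ a, ∑ b, E a b * D * E b a = t • 1
  one : ∑ a, ∑ b, σ 1 (E a b) * T 0 * σ 1 (D * E b a) = 1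
  dim : ∑ a, ∑ b, E b a * E a b = (d : K) • 1
  ptr : ∀ N, ∀ x ∈ B (N+1), ∀ a b, ∑ c, σ N (E c a) * x * σ N (E b c) ∈ B N
  EE : ∀ a b c e, b ≠ c → E a b * E c e = 0
  EE' : ∀ a b e, E a b * E b e = E a e
  Es : ∑ a, E a a = 1
  sl : ∀ Z ∈ B 1, ∃ (J : Type) (_ : Fintype J) (p r : J → A), ∑ j, σ 1 (p j) * T 0 * σ 1 (r j) = Z ∧ ∑ j, p j * r j = β Z • 1
  bD : 1 - (q - 1) * t ≠ 0 → ∀ Z ∈ B 1, β (D * Z) = (q⁻¹ * (1 - (q - 1) * t)) * χ 1 Z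
  cas : ∑ a, ∑ b, χ 1 (E b a) • E a b = 1
  σσ : ∀ m n x, σ m (σ n x) = σ (m+n) x

namespace Leav
variable {K A ι V : Type} [Field K] [CharZero K] [Ring A] [Algebra K A] [Fintype ι] [DecidableEq ι]
  [AddCommGroup V] [Module K V]
variable {s s' : ι → A} (lv : Leav s s') (b : Module.Basis ι K V) {R : V ⊗[K] V →ₗ[K] V ⊗[K] V}

omit [CharZero K] in
lemma sharp (lv : Leav s s') {q : K} (hR : IsHeckeSymmetry K V q R) : ∃ M N : Matrix (ι × ι) (ι × ι) K, M * N = 1 ∧ N * M = 1 ∧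
    ∀ a c, s' a * T0 s s' b R * s c = ∑ p : ι × ι, M p (a, c) • (s p.1 * s' p.2) := by
  obtain ⟨Rs, hb, hRs⟩ := hR.2.2.2
  let b1 := b.dualBasis.tensorProduct b
  let b2 := b.tensorProduct b.dualBasis
  let e := LinearEquiv.ofBijective Rs hb
  refine ⟨LinearMap.toMatrix b1 b2 e.toLinearMap, LinearMap.toMatrix b2 b1 e.symm.toLinearMap, ?_, ?_, ?_⟩
  · rw [← LinearMap.toMatrix_comp b2 b1 b2]; simp
  · rw [← LinearMap.toMatrix_comp b1 b2 b1]; simp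
  intro a c
  have h1 : ∀ x y z, b2.repr z (x, y) = b.coord x (dualTensorHom K V V (TensorProduct.comm K V (Module.Dual K V) z) (b y)) := by
    intro x y z
    have : b2.coord (x, y) = b.coord x ∘ₗ LinearMap.applyₗ (b y) ∘ₗ dualTensorHom K V V ∘ₗ (TensorProduct.comm K V (Module.Dual K V)).toLinearMap := by
      refine b2.ext fun ⟨i, j⟩ => ?_
      simp [b2, Module.Basis.tensorProduct_apply, dualTensorHom_apply, Finsupp.single_apply]
      by_cases h : i = x <;> by_cases h' : y = j <;> simp [h, h', Finsupp.single_apply, eq_comm]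
    exact LinearMap.congr_fun this z
  have h2 : ∀ x y, LinearMap.toMatrix b1 b2 e.toLinearMap (x, y) (a, c) =
      b.coord x (TensorProduct.lid K V (TensorProduct.map (b.coord a) LinearMap.id (R (b c ⊗ₜ b y)))) := by
    intro x y
    rw [LinearMap.toMatrix_apply, h1]
    have := hRs (b.coord a) (b c) (b y)
    rw [← this]
    simp [b1, Module.Basis.tensorProduct_apply, e]
  have h3 : ∀ u, s' a * m2 s b u = sv s b (TensorProduct.lid K V (TensorProduct.map (b.coord a) LinearMap.id u)) := by
    intro u
    have : LinearMap.mulLeft K (s' a) ∘ₗ m2 s b = sv s b ∘ₗ (TensorProduct.lid K V).toLinearMap ∘ₗ TensorProduct.map (b.coord a) LinearMap.id := by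
      refine (b.tensorProduct b).ext fun ⟨i, j⟩ => ?_
      simp [Module.Basis.tensorProduct_apply, m2_tmul, sv_b, ← mul_assoc, lv.orth, Finsupp.single_apply]
      by_cases h : a = i
      · simp [h, sv_b]
      · simp [h, Ne.symm h]
    exact LinearMap.congr_fun this u
  have h4 : ∀ v, sv s b v = ∑ x, b.coord x v • s x := fun v => by
    conv_lhs => rw [← b.sum_repr v]
    rw [map_sum]; simp only [map_smul, sv_b]; rfl
  have h5 : T0 s s' b R * s c = ∑ y, m2 s b (R (b c ⊗ₜ b y)) * s' y := by
    simp only [T0, sum_mul, mul_assoc, lv.orth]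
    rw [sum_eq_single c]
    · simp
    · intro x _ hx; simp [hx]
    · simp
  rw [mul_assoc, h5, mul_sum, Fintype.sum_prod_type, sum_comm]
  refine sum_congr rfl fun y _ => ?_
  rw [← mul_assoc, h3, h4, sum_mul]
  simp only [h2, smul_mul_assoc]

def emb (s s' : ι → A) (X : Matrix ι ι K) : A := ∑ i, ∑ j, X i j • (s i * s' j)
def mat (s s' : ι → A) (χ : A →ₗ[K] K) (Z : A) : Matrix ι ι K := of fun i j => χ (s' i * Z * s j)

omit [CharZero K] in
lemma emb_ent (lv : Leav s s') (X : Matrix ι ι K) (a c : ι) : s' a * emb s s' X * s c = X a c • 1 := by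
  simp only [emb, mul_sum, sum_mul, mul_smul_comm, smul_mul_assoc, mul_assoc, lv.orth]
  simp only [← mul_assoc, lv.orth]
  simp

omit [CharZero K] in
lemma mat_emb (lv : Leav s s') {χ : A →ₗ[K] K} (h1 : χ 1 = 1) (X : Matrix ι ι K) : mat s s' χ (emb s s' X) = X := by
  ext i j; simp [mat, lv.emb_ent, h1]

omit [CharZero K] in
lemma emb_mul (lv : Leav s s') (X Y : Matrix ι ι K) : emb s s' X * emb s s' Y = emb s s' (X * Y) := by
  refine lv.exp_eq fun a c => ?_
  rw [lv.mul_ent]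
  simp only [lv.emb_ent, Matrix.mul_apply, Finset.sum_smul, smul_mul_smul_comm, one_mul]

omit [CharZero K] in
lemma emb_smul_one (lv : Leav s s') (c : K) : emb s s' (c • (1 : Matrix ι ι K)) = c • 1 := by
  refine lv.exp_eq fun a b => ?_
  rw [lv.emb_ent, mul_smul_comm, mul_one, smul_mul_assoc, lv.orth, Matrix.smul_apply, Matrix.one_apply]
  split_ifs <;> simp

omit [CharZero K] in
lemma emb_mem (lv : Leav s s') (X : Matrix ι ι K) : emb s s' X ∈ lv.BB K 1 := fun a c => by
  rw [lv.emb_ent]; exact smul_mem _ (one_mem _) _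

omit [CharZero K] in
lemma emb_mat (lv : Leav s s') {χ : A →ₗ[K] K} (h1 : χ 1 = 1) {Z : A} (hZ : Z ∈ lv.BB K 1) : emb s s' (mat s s' χ Z) = Z := by
  refine lv.exp_eq fun a c => ?_
  rw [lv.emb_ent, lv.sc_of_mem h1 (hZ a c)]; rfl

omit [CharZero K] [DecidableEq ι] in
lemma chi_one (χ : A →ₗ[K] K) (Z : A) : chi s s' χ 1 Z = (mat s s' χ Z).trace := by
  rw [chi_succ]; rfl

omit [CharZero K] in
lemma E_emb (lv : Leav s s') (a c : ι) : s a * s' c = emb s s' (Matrix.single a c (1:K)) := by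
  refine lv.exp_eq fun x y => ?_
  rw [lv.emb_ent, ← mul_assoc, mul_assoc, lv.orth, lv.orth, Matrix.single_apply]
  by_cases h : x = a
  · subst h; simp
  · simp [h, Ne.symm h]

omit [CharZero K] in
lemma core (lv : Leav s s') {t0 : A} {M N : Matrix (ι × ι) (ι × ι) K} (hNM : N * M = 1)
    (hM : ∀ a c, s' a * t0 * s c = ∑ p : ι × ι, M p (a, c) • (s p.1 * s' p.2)) (z : Matrix ι ι K) :
    ∑ j : ι × ι × ι, lv.sig K ((∑ k : ι × ι, z k.1 k.2 * N k j.2) • (s j.1 * s' j.2.1)) * t0 * lv.sig K (s j.2.2 * s' j.1) = emb s s' z := by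
  refine lv.exp_eq fun x y => ?_
  rw [lv.emb_ent, mul_sum, sum_mul]
  have h : ∀ (u v : A), s' x * (lv.sig K u * t0 * lv.sig K v) * s y = u * (s' x * t0 * s y) * v := fun u v => by
    rw [← mul_assoc, ← mul_assoc, lv.s_sig]; simp only [mul_assoc, lv.sig_s]
  have h' : ∀ g o i, (s g * s' o) * (∑ p : ι × ι, M p (x, y) • (s p.1 * s' p.2)) * (s i * s' g) = M (o, i) (x, y) • (s g * s' g) := by
    intro g o i
    rw [mul_sum, sum_mul, sum_eq_single (o, i)]
    · rw [mul_smul_comm, smul_mul_assoc]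
      congr 1
      rw [mul_assoc, mul_assoc, mul_assoc, ← mul_assoc (s' i), ← mul_assoc (s' o), lv.orth, lv.orth]; simp
    · rintro ⟨o', i'⟩ _ hne
      rw [mul_smul_comm, smul_mul_assoc]
      have : s g * s' o * (s o' * s' i') * (s i * s' g) = s g * (s' o * s o') * (s' i' * s i) * s' g := by simp only [mul_assoc]
      rw [this, lv.orth, lv.orth]
      by_cases h1 : o = o'
      · by_cases h2 : i' = i
        · exact absurd (by rw [h1, h2]) hne
        · simp [h2]
      · simp [h1]
    · simp
  simp only [h, hM, smul_mul_assoc, h']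
  rw [Fintype.sum_prod_type]
  simp only [← Finset.smul_sum, smul_smul]
  simp only [← Finset.sum_smul]
  have e : ∑ o : ι × ι, (∑ k : ι × ι, z k.1 k.2 * N k o) * M o (x, y) = z x y := by
    simp only [sum_mul, mul_assoc]
    rw [sum_comm]
    simp only [← mul_sum]
    have : ∀ k, ∑ o, N k o * M o (x, y) = if k = (x, y) then 1 else 0 := fun k => by
      rw [← Matrix.mul_apply, hNM, Matrix.one_apply]
    simp [this]
  rw [e, ← Finset.smul_sum, lv.sum]

omit [CharZero K] in
lemma ptr (lv : Leav s s') (N : ℕ) : ∀ x ∈ lv.BB K (N+1), ∀ a b,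
    ∑ c, (lv.sig K ^ N) (s c * s' a) * x * (lv.sig K ^ N) (s b * s' c) ∈ lv.BB K N := by
  induction N with
  | zero =>
    intro x hx a b
    have : ∀ c, (lv.sig K ^ 0) (s c * s' a) * x * (lv.sig K ^ 0) (s b * s' c) = s c * (s' a * x * s b) * s' c := fun c => by
      simp [mul_assoc]
    simp only [this]
    obtain ⟨c, hc⟩ := Algebra.mem_bot.1 (hx a b)
    simp only [← hc, Algebra.algebraMap_eq_smul_one, mul_smul_comm, mul_one, smul_mul_assoc, ← Finset.smul_sum, lv.sum]
    exact smul_mem _ (one_mem _) _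
  | succ N ih =>
    intro x hx a b i j
    have := ih _ (hx i j) a b
    simp only [mul_sum, sum_mul]
    have e0 : ∀ u v, u = v → u ∈ lv.BB K N → v ∈ lv.BB K N := fun u v h => h ▸ id
    refine e0 _ _ ?_ this
    symm
    refine sum_congr rfl fun c _ => ?_
    rw [pow_succ', AlgHom.mul_apply, AlgHom.mul_apply, ← mul_assoc, ← mul_assoc, lv.s_sig]
    simp only [mul_assoc, lv.sig_s]

omit [CharZero K] in
theorem dat (lv : Leav s s') {q : K} {χ : A →ₗ[K] K} (h1 : χ 1 = 1) (hR : IsHeckeSymmetry K V q R)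
    (sy : Sys q (lv.TT b R) (Fintype.card ι) (lv.BB K) (chi s s' χ) (fun n => (lv.sig K)^n)) :
    ∃ D β t, Dat q (lv.TT b R) (Fintype.card ι) (lv.BB K) (chi s s' χ) (fun n => (lv.sig K)^n) (fun a c => s a * s' c) D β t := by
  obtain ⟨M, N, hMN, hNM, hM⟩ := sharp b lv hR
  set t0 := T0 s s' b R with ht0
  have hT0 : lv.TT b R 0 = t0 := by simp [TT, ht0]
  have hT1 : lv.TT b R 1 = lv.sig K t0 := by simp [TT, ht0]
  let Dm : Matrix ι ι K := of fun i o => ∑ a, N (a, a) (o, i)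
  let Bb : Matrix ι ι K := of fun x a => ∑ o, N (a, x) (o, o)
  have hrep : ∀ z : Matrix ι ι K, ∃ (J : Type) (_ : Fintype J) (p r : J → A),
      ∑ j, lv.sig K (p j) * t0 * lv.sig K (r j) = emb s s' z ∧ ∑ j, p j * r j = (Bb * z).trace • 1 := by
    intro z
    refine ⟨ι × ι × ι, inferInstance, _, _, lv.core hNM hM z, ?_⟩
    have : ∀ j : ι × ι × ι, (∑ k : ι × ι, z k.1 k.2 * N k j.2) • (s j.1 * s' j.2.1) * (s j.2.2 * s' j.1) =
        if j.2.1 = j.2.2 then (∑ k : ι × ι, z k.1 k.2 * N k j.2) • (s j.1 * s' j.1) else 0 := by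
      intro j
      rw [smul_mul_assoc, mul_assoc, ← mul_assoc (s' _), lv.orth]
      split_ifs <;> simp
    simp only [this]
    rw [Fintype.sum_prod_type, sum_comm, Fintype.sum_prod_type]
    simp only [Finset.sum_ite_irrel, ← Finset.smul_sum, lv.sum, Finset.sum_const_zero, Finset.sum_ite_eq, Finset.mem_univ, if_true]
    rw [← Finset.sum_smul]
    congr 1
    simp only [Matrix.trace, Matrix.diag, Matrix.mul_apply, Bb, of_apply, sum_mul]
    rw [sum_comm, Fintype.sum_prod_type, sum_comm]
    simp only [mul_comm]
  have hone : ∑ a, ∑ c, lv.sig K (s a * s' c) * t0 * lv.sig K (emb s s' Dm * (s c * s' a)) = 1 := by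
    have h := lv.core hNM hM 1
    have h2 := lv.emb_smul_one (1:K)
    rw [one_smul, one_smul] at h2
    rw [h2, Fintype.sum_prod_type] at h
    rw [← h]
    refine sum_congr rfl fun a _ => ?_
    rw [Fintype.sum_prod_type]
    refine sum_congr rfl fun c _ => ?_
    have : emb s s' Dm * (s c * s' a) = ∑ i, Dm i c • (s i * s' a) := by
      simp only [emb, sum_mul, smul_mul_assoc]
      refine sum_congr rfl fun i _ => ?_
      rw [sum_eq_single c]
      · rw [mul_assoc, ← mul_assoc (s' c), lv.orth]; simp
      · intro x _ hx; rw [mul_assoc, ← mul_assoc (s' x), lv.orth]; simp [hx]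
      · simp
    rw [this, map_sum, mul_sum]
    refine sum_congr rfl fun i _ => ?_
    rw [map_smul, map_smul, mul_smul_comm, smul_mul_assoc, smul_mul_assoc]
    congr 1
    simp only [Dm, of_apply]
    rw [Fintype.sum_prod_type]
    simp [Matrix.one_apply]
  have htt : Bb.trace = Dm.trace := by
    simp only [Matrix.trace, Matrix.diag, Bb, Dm, of_apply]
    rw [sum_comm]
  let β : A →ₗ[K] K := Matrix.traceLinearMap ι K K ∘ₗ LinearMap.mulLeft K Bb ∘ₗ
    ({ toFun := mat s s' χ
       map_add' := fun x y => by ext; simp [mat, mul_add, add_mul]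
       map_smul' := fun c x => by ext; simp [mat] } : A →ₗ[K] Matrix ι ι K)
  have hβ : ∀ Z, β Z = (Bb * mat s s' χ Z).trace := fun Z => rfl
  have hEm : ∀ a c, mat s s' χ (s a * s' c) = Matrix.single a c (1:K) := fun a c => by
    rw [lv.E_emb a c (K := K), lv.mat_emb h1]
  have hbD : Dm * Bb = (q⁻¹ * (1 - (q - 1) * Dm.trace)) • 1 := by
    have q0 := sy.hs.q0
    let F : A → A := fun y => ∑ x, s' x * emb s s' Bb * y * s x
    have Fl : ∀ y z, F (lv.sig K y * z) = y * F z := fun y z => by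
      simp only [F, mul_sum]
      refine sum_congr rfl fun x _ => ?_
      have := sy.tr.shc 1 _ (lv.emb_mem Bb) y
      rw [pow_one] at this
      have e2 : s' x * emb s s' Bb * (lv.sig K y * z) * s x = s' x * (emb s s' Bb * lv.sig K y) * z * s x := by simp only [mul_assoc]
      rw [e2, this, ← mul_assoc (s' x), lv.s_sig]; simp only [mul_assoc]
    have Fr : ∀ y z, F (z * lv.sig K y) = F z * y := fun y z => by
      simp only [F, sum_mul]
      refine sum_congr rfl fun x _ => ?_
      simp only [mul_assoc, lv.sig_s]
    have Fs : ∀ (J : Type) [Fintype J] (f : J → A), F (∑ j, f j) = ∑ j, F (f j) := fun J _ f => by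
      simp only [F, mul_sum, sum_mul]
      rw [sum_comm]
    have F1 : F 1 = Dm.trace • 1 := by
      simp only [F, mul_one, lv.emb_ent]
      rw [← Finset.sum_smul, ← htt]; rfl
    have FT : F t0 = 1 := by
      have : ∀ x, s' x * emb s s' Bb * t0 * s x = ∑ a, Bb x a • (s' a * t0 * s x) := fun x => by
        rw [mul_assoc (s' x), lv.mul_ent]
        simp only [lv.emb_ent, smul_mul_assoc, one_mul]
      simp only [F, this, hM, Finset.smul_sum, smul_smul]
      rw [sum_comm]
      have h3 : ∀ p, ∑ a, ∑ x, Bb x a * M p (a, x) = if p.1 = p.2 then 1 else 0 := by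
        intro p
        have : ∀ o, (M * N) p (o, o) = if p = (o, o) then 1 else 0 := fun o => by rw [hMN, Matrix.one_apply]
        simp only [Bb, of_apply, sum_mul]
        have h4 : ∑ o, (M * N) p (o, o) = if p.1 = p.2 then 1 else 0 := by
          simp only [this]
          rcases p with ⟨u, v⟩
          by_cases huv : u = v
          · subst huv; simp
          · rw [if_neg huv]
            refine sum_eq_zero fun o _ => if_neg ?_
            rintro h; simp only [Prod.mk.injEq] at h; exact huv (h.1.trans h.2.symm)
        rw [← h4]
        simp only [Matrix.mul_apply, Fintype.sum_prod_type]
        rw [Finset.sum_comm' (s := Finset.univ) (t := fun _ => Finset.univ) (t' := Finset.univ) (s' := fun _ => Finset.univ) (by simp)]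
        have : ∀ a : ι, ∑ x, ∑ o, N (a, x) (o, o) * M p (a, x) = ∑ o, ∑ x, M p (a, x) * N (a, x) (o, o) := fun a => by
          rw [sum_comm]; simp only [mul_comm]
        rw [sum_comm]
        simp only [this]
        rw [sum_comm]
      have h5 : ∑ a, ∑ x, ∑ p : ι × ι, (Bb x a * M p (a, x)) • (s p.1 * s' p.2) = ∑ p : ι × ι, (∑ a, ∑ x, Bb x a * M p (a, x)) • (s p.1 * s' p.2) := by
        simp only [Finset.sum_smul]
        rw [sum_comm]
        simp only [sum_comm (s := (Finset.univ : Finset ι)) (t := (Finset.univ : Finset (ι × ι)))]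
        refine sum_congr rfl fun p _ => sum_comm
      rw [h5]
      simp only [h3]
      rw [Fintype.sum_prod_type]
      simp [lv.sum]
    let Ti : A := q⁻¹ • (t0 - (q-1) • 1)
    have quad := sy.hs.quad 0
    have braid := sy.hs.braid 0
    rw [hT0] at quad
    rw [hT0, show 0 + 1 = 1 from rfl, hT1] at braid
    have hi1 : Ti * t0 = 1 := by
      simp only [Ti, smul_mul_assoc, sub_mul, one_mul, quad]; simp [q0]
    have hi2 : t0 * Ti = 1 := by
      simp only [Ti, mul_smul_comm, mul_sub, mul_one, quad]; simp [q0]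
    have FTi : F Ti = (q⁻¹ * (1 - (q - 1) * Dm.trace)) • 1 := by
      have : F Ti = q⁻¹ • (F t0 - (q-1) • F 1) := by
        simp only [F, Ti, mul_smul_comm, smul_mul_assoc, mul_sub, sub_mul, Finset.sum_sub_distrib, Finset.smul_sum, smul_sub]
      rw [this, FT, F1]; simp only [smul_sub, smul_smul, mul_sub, sub_smul]; congr 1 <;> ring_nf
    have hb : Ti * lv.sig K t0 * t0 = lv.sig K t0 * t0 * lv.sig K Ti := by
      have h6 : lv.sig K t0 * lv.sig K Ti = 1 := by rw [← map_mul, hi2, map_one]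
      calc Ti * lv.sig K t0 * t0 = Ti * (lv.sig K t0 * t0 * lv.sig K t0) * lv.sig K Ti := by
            simp only [mul_assoc, h6, mul_one]
        _ = _ := by rw [← braid, ← mul_assoc, ← mul_assoc, hi1, one_mul]
    have hF3 : F (Ti * lv.sig K t0 * t0) = 1 := by rw [hb, Fr, Fl, FT, mul_one, hi2]
    have hTi : Ti ∈ lv.BB K 2 := by
      have := sy.hT 0
      rw [hT0] at this
      exact smul_mem _ (sub_mem this (smul_mem _ (one_mem _) _)) _
    have ht2 : t0 ∈ lv.BB K 2 := by have := sy.hT 0; rwa [hT0] at this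
    have hs2 : ∀ y, (lv.sig K ^ 2) y = lv.sig K (lv.sig K y) := fun y => by rw [pow_two]; rfl
    have hF4 : ∀ z, F (Ti * lv.sig K (emb s s' z) * t0) = (Bb * z).trace • 1 := by
      intro z
      obtain ⟨J, _, p, r, e1, e2⟩ := hrep z
      have : Ti * lv.sig K (emb s s' z) * t0 = ∑ j, lv.sig K (lv.sig K (p j)) * (Ti * lv.sig K t0 * t0) * lv.sig K (lv.sig K (r j)) := by
        rw [← e1, map_sum, mul_sum, sum_mul]
        refine sum_congr rfl fun j _ => ?_
        have c1 := sy.tr.shc 2 _ hTi (p j)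
        have c2 := sy.tr.shc 2 _ ht2 (r j)
        simp only [hs2] at c1 c2
        rw [map_mul, map_mul]
        simp only [mul_assoc]
        rw [← c2, ← mul_assoc Ti, c1]; simp only [mul_assoc]
      rw [this, Fs]
      simp only [mul_assoc, Fl]
      simp only [← mul_assoc, Fr, hF3, one_mul]
      simp only [← map_mul, ← map_sum, e2, map_smul, map_one]
    have hfin : emb s s' Dm * emb s s' Bb = (q⁻¹ * (1 - (q - 1) * Dm.trace)) • 1 := by
      rw [← FTi]
      have : Ti = ∑ p : ι × ι, (Ti * lv.sig K (emb s s' (Matrix.single p.1 p.2 (1:K))) * t0) * lv.sig K (emb s s' Dm * (s p.2 * s' p.1)) := by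
        rw [Fintype.sum_prod_type]
        simp only [← lv.E_emb]
        conv_lhs => rw [← mul_one Ti, ← hone]
        simp only [mul_sum, mul_assoc]
      conv_rhs => rw [this, Fs]
      simp only [Fr, hF4, smul_mul_assoc, one_mul]
      rw [Fintype.sum_prod_type]
      have h9 : ∀ x y, (Bb * Matrix.single x y (1:K)).trace = Bb y x := fun x y => by
        simp [Matrix.trace_mul_single]
      simp only [h9]
      have h10 : emb s s' Bb = ∑ x, ∑ y, Bb y x • (s y * s' x) := by rw [emb, sum_comm]
      rw [h10]
      simp only [mul_sum, mul_smul_comm]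
    rw [lv.emb_mul, ← lv.emb_smul_one] at hfin
    have := congrArg (mat s s' χ) hfin
    rwa [lv.mat_emb h1, lv.mat_emb h1] at this
  refine ⟨emb s s' Dm, β, Dm.trace, ?_⟩
  constructor
  · intro a c; rw [lv.E_emb a c (K := K)]; exact lv.emb_mem _
  · exact lv.emb_mem _
  · have : ∀ a c, s a * s' c * emb s s' Dm * (s c * s' a) = Dm c c • (s a * s' a) := fun a c => by
      rw [show s a * s' c * emb s s' Dm * (s c * s' a) = s a * (s' c * emb s s' Dm * s c) * s' a by simp only [mul_assoc], lv.emb_ent]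
      simp
    simp only [this, ← Finset.sum_smul, ← Finset.smul_sum, lv.sum]; rfl
  · simpa [hT0] using hone
  · have : ∀ a c, s c * s' a * (s a * s' c) = s c * s' c := fun a c => by
      rw [mul_assoc, ← mul_assoc (s' a), lv.orth]; simp
    simp only [this, lv.sum]; simp [← Nat.cast_smul_eq_nsmul K]
  · exact lv.ptr
  · intro a x c e h
    rw [mul_assoc, ← mul_assoc (s' x), lv.orth, if_neg h]; simp
  · intro a x e
    rw [mul_assoc, ← mul_assoc (s' x), lv.orth, if_pos rfl]; simp
  · exact lv.sum
  · intro Z hZ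
    obtain ⟨J, i, p, r, e1, e2⟩ := hrep (mat s s' χ Z)
    refine ⟨J, i, p, r, ?_, e2⟩
    rw [lv.emb_mat h1 hZ] at e1
    simpa [hT0] using e1
  · intro hc Z hZ
    set c := q⁻¹ * (1 - (q - 1) * Dm.trace) with hcd
    have c0 : c ≠ 0 := mul_ne_zero (inv_ne_zero sy.hs.q0) hc
    have h7 : Bb * Dm = c • 1 := by
      have : Dm * (c⁻¹ • Bb) = 1 := by rw [Matrix.mul_smul, hbD, smul_smul, inv_mul_cancel₀ c0, one_smul]
      rw [mul_eq_one_comm, Matrix.smul_mul] at this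
      rw [← this, smul_smul, mul_inv_cancel₀ c0, one_smul]
    have h8 : mat s s' χ (emb s s' Dm * Z) = Dm * mat s s' χ Z := by
      conv_lhs => rw [← lv.emb_mat h1 hZ, lv.emb_mul, lv.mat_emb h1]
    rw [hβ, h8, ← Matrix.mul_assoc, h7, Matrix.smul_mul, one_mul, Matrix.trace_smul, chi_one]; rfl
  · simp only [chi_one, hEm]
    have : ∀ a c : ι, (Matrix.single c a (1:K)).trace • (s a * s' c) = if a = c then s a * s' a else 0 := fun a c => by
      by_cases h : a = c
      · subst h; simp [Matrix.trace]
      · rw [Matrix.trace_single_eq_of_ne _ _ _ (Ne.symm h), if_neg h, zero_smul]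
    simp only [this]; simp [lv.sum]
  · intro m n x; rw [pow_add]; rfl
end Leav
end HS

namespace HS
variable {K A ι : Type} [Field K] [CharZero K] [Ring A] [Algebra K A] [Fintype ι] {q : K} {T : ℕ → A}
variable {d : ℕ} {B : ℕ → Subalgebra K A} {χ : ℕ → A →ₗ[K] K} {σ : ℕ → A →ₐ[K] A} {E : ι → ι → A} {D : A} {β : A →ₗ[K] K} {t : K}

def Ex (σ : ℕ → A →ₐ[K] A) (E : ι → ι → A) (D : A) (N : ℕ) : A →ₗ[K] A :=
  ∑ a, ∑ b, mulLeftRight K (σ N (E a b), σ N (D * E b a))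

omit [CharZero K] in
lemma Ex_apply (N : ℕ) (x : A) : Ex σ E D N x = ∑ a, ∑ b, σ N (E a b) * x * σ N (D * E b a) := by
  simp [Ex, LinearMap.sum_apply, mulLeftRight_apply]

def EX (σ : ℕ → A →ₐ[K] A) (E : ι → ι → A) (D : A) (M : ℕ) : ℕ → A →ₗ[K] A
  | 0 => LinearMap.id
  | k+1 => EX σ E D M k ∘ₗ Ex σ E D (M+k)

def DD (σ : ℕ → A →ₐ[K] A) (D : A) : ℕ → A
  | 0 => 1
  | k+1 => DD σ D k * σ k D

namespace Dat
variable (sy : Sys q T d B χ σ) (da : Dat q T d B χ σ E D β t)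
include sy da

omit [CharZero K] in
lemma Ex_bim {N : ℕ} {x y : A} (hx : x ∈ B N) (hy : y ∈ B N) (z : A) : Ex σ E D N (x * z * y) = x * Ex σ E D N z * y := by
  simp only [Ex_apply, mul_sum, sum_mul]
  refine sum_congr rfl fun a _ => sum_congr rfl fun b _ => ?_
  have h1 := sy.tr.shc N x hx (E a b)
  have h2 := sy.tr.shc N y hy (D * E b a)
  calc σ N (E a b) * (x * z * y) * σ N (D * E b a) = (σ N (E a b) * x) * z * (y * σ N (D * E b a)) := by simp only [mul_assoc]
    _ = _ := by rw [← h1, h2]; simp only [mul_assoc]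

omit [CharZero K] in
lemma Ex_one (N : ℕ) : Ex σ E D N 1 = t • 1 := by
  have := congrArg (σ N) da.tr
  simp only [map_sum, map_mul, map_smul, map_one] at this
  simp only [Ex_apply, map_mul, mul_one, ← mul_assoc, this]

omit [CharZero K] in
lemma Ex_T (M : ℕ) : Ex σ E D (M+1) (T M) = 1 := by
  have := congrArg (σ M) da.one
  simp only [map_sum, map_mul, map_one, da.σσ, sy.hσ, Nat.add_zero] at this
  simp only [Ex_apply, map_mul, this]

omit [CharZero K] in
lemma Ex_HH (N : ℕ) {a : A} (ha : a ∈ HH K T (N+1)) : Ex σ E D N a ∈ HH K T N := by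
  cases N with
  | zero =>
    obtain ⟨c, rfl⟩ := HH_le_one (by omega) ha
    rw [map_smul, da.Ex_one sy]
    exact smul_mem _ (smul_mem _ (one_mem _) _) _
  | succ M =>
    have h := sy.hs.HH_succ M ha
    have : Submodule.span K ({z | z ∈ HH K T (M+1)} ∪ {z | ∃ x y, x ∈ HH K T (M+1) ∧ y ∈ HH K T (M+1) ∧ z = x * (T M * y)})
        ≤ (Subalgebra.toSubmodule (HH K T (M+1))).comap (Ex σ E D (M+1)) := by
      rw [Submodule.span_le]
      rintro z (hz | ⟨x, y, hx, hy, rfl⟩)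
      · show Ex σ E D (M+1) z ∈ HH K T (M+1)
        have := da.Ex_bim sy (sy.HH_le _ hz) (one_mem (B (M+1))) 1
        rw [mul_one, mul_one, mul_one, da.Ex_one sy] at this
        rw [this]
        exact mul_mem hz (smul_mem _ (one_mem _) _)
      · show Ex σ E D (M+1) _ ∈ HH K T (M+1)
        rw [← mul_assoc, da.Ex_bim sy (sy.HH_le _ hx) (sy.HH_le _ hy), da.Ex_T sy, mul_one]
        exact mul_mem hx hy
    exact this h

omit [CharZero K] in
lemma D_mem (N : ℕ) : σ N D ∈ B (N+1) := sy.tr.shm N 1 D da.D1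

lemma Ex_tr (hd : d ≠ 0) {N : ℕ} {a : A} (ha : a ∈ B (N+1)) : χ (N+1) (a * σ N D) = χ N (Ex σ E D N a) := by
  have hd' : (d : K) ≠ 0 := Nat.cast_ne_zero.2 hd
  have hx := mul_mem ha (da.D_mem sy N)
  have e1 : Ex σ E D N a = ∑ b, ∑ c, σ N (E c b) * (a * σ N D) * σ N (E b c) := by
    rw [Ex_apply, sum_comm]; simp only [map_mul, mul_assoc]
  have hm : Ex σ E D N a ∈ B N := by
    rw [e1]; exact sum_mem fun b _ => da.ptr N _ hx b b
  refine mul_left_cancel₀ hd' ?_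
  rw [← sy.tr.succ N _ hm, e1, map_sum]
  have e2 : ∀ b, χ (N+1) (∑ c, σ N (E c b) * (a * σ N D) * σ N (E b c)) = ∑ c, χ (N+1) ((a * σ N D) * σ N (E b c * E c b)) := fun b => by
    rw [map_sum]
    refine sum_congr rfl fun c _ => ?_
    rw [mul_assoc, sy.tr.comm (N+1) _ (sy.tr.shm N 1 _ (da.E1 c b)) _ (mul_mem hx (sy.tr.shm N 1 _ (da.E1 b c))), map_mul (σ N) (E b c)]
    simp only [mul_assoc]
  simp only [e2, ← map_sum, ← mul_sum]
  have := da.dim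
  rw [sum_comm] at this
  rw [sum_comm] at this
  rw [sum_comm, this]
  simp

omit [CharZero K] in
lemma DD_mem (k : ℕ) : DD σ D k ∈ B k := by
  induction k with
  | zero => exact one_mem _
  | succ k ih => exact mul_mem (sy.tr.mono _ ih) (da.D_mem sy k)

lemma EX_tr (hd : d ≠ 0) (M k : ℕ) : ∀ {a : A}, a ∈ HH K T (M+k) → χ (M+k) (a * σ M (DD σ D k)) = χ M (EX σ E D M k a) := by
  induction k with
  | zero => intro a _; simp [DD, EX]
  | succ k ih =>
    intro a ha
    have h1 := sy.tr.shm M k _ (da.DD_mem sy k)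
    show χ (M+k+1) _ = χ M (EX σ E D M k (Ex σ E D (M+k) a))
    rw [← ih (da.Ex_HH sy _ ha), DD, map_mul (σ M), da.σσ, ← mul_assoc,
      da.Ex_tr (N := M + k) sy hd (mul_mem (sy.HH_le _ ha) (sy.tr.mono _ h1))]
    have := da.Ex_bim sy (one_mem _) h1 a
    rw [one_mul, one_mul] at this
    rw [this]

lemma span (k : ℕ) {x : A} (hx : x ∈ B (k+1)) :
    x ∈ Submodule.span K {z | ∃ y ∈ B k, ∃ w ∈ B 1, z = y * σ k w} := by
  classical
  have : x = ∑ a, ∑ b, (∑ c, σ k (E c a) * x * σ k (E b c)) * σ k (E a b) := by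
    have h : ∀ a b, (∑ c, σ k (E c a) * x * σ k (E b c)) * σ k (E a b) = σ k (E a a) * x * σ k (E b b) := fun a b => by
      rw [sum_mul, sum_eq_single a]
      · rw [mul_assoc, ← map_mul, da.EE']
      · intro c _ hc
        rw [mul_assoc, ← map_mul, da.EE _ _ _ _ hc, map_zero, mul_zero]
      · simp
    simp only [h, ← mul_sum, ← sum_mul, ← map_sum, da.Es]
    simp
  rw [this]
  exact sum_mem fun a _ => sum_mem fun b _ => subset_span ⟨_, da.ptr k x hx a b, _, da.E1 a b, rfl⟩

lemma EX_off (M k : ℕ) {U : List ℕ} (hU : valid U) (hUl : U.length = M) : ∀ {w w' : List ℕ} {a : A}, w ∈ rel k U → w' ∈ rel k U → w' ≠ w →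
    a ∈ HH K T (M+k) → EX σ E D M k (idem q T (w' ++ U) * (a * idem q T (w ++ U))) = 0 := by
  induction k with
  | zero => intro w w' a hw hw' hne; simp only [rel, mem_singleton] at hw hw'; exact absurd (hw'.trans hw.symm) hne
  | succ k ih =>
    intro w w' a hw hw' hne ha
    rw [mem_rel hU] at hw hw'
    obtain ⟨hl, hv⟩ := hw
    obtain ⟨hl', hv'⟩ := hw'
    match w, w', hl, hl' with
    | r :: v, r' :: v', hl, hl' =>
      have hvl : v.length = k := by simpa using hl
      have hvl' : v'.length = k := by simpa using hl'
      have hVl : (v ++ U).length = M + k := by simp; omega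
      have hVl' : (v' ++ U).length = M + k := by simp; omega
      have hm := idem_mem (q := q) (T := T) (v ++ U)
      have hm' := idem_mem (q := q) (T := T) (v' ++ U)
      rw [hVl] at hm; rw [hVl'] at hm'
      set z := idem q T (r' :: v' ++ U) * (a * idem q T (r :: v ++ U)) with hz
      have hzm : z ∈ HH K T (M+k+1) := mul_mem (HH_mono (by simp; omega) (idem_mem _)) (mul_mem ha (HH_mono (by simp; omega) (idem_mem _)))
      have e1 : z = idem q T (v' ++ U) * z * idem q T (v ++ U) := by
        rw [hz, mul_assoc, mul_assoc, mul_assoc]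
        show idem q T (r' :: (v' ++ U)) * (a * idem q T (r :: (v ++ U))) = idem q T (v' ++ U) * (idem q T (r' :: (v' ++ U)) * (a * (idem q T (r :: (v ++ U)) * idem q T (v ++ U))))
        rw [sy.hs.idem_cons_right (S := v ++ U) hv.1, ← mul_assoc (idem q T (v' ++ U)), sy.hs.idem_cons_left (S := v' ++ U) hv'.1]
      have e2 : Ex σ E D (M+k) z = idem q T (v' ++ U) * (Ex σ E D (M+k) z * idem q T (v ++ U)) := by
        conv_lhs => rw [e1, da.Ex_bim sy (sy.HH_le _ hm') (sy.HH_le _ hm)]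
        rw [mul_assoc]
      show EX σ E D M k (Ex σ E D (M+k) z) = 0
      by_cases hr : v' = v
      · have hr' : r' ≠ r := fun h => hne (by rw [h, hr])
        have : z = 0 := by
          rw [hz]
          refine (sy.hs.block _ a ha _ _ (by simp; omega) (by simp; omega) hv' hv).1 ?_
          intro h
          have := h r
          simp [hr, count_cons, hr'] at this
        rw [this]; simp
      · rw [e2]
        exact ih ((mem_rel hU).2 ⟨hvl, hv.1⟩) ((mem_rel hU).2 ⟨hvl', hv'.1⟩) hr (da.Ex_HH sy _ hzm)

lemma EX_diag (M k : ℕ) {U : List ℕ} (hU : valid U) (hUl : U.length = M) {w : List ℕ} {p : A} (hw : w ∈ rel k U)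
    (hp : p ∈ HH K T (M+k)) (hpU : p * idem q T U = idem q T U * p) :
    EX σ E D M k (p * idem q T (w ++ U)) = EX σ E D M k (idem q T (w ++ U) * (p * idem q T (w ++ U))) := by
  have : p * idem q T (w ++ U) = ∑ w' ∈ rel k U, idem q T (w' ++ U) * (p * idem q T (w ++ U)) := by
    rw [← sum_mul, sy.hs.idem_sum_rel k hU, ← mul_assoc, ← hpU, mul_assoc, sy.hs.idem_app_left w hU]
  conv_lhs => rw [this, map_sum]
  exact sum_eq_single w (fun w' hw' hne => da.EX_off sy M k hU hUl hw hw' hne hp) (fun h => absurd hw h)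
end Dat
end HS

namespace HS

lemma scal {K : Type} [Field K] {I J : Finset ℕ} {c d : ℕ → K} (hc : Set.InjOn c I) (hd : Set.InjOn d J)
    (hcd : ∀ i ∈ I, ∀ j ∈ J, d j ≠ c i) (hIJ : I.card = J.card) (hc0 : ∀ i ∈ I, c i ≠ 0) (hd0 : ∀ j ∈ J, d j ≠ 0) :
    ∃ a : ℕ → K, (∀ j ∈ J, ∑ i ∈ I, a i / (d j - c i) = (d j)⁻¹) ∧ ∑ i ∈ I, a i ≠ 1 := by
  classical
  set Q := Lagrange.interpolate J d fun j => (∏ i ∈ I, (d j - c i)) / d j with hQ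
  have hQd : Q.degree < I.card := by rw [hIJ]; exact Lagrange.degree_interpolate_lt _ hd
  have hev : ∀ j ∈ J, Q.eval (d j) = (∏ i ∈ I, (d j - c i)) / d j := fun j hj => Lagrange.eval_interpolate_at_node _ hd hj
  refine ⟨fun i => Lagrange.nodalWeight I c i * Q.eval (c i), fun j hj => ?_, fun h1 => ?_⟩
  · have h := hev j hj
    rw [Lagrange.eq_interpolate hc hQd, Lagrange.eval_interpolate_not_at_node _ (fun i hi => hcd i hi j hj), Lagrange.eval_nodal] at h
    have hp : ∏ i ∈ I, (d j - c i) ≠ 0 := prod_ne_zero_iff.2 fun i hi => sub_ne_zero.2 (hcd i hi j hj)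
    rw [div_eq_mul_inv] at h
    rw [← mul_left_cancel₀ hp h]
    exact sum_congr rfl fun i _ => by rw [div_eq_mul_inv]; ring
  · have hl := Lagrange.coeff_eq_sum hc hQd
    have h1' : Q.coeff (I.card - 1) = 1 := by
      rw [hl, ← h1]
      refine sum_congr rfl fun i _ => ?_
      simp only [Lagrange.nodalWeight]
      rw [Finset.prod_inv_distrib, div_eq_mul_inv, mul_comm]
    have hI : 0 < I.card := by
      rcases Nat.eq_zero_or_pos I.card with h | h
      · rw [Finset.card_eq_zero.1 h] at h1; simp at h1
      · exact h
    have hdeg : (Lagrange.nodal I c - X * Q).degree < (J.card : WithBot ℕ) := by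
      rw [← hIJ, Polynomial.degree_lt_iff_coeff_zero]
      intro k hk
      rw [Polynomial.coeff_sub]
      obtain ⟨k, rfl⟩ : ∃ k', k = k' + 1 := ⟨k - 1, by omega⟩
      rw [Polynomial.coeff_X_mul]
      rcases eq_or_lt_of_le hk with h | h
      · have : k = I.card - 1 := by omega
        rw [this, h1', Nat.sub_add_cancel hI]
        have := Lagrange.nodal_monic (s := I) (v := c)
        rw [Polynomial.Monic, Polynomial.leadingCoeff, Lagrange.natDegree_nodal] at this
        rw [this, sub_self]
      · rw [Polynomial.coeff_eq_zero_of_degree_lt (by rw [Lagrange.degree_nodal]; exact_mod_cast h),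
          Polynomial.coeff_eq_zero_of_degree_lt (lt_of_lt_of_le hQd (by exact_mod_cast (by omega))), sub_zero]
    have h0 := Polynomial.eq_zero_of_degree_lt_of_eval_index_eq_zero _ hd hdeg fun j hj => by
      rw [Polynomial.eval_sub, Lagrange.eval_nodal, Polynomial.eval_mul, Polynomial.eval_X, hev j hj, mul_div_cancel₀ _ (hd0 j hj), sub_self]
    have := congrArg (Polynomial.eval 0) h0
    rw [Polynomial.eval_sub, Lagrange.eval_nodal, Polynomial.eval_mul, Polynomial.eval_X, zero_mul, sub_zero, Polynomial.eval_zero,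
      prod_eq_zero_iff] at this
    obtain ⟨i, hi, h⟩ := this
    exact hc0 i hi (by simpa using h)

open Classical in
def Rems (S : List ℕ) : Finset ℕ := (range S.length).filter (removable S)

lemma mem_Rems {S : List ℕ} (h : valid S) {r : ℕ} : r ∈ Rems S ↔ removable S r := by
  classical
  simp only [Rems, mem_filter, mem_range, and_iff_right_iff_imp]
  intro hr
  exact valid_mem h (count_pos_iff.1 (by unfold removable at hr; omega))

lemma Adds_eq {S : List ℕ} (h : valid S) : (Adds S).card = (Rems S).card + 1 := by
  classical
  have : Adds S = insert 0 ((Rems S).image Nat.succ) := by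
    ext r
    simp only [mem_Adds h, addable, mem_insert, mem_image, mem_Rems h, removable]
    constructor
    · rintro (h0 | h0)
      · exact Or.inl h0
      · refine Or.inr ⟨r - 1, ?_, ?_⟩ <;> rcases r with _ | r <;> simp at *
        exact h0
    · rintro (h0 | ⟨s, hs, rfl⟩)
      · exact Or.inl h0
      · exact Or.inr hs
  rw [this, Finset.card_insert_of_notMem (by simp), Finset.card_image_of_injective _ Nat.succ_injective]

lemma Adds_congr {S S' : List ℕ} (h : sh S = sh S') : Adds S = Adds S' := by
  classical
  have h' : ∀ i, S.count i = S'.count i := fun i => congrFun h i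
  unfold Adds
  rw [len_of_sh h]
  exact Finset.filter_congr fun r _ => addable_congr h'

section
variable {K A : Type} [Field K] [Ring A] [Algebra K A] {q : K} {T : ℕ → A}
omit [Ring A] in
lemma cont_congr {S S' : List ℕ} (h : sh S = sh S') : cont q S = cont q S' := by
  funext i; simp only [cont, cz]; rw [show S.count i = S'.count i from congrFun h i]

structure Iso (q : K) (T : ℕ → A) (S S' : List ℕ) (x y : A) : Prop where
  mx : x ∈ HH K T S.length
  my : y ∈ HH K T S.length
  xy : x * y = idem q T S'
  yx : y * x = idem q T S
  ex : idem q T S' * x = x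
  xe : x * idem q T S = x
  ey : idem q T S * y = y
  ye : y * idem q T S' = y

lemma HeckeSys.transport (hs : HeckeSys q T) {S S' : List ℕ} {x y : A} (h : sh S = sh S') (hy : y ∈ HH K T S.length)
    (xy : x * y = idem q T S') (xe : x * idem q T S = x) (r : ℕ) : x * idem q T (r :: S) * y = idem q T (r :: S') := by
  have hc : ∀ p : K[X], aeval (JM q T S.length) p * y = y * aeval (JM q T S.length) p := fun p => by
    have h1 : JM q T S.length ∈ Subalgebra.centralizer K {y} := by
      rw [Subalgebra.mem_centralizer_iff]; rintro _ rfl; exact hs.JM_comm_HH le_rfl hy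
    exact ((Subalgebra.mem_centralizer_iff K).1 (aeval_mem h1 p) y rfl).symm
  simp only [idem]
  rw [← mul_assoc, xe, mul_assoc, hc, ← mul_assoc, xy, Adds_congr h, cont_congr h, len_of_sh h]

lemma Sys.iso [CharZero K] {d : ℕ} {B : ℕ → Subalgebra K A} {χ : ℕ → A →ₗ[K] K} {σ : ℕ → A →ₐ[K] A} (sy : Sys q T d B χ σ)
    {S S' : List ℕ} (hS : valid S) (hS' : valid S') (h : sh S = sh S') : ∃ x y, Iso q T S S' x y := by
  obtain ⟨x, y, hx, hy, h1, h2⟩ := sy.trans_sh hS hS' h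
  have a1 := h1 _ (sy.hs.isW_idem hS)
  have a2 := h2 _ (sy.hs.isW_idem hS')
  have b1 := sy.hs.idem_act hS' a1.1
  have b2 := sy.hs.idem_act hS a2.1
  have i1 := sy.hs.idem_idem hS
  have i2 := sy.hs.idem_idem hS'
  have hl := len_of_sh h
  refine ⟨x * idem q T S, y * idem q T S', mul_mem hx (idem_mem _), mul_mem hy (hl ▸ idem_mem _), ?_, ?_, b1, ?_, b2, ?_⟩
  · rw [mul_assoc, b2, a2.2]
  · rw [mul_assoc, b1, a1.2]
  · rw [mul_assoc, i1]
  · rw [mul_assoc, i2]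
end
end HS

namespace HS
variable {K A ι : Type} [Field K] [CharZero K] [Ring A] [Algebra K A] [Fintype ι] {q : K} {T : ℕ → A}
variable {d : ℕ} {B : ℕ → Subalgebra K A} {χ : ℕ → A →ₗ[K] K} {σ : ℕ → A →ₐ[K] A} {E : ι → ι → A} {D : A} {β : A →ₗ[K] K} {t : K}

omit [CharZero K] in
lemma HeckeSys.yTx (hs : HeckeSys q T) {S U : List ℕ} {r : ℕ} {x y : A} (hv : valid (r :: U)) (hsh : sh S = sh (r :: U))
    (i : Iso q T S (r :: U) x y) : y * T U.length * x = ∑ b ∈ Adds S, adiag q (cont q U r) (cont q S b) • idem q T (b :: S) := by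
  classical
  have h1 : idem q T (r :: U) * T U.length * idem q T (r :: U) =
      ∑ b ∈ Adds (r :: U), adiag q (cont q U r) (cont q (r :: U) b) • idem q T (b :: r :: U) := by
    conv_lhs => rw [← hs.idem_sum hv, mul_assoc, sum_mul]
    refine sum_congr rfl fun b hb => ?_
    have hb' : valid (b :: r :: U) := ⟨hv, (mem_Adds hv).1 hb⟩
    rw [mul_sum, mul_sum, sum_eq_single b]
    · exact hs.T_diag hb'
    · intro b' hb2 hne
      refine hs.T_block rfl hb' ⟨hv, (mem_Adds hv).1 hb2⟩ ?_ ?_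
      · rintro ⟨_, h2, _, h3⟩; exact h3 h2
      · intro h; exact hne (List.cons.inj h).1.symm
    · exact fun h => absurd hb h
  have h2 : y * T U.length * x = y * (idem q T (r :: U) * T U.length * idem q T (r :: U)) * x := by
    rw [← mul_assoc, ← mul_assoc, i.ye, mul_assoc _ (idem q T (r :: U)) x, i.ex]
  rw [h2, h1, Adds_congr hsh, cont_congr hsh, mul_sum, sum_mul]
  refine sum_congr rfl fun b _ => ?_
  rw [mul_smul_comm, smul_mul_assoc, hs.transport hsh.symm (len_of_sh hsh ▸ i.mx) i.yx i.ye]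

namespace Dat
variable (sy : Sys q T d B χ σ) (da : Dat q T d B χ σ E D β t)
include sy da

theorem OS {M n : ℕ} {S : List ℕ} (hS : valid S) (hl : S.length = M + 1) (h0 : idem q T S ≠ 0) (hn : addable S n)
    (hn0 : idem q T (n :: S) = 0) (U : ℕ → List ℕ) (hU : ∀ r ∈ Rems S, valid (r :: U r) ∧ sh (r :: U r) = sh S) :
    1 - (q - 1) * t ≠ 0 ∧ ∃ (κ : ℕ → K) (x y : ℕ → A),
      (∀ r ∈ Rems S, Iso q T S (r :: U r) (x r) (y r)) ∧
      (∀ Z ∈ B 1, (q⁻¹ * (1 - (q-1) * t) * χ 1 Z) • idem q T S = ∑ r ∈ Rems S, κ r • (y r * σ M (D * Z) * x r)) ∧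
      (∀ r ∈ Rems S, ∀ V, valid V → sh V = sh (U r) → κ r • Ex σ E D M (idem q T (r :: V)) = (q⁻¹ * (1 - (q-1) * t)) • idem q T V) := by
  classical
  have hs := sy.hs
  have hq1 : q - 1 ≠ 0 := sub_ne_zero.2 hs.q_ne_one
  have hex : ∀ r, ∃ x y, r ∈ Rems S → Iso q T S (r :: U r) x y := fun r => by
    by_cases hr : r ∈ Rems S
    · obtain ⟨x, y, h⟩ := sy.iso hS (hU r hr).1 (hU r hr).2.symm
      exact ⟨x, y, fun _ => h⟩
    · exact ⟨0, 0, fun h => absurd h hr⟩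
  choose x y hxy using hex
  have hUl : ∀ r ∈ Rems S, (U r).length = M := fun r hr => by
    have := len_of_sh (hU r hr).2; simp at this; omega
  have hcU : ∀ r ∈ Rems S, cont q (U r) r = q ^ (cz S r - 1) := fun r hr => by
    have := congrFun (hU r hr).2 r
    simp only [sh, count_cons_self] at this
    simp only [cont, cz]; congr 1; omega
  obtain ⟨a, ha, ha1⟩ := scal (I := Rems S) (J := (Adds S).erase n) (c := fun r => q ^ (cz S r - 1)) (d := cont q S)
    (fun i _ j _ h => cz_inj hS (by have := hs.qz_inj h; omega))
    (fun i hi j hj h => hs.cont_injOn hS (Finset.mem_of_mem_erase hi) (Finset.mem_of_mem_erase hj) h)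
    (fun i hi j hj h => by
      have h1 := hs.qz_inj h
      have hi := (mem_Rems hS).1 hi
      have hj := (mem_Adds hS).1 (Finset.mem_of_mem_erase hj)
      unfold removable at hi
      rcases le_or_gt j i with h2 | h2
      · have := valid_anti hS h2; simp only [cz] at h1; omega
      · have := valid_anti hS (Nat.succ_le_of_lt h2); simp only [cz] at h1; simp at this; omega)
    (by rw [Finset.card_erase_of_mem ((mem_Adds hS).2 hn), Adds_eq hS]; rfl)
    (fun i _ => zpow_ne_zero _ hs.q0) (fun j _ => hs.cont_ne_zero S j)
  set κ : ℕ → K := fun r => a r / (q - 1) with hκ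
  have eA : idem q T S = ∑ r ∈ Rems S, κ r • (y r * T M * x r) := by
    have : ∀ r ∈ Rems S, κ r • (y r * T M * x r) = ∑ b ∈ Adds S, (κ r * adiag q (q ^ (cz S r - 1)) (cont q S b)) • idem q T (b :: S) := fun r hr => by
      rw [← hUl r hr, hs.yTx (hU r hr).1 (hU r hr).2.symm (hxy r hr), Finset.smul_sum, hcU r hr]
      simp only [smul_smul]
    rw [sum_congr rfl this, sum_comm, ← hs.idem_sum hS]
    refine sum_congr rfl fun b hb => ?_
    rw [← Finset.sum_smul]
    by_cases hbn : b = n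
    · rw [hbn, hn0, smul_zero]
    · have hd := hs.cont_ne_zero S b
      have h1 := ha b (Finset.mem_erase.2 ⟨hbn, hb⟩)
      have : ∑ r ∈ Rems S, κ r * adiag q (q ^ (cz S r - 1)) (cont q S b) = cont q S b * ∑ r ∈ Rems S, a r / (cont q S b - q ^ (cz S r - 1)) := by
        rw [mul_sum]
        refine sum_congr rfl fun r _ => ?_
        simp only [hκ, adiag]; field_simp
      rw [this, h1, mul_inv_cancel₀ hd, one_smul]
  have mS : idem q T S ∈ B (M+1) := sy.HH_le _ (hl ▸ idem_mem S)
  have mx : ∀ r ∈ Rems S, x r ∈ B (M+1) := fun r hr => sy.HH_le _ (hl ▸ (hxy r hr).mx)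
  have my : ∀ r ∈ Rems S, y r ∈ B (M+1) := fun r hr => sy.HH_le _ (hl ▸ (hxy r hr).my)
  have ht : t = ∑ r ∈ Rems S, κ r := by
    have h1 : Ex σ E D (M+1) (idem q T S) = t • idem q T S := by
      have := da.Ex_bim sy mS (one_mem (B (M+1))) 1
      rwa [mul_one, mul_one, mul_one, da.Ex_one sy, mul_smul_comm, mul_one] at this
    rw [eA, map_sum] at h1
    have h2 : ∀ r ∈ Rems S, Ex σ E D (M+1) (κ r • (y r * T M * x r)) = κ r • idem q T S := fun r hr => by
      rw [map_smul, da.Ex_bim sy (my r hr) (mx r hr), da.Ex_T sy, mul_one, (hxy r hr).yx]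
    rw [sum_congr rfl h2, ← eA, ← Finset.sum_smul] at h1
    exact (smul_left_injective K h0 h1).symm
  have htq : 1 - (q - 1) * t ≠ 0 := by
    rw [ht, mul_sum, sum_congr rfl (fun r _ => mul_div_cancel₀ (a r) hq1)]
    exact sub_ne_zero.2 (Ne.symm ha1)
  set c := q⁻¹ * (1 - (q-1) * t) with hc
  have e2 : ∀ Z ∈ B 1, (c * χ 1 Z) • idem q T S = ∑ r ∈ Rems S, κ r • (y r * σ M (D * Z) * x r) := fun Z hZ => by
    rw [← da.bD htq Z hZ]
    obtain ⟨J, _, p, s, h1, h2⟩ := da.sl _ (mul_mem da.D1 hZ)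
    have h3 : ∑ j, σ (M+1) (p j) * idem q T S * σ (M+1) (s j) = β (D * Z) • idem q T S := by
      have : ∀ j, σ (M+1) (p j) * idem q T S * σ (M+1) (s j) = idem q T S * σ (M+1) (p j * s j) := fun j => by
        rw [← sy.tr.shc _ _ mS, mul_assoc, map_mul]
      rw [sum_congr rfl fun j _ => this j, ← mul_sum, ← map_sum, h2, map_smul, map_one, mul_smul_comm, mul_one]
    rw [← h3, ← h1]
    simp only [map_sum, map_mul, da.σσ, sy.hσ, Nat.add_zero]
    conv_lhs => rw [eA]
    simp only [mul_sum, sum_mul, Finset.smul_sum]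
    rw [sum_comm]
    refine sum_congr rfl fun r hr => sum_congr rfl fun j _ => ?_
    rw [mul_smul_comm, smul_mul_assoc]
    congr 1
    rw [← mul_assoc, ← mul_assoc, ← sy.tr.shc _ _ (my r hr), mul_assoc _ (x r), sy.tr.shc _ _ (mx r hr)]
    simp only [mul_assoc]
  refine ⟨htq, κ, x, y, hxy, e2, fun r hr V hV hVU => ?_⟩
  have hvU := (hU r hr).1.1
  have mU : ∀ r ∈ Rems S, idem q T (U r) ∈ B M := fun r hr => sy.HH_le _ (hUl r hr ▸ idem_mem _)
  have eU : ∀ r' ∈ Rems S, Ex σ E D M (x r * y r') = idem q T (U r) * (Ex σ E D M (x r * y r') * idem q T (U r')) := fun r' hr' => by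
    have := da.Ex_bim sy (mU r hr) (mU r' hr') (x r * y r')
    rw [← mul_assoc (idem q T (U r)), ← this]
    congr 1
    have h1 : idem q T (U r) * x r = x r := by
      rw [← (hxy r hr).ex, ← mul_assoc, hs.idem_cons_left hvU]
    have h2 : y r' * idem q T (U r') = y r' := by
      rw [← (hxy r' hr').ye, mul_assoc, hs.idem_cons_right (hU r' hr').1.1]
    rw [← mul_assoc, h1, mul_assoc, h2]
  have mE : ∀ r' ∈ Rems S, Ex σ E D M (x r * y r') ∈ HH K T M := fun r' hr' =>
    da.Ex_HH sy M (mul_mem (hl ▸ (hxy r hr).mx) (hl ▸ (hxy r' hr').my))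
  obtain ⟨w, hw⟩ : ∃ w : K, Ex σ E D M (idem q T (r :: U r)) = w • idem q T (U r) := by
    have := (hs.block M _ (mE r hr) _ _ (hUl r hr) (hUl r hr) hvU hvU).2 rfl
    rw [← eU r hr, (hxy r hr).xy, mem_span_singleton] at this
    obtain ⟨w, h⟩ := this; exact ⟨w, h.symm⟩
  have hx0 : x r ≠ 0 := fun h => h0 (by rw [← (hxy r hr).yx, h, mul_zero])
  have key : c • x r = (κ r * w) • x r := by
    have h1 : c • x r = ∑ a, ∑ b, σ M (E a b) * x r * ((c * χ 1 (E b a)) • idem q T S) := by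
      have h2 := congrArg (σ M) da.cas
      simp only [map_sum, map_smul, map_one] at h2
      simp only [mul_smul_comm, mul_assoc, (hxy r hr).xe]
      have h3 : x r = (∑ a, ∑ b, χ 1 (E b a) • σ M (E a b)) * x r := by rw [h2, one_mul]
      conv_lhs => rw [h3]
      simp only [sum_mul, Finset.smul_sum, smul_mul_assoc, smul_smul]
    rw [h1]
    simp only [e2 _ (da.E1 _ _), mul_sum]
    have h3 : ∑ a, ∑ b, ∑ i ∈ Rems S, σ M (E a b) * x r * κ i • (y i * σ M (D * E b a) * x i) = ∑ i ∈ Rems S, κ i • (Ex σ E D M (x r * y i) * x i) := by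
      simp only [Ex_apply, sum_mul, Finset.smul_sum]
      rw [sum_congr rfl fun a _ => sum_comm, sum_comm]
      simp only [mul_smul_comm, mul_assoc]
    rw [h3, sum_eq_single r]
    · rw [(hxy r hr).xy, hw, smul_mul_assoc, smul_smul, ← (hxy r hr).ex, ← mul_assoc, hs.idem_cons_left hvU]
    · intro i hi hne
      rw [eU i hi, (hs.block M _ (mE i hi) _ _ (hUl r hr) (hUl i hi) hvU (hU i hi).1.1).1, zero_mul, smul_zero]
      intro h
      have h4 := (hU r hr).2.trans (hU i hi).2.symm
      rw [sh_cons, sh_cons, sameSh_iff.1 h] at h4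
      have := congrFun h4 r
      simp [up, Ne.symm hne] at this
    · exact fun h => absurd hr h
  have hcw := smul_left_injective K hx0 key
  obtain ⟨u, v, i⟩ := sy.iso hvU hV hVU.symm
  have hmu : u ∈ B M := sy.HH_le _ (hUl r hr ▸ i.mx)
  have hmv : v ∈ B M := sy.HH_le _ (hUl r hr ▸ i.my)
  rw [← hs.transport hVU.symm i.my i.xy i.xe r, da.Ex_bim sy hmu hmv, hw, mul_smul_comm, smul_mul_assoc, i.xe, i.xy, smul_smul, ← hcw]
end Dat
end HS

namespace HS

def IsSh (f : ℕ → ℕ) : Prop := ∃ S, valid S ∧ sh S = f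
open Classical in
def W (f : ℕ → ℕ) : List ℕ := if h : IsSh f then h.choose else []
lemma W_spec {f : ℕ → ℕ} (h : IsSh f) : valid (W f) ∧ sh (W f) = f := by
  rw [W, dif_pos h]; exact h.choose_spec

open Classical in
def RW : ℕ → (ℕ → ℕ) → Finset (List ℕ)
  | 0, _ => {[]}
  | k+1, f => (Rems (W f)).biUnion fun r => (RW k (dn f r)).image (r :: ·)

def sub (f : ℕ → ℕ) (w : List ℕ) (i : ℕ) : ℕ := f i - w.count i

lemma sub_cons (f : ℕ → ℕ) (r : ℕ) (w : List ℕ) : sub f (r :: w) = sub (dn f r) w := by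
  funext i
  simp only [sub, dn, count_cons, beq_iff_eq, eq_comm (a := r)]
  split_ifs <;> omega

lemma sub_app (w V : List ℕ) : sub (sh (w ++ V)) w = sh V := by
  funext i; simp [sub, sh, count_app]

lemma dn_up (f : ℕ → ℕ) (r : ℕ) : dn (up f r) r = f := by
  funext i; simp only [up, dn]; split_ifs <;> omega

lemma rem_dn {f : ℕ → ℕ} (hf : IsSh f) {r : ℕ} (hr : r ∈ Rems (W f)) :
    IsSh (dn f r) ∧ ∀ V, valid V → sh V = dn f r → valid (r :: V) ∧ sh (r :: V) = f := by
  obtain ⟨h1, h2⟩ := W_spec hf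
  have hr' : f (r+1) < f r := by rw [← h2]; exact (mem_Rems h1).1 hr
  have ha : Antitone f := h2 ▸ sh_anti h1
  have hb : ∀ i, (W f).length ≤ i → f i = 0 := fun i hi => (congrFun h2 i).symm.trans (sh_bdd h1 i hi)
  refine ⟨Par.word (n := (W f).length) ⟨antitone_nat_of_succ_le fun i => ?_, fun i hi => ?_⟩, fun V hV hs => ⟨⟨hV, ?_⟩, ?_⟩⟩
  · have := ha (le_succ i); simp only [dn, Nat.succ_eq_add_one] at *
    by_cases h4 : i = r
    · subst h4; simp; omega
    · rw [if_neg h4]; omega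
  · simp [dn, hb i hi]
  · by_cases h0 : r = 0
    · exact Or.inl h0
    · have e1 := congrFun hs r
      have e2 := congrFun hs (r-1)
      have := ha (Nat.sub_le r 1)
      simp only [sh, dn, if_true] at e1 e2
      rw [if_neg (by omega)] at e2
      exact Or.inr (by omega)
  · rw [sh_cons, hs, up_dn (by omega)]

lemma mem_RW {k : ℕ} : ∀ {f : ℕ → ℕ} (hf : IsSh f) {w : List ℕ},
    w ∈ RW k f ↔ w.length = k ∧ ∃ V, valid (w ++ V) ∧ sh (w ++ V) = f := by
  classical
  induction k with
  | zero =>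
    intro f hf w
    simp only [RW, mem_singleton, length_eq_zero_iff]
    exact ⟨fun h => ⟨h, by subst h; exact hf⟩, fun h => h.1⟩
  | succ k ih =>
    intro f hf w
    simp only [RW, mem_biUnion, mem_image]
    constructor
    · rintro ⟨r, hr, w', hw', rfl⟩
      obtain ⟨h1, h2⟩ := rem_dn hf hr
      obtain ⟨h3, V, h4, h5⟩ := (ih h1).1 hw'
      exact ⟨by simp [h3], V, h2 _ h4 h5⟩
    · rintro ⟨hl, V, hV, rfl⟩
      match w, hl with
      | r :: w', hl =>
        have hr : r ∈ Rems (W (sh (r :: w' ++ V))) := by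
          obtain ⟨h1, h2⟩ := W_spec hf
          rw [mem_Rems h1]
          have := removable_head (S := w' ++ V) (r := r) hV
          unfold removable at this ⊢
          have e : ∀ i, (W (sh (r :: w' ++ V))).count i = (r :: (w' ++ V)).count i := fun i => congrFun h2 i
          rw [e, e]; exact this
        refine ⟨r, hr, w', (ih (rem_dn hf hr).1).2 ⟨by simpa using hl, V, hV.1, ?_⟩, rfl⟩
        show _ = dn (sh (r :: (w' ++ V))) r
        rw [sh_cons, dn_up]

lemma sum_RW {G : Type} [AddCommMonoid G] (k : ℕ) (f : ℕ → ℕ) (F : List ℕ → G) :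
    ∑ w ∈ RW (k+1) f, F w = ∑ r ∈ Rems (W f), ∑ w ∈ RW k (dn f r), F (r :: w) := by
  classical
  rw [RW, sum_biUnion]
  · exact sum_congr rfl fun r _ => sum_image (fun a _ b _ h => (List.cons.inj h).2)
  · intro r _ r' _ hne
    rw [Function.onFun, disjoint_left]
    intro w h1 h2
    obtain ⟨a, _, rfl⟩ := mem_image.1 h1
    obtain ⟨b, _, h⟩ := mem_image.1 h2
    exact hne (List.cons.inj h).1.symm

lemma RW_spec {k : ℕ} {f : ℕ → ℕ} (hf : IsSh f) {w : List ℕ} (hw : w ∈ RW k f) :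
    IsSh (sub f w) ∧ valid (w ++ W (sub f w)) ∧ sh (w ++ W (sub f w)) = f := by
  induction k generalizing f w with
  | zero =>
    simp only [RW, mem_singleton] at hw; subst hw
    have : sub f [] = f := by funext i; simp [sub]
    rw [this]; exact ⟨hf, W_spec hf⟩
  | succ k ih =>
    classical
    simp only [RW, mem_biUnion, mem_image] at hw
    obtain ⟨r, hr, w', hw', rfl⟩ := hw
    obtain ⟨h1, h2⟩ := rem_dn hf hr
    rw [sub_cons]
    obtain ⟨h3, h4, h5⟩ := ih h1 hw'
    exact ⟨h3, h2 _ h4 h5⟩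

def Dp (m n j : ℕ) (f : ℕ → ℕ) : Prop := f n = m ∧ f (n+j) = m ∧ (0 < n → m + j + 1 ≤ f (n-1))

lemma Dp.dn {m n j : ℕ} {f : ℕ → ℕ} (hf : IsSh f) (h : Dp m n (j+1) f) {r : ℕ} (hr : f (r+1) < f r) : Dp m n j (dn f r) := by
  obtain ⟨h1, h2, h3⟩ := h
  obtain ⟨S, hS, rfl⟩ := hf
  have ha := sh_anti hS
  have hn : ¬ (n ≤ r ∧ r ≤ n + j) := fun h => by
    have := ha h.1; have := ha (show r + 1 ≤ n + (j+1) by omega); omega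
  have a1 := ha (show n ≤ n + j by omega)
  have a2 := ha (show n + j ≤ n + (j+1) by omega)
  refine ⟨?_, ?_, fun h => ?_⟩ <;> simp only [HS.dn] <;> split_ifs <;> omega

variable {K A ι : Type} [Field K] [CharZero K] [Ring A] [Algebra K A] [Fintype ι] {q : K} {T : ℕ → A}
variable {d : ℕ} {B : ℕ → Subalgebra K A} {χ : ℕ → A →ₗ[K] K} {σ : ℕ → A →ₐ[K] A} {E : ι → ι → A} {D : A} {β : A →ₗ[K] K} {t : K}

namespace Dat
variable (sy : Sys q T d B χ σ) (da : Dat q T d B χ σ E D β t)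
include sy da

theorem claim (hB : ∀ Z ∈ B 0, Z = χ 0 Z • 1) {m n : ℕ} (hz : ∀ S, valid S → m + 1 ≤ S.count n → idem q T S = 0) {c : K} (hc : c = q⁻¹ * (1 - (q-1) * t)) {M : ℕ} (k : ℕ) :
    ∀ f, IsSh f → Dp m n k f → idem q T (W f) ≠ 0 → (W f).length = M + k → c ^ k ≠ 0 ∧ ∃ (κ : List ℕ → K) (x y : List ℕ → A),
      (∀ Z ∈ B k, (c ^ k * χ k Z) • idem q T (W f) = ∑ w ∈ RW k f, κ w • (y w * σ M (DD σ D k * Z) * x w)) ∧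
      (∀ w ∈ RW k f, x w ∈ HH K T (M + k) ∧ y w ∈ HH K T (M + k) ∧ x w * y w = idem q T (w ++ W (sub f w)) ∧ x w * idem q T (W f) = x w) ∧
      (∀ w ∈ RW k f, κ w • EX σ E D M k (idem q T (w ++ W (sub f w))) = c ^ k • idem q T (W (sub f w))) := by
  have hs := sy.hs
  induction k with
  | zero =>
    intro f hf _ _ hl
    have h0 : sub f [] = f := by funext i; simp [sub]
    refine ⟨by simp, fun _ => 1, fun _ => idem q T (W f), fun _ => idem q T (W f), fun Z hZ => ?_, ?_, ?_⟩
    · simp only [RW, sum_singleton, DD, pow_zero, one_mul, one_smul]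
      conv_rhs => rw [hB Z hZ, map_smul, map_one, mul_smul_comm, mul_one, smul_mul_assoc, hs.idem_idem (W_spec hf).1]
    · intro w hw
      simp only [RW, mem_singleton] at hw; subst hw
      have hm : idem q T (W f) ∈ HH K T M := by rw [show M = (W f).length by omega]; exact idem_mem _
      rw [h0]
      exact ⟨hm, hm, hs.idem_idem (W_spec hf).1, hs.idem_idem (W_spec hf).1⟩
    · intro w hw
      simp only [RW, mem_singleton] at hw; subst hw
      simp [h0, EX]
  | succ k ih =>
    intro f hf hD h0 hl
    obtain ⟨hv, hsh⟩ := W_spec hf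
    have hcnt : ∀ i, (W f).count i = f i := fun i => congrFun hsh i
    have hU : ∀ r ∈ Rems (W f), valid (r :: W (dn f r)) ∧ sh (r :: W (dn f r)) = sh (W f) := fun r hr => by
      obtain ⟨h1, h2⟩ := rem_dn hf hr
      have h3 := W_spec h1
      rw [hsh]; exact h2 _ h3.1 h3.2
    have han : addable (W f) n := by
      unfold addable; rw [hcnt, hcnt]
      obtain ⟨h1, h2, h3⟩ := hD
      rcases Nat.eq_zero_or_pos n with h | h
      · exact Or.inl h
      · have := h3 h; exact Or.inr (by omega)
    obtain ⟨htq, κ, x, y, hi, hZ, hE⟩ := da.OS sy (M := M + k) hv hl h0 han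
      (hz _ ⟨hv, han⟩ (by rw [count_cons_self, hcnt, hD.1])) _ hU
    rw [← hc] at hZ hE
    have hUl : ∀ r ∈ Rems (W f), (W (dn f r)).length = M + k := fun r hr => by
      have := len_of_sh (hU r hr).2; simp at this; omega
    have ihr : ∀ r, ∃ (κ' : List ℕ → K) (x' y' : List ℕ → A), r ∈ Rems (W f) → c ^ k ≠ 0 ∧
        (∀ Z ∈ B k, (c ^ k * χ k Z) • idem q T (W (dn f r)) = ∑ w ∈ RW k (dn f r), κ' w • (y' w * σ M (DD σ D k * Z) * x' w)) ∧
        (∀ w ∈ RW k (dn f r), x' w ∈ HH K T (M + k) ∧ y' w ∈ HH K T (M + k) ∧ x' w * y' w = idem q T (w ++ W (sub (dn f r) w)) ∧ x' w * idem q T (W (dn f r)) = x' w) ∧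
        (∀ w ∈ RW k (dn f r), κ' w • EX σ E D M k (idem q T (w ++ W (sub (dn f r) w))) = c ^ k • idem q T (W (sub (dn f r) w))) := fun r => by
      by_cases hr : r ∈ Rems (W f)
      · obtain ⟨h1, h2⟩ := rem_dn hf hr
        have hr' : f (r+1) < f r := by
          have := (mem_Rems hv).1 hr; unfold removable at this; rwa [hcnt, hcnt] at this
        obtain ⟨hck, κ', x', y', h⟩ := ih (dn f r) h1 (hD.dn hf hr') (fun h => h0 (by
          rw [← (hi r hr).yx, ← (hi r hr).ex, idem, h, zero_mul, zero_mul, mul_zero])) (hUl r hr)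
        exact ⟨κ', x', y', fun _ => ⟨hck, h⟩⟩
      · exact ⟨0, 0, 0, fun h => absurd h hr⟩
    choose κ' x' y' hI using ihr
    have hc0 : c ≠ 0 := by rw [hc]; exact mul_ne_zero (inv_ne_zero hs.q0) htq
    refine ⟨pow_ne_zero _ hc0, fun w => match w with | [] => 0 | r :: w => κ r * κ' r w,
      fun w => match w with | [] => 0 | r :: w => x' r w * x r, fun w => match w with | [] => 0 | r :: w => y r * y' r w, ?_, ?_, ?_⟩
    · intro Z hZm
      have hsp := da.span sy k hZm
      clear hZm
      rw [sum_RW]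
      simp only
      induction hsp using span_induction with
      | zero => simp
      | add u v _ _ hu hw =>
        simp only [map_add, mul_add, add_smul, add_mul, smul_add, sum_add_distrib, hu, hw]
      | smul a u _ hu =>
        have : (c ^ (k+1) * χ (k+1) (a • u)) • idem q T (W f) = a • ((c ^ (k+1) * χ (k+1) u) • idem q T (W f)) := by
          rw [smul_smul, map_smul, smul_eq_mul]; congr 1; ring
        rw [this, hu, Finset.smul_sum]
        refine sum_congr rfl fun r _ => ?_
        rw [Finset.smul_sum]
        refine sum_congr rfl fun w _ => ?_
        rw [mul_smul_comm, map_smul, mul_smul_comm, smul_mul_assoc, smul_comm]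
      | mem u hu =>
        obtain ⟨Y, hY, z, hz1, rfl⟩ := hu
        have e1 : c ^ (k+1) * χ (k+1) (Y * σ k z) = (c ^ k * χ k Y) * (c * χ 1 z) := by
          rw [sy.tr.sht k 1 Y hY z hz1]; ring
        rw [e1, mul_smul, hZ z hz1, Finset.smul_sum]
        refine sum_congr rfl fun r hr => ?_
        obtain ⟨-, i1, i2, i3⟩ := hI r hr
        have hyU : y r * idem q T (W (dn f r)) = y r := by
          rw [← (hi r hr).ye, mul_assoc, hs.idem_cons_right (hU r hr).1.1]
        have e2 : (c ^ k * χ k Y) • κ r • (y r * σ (M+k) (D * z) * x r) =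
            κ r • (y r * ((c ^ k * χ k Y) • idem q T (W (dn f r))) * σ (M+k) (D * z) * x r) := by
          rw [mul_smul_comm, hyU, smul_mul_assoc, smul_mul_assoc, smul_comm]
        rw [e2, i1 Y hY, mul_sum, sum_mul, sum_mul, Finset.smul_sum]
        refine sum_congr rfl fun w hw => ?_
        have e3 : σ M (DD σ D (k+1) * (Y * σ k z)) = σ M (DD σ D k * Y) * σ (M+k) (D * z) := by
          rw [DD, ← da.σσ, ← map_mul (σ M), map_mul (σ k)]
          congr 1
          rw [mul_assoc, ← mul_assoc (σ k D), ← sy.tr.shc k Y hY]; simp only [mul_assoc]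
        have e4 := sy.tr.shc (M+k) _ (sy.HH_le _ (i2 w hw).1) (D * z)
        rw [e3, mul_smul_comm, smul_mul_assoc, smul_mul_assoc, smul_smul]
        congr 1
        simp only [mul_assoc]
        rw [← mul_assoc (x' r w), e4]; simp only [mul_assoc]
    · intro w hw
      classical
      simp only [RW, mem_biUnion, mem_image] at hw
      obtain ⟨r, hr, w, hw, rfl⟩ := hw
      obtain ⟨-, i1, i2, i3⟩ := hI r hr
      obtain ⟨j1, j2, j3, j4⟩ := i2 w hw
      have hsw := RW_spec (rem_dn hf hr).1 hw
      have mx := hl ▸ (hi r hr).mx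
      have my := hl ▸ (hi r hr).my
      refine ⟨mul_mem (HH_mono (by omega) j1) mx, mul_mem my (HH_mono (by omega) j2), ?_, ?_⟩
      · simp only
        rw [sub_cons, mul_assoc, ← mul_assoc (x r), (hi r hr).xy, ← mul_assoc]
        exact hs.transport ((W_spec (rem_dn hf hr).1).2.trans hsw.2.2.symm) ((hUl r hr).symm ▸ j2) j3 j4 r
      · simp only
        rw [mul_assoc, (hi r hr).xe]
    · intro w hw
      classical
      simp only [RW, mem_biUnion, mem_image] at hw
      obtain ⟨r, hr, w, hw, rfl⟩ := hw
      obtain ⟨-, i1, i2, i3⟩ := hI r hr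
      have hsw := RW_spec (rem_dn hf hr).1 hw
      have h1 := hE r hr _ hsw.2.1 (hsw.2.2.trans (W_spec (rem_dn hf hr).1).2.symm)
      show (κ r * κ' r w) • EX σ E D M k (Ex σ E D (M+k) (idem q T (r :: (w ++ W (sub f (r :: w)))))) = _
      rw [sub_cons, mul_comm, mul_smul, ← map_smul, h1, map_smul, smul_comm, i3 w hw, smul_smul, pow_succ, mul_comm]
end Dat
end HS

namespace HS
variable {K A ι : Type} [Field K] [CharZero K] [Ring A] [Algebra K A] [Fintype ι] {q : K} {T : ℕ → A}
variable {d : ℕ} {B : ℕ → Subalgebra K A} {χ : ℕ → A →ₗ[K] K} {σ : ℕ → A →ₐ[K] A} {E : ι → ι → A} {D : A} {β : A →ₗ[K] K} {t : K}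

namespace Dat
variable (sy : Sys q T d B χ σ) (da : Dat q T d B χ σ E D β t)
include sy da

theorem kstep (hd : d ≠ 0) (hB : ∀ Z ∈ B 0, Z = χ 0 Z • 1) {m n : ℕ} (hz : ∀ S, valid S → m + 1 ≤ S.count n → idem q T S = 0)
    {M k : ℕ} {f : ℕ → ℕ} (hf : IsSh f) (hD : Dp m n k f) (h0 : Nf q T χ f ≠ 0) (hl : (W f).length = M + k) :
    ∃ F : Finset (ℕ → ℕ), (∀ g, g ∈ F ↔ IsSh g ∧ f ∈ LS k (W g)) ∧
      Nw q T χ (row k) * Nf q T χ f = ∑ g ∈ F, Nf q T χ g := by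
  classical
  have hs := sy.hs
  obtain ⟨hv, hsh⟩ := W_spec hf
  have hNf : Nf q T χ f = Nw q T χ (W f) := by rw [← sy.Nf_sh hv, hsh]
  have h0' : idem q T (W f) ≠ 0 := fun h => h0 (hNf.trans ((sy.Nw_zero hv).2 h))
  have hNs := sy.Nw_spec hv
  rw [hl, ← hNf] at hNs
  obtain ⟨hc, κ, x, y, hi, hxy, hE⟩ := da.claim sy hB hz rfl k f hf hD h0' hl
  set c := q⁻¹ * (1 - (q-1) * t) with hcd
  have hP := sy.idem_B (row k)
  rw [length_replicate] at hP
  have hNr := sy.Nw_spec (valid_row k)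
  rw [length_replicate] at hNr
  have key : (Nf q T χ f : K) * (Nw q T χ (row k) * Nf q T χ f) =
      ∑ w ∈ RW k f, (Nf q T χ (sub f w) : K) * χ (M+k) (idem q T (w ++ W (sub f w)) * Psh q T σ M k) := by
    have h1 := congrArg (χ (M+k)) (hi _ hP)
    rw [map_smul, smul_eq_mul, hNr, hNs, map_sum] at h1
    apply mul_left_cancel₀ hc
    calc c ^ k * (Nf q T χ f * (Nw q T χ (row k) * Nf q T χ f)) = Nf q T χ f * (c ^ k * (Nw q T χ (row k)) * Nf q T χ f) := by ring
      _ = _ := by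
        rw [h1, mul_sum, mul_sum]
        refine sum_congr rfl fun w hw => ?_
        obtain ⟨mx, my, exy, -⟩ := hxy w hw
        obtain ⟨s1, s2, s3⟩ := RW_spec hf hw
        obtain ⟨v1, v2⟩ := W_spec s1
        have hwl : w.length = k := ((mem_RW hf).1 hw).1
        have hVl : (W (sub f w)).length = M := by
          have := len_of_sh (s3.trans hsh.symm); simp at this; omega
        have hel : (w ++ W (sub f w)).length = M + k := by simp; omega
        obtain ⟨-, p2, p3, -⟩ := sy.Psh_props (W (sub f w)) k
        rw [hVl] at p2 p3
        have heH : idem q T (w ++ W (sub f w)) ∈ HH K T (M+k) := hel ▸ idem_mem _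
        set e := idem q T (w ++ W (sub f w)) with he
        set P := Psh q T σ M k with hPd
        have mD := sy.tr.shm M k _ (da.DD_mem sy k)
        have bP := sy.HH_le _ p2
        have be := sy.HH_le _ heH
        have e1 : χ (M+k) (y w * σ M (DD σ D k * idem q T (row k)) * x w) = χ M (EX σ E D M k (e * (P * e))) := by
          have bb : σ M (DD σ D k) * P ∈ B (M+k) := mul_mem mD bP
          rw [map_mul (σ M), show σ M (idem q T (row k)) = P from rfl,
            sy.tr.comm _ _ (mul_mem (sy.HH_le _ my) bb) _ (sy.HH_le _ mx), ← mul_assoc, exy, ← mul_assoc,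
            sy.tr.comm _ _ (mul_mem be mD) _ bP, ← mul_assoc, da.EX_tr sy hd M k (mul_mem p2 heH),
            da.EX_diag sy M k v1 hVl ((mem_rel v1).2 ⟨hwl, s2⟩) p2 p3]
        obtain ⟨s, hss⟩ := mem_span_singleton.1 ((hs.block _ _ p2 _ _ hel hel s2 s2).2 rfl)
        rw [← he] at hss
        have hNe := sy.Nw_spec s2
        rw [hel, ← sy.Nf_sh s2, s3] at hNe
        have hNv := sy.Nw_spec v1
        rw [hVl, ← sy.Nf_sh v1, v2] at hNv
        have e2 : χ (M+k) (e * P) = s * Nf q T χ f := by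
          rw [← hNe, ← he, ← smul_eq_mul s, ← map_smul, hss, sy.tr.comm _ _ be _ (mul_mem bP be), mul_assoc, hs.idem_idem s2,
            sy.tr.comm _ _ bP _ be]
        have h3 := hE w hw
        rw [map_smul, e1, ← hss, map_smul, map_smul, e2, smul_eq_mul, smul_eq_mul, mul_left_comm (κ w), ← smul_eq_mul (κ w), ← map_smul (χ M), h3, map_smul, smul_eq_mul, hNv]
        ring
  refine ⟨((RW k f).image (sub f)).filter fun g => f ∈ LS k (W g), fun g => ?_, ?_⟩
  · rw [mem_filter, mem_image]
    constructor
    · rintro ⟨⟨w, hw, rfl⟩, h⟩; exact ⟨(RW_spec hf hw).1, h⟩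
    · rintro ⟨hg, h⟩
      refine ⟨?_, h⟩
      obtain ⟨v1, v2⟩ := W_spec hg
      obtain ⟨w, h1, h2, rfl⟩ := (mem_Lam v1).1 (sy.LS_sub h)
      exact ⟨w, (mem_RW hf).2 ⟨h1, _, h2, rfl⟩, by rw [sub_app, v2]⟩
  · have h1 : (Nf q T χ f : K) ≠ 0 := Nat.cast_ne_zero.2 h0
    have : ((Nw q T χ (row k) * Nf q T χ f : ℕ) : K) = ((∑ g ∈ ((RW k f).image (sub f)).filter fun g => f ∈ LS k (W g), Nf q T χ g : ℕ) : K) := by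
      apply mul_left_cancel₀ h1
      push_cast
      rw [key, ← sum_fiberwise_of_maps_to (s := RW k f) (g := sub f) (t := (RW k f).image (sub f)) fun w hw => mem_image_of_mem _ hw,
        Finset.sum_filter, mul_sum]
      refine sum_congr rfl fun g hg => ?_
      obtain ⟨w, hw, rfl⟩ := mem_image.1 hg
      obtain ⟨s1, s2, s3⟩ := RW_spec hf hw
      generalize hgg : sub f w = g at *
      obtain ⟨v1, v2⟩ := W_spec s1
      have hVl : (W g).length = M := by
        have := len_of_sh (s3.trans hsh.symm); have := ((mem_RW hf).1 hw).1; simp at *; omega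
      have e1 : ∑ w ∈ (RW k f).filter (fun w => sub f w = g), (Nf q T χ (sub f w) : K) * χ (M+k) (idem q T (w ++ W (sub f w)) * Psh q T σ M k)
          = Nf q T χ g * xx q T χ σ k (W g) f := by
        rw [xx, esh, hVl, sum_mul, map_sum, mul_sum]
        refine sum_congr ?_ fun w hw => ?_
        · ext w
          simp only [mem_filter, mem_RW hf, mem_rel v1]
          constructor
          · rintro ⟨h, e⟩
            have := RW_spec hf ((mem_RW hf).2 h)
            rw [e] at this
            exact ⟨⟨h.1, this.2.1⟩, this.2.2⟩
          · rintro ⟨⟨h, h2⟩, h3⟩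
            exact ⟨⟨h, _, h2, h3⟩, by rw [← h3, sub_app, v2]⟩
        · simp only [mem_filter, mem_rel v1] at hw
          rw [show sub f w = g by rw [← hw.2, sub_app, v2]]
      rw [e1]
      split_ifs with hL
      · rw [sy.xx_eq v1 k hL, mul_comm]
      · rw [sy.xx_nonstrip v1 k, mul_zero, mul_zero]
        by_contra hcc; push Not at hcc
        have := ((mem_RW hf).1 hw).1
        exact hL (mem_filter.2 ⟨(mem_Lam v1).2 ⟨w, this, s2, s3⟩, hcc⟩)
    exact_mod_cast this
end Dat
end HS

namespace HS

def tl (n b i : ℕ) (r : ℕ) : ℕ := if r + 1 < n then b else if r + 1 = n then b - i else 0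

lemma tl_par (n b i : ℕ) : Par n (tl n b i) :=
  ⟨fun r s h => by simp only [tl]; split_ifs <;> omega, fun r h => by simp only [tl]; split_ifs <;> omega⟩

lemma rev_coeff {g : ℝ[X]} {n : ℕ} (hgn : g.natDegree = n) (r : ℕ) : g.reverse.coeff r = if r ≤ n then g.coeff (n - r) else 0 := by
  rw [coeff_reverse, hgn]
  split_ifs with h
  · rw [revAt_le h]
  · rw [revAt_eq_self_of_lt (by omega)]; exact coeff_eq_zero_of_natDegree_lt (by omega)

namespace PD
variable {N : (ℕ → ℕ) → ℕ} {h : ℕ → ℕ} (pd : PD N h)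
include pd

lemma tau {n m k : ℕ} {f g : ℝ[X]} (hgn : g.natDegree = n) (hfm : f.natDegree = m) (hgl : g.coeff n ≠ 0)
    (hfg : ser h * (g : PowerSeries ℝ) = f) {c : PowerSeries ℝ} (hc : (g.reverse : PowerSeries ℝ) * c = PowerSeries.C (g.coeff n)) (i : ℕ) :
    i ≤ k → (n = 0 → i = 0) → (N (tl n (m+k+1) i) : ℝ) = N (tl n (m+k+1) 0) * PowerSeries.coeff i c := by
  have hr0 : g.reverse.coeff 0 = g.coeff n := by rw [rev_coeff hgn]; simp
  have hc0 : PowerSeries.coeff 0 c = 1 := by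
    have := congrArg (PowerSeries.coeff 0) hc
    simp only [PowerSeries.coeff_zero_eq_constantCoeff, map_mul, PowerSeries.constantCoeff_C, Polynomial.constantCoeff_coe, hr0] at this
    exact mul_left_cancel₀ hgl (by simpa using this)
  induction i using strong_induction_on with
  | _ i ih =>
  intro hik hn
  rcases Nat.eq_zero_or_pos i with rfl | hi
  · rw [hc0, mul_one]
  obtain ⟨p, rfl⟩ : ∃ p, n = p + 1 := ⟨n - 1, by omega⟩
  let M0 : Matrix (Fin (p+1)) (Fin (p+1)) ℝ := of fun r j => Hz h ((m+k+1 : ℕ) - (r : ℕ) + (j : ℕ))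
  let φ : (Fin (p+1) → ℝ) →ₗ[ℝ] ℝ := Matrix.detRowAlternating.toMultilinearMap.toLinearMap M0 (Fin.last p)
  have hφ : ∀ u, φ u = (M0.updateRow (Fin.last p) u).det := fun u => rfl
  let u : ℤ → Fin (p+1) → ℝ := fun e j => Hz h ((m+k+1 : ℕ) - e - p + (j : ℕ))
  have hτ : ∀ e ≤ k, (N (tl (p+1) (m+k+1) e) : ℝ) = φ (u e) := fun e he => by
    rw [pd.jt _ _ (tl_par _ _ _), JT, hφ]
    congr 1
    ext r j
    rw [Matrix.updateRow_apply]
    split_ifs with hr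
    · subst hr
      simp only [of_apply, u, tl, Fin.val_last]
      congr 1; simp; omega
    · have : (r : ℕ) < p := by have := r.2; have : (r:ℕ) ≠ p := fun h => hr (Fin.ext h); omega
      simp only [of_apply, M0, tl]
      rw [if_pos (by omega)]
  have hneg : ∀ s : ℕ, 0 < s → s ≤ p → φ (u (-s)) = 0 := fun s h1 h2 => by
    have : u (-s) = M0 ⟨p - s, by omega⟩ := by
      funext j; simp only [u, M0, of_apply]; congr 1; push_cast [Nat.cast_sub h2]; ring
    rw [hφ, this]
    exact Matrix.det_updateRow_eq_zero (fun h => by have := congrArg Fin.val h; simp at this; omega)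
  have hlin : ∑ r ∈ range (p+2), g.coeff r * φ (u (i + r - (p+1))) = 0 := by
    have : ∑ r ∈ range (p+2), g.coeff r • u (i + r - (p+1)) = 0 := by
      funext j
      simp only [Finset.sum_apply, Pi.smul_apply, smul_eq_mul, Pi.zero_apply]
      have := convP h g (d := p+1) (by omega) ((m+k+1 : ℕ) - i + 1 + (j:ℕ))
      rw [if_pos (by omega), hfg, coeff_coe, coeff_eq_zero_of_natDegree_lt (by omega)] at this
      rw [← this]
      refine sum_congr rfl fun r _ => ?_
      simp only [u]; congr 2; ring
    have := congrArg φ this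
    simpa [map_sum] using this
  have hrev : ∑ r ∈ range (i+1), g.reverse.coeff r * φ (u ((i:ℤ) - r)) = 0 := by
    have e1 : ∑ r ∈ range (p+2), g.reverse.coeff r * φ (u ((i:ℤ) - r)) = 0 := by
      rw [← hlin, ← sum_range_reflect]
      refine sum_congr rfl fun r hr => ?_
      have hr := mem_range.1 hr
      rw [rev_coeff hgn, if_pos (by omega)]
      congr 3
      · omega
      · omega
    have e2 : ∑ r ∈ range (p+2), g.reverse.coeff r * φ (u ((i:ℤ) - r)) = ∑ r ∈ range (p+2+i), g.reverse.coeff r * φ (u ((i:ℤ) - r)) := by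
      refine sum_subset (by simp) fun r _ hr => ?_
      rw [mem_range] at hr
      rw [rev_coeff hgn, if_neg (by omega), zero_mul]
    have e3 : ∑ r ∈ range (i+1), g.reverse.coeff r * φ (u ((i:ℤ) - r)) = ∑ r ∈ range (p+2+i), g.reverse.coeff r * φ (u ((i:ℤ) - r)) := by
      refine sum_subset (Finset.range_subset_range.2 (by omega)) fun r _ hr => ?_
      rw [mem_range] at hr
      by_cases h1 : r ≤ p + 1
      · have := hneg (r - i) (by omega) (by omega)
        rw [show (i:ℤ) - r = -((r - i : ℕ) : ℤ) by omega, this, mul_zero]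
      · rw [rev_coeff hgn, if_neg (by omega), zero_mul]
    rw [e3, ← e2, e1]
  have hcc : ∑ r ∈ range (i+1), g.reverse.coeff r * PowerSeries.coeff (i - r) c = 0 := by
    have := congrArg (PowerSeries.coeff i) hc
    rw [PowerSeries.coeff_mul, Finset.Nat.sum_antidiagonal_eq_sum_range_succ_mk, PowerSeries.coeff_C, if_neg (by omega)] at this
    simpa only [coeff_coe] using this
  rw [sum_range_succ', hr0] at hrev hcc
  have e : ∑ r ∈ range i, g.reverse.coeff (r+1) * φ (u ((i:ℤ) - (r+1 : ℕ))) = N (tl (p+1) (m+k+1) 0) * ∑ r ∈ range i, g.reverse.coeff (r+1) * PowerSeries.coeff (i - (r+1)) c := by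
    rw [mul_sum]
    refine sum_congr rfl fun r hr => ?_
    have hr := mem_range.1 hr
    have := ih (i - (r+1)) (by omega) (by omega) (by omega)
    rw [hτ _ (by omega), show ((i - (r+1) : ℕ) : ℤ) = (i:ℤ) - (r+1 : ℕ) by omega] at this
    rw [this]; ring
  rw [e] at hrev
  rw [hτ i hik]
  apply mul_left_cancel₀ hgl
  simp only [cast_zero, sub_zero, Nat.sub_zero] at hrev hcc
  linear_combination hrev - (N (tl (p+1) (m+k+1) 0) : ℝ) * hcc

def _root_.HS.nu (n m k : ℕ) (p : ℕ × ℕ) (r : ℕ) : ℕ :=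
  if r + 1 < n then m+k+1 else if r + 1 = n then m+k+1 - p.1 else if r < n + k then m else if r = n + k then m - p.2 else 0

omit pd in
lemma nu_mid {n m k x : ℕ} (p : ℕ × ℕ) (hx : x < k) : nu n m k p (n+x) = m := by
  simp only [nu]; split_ifs <;> omega

omit pd in
lemma nu_last {n m k : ℕ} (p : ℕ × ℕ) : nu n m k p (n+k) = m - p.2 := by
  simp only [nu]; split_ifs <;> omega

lemma N_nu {n m k : ℕ} {f g : ℝ[X]} (hgn : g.natDegree = n) (hfm : f.natDegree = m) (hg0 : g.coeff 0 = 1)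
    (hfg : ser h * (g : PowerSeries ℝ) = f) {p : ℕ × ℕ} (h1 : p.1 ≤ k) (h2 : p.2 ≤ m) :
    (N (nu n m k p) : ℝ) = N (tl n (m+k+1) p.1) * (f.coeff m ^ k * f.coeff (m - p.2)) := by
  have hp : Par (n + (k+1)) (nu n m k p) :=
    ⟨fun r s h => by simp only [nu]; split_ifs <;> omega, fun r h => by simp only [nu]; split_ifs <;> omega⟩
  rw [pd.fac hgn hg0 hfg hp (fun i hi => by rw [hfm]; simp only [nu]; split_ifs <;> omega)]
  have e1 : restr n (nu n m k p) = tl n (m+k+1) p.1 := by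
    funext r; simp only [restr, nu, tl]; split_ifs <;> omega
  rw [e1]; congr 1
  rw [Matrix.det_of_isLowerTriangular, Fin.prod_univ_castSucc]
  · congr 1
    · rw [prod_congr rfl (g := fun _ => f.coeff m), Finset.prod_const, Finset.card_univ, Fintype.card_fin]
      intro i _
      have := i.2
      simp only [of_apply, fz, Fin.val_castSucc, nu_mid p this]
      rw [if_pos (by omega)]
      congr 1; omega
    · simp only [of_apply, fz, Fin.val_last, nu_last]
      rw [if_pos (by omega)]
      congr 1; omega
  · intro i j hij
    have hij' : (i:ℕ) < j := hij
    have := j.2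
    simp only [of_apply, fz, nu_mid p (show (i:ℕ) < k by omega)]
    rw [if_pos (by omega)]
    exact coeff_eq_zero_of_natDegree_lt (by omega)

def _root_.HS.DS (N : (ℕ → ℕ) → ℕ) (h : ℕ → ℕ) (m n : ℕ) : Prop :=
  ∀ L f k, Par L f → Dp m n k f → N f ≠ 0 → k ≤ ∑ i ∈ range L, f i →
    ∃ F : Finset (ℕ → ℕ), (∀ g, g ∈ F ↔ Par L g ∧ strip g f ∧ ∑ i ∈ range L, g i + k = ∑ i ∈ range L, f i) ∧
      h k * N f = ∑ g ∈ F, N g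

omit pd in
lemma sum_nu {n m k : ℕ} {p : ℕ × ℕ} (h1 : p.1 ≤ m + k + 1) (h2 : p.2 ≤ m) (h3 : n = 0 → p.1 = 0) :
    ∑ i ∈ range (n+k+1), nu n m k p i + (p.1 + p.2) = ∑ i ∈ range (n+k+1), nu n m k (0,0) i := by
  rw [sum_range_succ, sum_range_succ, Finset.sum_range_add, Finset.sum_range_add]
  have e1 : ∑ x ∈ range k, nu n m k p (n+x) = ∑ x ∈ range k, nu n m k (0,0) (n+x) :=
    sum_congr rfl fun x hx => by
      rw [nu_mid _ (mem_range.1 hx), nu_mid _ (mem_range.1 hx)]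
  have e2 : nu n m k p (n+k) = m - p.2 := by simp only [nu]; split_ifs <;> omega
  have e3 : nu n m k (0,0) (n+k) = m := by simp only [nu]; split_ifs <;> omega
  have e4 : ∑ x ∈ range n, nu n m k p x + p.1 = ∑ x ∈ range n, nu n m k (0,0) x := by
    rcases n with _ | n
    · simp [h3]
    · rw [sum_range_succ, sum_range_succ]
      have : ∑ x ∈ range n, nu (n+1) m k p x = ∑ x ∈ range n, nu (n+1) m k (0,0) x :=
        sum_congr rfl fun x hx => by
          have := mem_range.1 hx
          simp only [nu]; rw [if_pos (by omega), if_pos (by omega)]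
      rw [this]
      have e5 : nu (n+1) m k p n = m + k + 1 - p.1 := by simp [nu]
      have e6 : nu (n+1) m k (0,0) n = m + k + 1 := by simp [nu]
      omega
  omega

lemma hk {n m : ℕ} (hmn : 0 < m ∨ 0 < n) {f g : ℝ[X]} (hgn : g.natDegree = n) (hfm : f.natDegree = m) (hg0 : g.coeff 0 = 1)
    (hgl : g.coeff n ≠ 0) (hfl : f.coeff m ≠ 0) (hnz : ∀ l, Par n l → N l ≠ 0)
    (hfg : ser h * (g : PowerSeries ℝ) = f) {c : PowerSeries ℝ} (hc : (g.reverse : PowerSeries ℝ) * c = PowerSeries.C (g.coeff n))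
    (ds : DS N h m n) : PowerSeries.C (f.coeff m) * ser h = c * (f.reverse : PowerSeries ℝ) := by
  classical
  ext k
  have hN0 : (N (tl n (m+k+1) 0) : ℝ) ≠ 0 := Nat.cast_ne_zero.2 (hnz _ (tl_par _ _ _))
  have hP : ∀ p : ℕ × ℕ, p.1 ≤ k → Par (n+k+1) (nu n m k p) := fun p h1 =>
    ⟨fun r s h => by simp only [nu]; split_ifs <;> omega, fun r h => by simp only [nu]; split_ifs <;> omega⟩
  have hv : ∀ p : ℕ × ℕ, nu n m k p (n+k) = m - p.2 := nu_last
  have hv' : ∀ p : ℕ × ℕ, 0 < n → nu n m k p (n-1) = m+k+1-p.1 := fun p h => by simp only [nu]; split_ifs <;> omega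
  have hNl := pd.N_nu (k := k) (p := (0,0)) hgn hfm hg0 hfg (by simp) (by simp)
  simp only [Nat.sub_zero] at hNl
  have hNl0 : N (nu n m k (0,0)) ≠ 0 := fun h0 => by
    rw [h0] at hNl; push_cast at hNl
    exact mul_ne_zero hN0 (mul_ne_zero (pow_ne_zero _ hfl) hfl) hNl.symm
  have hsum : k ≤ ∑ i ∈ range (n+k+1), nu n m k (0,0) i := by
    rcases hmn with h | h
    · have : ∀ i ∈ range (n+k+1), 1 ≤ nu n m k (0,0) i := fun i hi => by
        have := mem_range.1 hi; simp only [nu]; split_ifs <;> omega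
      have := Finset.card_nsmul_le_sum _ _ _ this
      simp only [Finset.card_range, smul_eq_mul, mul_one] at this; exact le_trans (by omega) this
    · have := Finset.single_le_sum (f := nu n m k (0,0)) (s := range (n+k+1)) (fun _ _ => Nat.zero_le _) (mem_range.2 (show n - 1 < n+k+1 by omega))
      rw [hv' _ h] at this; exact le_trans (by simp; omega) this
  obtain ⟨F, hF, hE⟩ := ds (n+k+1) (nu n m k (0,0)) k (hP _ (by simp)) ⟨by simp only [nu]; split_ifs <;> omega,
    by rw [hv]; simp, fun h => by rw [hv' _ h]; simp⟩ hNl0 hsum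
  set I := (Finset.HasAntidiagonal.antidiagonal k).filter (fun p => p.2 ≤ m ∧ (n = 0 → p.1 = 0)) with hI
  have hIm : ∀ p, p ∈ I ↔ p.1 + p.2 = k ∧ p.2 ≤ m ∧ (n = 0 → p.1 = 0) := fun p => by simp [hI]
  have hFI : F = I.image (nu n m k) := by
    ext ν
    rw [hF, mem_image]
    constructor
    · rintro ⟨h1, h2, h3⟩
      have h4 : ∀ r, n ≤ r → r < n + k → ν r = m := fun r ha hb => by
        have a1 := h2 r
        simp only [nu] at a1; split_ifs at a1 <;> omega
      have h5 : ∀ r, r + 1 < n → ν r = m + k + 1 := fun r ha => by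
        have a1 := h2 r
        simp only [nu] at a1; split_ifs at a1 <;> omega
      have h6 := (h2 (n+k)).1
      rw [hv] at h6
      have h7 : 0 < n → m ≤ ν (n-1) ∧ ν (n-1) ≤ m + k + 1 := fun h => by
        have a1 := h2 (n-1)
        rw [hv' _ h, show n - 1 + 1 = n by omega, show nu n m k (0,0) n = m by simp only [nu]; split_ifs <;> omega] at a1
        simpa [and_comm] using a1
      have key : ∀ p : ℕ × ℕ, p.1 ≤ m+k+1 → p.2 = m - ν (n+k) → (0 < n → p.1 = m+k+1 - ν (n-1)) → ν = nu n m k p := fun p b0 b1 b2 => by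
        funext r
        simp only [nu]
        split_ifs with c1 c2 c3 c4
        · exact h5 r c1
        · have := b2 (by omega); have := h7 (by omega); rw [show r = n - 1 by omega]; omega
        · exact h4 r (by omega) c3
        · rw [c4]; omega
        · exact h1.2 r (by omega)
      obtain ⟨p, e, hp1, hp2, hp3⟩ : ∃ p : ℕ × ℕ, ν = nu n m k p ∧ p.1 ≤ m+k+1 ∧ p.2 ≤ m ∧ (n = 0 → p.1 = 0) := by
        rcases Nat.eq_zero_or_pos n with h | h
        · exact ⟨(0, m - ν (n+k)), key _ (by simp) rfl (by omega), by simp, by simp, by simp⟩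
        · exact ⟨(m+k+1 - ν (n-1), m - ν (n+k)), key _ (by simp) rfl (fun _ => rfl), by simp, by simp, by omega⟩
      have := sum_nu hp1 hp2 hp3 (k := k)
      rw [e] at h3
      exact ⟨p, (hIm p).2 ⟨by omega, hp2, hp3⟩, e.symm⟩
    · rintro ⟨p, hp, rfl⟩
      obtain ⟨p1, p2, p3⟩ := (hIm p).1 hp
      refine ⟨hP _ (by omega), fun r => ?_, ?_⟩
      · simp only [nu]; split_ifs <;> omega
      · have := sum_nu (k := k) (by omega) p2 p3; omega
  have hinj : Set.InjOn (nu n m k) I := fun p hp p' hp' e => by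
    have a := (hIm p).1 hp
    have a' := (hIm p').1 hp'
    have e1 := congrFun e (n+k)
    rw [hv, hv] at e1
    ext <;> omega
  rw [hFI, sum_image hinj] at hE
  have hE' : (h k : ℝ) * N (nu n m k (0,0)) = ∑ p ∈ I, (N (nu n m k p) : ℝ) := by exact_mod_cast hE
  rw [hNl] at hE'
  rw [PowerSeries.coeff_C_mul, PowerSeries.coeff_mul, ser, PowerSeries.coeff_mk]
  apply mul_left_cancel₀ (mul_ne_zero hN0 (pow_ne_zero k hfl))
  rw [mul_sum]
  trans ∑ p ∈ I, (N (nu n m k p) : ℝ)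
  · rw [← hE']; ring
  rw [hI, Finset.sum_filter]
  refine sum_congr rfl fun p hp => ?_
  rw [Finset.HasAntidiagonal.mem_antidiagonal] at hp
  rw [coeff_coe, rev_coeff hfm]
  by_cases hp2 : p.2 ≤ m
  · rw [if_pos hp2]
    by_cases hn : n = 0 → p.1 = 0
    · rw [if_pos ⟨hp2, hn⟩, pd.N_nu hgn hfm hg0 hfg (by omega) hp2, pd.tau hgn hfm hgl hfg hc _ (by omega) hn]
      ring
    · rw [if_neg (fun h => hn h.2)]
      push Not at hn
      have : g = 1 := by
        rw [eq_C_of_natDegree_eq_zero (hgn.trans hn.1), hg0]; simp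
      have hc1 : c = 1 := by simpa [this, hn.1, Polynomial.reverse] using hc
      rw [hc1, PowerSeries.coeff_one, if_neg hn.2]; ring
  · rw [if_neg (fun h => hp2 h.1), if_neg hp2]; ring
end PD
end HS

namespace HS

lemma final {m n : ℕ} {x : Fin m → ℝ} {y : Fin n → ℝ} {f g : ℝ[X]} (hx : ∀ i, 0 < x i) (hy : ∀ i, 0 < y i)
    (hf : f = ∏ i, (1 + C (x i) * X)) (hg : g = ∏ j, (1 - C (y j) * X)) (hfm : f.natDegree = m) (hgn : g.natDegree = n)
    (hcop : IsCoprime f g) (hf0 : f.coeff 0 = 1) (hg0 : g.coeff 0 = 1)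
    (hE : C (f.coeff m) * f * g.reverse = C (g.coeff n) * f.reverse * g) :
    (∀ i ≤ m, f.coeff i = f.coeff (m - i)) ∧ ∀ j ≤ n, (-1:ℝ)^j * g.coeff j = (-1:ℝ)^(n-j) * g.coeff (n-j) := by
  have fl : f.coeff m = ∏ i, x i := by
    have := Polynomial.coeff_prod_of_natDegree_le (s := Finset.univ) (fun i : Fin m => (1 + C (x i) * X : ℝ[X])) 1
      (fun i _ => by compute_degree)
    rw [hf]; simpa [coeff_one] using this
  have gl : g.coeff n = (-1)^n * ∏ i, y i := by
    have := Polynomial.coeff_prod_of_natDegree_le (s := Finset.univ) (fun i : Fin n => (1 - C (y i) * X : ℝ[X])) 1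
      (fun i _ => by compute_degree)
    rw [hg]; simpa [coeff_one, Finset.prod_neg] using this
  have fp : 0 < f.coeff m := by rw [fl]; exact Finset.prod_pos fun i _ => hx i
  have yp : 0 < ∏ i, y i := Finset.prod_pos fun i _ => hy i
  have gn0 : g.coeff n ≠ 0 := by rw [gl]; exact mul_ne_zero (by simp) yp.ne'
  have main : ∀ (p : ℝ[X]) (d : ℕ), p.natDegree = d → p.coeff 0 = 1 → p ∣ p.reverse →
      (∀ i ≤ d, p.coeff (d - i) = p.coeff d * p.coeff i) ∧ p.coeff d * p.coeff d = 1 := by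
    rintro p d hp h0 ⟨r, hr⟩
    have hp0 : p ≠ 0 := by rintro rfl; simp at h0
    have hr0 : r ≠ 0 := by rintro rfl; rw [mul_zero, reverse_eq_zero] at hr; exact hp0 hr
    have h1 := reverse_natDegree_le p
    rw [hr, natDegree_mul hp0 hr0] at h1
    obtain ⟨c, rfl⟩ : ∃ c, r = C c := ⟨_, eq_C_of_natDegree_eq_zero (by omega)⟩
    have h2 : ∀ i ≤ d, p.coeff (d - i) = p.coeff i * c := fun i hi => by
      have := congrArg (fun z => z.coeff i) hr
      simp only [rev_coeff hp, coeff_mul_C] at this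
      rwa [if_pos hi] at this
    have h3 := h2 0 (by omega)
    rw [h0, one_mul, Nat.sub_zero] at h3
    have h4 := h2 d le_rfl
    rw [Nat.sub_self, h0] at h4
    exact ⟨fun i hi => by rw [h2 i hi, h3, mul_comm], by rw [h4]; congr 1⟩
  have uf : IsUnit (C (f.coeff m)) := isUnit_C.2 fp.ne'.isUnit
  have ug : IsUnit (C (g.coeff n)) := isUnit_C.2 gn0.isUnit
  obtain ⟨f1, f2⟩ := main f m hfm hf0 (by
    refine hcop.dvd_of_dvd_mul_right ?_
    have : f ∣ C (g.coeff n) * (f.reverse * g) := ⟨C (f.coeff m) * g.reverse, by rw [← mul_assoc, ← hE]; ring⟩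
    exact (ug.dvd_mul_left).1 this)
  obtain ⟨g1, g2⟩ := main g n hgn hg0 (by
    refine hcop.symm.dvd_of_dvd_mul_left ?_
    have : g ∣ C (f.coeff m) * (f * g.reverse) := ⟨C (g.coeff n) * f.reverse, by rw [← mul_assoc, hE]; ring⟩
    exact (uf.dvd_mul_left).1 this)
  have f3 : f.coeff m = 1 := by nlinarith
  have g3 : g.coeff n = (-1)^n := by
    have : (∏ i, y i) = 1 := by
      rw [gl] at g2
      have e : ((-1:ℝ)^n * (-1)^n) = 1 := by rw [← mul_pow]; simp
      have : (∏ i, y i) * (∏ i, y i) = 1 := by linear_combination g2 - (∏ i, y i) * (∏ i, y i) * e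
      nlinarith
    rw [gl, this, mul_one]
  refine ⟨fun i hi => by rw [f1 i hi, f3, one_mul], fun j hj => ?_⟩
  rw [g1 j hj, g3, ← mul_assoc, ← pow_add]
  congr 1
  rw [show n - j + n = j + 2 * (n - j) by omega, pow_add, pow_mul]; simp

variable {K A ι : Type} [Field K] [CharZero K] [Ring A] [Algebra K A] [Fintype ι] {q : K} {T : ℕ → A}
variable {d : ℕ} {B : ℕ → Subalgebra K A} {χ : ℕ → A →ₗ[K] K} {σ : ℕ → A →ₐ[K] A} {E : ι → ι → A} {D : A} {β : A →ₗ[K] K} {t : K}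

lemma Sys.hz (sy : Sys q T d B χ σ) {n m : ℕ} {f g : ℝ[X]} (hgn : g.natDegree = n) (hfm : f.natDegree = m) (hg0 : g.coeff 0 = 1)
    (hfg : ser (fun k => Nw q T χ (row k)) * (g : PowerSeries ℝ) = f) (S : List ℕ) (hS : valid S) (hm : m + 1 ≤ S.count n) :
    idem q T S = 0 := by
  rw [← sy.Nw_zero hS, ← sy.Nf_sh hS]
  have ha := sh_anti hS
  have hp : Par (n + (S.length + 1)) (sh S) := ⟨ha, fun i hi => sh_bdd hS i (by omega)⟩
  have := sy.toPD.fac hgn hg0 hfg hp (fun i hi => by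
    have := ha hi.le; simp only [sh] at this ⊢; omega)
  rw [Matrix.det_eq_zero_of_row_eq_zero 0, mul_zero] at this
  · exact_mod_cast this
  · intro j
    have hm' : m + 1 ≤ sh S n := hm
    simp only [of_apply, fz, Fin.val_zero, add_zero]
    rw [if_pos (by omega)]
    exact coeff_eq_zero_of_natDegree_lt (by omega)

lemma Dat.ds (sy : Sys q T d B χ σ) (da : Dat q T d B χ σ E D β t) (hd : d ≠ 0) (hB : ∀ Z ∈ B 0, Z = χ 0 Z • 1) {m n : ℕ}
    (hz : ∀ S, valid S → m + 1 ≤ S.count n → idem q T S = 0) : DS (Nf q T χ) (fun k => Nw q T χ (row k)) m n := by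
  intro L f k hf hD h0 hk
  have hS := hf.word
  obtain ⟨v1, v2⟩ := W_spec hS
  have hl := sum_sh (n := L) (S := W f) (by rw [v2]; exact hf.2)
  rw [v2] at hl
  obtain ⟨F, h1, h2⟩ := da.kstep sy hd hB hz hS hD h0 (M := (W f).length - k) (by omega)
  refine ⟨F, fun g => ?_, h2⟩
  rw [h1]
  have e : ∑ i ∈ range (L+1), f i = ∑ i ∈ range L, f i := by
    rw [sum_range_succ, hf.2 L le_rfl, add_zero]
  constructor
  · rintro ⟨hg, hL⟩
    obtain ⟨w1, w2⟩ := W_spec hg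
    have h3 := ((mem_LS w1 (sh_bdd w1)).1 hL).1
    rw [w2] at h3
    have hz : ∀ i, L ≤ i → g i = 0 := fun i hi => by have := (h3 i).1; rw [hf.2 i hi] at this; omega
    have hp : Par L g := ⟨w2 ▸ sh_anti w1, hz⟩
    have h4 := ((mem_LS w1 (by rw [w2]; exact hz)).1 hL).2
    rw [← sum_sh (n := L) (by rw [w2]; exact hz), w2, e] at h4
    exact ⟨hp, h3, h4.symm⟩
  · rintro ⟨hp, hs, hsum⟩
    have hg := hp.word
    obtain ⟨w1, w2⟩ := W_spec hg
    refine ⟨hg, (mem_LS w1 (by rw [w2]; exact hp.2)).2 ⟨by rw [w2]; exact hs, ?_⟩⟩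
    rw [← sum_sh (n := L) (by rw [w2]; exact hp.2), w2, e, hsum]

theorem Dat.res (sy : Sys q T d B χ σ) (da : Dat q T d B χ σ E D β t) (hd : d ≠ 0) (hB : ∀ Z ∈ B 0, Z = χ 0 Z • 1) :
    ∃ (m n : ℕ) (x : Fin m → ℝ) (y : Fin n → ℝ) (f g : ℝ[X]), (∀ i, 0 < x i) ∧ (∀ j, 0 < y j) ∧
      f = ∏ i, (1 + C (x i) * X) ∧ g = ∏ j, (1 - C (y j) * X) ∧ ser (fun k => Nw q T χ (row k)) * (g : PowerSeries ℝ) = f ∧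
      (∀ i ≤ m, f.coeff i = f.coeff (m - i)) ∧ ∀ j ≤ n, (-1:ℝ)^j * g.coeff j = (-1:ℝ)^(n-j) * g.coeff (n-j) := by
  obtain ⟨m, n, x, y, f, g, hx, hy, hf, hg, hfm, hgn, hfg, hcop, hnz, hf0, hg0⟩ := sy.toPD.poly sy.dual.toPD (fun j => by
    rw [sy.dual_row, ← sy.Nf_sh (valid_col j)]
    congr 1; funext i; rw [sh_col]; rfl)
  refine ⟨m, n, x, y, f, g, hx, hy, hf, hg, hfg, ?_⟩
  have hf' : f ≠ 0 := by rintro rfl; simp at hf0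
  have hg' : g ≠ 0 := by rintro rfl; simp at hg0
  have hfl : f.coeff m ≠ 0 := by rw [← hfm]; exact leadingCoeff_ne_zero.2 hf'
  have hgl : g.coeff n ≠ 0 := by rw [← hgn]; exact leadingCoeff_ne_zero.2 hg'
  by_cases hmn : 0 < m ∨ 0 < n
  · refine final hx hy hf hg hfm hgn hcop hf0 hg0 ?_
    have hc : (g.reverse : PowerSeries ℝ) * ((g.reverse : PowerSeries ℝ)⁻¹ * PowerSeries.C (g.coeff n)) = PowerSeries.C (g.coeff n) := by
      rw [← mul_assoc, PowerSeries.mul_inv_cancel, one_mul]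
      rw [Polynomial.constantCoeff_coe, rev_coeff hgn]; simpa using hgl
    have := sy.toPD.hk hmn hgn hfm hg0 hgl hfl hnz hfg hc (da.ds sy hd hB (sy.hz hgn hfm hg0 hfg))
    set c := (g.reverse : PowerSeries ℝ)⁻¹ * PowerSeries.C (g.coeff n)
    apply coe_injective
    simp only [coe_mul, Polynomial.coe_C]
    rw [← hfg, ← hc]
    linear_combination (g.reverse * g : PowerSeries ℝ) * this
  · obtain ⟨rfl, rfl⟩ : m = 0 ∧ n = 0 := by omega
    refine ⟨fun i hi => ?_, fun i hi => ?_⟩ <;> obtain rfl : i = 0 := by omega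
    all_goals rfl
end HS

namespace HS
lemma poinc_triv (K : Type) [Field K] (V : Type) [AddCommGroup V] [Module K V] [Subsingleton V] (q : K)
    (R : V ⊗[K] V →ₗ[K] V ⊗[K] V) : poincareS K V q R = 1 := by
  have hr : LinearMap.range (TensorAlgebra.ι K : V →ₗ[K] TensorAlgebra K V) = ⊥ := by
    rw [LinearMap.range_eq_bot]; ext v; simp [Subsingleton.elim v 0]
  have hu : ∀ u : V ⊗[K] V, u = 0 := fun u => by
    induction u using TensorProduct.induction_on with
    | zero => rfl
    | tmul a b => rw [Subsingleton.elim a 0, zero_tmul]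
    | add a b ha hb => rw [ha, hb, add_zero]
  let φ : RingQuot (sRel K V q R) →ₐ[K] K := RingQuot.liftAlgHom K ⟨TensorAlgebra.algebraMapInv, by
    rintro a b ⟨rfl, u, rfl⟩
    rw [hu u, map_zero, map_zero]⟩
  haveI : Nontrivial (RingQuot (sRel K V q R)) := φ.toRingHom.domain_nontrivial
  ext l
  rw [poincareS, PowerSeries.coeff_mk, PowerSeries.coeff_one, sGrade, hr]
  rcases l with _ | l
  · rw [pow_zero, Submodule.one_eq_span, Submodule.map_span, Set.image_singleton]
    have : (RingQuot.mkAlgHom K (sRel K V q R)).toLinearMap 1 ≠ 0 := by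
      rw [AlgHom.toLinearMap_apply, map_one]; exact one_ne_zero
    rw [finrank_span_singleton this]; simp
  · rw [← Submodule.zero_eq_bot, zero_pow (by omega), Submodule.zero_eq_bot, Submodule.map_bot]; simp
end HS

/-- The Poincaré series of the function algebra `S` of a Hecke symmetry is a rational
function `∏ (1 + uᵢ t) / ∏ (1 - vⱼ t)` with `uᵢ, vⱼ > 0`, whose numerator is a
reciprocal polynomial and whose denominator is a skew-reciprocal polynomial. -/
theorem poincare_series_S_reciprocal
    (K : Type) [Field K] [CharZero K]
    (V : Type) [AddCommGroup V] [Module K V] [FiniteDimensional K V]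
    (q : K) (hq0 : q ≠ 0) (hq : ∀ n : ℕ, 1 < n → q ^ n ≠ 1)
    (R : V ⊗[K] V →ₗ[K] V ⊗[K] V) (hR : IsHeckeSymmetry K V q R) :
    ∃ (m n : ℕ) (x : Fin m → ℝ) (y : Fin n → ℝ),
      (∀ i, 0 < x i) ∧ (∀ j, 0 < y j) ∧
      poincareS K V q R *
          ((∏ j : Fin n, (1 - Polynomial.C (y j) * Polynomial.X) : Polynomial ℝ) :
            PowerSeries ℝ) =
        ((∏ i : Fin m, (1 + Polynomial.C (x i) * Polynomial.X) : Polynomial ℝ) :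
          PowerSeries ℝ) ∧
      (∀ i ≤ m,
        (∏ i : Fin m, (1 + Polynomial.C (x i) * Polynomial.X)).coeff i =
          (∏ i : Fin m, (1 + Polynomial.C (x i) * Polynomial.X)).coeff (m - i)) ∧
      (∀ j ≤ n,
        (-1 : ℝ) ^ j * (∏ j : Fin n, (1 - Polynomial.C (y j) * Polynomial.X)).coeff j =
          (-1 : ℝ) ^ (n - j) *
            (∏ j : Fin n, (1 - Polynomial.C (y j) * Polynomial.X)).coeff (n - j)) := by
  rcases subsingleton_or_nontrivial V with hV | hV
  · refine ⟨0, 0, fun _ => 1, fun _ => 1, fun _ => one_pos, fun _ => one_pos, ?_, fun i hi => ?_, fun i hi => ?_⟩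
    · rw [HS.poinc_triv]; simp
    · rw [Nat.le_zero.1 hi]
    · rw [Nat.le_zero.1 hi]
  · have hd : Module.finrank K V ≠ 0 := Module.finrank_pos.ne'
    haveI : Nonempty (Fin (Module.finrank K V)) := ⟨⟨0, Nat.pos_of_ne_zero hd⟩⟩
    obtain ⟨s, s', χ, lv, h1⟩ := HS.exists_leav K (Fin (Module.finrank K V))
    have sy := lv.sys (Module.finBasis K V) hq0 hq hR h1
    obtain ⟨D, β, t, da⟩ := lv.dat (Module.finBasis K V) h1 hR sy
    obtain ⟨m, n, x, y, f, g, hx, hy, rfl, rfl, hE, h⟩ := da.res sy (by simpa using hd) (fun Z hZ => lv.sc_of_mem h1 hZ)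
    refine ⟨m, n, x, y, hx, hy, ?_, h⟩
    rw [← hE]
    congr 1
    ext k
    rw [poincareS, HS.ser, PowerSeries.coeff_mk, PowerSeries.coeff_mk, lv.dim _ h1 sy]

end
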